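/- For every integer m ≥ 1, every list of total degrees d_1,…,d_m and every integer n ≥ 3, there exists a constant C = C(m, d_1,…,d_m, n) with the following property. Let q be a prime power of characteristic p and let F_1,…,F_m ∈ F_q[t][x] be pairwise non-associate irreducible polynomials with deg F_i = d_i and deg_x F_i > 0, each separable over F_q(t) (F_i ∉ F_q[t][x^p]), not necessarily monic in x. Set F = ∏_{i=1}^m F_i and let C be the (possibly reducible) affine plane curve over the algebraic closure of F_q defined by F(t,x) = 0. Let a_0,…,a_n be algebraically independent variables, f♯ = Σ_{j=0}^n a_j t^j, and N_i = deg_t F_i(t, f♯). Assume n > #{P ∈ C(F̄_q) : m_P > 2} and p > max_{1≤i≤m} N_i. Let μ_i be the number of irreducible factors of F_i over the algebraic closure of F_q. Then |#{f ∈ F_q[t] : deg f = n and F_i(t,f) is irreducible in F_q[t] for all 1 ≤ i ≤ m} − (∏_{i=1}^m μ_i/N_i)·q^{n+1}| ≤ C·q^{n+1/2}. -/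

import Mathlib

open Polynomial

/-- The generic polynomial `f♯ = Σ_{j=0}^n a_j t^j`. -/
noncomputable def fsharp (K : Type) [CommRing K] (n : ℕ) :
    Polynomial (MvPolynomial (Fin (n + 1)) K) :=
  ∑ j : Fin (n + 1), Polynomial.C (MvPolynomial.X j) * Polynomial.X ^ (j : ℕ)

/-- For `F ∈ K[t][x]` (with `x` the outer variable), the substitution
`F(t, f♯) ∈ K[a_0,…,a_n][t]`. -/
noncomputable def substF {K : Type} [CommRing K] (n : ℕ)
    (F : Polynomial (Polynomial K)) :
    Polynomial (MvPolynomial (Fin (n + 1)) K) :=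
  Polynomial.eval (fsharp K n) (F.map (Polynomial.mapRingHom MvPolynomial.C))

/-- The total degree of a polynomial `P ∈ K[t][x]` (with `x` the outer variable). -/
noncomputable def totalDeg {K : Type} [Field K] (P : Polynomial (Polynomial K)) : ℕ :=
  (Finset.range (P.natDegree + 1)).sup fun j => j + (P.coeff j).natDegree

/-- The multiplicity of the point `(τ, ξ)` on the affine plane curve `F(t,x) = 0`:
the lowest total degree of a monomial of the Taylor expansion of `F` at `(τ, ξ)`. -/
noncomputable def multAt {K : Type} [Field K] (F : Polynomial (Polynomial K)) (τ ξ : K) : ℕ :=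
  sInf {d : ℕ | ∃ j l, j + l = d ∧
    (((F.map (Polynomial.aeval (Polynomial.X + Polynomial.C τ) :
          Polynomial K →ₐ[K] Polynomial K).toRingHom).comp
        (Polynomial.X + Polynomial.C (Polynomial.C ξ))).coeff j).coeff l ≠ 0}

namespace BH

section Filt
variable {R : Type*} [CommRing R]

/-- power series whose `r`-th coefficient lies in `W r` -/
def FS (W : ℕ → AddSubgroup R) (hmul : ∀ i j a b, a ∈ W i → b ∈ W j → a * b ∈ W (i + j))
    (h1 : (1 : R) ∈ W 0) : Subring (PowerSeries R) where
  carrier := {f | ∀ r, PowerSeries.coeff r f ∈ W r}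
  mul_mem' := by
    intro a b ha hb r
    rw [PowerSeries.coeff_mul]
    refine sum_mem ?_
    intro x hx
    rw [← Finset.HasAntidiagonal.mem_antidiagonal.1 hx]
    exact hmul _ _ _ _ (ha _) (hb _)
  one_mem' := by
    intro r
    rw [PowerSeries.coeff_one]
    split_ifs with h
    · rw [h]; exact h1
    · exact zero_mem _
  add_mem' := by
    intro a b ha hb r
    rw [map_add]; exact add_mem (ha r) (hb r)
  zero_mem' := by
    intro r; rw [map_zero]; exact zero_mem _
  neg_mem' := by
    intro a ha r
    rw [map_neg]; exact neg_mem (ha r)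

variable {W : ℕ → AddSubgroup R} {hmul : ∀ i j a b, a ∈ W i → b ∈ W j → a * b ∈ W (i + j)}
    {h1 : (1 : R) ∈ W 0}

lemma mem_FS {f : PowerSeries R} : f ∈ FS W hmul h1 ↔ ∀ r, PowerSeries.coeff r f ∈ W r := Iff.rfl

lemma C_mem_FS {a : R} (ha : a ∈ W 0) : PowerSeries.C a ∈ FS W hmul h1 := by
  intro r
  rw [PowerSeries.coeff_C]
  split_ifs with h
  · rw [h]; exact ha
  · exact zero_mem _

lemma eval_mem_subring {S : Type*} [CommRing S] (T : Subring S) (p : Polynomial S)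
    (hp : ∀ i, p.coeff i ∈ T) (z : S) (hz : z ∈ T) : p.eval z ∈ T := by
  rw [Polynomial.eval_eq_sum_range]
  exact sum_mem fun i _ => mul_mem (hp i) (pow_mem hz i)

/-- filtered Hensel lemma -/
theorem filtered_hensel (hmul : ∀ i j a b, a ∈ W i → b ∈ W j → a * b ∈ W (i + j))
    (h1 : (1 : R) ∈ W 0) (p : Polynomial (PowerSeries R)) (hp : ∀ i, p.coeff i ∈ FS W hmul h1)
    (t0 w : R) (ht0 : t0 ∈ W 0) (hw : w ∈ W 0)
    (h0 : PowerSeries.constantCoeff (p.eval (PowerSeries.C t0)) = 0)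
    (hd : PowerSeries.constantCoeff (p.derivative.eval (PowerSeries.C t0)) * w = 1) :
    ∃ z ∈ FS W hmul h1, PowerSeries.constantCoeff z = t0 ∧ p.eval z = 0 := by
  classical
  let z : ℕ → PowerSeries R := fun n => Nat.rec (PowerSeries.C t0)
    (fun _ y => y - PowerSeries.C w * p.eval y) n
  have z0 : z 0 = PowerSeries.C t0 := rfl
  have zs : ∀ n, z (n+1) = z n - PowerSeries.C w * p.eval (z n) := fun n => rfl
  have zF : ∀ n, z n ∈ FS W hmul h1 := by
    intro n
    induction n with
    | zero => rw [z0]; exact C_mem_FS ht0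
    | succ n ih =>
      rw [zs]
      exact sub_mem ih (mul_mem (C_mem_FS hw) (eval_mem_subring _ p hp _ ih))
  have key : ∀ n, (PowerSeries.X : PowerSeries R)^(n+1) ∣ p.eval (z n) ∧
      (PowerSeries.X : PowerSeries R) ∣ z n - PowerSeries.C t0 := by
    intro n
    induction n with
    | zero =>
      rw [z0]
      refine ⟨?_, by simp⟩
      rw [zero_add, pow_one, PowerSeries.X_dvd_iff]; exact h0
    | succ n ih =>
      obtain ⟨ih1, ih2⟩ := ih
      have hX : (PowerSeries.X : PowerSeries R) ∣ p.eval (z n) :=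
        dvd_trans (dvd_pow_self _ (Nat.succ_ne_zero n)) ih1
      constructor
      · obtain ⟨c, hc⟩ := Polynomial.binomExpansion p (z n) (-(PowerSeries.C w * p.eval (z n)))
        rw [zs, sub_eq_add_neg, hc]
        have e : p.eval (z n) + p.derivative.eval (z n) * (-(PowerSeries.C w * p.eval (z n))) +
          c * (-(PowerSeries.C w * p.eval (z n)))^2 =
          p.eval (z n) * ((1 - p.derivative.eval (z n) * PowerSeries.C w) + p.eval (z n) * (c * PowerSeries.C w ^2)) := by
          ring
        rw [e, pow_succ]
        refine mul_dvd_mul ih1 (dvd_add ?_ (Dvd.dvd.mul_right hX _))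
        have h2 : (PowerSeries.X : PowerSeries R) ∣ p.derivative.eval (z n) - p.derivative.eval (PowerSeries.C t0) :=
          dvd_trans ih2 (Polynomial.sub_dvd_eval_sub _ _ _)
        have h3 : (PowerSeries.X : PowerSeries R) ∣ 1 - p.derivative.eval (PowerSeries.C t0) * PowerSeries.C w := by
          rw [PowerSeries.X_dvd_iff]
          simp [hd]
        have := dvd_sub h3 (Dvd.dvd.mul_right h2 (PowerSeries.C w))
        convert this using 1; ring
      · rw [zs]
        have := dvd_sub ih2 (Dvd.dvd.mul_left hX (PowerSeries.C w))
        convert this using 1; ring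
  let y : PowerSeries R := PowerSeries.mk fun r => PowerSeries.coeff r (z r)
  have stab : ∀ r n, r ≤ n → PowerSeries.coeff r (z n) = PowerSeries.coeff r (z r) := by
    intro r n h
    induction n, h using Nat.le_induction with
    | base => rfl
    | succ n hn ih =>
      rw [zs, map_sub, ih, sub_eq_self]
      exact PowerSeries.X_pow_dvd_iff.1 (Dvd.dvd.mul_left (key n).1 _) r (by omega)
  have hy : ∀ n, (PowerSeries.X : PowerSeries R)^(n+1) ∣ y - z n := by
    intro n
    rw [PowerSeries.X_pow_dvd_iff]
    intro r hr
    rw [map_sub, PowerSeries.coeff_mk, stab r n (by omega), sub_self]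
  refine ⟨y, ?_, ?_, ?_⟩
  · intro r
    rw [PowerSeries.coeff_mk]
    exact zF r r
  · rw [← PowerSeries.coeff_zero_eq_constantCoeff_apply, PowerSeries.coeff_mk, z0]
    simp
  · have : ∀ n, (PowerSeries.X : PowerSeries R)^(n+1) ∣ p.eval y := by
      intro n
      have := dvd_add (dvd_trans (hy n) (Polynomial.sub_dvd_eval_sub y (z n) p)) (key n).1
      simpa using this
    ext n
    simpa using PowerSeries.X_pow_dvd_iff.1 (this n) n (by omega)

/-- ordinary Hensel for power series -/
theorem ps_hensel (p : Polynomial (PowerSeries R)) (t0 w : R)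
    (h0 : PowerSeries.constantCoeff (p.eval (PowerSeries.C t0)) = 0)
    (hd : PowerSeries.constantCoeff (p.derivative.eval (PowerSeries.C t0)) * w = 1) :
    ∃ z : PowerSeries R, PowerSeries.constantCoeff z = t0 ∧ p.eval z = 0 := by
  obtain ⟨z, -, h⟩ := filtered_hensel (W := fun _ => (⊤ : AddSubgroup R)) (by simp) (by simp) p
    (by intro i r; simp) t0 w (by simp) (by simp) h0 hd
  exact ⟨z, h⟩

theorem ps_hensel_unique (p : Polynomial (PowerSeries R)) (z z' : PowerSeries R)
    (hzz : PowerSeries.constantCoeff z = PowerSeries.constantCoeff z')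
    (hz : p.eval z = 0) (hz' : p.eval z' = 0)
    (hd : IsUnit (PowerSeries.constantCoeff (p.derivative.eval z))) : z = z' := by
  obtain ⟨c, hc⟩ := Polynomial.binomExpansion p z (z' - z)
  rw [add_sub_cancel, hz, hz', zero_add] at hc
  have e : (z' - z) * (p.derivative.eval z + c * (z' - z)) = 0 := by rw [hc]; ring
  have u : IsUnit (p.derivative.eval z + c * (z' - z)) := by
    rw [PowerSeries.isUnit_iff_constantCoeff]
    simpa [hzz] using hd
  have := (u.mul_left_eq_zero).1 e
  exact (sub_eq_zero.1 this).symm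
end Filt
end BH

namespace BH

section Ev
variable {k : Type*} [CommRing k] {S : Type*} [CommRing S] [Algebra k S]

/-- evaluation of a bivariate polynomial `P(s,Y)` (outer variable `Y`) at `s = a`, `Y = b` -/
noncomputable def ev (a b : S) : k[X][X] →ₐ[k] S := aevalAeval a b

@[simp] lemma ev_C (a b : S) (c : k[X]) : ev a b (C c) = aeval a c := by
  unfold ev; exact aevalAeval_C a b c

@[simp] lemma ev_X (a b : S) : ev (k := k) a b X = b := by
  unfold ev; simp

lemma ev_sum (a b : S) (P : k[X][X]) :
    ev a b P = ∑ j ∈ Finset.range (P.natDegree + 1), aeval a (P.coeff j) * b ^ j := by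
  conv_lhs => rw [P.as_sum_range_C_mul_X_pow]
  simp [map_sum]

lemma ev_eq_eval₂ (a b : S) (P : k[X][X]) :
    ev a b P = P.eval₂ (aeval a : k[X] →ₐ[k] S).toRingHom b := by
  rw [ev_sum, Polynomial.eval₂_eq_sum_range]; rfl

lemma ev_eq_eval_map (a b : S) (P : k[X][X]) :
    ev a b P = (P.map (aeval a : k[X] →ₐ[k] S).toRingHom).eval b := by
  rw [ev_eq_eval₂, Polynomial.eval_map]

lemma hom_ev {S' : Type*} [CommRing S'] [Algebra k S'] (φ : S →ₐ[k] S') (a b : S) (P : k[X][X]) :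
    φ (ev a b P) = ev (φ a) (φ b) P := by
  rw [ev_sum, ev_sum, map_sum]
  refine Finset.sum_congr rfl fun j _ => ?_
  rw [map_mul, map_pow, ← Polynomial.aeval_algHom_apply]

end Ev

section Wt
variable {k : Type*} [Field k]

/-- bivariate polynomials of weighted degree at most `m`; `s` has weight `1`, `Y` weight `κ` -/
def Wt (k : Type*) [Field k] (κ m : ℕ) : Submodule k k[X][X] where
  carrier := {P | ∀ b a, (P.coeff b).coeff a ≠ 0 → a + κ * b ≤ m}
  add_mem' := by
    intro P Q hP hQ b a h
    by_contra hc
    apply h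
    have h1 : (P.coeff b).coeff a = 0 := by by_contra h'; exact hc (hP b a h')
    have h2 : (Q.coeff b).coeff a = 0 := by by_contra h'; exact hc (hQ b a h')
    simp [h1, h2]
  zero_mem' := by intro b a h; simp at h
  smul_mem' := by
    intro c P hP b a h
    apply hP b a
    intro h'
    apply h
    simp [h']

lemma mem_Wt {κ m : ℕ} {P : k[X][X]} :
    P ∈ Wt k κ m ↔ ∀ b a, (P.coeff b).coeff a ≠ 0 → a + κ * b ≤ m := Iff.rfl

lemma Wt_mono {κ m m' : ℕ} (h : m ≤ m') : Wt k κ m ≤ Wt k κ m' :=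
  fun _ hP b a hc => (hP b a hc).trans h

lemma Wt_of_natDegree {κ m : ℕ} {P : k[X][X]}
    (h : ∀ b, P.coeff b ≠ 0 → (P.coeff b).natDegree + κ * b ≤ m) : P ∈ Wt k κ m := by
  intro b a hc
  have h1 : P.coeff b ≠ 0 := by intro h'; simp [h'] at hc
  have := le_natDegree_of_ne_zero hc
  have := h b h1
  omega

lemma Wt_mul {κ m m' : ℕ} {P Q : k[X][X]} (hP : P ∈ Wt k κ m) (hQ : Q ∈ Wt k κ m') :
    P * Q ∈ Wt k κ (m + m') := by
  intro b a h
  rw [coeff_mul, finsetSum_coeff] at h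
  obtain ⟨x, hx, hx'⟩ := Finset.exists_ne_zero_of_sum_ne_zero h
  rw [coeff_mul] at hx'
  obtain ⟨y, hy, hy'⟩ := Finset.exists_ne_zero_of_sum_ne_zero hx'
  have h1 := hP _ _ (left_ne_zero_of_mul hy')
  have h2 := hQ _ _ (right_ne_zero_of_mul hy')
  rw [Finset.HasAntidiagonal.mem_antidiagonal] at hx hy
  rw [← hx, ← hy, mul_add]
  omega

lemma Wt_C {κ m : ℕ} {c : k[X]} (h : c.natDegree ≤ m) : (C c : k[X][X]) ∈ Wt k κ m := by
  refine Wt_of_natDegree fun b hb => ?_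
  rw [coeff_C] at hb ⊢
  split_ifs at hb ⊢ with h0
  · subst h0; simpa using h
  · exact absurd rfl hb

lemma Wt_one {κ : ℕ} : (1 : k[X][X]) ∈ Wt k κ 0 := by
  have := Wt_C (k := k) (κ := κ) (m := 0) (c := 1) (by simp)
  simpa using this

lemma Wt_X {κ : ℕ} : (X : k[X][X]) ∈ Wt k κ κ := by
  refine Wt_of_natDegree fun b hb => ?_
  rw [coeff_X] at hb ⊢
  split_ifs at hb ⊢ with h0
  · subst h0; simp
  · exact absurd rfl hb

lemma Wt_pow {κ m : ℕ} {P : k[X][X]} (hP : P ∈ Wt k κ m) (b : ℕ) : P ^ b ∈ Wt k κ (b * m) := by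
  induction b with
  | zero => simpa using Wt_one
  | succ b ih =>
    rw [pow_succ, add_mul, one_mul]; exact Wt_mul ih hP

lemma ev_mem_filt {S : Type*} [CommRing S] [Algebra k S] (F : ℕ → AddSubgroup S)
    (hmul : ∀ i j a b, a ∈ F i → b ∈ F j → a * b ∈ F (i + j))
    (hmono : ∀ i j, i ≤ j → F i ≤ F j)
    (hk : ∀ c : k, algebraMap k S c ∈ F 0) {κ m : ℕ} {a b : S} (ha : a ∈ F 1) (hb : b ∈ F κ)
    {P : k[X][X]} (hP : P ∈ Wt k κ m) : ev a b P ∈ F m := by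
  have hpow : ∀ (x : S) (i j : ℕ), x ∈ F i → x ^ j ∈ F (i * j) := by
    intro x i j hx
    induction j with
    | zero => have := hk 1; simpa using this
    | succ j ih => rw [pow_succ, mul_add, mul_one]; exact hmul _ _ _ _ ih hx
  rw [ev_sum]
  refine sum_mem fun j _ => ?_
  rw [Polynomial.aeval_eq_sum_range, Finset.sum_mul]
  refine sum_mem fun i _ => ?_
  by_cases h : (P.coeff j).coeff i = 0
  · rw [h, zero_smul, zero_mul]; exact zero_mem _
  · have h1 := hP j i h
    rw [Algebra.smul_def]
    have h2 := hmul _ _ _ _ (hmul _ _ _ _ (hk ((P.coeff j).coeff i)) (hpow a 1 i ha))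
      (hpow b κ j hb)
    refine hmono _ _ ?_ h2
    omega

/-- reduction modulo a monic polynomial preserves weights -/
lemma Wt_reduce {κ D : ℕ} {Φ : k[X][X]} (hΦ : Φ.Monic) (hD : Φ.natDegree = D)
    (hw : Φ ∈ Wt k κ (κ * D)) (hD0 : 0 < D) : ∀ (n m : ℕ) (P : k[X][X]), P.natDegree ≤ n → P ∈ Wt k κ m →
    ∃ P' ∈ Wt k κ m, P'.natDegree < D ∧ Φ ∣ P - P' := by
  intro n
  induction n with
  | zero =>
    intro m P hP hPm
    exact ⟨P, hPm, by omega, by simp⟩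
  | succ n ih =>
    intro m P hP hPm
    by_cases hlt : P.natDegree < D
    · exact ⟨P, hPm, hlt, by simp⟩
    push Not at hlt
    by_cases hP0 : P = 0
    · subst hP0; simp at hlt; omega
    let c := P.leadingCoeff
    let e := P.natDegree - D
    let T : k[X][X] := C c * X ^ e * Φ
    have hcw : c.natDegree + κ * P.natDegree ≤ m := by
      have h : (P.coeff P.natDegree).coeff c.natDegree ≠ 0 := by
        change c.coeff c.natDegree ≠ 0
        rw [coeff_natDegree, leadingCoeff_ne_zero]
        exact leadingCoeff_ne_zero.2 hP0
      exact hPm _ _ h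
    have hT : T ∈ Wt k κ m := by
      have h1 := Wt_mul (Wt_mul (Wt_C (k := k) (κ := κ) (le_refl c.natDegree)) (Wt_pow (Wt_X (k := k) (κ := κ)) e)) hw
      refine Wt_mono ?_ h1
      have : κ * P.natDegree = e * κ + κ * D := by
        have : P.natDegree = e + D := by simp only [e]; omega
        rw [this]; ring
      omega
    have hTd : (P - T).natDegree ≤ n := by
      have hc0 : c ≠ 0 := leadingCoeff_ne_zero.2 hP0
      have hTne : T ≠ 0 := by
        simp only [T]
        refine mul_ne_zero (mul_ne_zero (by simpa using hc0) (by simp)) hΦ.ne_zero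
      have hTlc : T.leadingCoeff = c := by
        simp only [T]
        rw [leadingCoeff_mul_monic hΦ, leadingCoeff_mul_X_pow, leadingCoeff_C]
      have hTdeg : T.natDegree = P.natDegree := by
        simp only [T]
        rw [natDegree_mul (mul_ne_zero (by simpa using hc0) (by simp)) hΦ.ne_zero,
          natDegree_C_mul_X_pow _ _ hc0, hD]
        omega
      have hlt' : (P - T).degree < P.degree :=
        degree_sub_lt_left (by rw [degree_eq_natDegree hP0, degree_eq_natDegree hTne, hTdeg]) hP0 hTlc.symm
      by_cases h0 : P - T = 0
      · rw [h0]; simp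
      · have := natDegree_lt_natDegree h0 hlt'
        omega
    obtain ⟨P', h1, h2, h3⟩ := ih m (P - T) hTd (Submodule.sub_mem _ hPm hT)
    refine ⟨P', h1, h2, ?_⟩
    have : P - P' = (P - T - P') + C c * X ^ e * Φ := by simp only [T]; ring
    rw [this]
    exact dvd_add h3 (Dvd.intro_left _ rfl)

end Wt
end BH

namespace BH

section Taylor
variable {k : Type*} [Field k]

/-- partial derivative in the inner variable -/
noncomputable def dS (P : k[X][X]) : k[X][X] :=
  ∑ b ∈ Finset.range (P.natDegree + 1), monomial b (derivative (P.coeff b))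

lemma coeff_dS (P : k[X][X]) (b : ℕ) : (dS P).coeff b = derivative (P.coeff b) := by
  unfold dS
  simp only [finsetSum_coeff, coeff_monomial]
  rw [Finset.sum_ite_eq' (Finset.range (P.natDegree + 1)) b (fun b => derivative (P.coeff b))]
  split_ifs with h
  · rfl
  · rw [coeff_eq_zero_of_natDegree_lt (by simpa using h)]; simp

lemma dS_mem_Wt {κ m : ℕ} {P : k[X][X]} (hP : P ∈ Wt k κ m) : dS P ∈ Wt k κ m := by
  intro b a h
  rw [coeff_dS, coeff_derivative] at h
  have := hP _ _ (left_ne_zero_of_mul h)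
  omega

lemma derivative_mem_Wt {κ m : ℕ} {P : k[X][X]} (hP : P ∈ Wt k κ m) :
    derivative P ∈ Wt k κ m := by
  intro b a h
  rw [coeff_derivative] at h
  have h1 : (P.coeff (b+1)).coeff a ≠ 0 := by
    intro h'
    apply h
    have : ((b : k[X]) + 1) = C ((b : k) + 1) := by simp
    rw [this, coeff_mul_C, h', zero_mul]
  have := hP _ _ h1
  rw [mul_add] at this
  omega

lemma derivative_aeval' {A : Type*} [CommRing A] [Algebra k A] (a : A[X]) (c : k[X]) :
    derivative (aeval a c) = aeval a (derivative c) * derivative a := by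
  induction c using Polynomial.induction_on' with
  | add p q hp hq => simp [hp, hq, add_mul]
  | monomial n c =>
    rw [aeval_monomial, derivative_monomial, aeval_monomial, derivative_mul, derivative_pow]
    have : derivative (algebraMap k A[X] c) = 0 := by
      rw [Polynomial.algebraMap_apply, derivative_C]
    rw [this]
    simp
    ring

lemma derivative_ev {A : Type*} [CommRing A] [Algebra k A] (a b : A[X]) (P : k[X][X]) :
    derivative (ev a b P) = ev a b (dS P) * derivative a + ev a b (derivative P) * derivative b := by
  have h1 : ev a b (dS P) = ∑ j ∈ Finset.range (P.natDegree + 1), aeval a (derivative (P.coeff j)) * b ^ j := by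
    unfold dS
    rw [map_sum]
    refine Finset.sum_congr rfl fun j _ => ?_
    rw [← C_mul_X_pow_eq_monomial]; simp
  have h2 : ev a b (derivative P) = ∑ j ∈ Finset.range (P.natDegree + 1), aeval a (P.coeff j) * (C (j : A) * b ^ (j - 1)) := by
    conv_lhs => rw [P.as_sum_range_C_mul_X_pow]
    rw [derivative_sum, map_sum]
    refine Finset.sum_congr rfl fun j _ => ?_
    rw [derivative_C_mul_X_pow]
    simp [mul_assoc]
  rw [ev_sum, derivative_sum, h1, h2, Finset.sum_mul, Finset.sum_mul, ← Finset.sum_add_distrib]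
  refine Finset.sum_congr rfl fun j _ => ?_
  rw [derivative_mul, derivative_aeval', derivative_pow]
  ring

lemma ev_coeff_zero {A : Type*} [CommRing A] [Algebra k A] (a b : A[X]) (P : k[X][X]) :
    (ev a b P).coeff 0 = ev (a.coeff 0) (b.coeff 0) P := by
  have := hom_ev ((Polynomial.aeval (0 : A)).restrictScalars k : A[X] →ₐ[k] A) a b P
  simpa [coeff_zero_eq_eval_zero, Polynomial.coe_aeval_eq_eval] using this

lemma ev_coeff_one {A : Type*} [CommRing A] [Algebra k A] (a b : A[X]) (P : k[X][X]) :
    (ev a b P).coeff 1 = ev (a.coeff 0) (b.coeff 0) (dS P) * a.coeff 1 +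
      ev (a.coeff 0) (b.coeff 0) (derivative P) * b.coeff 1 := by
  have h : ∀ f : A[X], f.coeff 1 = (derivative f).coeff 0 := by
    intro f; rw [coeff_derivative]; simp
  rw [h, derivative_ev, coeff_add, mul_coeff_zero, mul_coeff_zero, ev_coeff_zero, ev_coeff_zero,
    ← h, ← h]

/-- Taylor expansion along the curve, with control of weights -/
theorem taylor_curve {B : Type*} [CommRing B] [Algebra k B] (W : ℕ → AddSubgroup B)
    (hmul : ∀ i j a b, a ∈ W i → b ∈ W j → a * b ∈ W (i + j))
    (hmono : ∀ i j, i ≤ j → W i ≤ W j)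
    (hk : ∀ c : k, algebraMap k B c ∈ W 0) {κ E : ℕ} (σ η : B) (hσ : σ ∈ W 1) (hη : η ∈ W κ)
    (Φ : k[X][X]) (hΦ : Φ ∈ Wt k κ E) (h0 : ev σ η Φ = 0) (U : B)
    (hU : ev σ η (derivative Φ) = U) :
    ∃ y : PowerSeries B, PowerSeries.constantCoeff y = η ∧
      (∀ r, PowerSeries.coeff r y ∈ W (κ + 3 * E * r)) ∧
      ev (PowerSeries.C σ + PowerSeries.C (U ^ 2) * PowerSeries.X) y Φ = 0 := by
  classical
  set β : B := ev σ η (dS Φ) with hβ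
  have hUE : U ∈ W E := hU ▸ ev_mem_filt W hmul hmono hk hσ hη (derivative_mem_Wt hΦ)
  have hβE : β ∈ W E := ev_mem_filt W hmul hmono hk hσ hη (dS_mem_Wt hΦ)
  have h1 : (1 : B) ∈ W 0 := by simpa using hk 1
  -- filtration on `B[z]`
  let F : ℕ → AddSubgroup B[X] := fun m =>
    { carrier := {P | ∀ i, P.coeff i ∈ W m}
      add_mem' := fun {a b} ha hb i => by rw [coeff_add]; exact add_mem (ha i) (hb i)
      zero_mem' := fun i => by rw [coeff_zero]; exact zero_mem _
      neg_mem' := fun {a} ha i => by rw [coeff_neg]; exact neg_mem (ha i) }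
  have memF : ∀ m P, P ∈ F m ↔ ∀ i, P.coeff i ∈ W m := fun m P => Iff.rfl
  have Fmul : ∀ i j a b, a ∈ F i → b ∈ F j → a * b ∈ F (i + j) := by
    intro i j a b ha hb l
    rw [coeff_mul]
    exact sum_mem fun x _ => hmul _ _ _ _ (ha _) (hb _)
  have Fmono : ∀ i j, i ≤ j → F i ≤ F j := fun i j h P hP l => hmono i j h (hP l)
  have FC : ∀ m b, b ∈ W m → (C b : B[X]) ∈ F m := by
    intro m b hb i
    rw [coeff_C]; split_ifs
    · exact hb
    · exact zero_mem _
  have FX : (X : B[X]) ∈ F 0 := by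
    intro i; rw [coeff_X]; split_ifs
    · exact h1
    · exact zero_mem _
  -- filtration on `B[z][τ]`
  let G : ℕ → AddSubgroup B[X][X] := fun m =>
    { carrier := {P | ∀ i, P.coeff i ∈ F (m + E * i)}
      add_mem' := fun {a b} ha hb i => by rw [coeff_add]; exact add_mem (ha i) (hb i)
      zero_mem' := fun i => by rw [coeff_zero]; exact zero_mem _
      neg_mem' := fun {a} ha i => by rw [coeff_neg]; exact neg_mem (ha i) }
  have Gmul : ∀ i j a b, a ∈ G i → b ∈ G j → a * b ∈ G (i + j) := by
    intro i j a b ha hb l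
    rw [coeff_mul]
    refine sum_mem fun x hx => ?_
    have := Fmul _ _ _ _ (ha x.1) (hb x.2)
    rw [Finset.HasAntidiagonal.mem_antidiagonal] at hx
    refine Fmono _ _ ?_ this
    rw [← hx, mul_add]; omega
  have Gmono : ∀ i j, i ≤ j → G i ≤ G j := fun i j h P hP l => Fmono _ _ (by omega) (hP l)
  have GCC : ∀ m b0 b1, b0 ∈ F m → b1 ∈ F (m + E) → (C b0 + C b1 * X : B[X][X]) ∈ G m := by
    intro m b0 b1 hb0 hb1 i
    rw [coeff_add, coeff_C, coeff_C_mul, coeff_X]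
    rcases i with _ | _ | i
    · simpa using hb0
    · simpa using hb1
    · simp [zero_mem]
  have Gk : ∀ c : k, algebraMap k B[X][X] c ∈ G 0 := by
    intro c
    have := GCC 0 (C (algebraMap k B c)) 0 (FC _ _ (hk c)) (zero_mem _)
    simpa using this
  let a : B[X][X] := C (C σ) + C (C U) * X
  let b : B[X][X] := C (C η) + C (X - C β) * X
  have ha : a ∈ G 1 := GCC _ _ _ (FC _ _ hσ) (FC _ _ (hmono _ _ (by omega) hUE))
  have hb : b ∈ G κ := GCC _ _ _ (FC _ _ hη)
    (sub_mem (Fmono _ _ (by omega) FX) (FC _ _ (hmono _ _ (by omega) hβE)))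
  let f : B[X][X] := ev a b Φ
  have hf : f ∈ G E := ev_mem_filt G Gmul Gmono Gk ha hb hΦ
  have a0 : a.coeff 0 = C σ := by simp [a]
  have a1 : a.coeff 1 = C U := by simp [a, coeff_C]
  have b0 : b.coeff 0 = C η := by simp [b]
  have b1 : b.coeff 1 = X - C β := by simp [b, coeff_C]
  have evC : ∀ P : k[X][X], ev (C σ : B[X]) (C η) P = C (ev σ η P) := by
    intro P
    exact (hom_ev ((Polynomial.CAlgHom (R := B) (A := B)).restrictScalars k) σ η P).symm
  have f0 : f.coeff 0 = 0 := by
    rw [ev_coeff_zero, a0, b0, evC, h0, C_0]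
  have f1 : f.coeff 1 = C U * X := by
    rw [ev_coeff_one, a0, b0, a1, b1, evC, evC, hU, ← hβ]; ring
  let g : B[X][X] := f.divX.divX
  have hg : ∀ i, g.coeff i ∈ F (3 * E + E * i) := by
    intro i
    simp only [g, coeff_divX]
    refine Fmono _ _ ?_ (hf (i + 1 + 1))
    rw [mul_add, mul_add]; omega
  have hfg : f = C (C U * X) * X + g * X ^ 2 := by
    have e1 := Polynomial.divX_mul_X_add f
    have e2 := Polynomial.divX_mul_X_add f.divX
    rw [f0, C_0, add_zero] at e1
    rw [coeff_divX, zero_add, f1] at e2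
    rw [← e1, ← e2]; simp only [g]; ring
  -- the polynomial to which Hensel is applied
  let cc : ℕ := 3 * E
  let W' : ℕ → AddSubgroup B := fun r => W (cc * r)
  have W'mul : ∀ i j a b, a ∈ W' i → b ∈ W' j → a * b ∈ W' (i + j) := by
    intro i j a b ha hb
    have := hmul _ _ _ _ ha hb
    rw [← mul_add] at this; exact this
  have W'1 : (1 : B) ∈ W' 0 := by simpa [W'] using h1
  let T := FS W' W'mul W'1
  let χ : B[X][X] →+* (PowerSeries B)[X] :=
    eval₂RingHom (mapRingHom PowerSeries.C) (C (PowerSeries.C U * PowerSeries.X))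
  let p : (PowerSeries B)[X] := X + C PowerSeries.X * χ g
  have hχg : ∀ j, PowerSeries.X * (χ g).coeff j ∈ T := by
    intro j
    have : (χ g).coeff j = ∑ i ∈ Finset.range (g.natDegree + 1),
        PowerSeries.C ((g.coeff i).coeff j * U ^ i) * PowerSeries.X ^ i := by
      simp only [χ, coe_eval₂RingHom]
      rw [eval₂_eq_sum_range, finsetSum_coeff]
      refine Finset.sum_congr rfl fun i _ => ?_
      rw [← C_pow, coeff_mul_C, coe_mapRingHom, coeff_map, mul_pow, map_mul, map_pow]
      ring
    rw [this, Finset.mul_sum]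
    refine sum_mem fun i _ => ?_
    intro r
    have e : (PowerSeries.X : PowerSeries B) * (PowerSeries.C ((g.coeff i).coeff j * U ^ i) * PowerSeries.X ^ i)
      = PowerSeries.C ((g.coeff i).coeff j * U ^ i) * PowerSeries.X ^ (i+1) := by ring
    rw [e, PowerSeries.coeff_C_mul, PowerSeries.coeff_X_pow]
    split_ifs with h
    · subst h
      rw [mul_one]
      have hUi : U ^ i ∈ W (E * i) := by
        clear e this
        rename_i hi
        clear hi
        induction i with
        | zero => simpa using h1
        | succ i ih => rw [pow_succ, mul_add, mul_one]; exact hmul _ _ _ _ ih hUE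
      refine hmono _ _ ?_ (hmul _ _ _ _ (hg i j) hUi)
      simp only [cc]; rw [mul_add, mul_assoc]; omega
    · rw [mul_zero]; exact zero_mem _
  have hp : ∀ j, p.coeff j ∈ T := by
    intro j
    simp only [p]
    rw [coeff_add, coeff_C_mul]
    refine add_mem ?_ (hχg j)
    rw [coeff_X]; split_ifs
    · exact one_mem _
    · exact zero_mem _
  obtain ⟨z, hzT, -, hz⟩ := filtered_hensel W'mul W'1 p hp 0 1 (zero_mem _) W'1 (by simp [p])
    (by simp [p])
  refine ⟨PowerSeries.C η + PowerSeries.C U * PowerSeries.X * (z - PowerSeries.C β), ?_, ?_, ?_⟩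
  · simp
  · intro r
    rcases r with _ | r
    · simpa using hη
    · have e : PowerSeries.C η + PowerSeries.C U * PowerSeries.X * (z - PowerSeries.C β) =
        PowerSeries.C η + PowerSeries.C U * ((z - PowerSeries.C β) * PowerSeries.X) := by ring
      rw [e, map_add, PowerSeries.coeff_C_mul, PowerSeries.coeff_succ_mul_X, PowerSeries.coeff_C,
        if_neg (Nat.succ_ne_zero r), zero_add]
      have h2 : PowerSeries.coeff r (z - PowerSeries.C β) ∈ W (E + cc * r) := by
        rw [map_sub, PowerSeries.coeff_C]
        refine sub_mem (hmono _ _ (by omega) (hzT r)) ?_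
        split_ifs with h
        · exact hmono _ _ (by omega) hβE
        · exact zero_mem _
      refine hmono _ _ ?_ (hmul _ _ _ _ hUE h2)
      simp only [cc]; rw [mul_add]; omega
  · let ψ : B[X][X] →+* PowerSeries B := (evalRingHom z).comp χ
    have ψC : ∀ x : B, ψ (C (C x)) = PowerSeries.C x := by intro x; simp [ψ, χ]
    have ψz : ψ (C X) = z := by simp [ψ, χ]
    have ψX : ψ X = PowerSeries.C U * PowerSeries.X := by simp [ψ, χ]
    let ψ' : B[X][X] →ₐ[k] PowerSeries B :=
      { ψ with
        commutes' := by
          intro c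
          change ψ (algebraMap k B[X][X] c) = _
          have : algebraMap k B[X][X] c = C (C (algebraMap k B c)) := rfl
          rw [this, ψC, PowerSeries.algebraMap_apply] }
    have e1 : ψ f = ev (ψ a) (ψ b) Φ := hom_ev ψ' a b Φ
    have e2 : ψ a = PowerSeries.C σ + PowerSeries.C (U ^ 2) * PowerSeries.X := by
      simp only [a, map_add, map_mul, ψC, ψX, map_pow]; ring
    have e3 : ψ b = PowerSeries.C η + PowerSeries.C U * PowerSeries.X * (z - PowerSeries.C β) := by
      simp only [b, map_add, map_mul, ψC, ψX, map_sub, ψz]; ring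
    rw [← e2, ← e3, ← e1, hfg]
    have e4 : z + PowerSeries.X * ψ g = 0 := by
      have : p.eval z = z + PowerSeries.X * ψ g := by simp [p, ψ]
      rw [← this, hz]
    simp only [map_add, map_mul, map_pow, ψC, ψX, ψz]
    linear_combination (PowerSeries.C U ^ 2 * PowerSeries.X) * e4

end Taylor
end BH

namespace BH

section Res
variable {k : Type*} [Field k]

lemma natDegree_det_le_col {N : ℕ} (M : Matrix (Fin N) (Fin N) k[X]) (e : Fin N → ℕ)
    (h : ∀ i j, (M i j).natDegree ≤ e j) : M.det.natDegree ≤ ∑ j, e j := by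
  rw [Matrix.det_apply]
  refine natDegree_sum_le_of_forall_le _ _ fun σ _ => ?_
  have h1 : (∏ i, M (σ i) i).natDegree ≤ ∑ j, e j :=
    (natDegree_prod_le _ _).trans (Finset.sum_le_sum fun i _ => h _ _)
  rcases Int.units_eq_one_or (Equiv.Perm.sign σ) with h' | h' <;> rw [h'] <;> simpa using h1

lemma natDegree_resultant_le (f g : k[X][X]) (m n e1 e2 : ℕ)
    (hf : ∀ i, (f.coeff i).natDegree ≤ e1) (hg : ∀ i, (g.coeff i).natDegree ≤ e2) :
    (f.resultant g m n).natDegree ≤ m * e2 + n * e1 := by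
  have := natDegree_det_le_col (sylvester f g m n)
    (fun j => Fin.addCases (fun _ => e2) (fun _ => e1) j) (by
      intro i j
      refine Fin.addCases (fun j₁ => ?_) (fun j₁ => ?_) j
      · simp only [sylvester, Matrix.of_apply, Fin.addCases_left]
        split_ifs
        · exact hg _
        · simp
      · simp only [sylvester, Matrix.of_apply, Fin.addCases_right]
        split_ifs
        · exact hf _
        · simp)
  rw [Fin.sum_univ_add] at this
  simpa [resultant] using this

lemma resultant_ne_zero_of_irred (Φ h : k[X][X]) (hΦ : Φ.Monic) (hirr : Irreducible Φ)
    (hd : ¬ Φ ∣ h) : Φ.resultant h ≠ 0 := by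
  let K := FractionRing k[X]
  let φ := algebraMap k[X] K
  have hinj : Function.Injective φ := IsFractionRing.injective _ _
  have h1 : Irreducible (Φ.map φ) :=
    (Monic.irreducible_iff_irreducible_map_fraction_map hΦ).1 hirr
  have h2 : ¬ Φ.map φ ∣ h.map φ := by rwa [Polynomial.map_dvd_map φ hinj hΦ]
  have h3 : IsCoprime (Φ.map φ) (h.map φ) := (h1.coprime_iff_not_dvd).2 h2
  have h4 := resultant_ne_zero _ _ h3
  rw [natDegree_map_eq_of_injective hinj, natDegree_map_eq_of_injective hinj,
    resultant_map_map] at h4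
  intro h0; rw [h0, map_zero] at h4; exact h4 rfl

lemma aeval_shift_eq_coe (s0 : k) (R : k[X]) :
    aeval (PowerSeries.C s0 + PowerSeries.X : PowerSeries k) R = ((R.comp (X + C s0) : k[X]) : PowerSeries k) := by
  induction R using Polynomial.induction_on' with
  | add p q hp hq => simp [hp, hq]
  | monomial n c =>
    simp [PowerSeries.algebraMap_apply, add_comm]

lemma pow_dvd_of_coe {R : k[X]} {n : ℕ}
    (h : (PowerSeries.X : PowerSeries k) ^ n ∣ (R : PowerSeries k)) : X ^ n ∣ R := by
  rw [PowerSeries.X_pow_dvd_iff] at h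
  rw [Polynomial.X_pow_dvd_iff]
  intro d hd
  simpa using h d hd

lemma mult_resultant (Φ h : k[X][X]) (hΦ : Φ.Monic) (s0 : k) (Y0 : Finset k) (M : ℕ)
    (hη : ∀ y ∈ Y0, ∃ η : PowerSeries k, PowerSeries.constantCoeff η = y ∧
      ev (PowerSeries.C s0 + PowerSeries.X) η Φ = 0 ∧
      (PowerSeries.X : PowerSeries k) ^ M ∣ ev (PowerSeries.C s0 + PowerSeries.X) η h) :
    (X - C s0) ^ (Y0.card * M) ∣ Φ.resultant h := by
  classical
  choose! η h1 h2 h3 using hη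
  let φ : k[X] →+* PowerSeries k := (aeval (PowerSeries.C s0 + PowerSeries.X : PowerSeries k) : k[X] →ₐ[k] _).toRingHom
  have hA : ∏ y ∈ Y0, (X - C (η y)) ∣ Φ.map φ := by
    refine Finset.prod_dvd_of_coprime ?_ ?_
    · intro a ha b hb hab
      refine Polynomial.isCoprime_X_sub_C_of_isUnit_sub ?_
      rw [PowerSeries.isUnit_iff_constantCoeff, map_sub, h1 a ha, h1 b hb]
      exact (sub_ne_zero.2 hab).isUnit
    · intro y hy
      rw [dvd_iff_isRoot, IsRoot, ← ev_eq_eval_map]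
      exact h2 y hy
  obtain ⟨R', hR'⟩ := hA
  have hφΦ : (Φ.map φ).Monic := hΦ.map φ
  have hne : ∏ y ∈ Y0, (X - C (η y)) ≠ 0 := Finset.prod_ne_zero_iff.2 fun y _ => X_sub_C_ne_zero _
  have hR0 : R' ≠ 0 := by rintro rfl; rw [mul_zero] at hR'; exact hφΦ.ne_zero hR'
  have hdeg : Φ.natDegree = (∏ y ∈ Y0, (X - C (η y))).natDegree + R'.natDegree := by
    rw [← natDegree_mul hne hR0, ← hR', hΦ.natDegree_map]
  have key : φ (Φ.resultant h) = (∏ y ∈ Y0, (h.map φ).eval (η y)) *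
      R'.resultant (h.map φ) R'.natDegree h.natDegree := by
    rw [← resultant_map_map, hdeg, hR', resultant_mul_left _ _ _ _ natDegree_map_le]
    congr 1
    rw [resultant_prod_left _ _ _ _ (by simp) natDegree_map_le]
    refine Finset.prod_congr rfl fun y _ => ?_
    rw [natDegree_X_sub_C, resultant_X_sub_C_left _ _ _ natDegree_map_le]
  have hX : (PowerSeries.X : PowerSeries k) ^ (Y0.card * M) ∣ φ (Φ.resultant h) := by
    rw [key]
    refine Dvd.dvd.mul_right ?_ _
    rw [mul_comm, pow_mul, ← Finset.prod_const]
    refine Finset.prod_dvd_prod_of_dvd _ _ fun y hy => ?_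
    rw [← ev_eq_eval_map]
    exact h3 y hy
  rw [X_sub_C_pow_dvd_iff]
  apply pow_dvd_of_coe
  rw [← aeval_shift_eq_coe]
  exact hX

/-- echelon form: a finite dimensional space of power series contains elements with strictly
increasing orders -/
lemma echelon : ∀ (I : ℕ) (V : Submodule k (PowerSeries k)) [FiniteDimensional k V],
    Module.finrank k V = I →
    ∃ (f : Fin I → PowerSeries k) (o : Fin I → ℕ), (∀ i, f i ∈ V) ∧ StrictMono o ∧
      ∀ i, PowerSeries.coeff (o i) (f i) ≠ 0 ∧ ∀ j < o i, PowerSeries.coeff j (f i) = 0 := by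
  intro I
  induction I with
  | zero => intro V _ _; exact ⟨Fin.elim0, Fin.elim0, fun i => i.elim0, fun i => i.elim0, fun i => i.elim0⟩
  | succ I ih =>
    intro V _ hV
    classical
    have hex : ∃ n, ∃ f ∈ V, PowerSeries.coeff n f ≠ 0 := by
      by_contra hcon
      push Not at hcon
      have : V = ⊥ := by
        rw [eq_bot_iff]
        intro f hf
        rw [Submodule.mem_bot]
        ext n; simpa using hcon n f hf
      rw [this] at hV
      simp at hV
    let n := Nat.find hex
    obtain ⟨f0, hf0, hn⟩ := Nat.find_spec hex
    have hmin : ∀ m < n, ∀ f ∈ V, PowerSeries.coeff m f = 0 := by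
      intro m hm f hf
      by_contra h
      exact Nat.find_min hex hm ⟨f, hf, h⟩
    let ℓ : V →ₗ[k] k := (PowerSeries.coeff n).comp V.subtype
    have hsurj : Function.Surjective ℓ := by
      refine LinearMap.surjective_of_ne_zero ?_
      intro h
      apply hn
      have := LinearMap.congr_fun h ⟨f0, hf0⟩
      simpa [ℓ] using this
    have hrk := ℓ.finrank_range_add_finrank_ker
    rw [LinearMap.range_eq_top.2 hsurj, finrank_top, Module.finrank_self, hV] at hrk
    let V' : Submodule k (PowerSeries k) := (LinearMap.ker ℓ).map V.subtype
    have hV' : Module.finrank k V' = I := by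
      have : Module.finrank k V' = Module.finrank k (LinearMap.ker ℓ) :=
        (LinearEquiv.finrank_eq (Submodule.equivMapOfInjective V.subtype V.injective_subtype (LinearMap.ker ℓ))).symm
      omega
    obtain ⟨f, o, h1, h2, h3⟩ := ih V' hV'
    have hmem : ∀ g ∈ V', g ∈ V ∧ PowerSeries.coeff n g = 0 := by
      rintro g ⟨x, hx, rfl⟩
      exact ⟨x.2, hx⟩
    have hno : ∀ i, n < o i := by
      intro i
      by_contra hc
      have hc' : o i ≤ n := by omega
      rcases hc'.lt_or_eq with h | h
      · exact (h3 i).1 (hmin _ h _ (hmem _ (h1 i)).1)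
      · exact (h3 i).1 (by rw [h]; exact (hmem _ (h1 i)).2)
    refine ⟨Fin.cons f0 f, Fin.cons n o, ?_, ?_, ?_⟩
    · intro i
      refine Fin.cases ?_ (fun i => ?_) i
      · simpa using hf0
      · simpa using (hmem _ (h1 i)).1
    · intro i j
      refine Fin.cases ?_ (fun i => ?_) i <;> refine Fin.cases ?_ (fun j => ?_) j
      · simp
      · simpa using hno j
      · simp
      · simpa using fun h => h2 h
    · intro i
      refine Fin.cases ?_ (fun i => ?_) i
      · exact ⟨by simpa using hn, fun j hj => hmin j (by simpa using hj) _ hf0⟩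
      · simpa using h3 i

end Res
end BH

namespace BH

section Stepanov
variable {k : Type*} [Field k]

/-- bivariate polynomials with bounded degrees, by their coefficients -/
noncomputable def toP (k : Type*) [Field k] (D n : ℕ) : (Fin D × Fin n → k) →ₗ[k] k[X][X] where
  toFun v := ∑ x : Fin D × Fin n, monomial (x.1 : ℕ) (monomial (x.2 : ℕ) (v x))
  map_add' u v := by simp [Finset.sum_add_distrib]
  map_smul' c v := by
    simp only [Pi.smul_apply, RingHom.id_apply, Finset.smul_sum]
    refine Finset.sum_congr rfl fun x _ => ?_
    rw [smul_monomial, smul_monomial]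

lemma toP_apply (D n : ℕ) (v : Fin D × Fin n → k) :
    toP k D n v = ∑ x : Fin D × Fin n, monomial (x.1 : ℕ) (monomial (x.2 : ℕ) (v x)) := rfl

lemma coeff_toP {D n : ℕ} (v : Fin D × Fin n → k) (b a : ℕ) :
    ((toP k D n v).coeff b).coeff a =
      if h : b < D ∧ a < n then v (⟨b, h.1⟩, ⟨a, h.2⟩) else 0 := by
  rw [toP_apply]
  simp only [finsetSum_coeff, coeff_monomial]
  have : ∀ x : Fin D × Fin n, (if (x.1 : ℕ) = b then monomial (x.2 : ℕ) (v x) else 0).coeff a =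
      if (x.1 : ℕ) = b ∧ (x.2 : ℕ) = a then v x else 0 := by
    intro x
    by_cases h1 : (x.1 : ℕ) = b <;> by_cases h2 : (x.2 : ℕ) = a <;> simp [h1, h2, coeff_monomial]
  simp only [this]
  split_ifs with h
  · rw [Finset.sum_eq_single (⟨b, h.1⟩, ⟨a, h.2⟩)]
    · simp
    · rintro ⟨x1, x2⟩ _ hx
      rw [if_neg]
      rintro ⟨h1, h2⟩
      apply hx
      ext
      · exact h1
      · exact h2
    · simp
  · refine Finset.sum_eq_zero fun x _ => ?_
    rw [if_neg]
    rintro ⟨h1, h2⟩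
    exact h ⟨h1 ▸ x.1.2, h2 ▸ x.2.2⟩

lemma toP_injective (D n : ℕ) : Function.Injective (toP k D n) := by
  intro u v h
  ext ⟨b, a⟩
  have := congrArg (fun P : k[X][X] => (P.coeff b).coeff a) h
  simpa [coeff_toP] using this

lemma toP_natDegree {D n : ℕ} (hD : 0 < D) (v : Fin D × Fin n → k) : (toP k D n v).natDegree < D := by
  rw [Nat.lt_iff_le_pred hD, natDegree_le_iff_coeff_eq_zero]
  intro b hb
  ext a
  rw [coeff_toP, dif_neg]; · simp
  rintro ⟨h, _⟩
  omega

lemma toP_coeff_natDegree {D n : ℕ} (v : Fin D × Fin n → k) (b : ℕ) :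
    ((toP k D n v).coeff b).natDegree ≤ n := by
  rw [natDegree_le_iff_coeff_eq_zero]
  intro a ha
  rw [coeff_toP, dif_neg]
  rintro ⟨_, h⟩
  omega

lemma toP_mem_Wt {κ D n : ℕ} (v : Fin D × Fin n → k) : toP k D n v ∈ Wt k κ (n + κ * D) := by
  intro b a h
  rw [coeff_toP] at h
  split_ifs at h with h'
  · have : κ * b ≤ κ * D := Nat.mul_le_mul_left _ h'.1.le
    omega
  · exact absurd rfl h

lemma mem_range_toP {D n : ℕ} {P : k[X][X]} (h1 : P.natDegree < D)
    (h2 : ∀ b, (P.coeff b).natDegree < n) : P ∈ LinearMap.range (toP k D n) := by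
  refine ⟨fun x => (P.coeff x.1).coeff x.2, ?_⟩
  ext b a
  rw [coeff_toP]
  split_ifs with h
  · rfl
  · rw [not_and_or] at h
    rcases h with h | h
    · rw [coeff_eq_zero_of_natDegree_lt (p := P) (n := b) (by omega)]; simp
    · rw [coeff_eq_zero_of_natDegree_lt (p := P.coeff b) (n := a)]
      have := h2 b; omega

/-- orders of bounded degree functions along a branch -/
lemma order_bound {D κ e : ℕ} (hD : 0 < D) {Φ : k[X][X]} (hΦ : Φ.Monic) (hirr : Irreducible Φ)
    (hdeg : Φ.natDegree = D) (hκ : ∀ b, (Φ.coeff b).natDegree ≤ κ) (y : PowerSeries k)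
    (hy : ev PowerSeries.X y Φ = 0) (c : k[X][X]) (hc : c ≠ 0) (hcD : c.natDegree < D)
    (hce : ∀ b, (c.coeff b).natDegree ≤ e) :
    ∃ o ≤ D * e + D * κ, PowerSeries.coeff o (ev PowerSeries.X y c) ≠ 0 := by
  have hnd : ¬ Φ ∣ c := hΦ.not_dvd_of_natDegree_lt hc (by omega)
  have hR := resultant_ne_zero_of_irred Φ c hΦ hirr hnd
  have hRd := natDegree_resultant_le Φ c Φ.natDegree c.natDegree κ e hκ hce
  obtain ⟨p, r, -, -, hpr⟩ := exists_mul_add_mul_eq_C_resultant Φ c (le_refl _) (le_refl _)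
    (Or.inl (by omega))
  by_contra hcon
  push Not at hcon
  have h1 := congrArg (ev (PowerSeries.X : PowerSeries k) y) hpr
  rw [map_add, map_mul, map_mul, hy, zero_mul, zero_add, ev_C] at h1
  have h2 : aeval (PowerSeries.X : PowerSeries k) (Φ.resultant c) = ((Φ.resultant c : k[X]) : PowerSeries k) := by
    have := aeval_shift_eq_coe 0 (Φ.resultant c)
    simpa using this
  rw [h2] at h1
  have h3 : (PowerSeries.X : PowerSeries k) ^ (D * e + D * κ + 1) ∣ ev PowerSeries.X y c := by
    rw [PowerSeries.X_pow_dvd_iff]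
    intro m hm
    exact hcon m (by omega)
  have h4 : X ^ (D * e + D * κ + 1) ∣ Φ.resultant c := pow_dvd_of_coe (h1 ▸ Dvd.dvd.mul_right h3 _)
  have h5 := natDegree_le_of_dvd h4 hR
  rw [natDegree_X_pow, ] at h5
  have : c.natDegree * κ ≤ D * κ := Nat.mul_le_mul_right _ hcD.le
  rw [hdeg] at hRd h5
  omega

theorem stepanov_core {p : ℕ} [Fact p.Prime] [CharP k p] (e0 : ℕ) (D κ : ℕ) (hD : 0 < D)
    (Φ Q : k[X][X]) (hΦ : Φ.Monic) (hirr : Irreducible Φ)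
    (hdeg : Φ.natDegree = D) (hκ : ∀ b, (Φ.coeff b).natDegree ≤ κ)
    (hQD : Q.natDegree < D) (hQκ : ∀ b, (Q.coeff b).natDegree ≤ κ)
    (y : PowerSeries k) (hy : ev PowerSeries.X y Φ = 0)
    (Z : Finset (k × k)) (hZ : ∀ z ∈ Z, z.1 ^ (p ^ e0) = z.1 ∧ ev z.1 z.2 Φ = 0 ∧
      ev z.1 z.2 (derivative Φ) ≠ 0 ∧ z.2 ^ (p ^ e0) * ev z.1 z.2 (derivative Φ) = ev z.1 z.2 Q)
    (a' j' M : ℕ) (h1 : D * a' + D * κ < p ^ e0) (h2 : M ≤ p ^ e0)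
    (h3 : M * (D * (a' + κ * D + 3 * (κ * D) * M + j' + D * (κ * D) + 1)) < (D * j') * (D * a')) :
    Z.card * M ≤ D * (a' + p ^ e0 * j') + (p ^ e0 + 1) * D * κ := by
  classical
  set q := p ^ e0 with hq
  set E := κ * D with hE
  have hΦE : Φ ∈ Wt k κ E := by
    refine Wt_of_natDegree fun b hb => ?_
    by_cases hbD : b = D
    · subst hbD
      have : Φ.coeff b = 1 := by rw [← hdeg]; exact hΦ
      rw [this]; simp [hE]
    · have hb' : b < D := by
        have := le_natDegree_of_ne_zero hb; omega
      have : κ * (b + 1) ≤ κ * D := Nat.mul_le_mul_left _ hb'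
      have := hκ b
      rw [mul_add] at *
      omega
  have hQE : Q ∈ Wt k κ E := by
    refine Wt_of_natDegree fun b hb => ?_
    have hb' : b < D := by
      have := le_natDegree_of_ne_zero hb; omega
    have : κ * (b + 1) ≤ κ * D := Nat.mul_le_mul_left _ hb'
    have := hQκ b
    rw [mul_add] at *
    omega
  -- the coordinate ring and its filtration
  let B := AdjoinRoot Φ
  let π : k[X][X] →ₐ[k] B := (AdjoinRoot.mkₐ Φ).restrictScalars k
  have hπ : ∀ P, π P = 0 ↔ Φ ∣ P := fun P => AdjoinRoot.mk_eq_zero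
  let W : ℕ → Submodule k B := fun m => (Wt k κ m).map π.toLinearMap
  let WA : ℕ → AddSubgroup B := fun m => (W m).toAddSubgroup
  have memW : ∀ m P, P ∈ Wt k κ m → π P ∈ W m := fun m P hP => ⟨P, hP, rfl⟩
  have hmul : ∀ i j a b, a ∈ WA i → b ∈ WA j → a * b ∈ WA (i + j) := by
    rintro i j _ _ ⟨P, hP, rfl⟩ ⟨P', hP', rfl⟩
    exact ⟨P * P', Wt_mul hP hP', map_mul π _ _⟩
  have hmono : ∀ i j, i ≤ j → WA i ≤ WA j := by
    rintro i j hij _ ⟨P, hP, rfl⟩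
    exact ⟨P, Wt_mono hij hP, rfl⟩
  have hk : ∀ c : k, algebraMap k B c ∈ WA 0 := by
    intro c
    refine ⟨C (C c), Wt_C (by simp), ?_⟩
    exact π.commutes c
  let σ : B := π (C X)
  let η : B := π X
  have hσ : σ ∈ WA 1 := memW _ _ (Wt_C (by simp))
  have hη : η ∈ WA κ := memW _ _ Wt_X
  have evπ : ∀ P, ev σ η P = π P := by
    intro P
    have : ev (C X : k[X][X]) X P = P := by
      rw [ev_sum]
      conv_rhs => rw [P.as_sum_range_C_mul_X_pow]
      refine Finset.sum_congr rfl fun j _ => ?_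
      congr 1
      have := Polynomial.aeval_algHom_apply ((Polynomial.CAlgHom (R := k[X]) (A := k[X])).restrictScalars k) X (P.coeff j)
      simpa using this
    conv_rhs => rw [← this]
    rw [hom_ev π]
  let U : B := π (derivative Φ)
  obtain ⟨ŷ, hŷ0, hŷ1, hŷ2⟩ := taylor_curve WA hmul hmono hk σ η hσ hη Φ hΦE
    (by rw [evπ, hπ]) U (evπ _)
  let ŝ : PowerSeries B := PowerSeries.C σ + PowerSeries.C (U ^ 2) * PowerSeries.X
  have hU : U ∈ WA E := memW _ _ (derivative_mem_Wt hΦE)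
  let Ψ : ℕ → k[X][X] →ₗ[k] B := fun r =>
    ((PowerSeries.coeff (R := B) r).restrictScalars k).comp (ev ŝ ŷ).toLinearMap
  have hΨa : ∀ r P, Ψ r P = PowerSeries.coeff r (ev ŝ ŷ P) := fun r P => rfl
  have hΨ : ∀ r m P, P ∈ Wt k κ m → Ψ r P ∈ W (m + 3 * E * r) := by
    intro r m P hP
    let FM : ℕ → AddSubgroup (PowerSeries B) := fun m =>
      { carrier := {f | ∀ r, PowerSeries.coeff r f ∈ WA (m + 3 * E * r)}
        add_mem' := fun {a b} ha hb i => by rw [map_add]; exact add_mem (ha i) (hb i)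
        zero_mem' := fun i => by rw [map_zero]; exact zero_mem _
        neg_mem' := fun {a} ha i => by rw [map_neg]; exact neg_mem (ha i) }
    have : ev ŝ ŷ P ∈ FM m := by
      refine ev_mem_filt FM ?_ ?_ ?_ ?_ ?_ hP
      · intro i j a b ha hb r
        rw [PowerSeries.coeff_mul]
        refine sum_mem fun x hx => ?_
        rw [Finset.HasAntidiagonal.mem_antidiagonal] at hx
        refine hmono _ _ ?_ (hmul _ _ _ _ (ha x.1) (hb x.2))
        rw [← hx, mul_add]; omega
      · intro i j hij f hf r
        exact hmono _ _ (by omega) (hf r)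
      · intro c r
        rw [PowerSeries.algebraMap_apply, PowerSeries.coeff_C]
        split_ifs
        · exact hmono _ _ (by omega) (hk c)
        · exact zero_mem _
      · intro r
        simp only [ŝ, map_add, PowerSeries.coeff_C, PowerSeries.coeff_C_mul, PowerSeries.coeff_X]
        refine add_mem ?_ ?_
        · split_ifs
          · exact hmono _ _ (by omega) hσ
          · exact zero_mem _
        · split_ifs with hr
          · rw [mul_one, pow_two]
            refine hmono _ _ ?_ (hmul _ _ _ _ hU hU)
            subst hr; omega
          · rw [mul_zero]; exact zero_mem _
      · exact hŷ1
    exact this r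
  have hWfin : ∀ m, FiniteDimensional k (W m) ∧ Module.finrank k (W m) ≤ D * (m + 1) := by
    intro m
    let L : (Fin D × Fin (m + 1) → k) →ₗ[k] B := π.toLinearMap.comp (toP k D (m + 1))
    have hle : W m ≤ LinearMap.range L := by
      rintro _ ⟨P, hP, rfl⟩
      obtain ⟨P', hP', hd, hdv⟩ := Wt_reduce hΦ hdeg hΦE hD _ m P (le_refl _) hP
      obtain ⟨v, hv⟩ := mem_range_toP (n := m + 1) hd (by
        intro b
        by_cases hb : P'.coeff b = 0
        · rw [hb]; simp
        · have := hP' b (P'.coeff b).natDegree (by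
            rw [coeff_natDegree, leadingCoeff_ne_zero]; exact hb)
          omega)
      refine ⟨v, ?_⟩
      change π (toP k D (m+1) v) = π P
      rw [hv]
      have := (hπ (P - P')).2 hdv
      rw [map_sub, sub_eq_zero] at this
      exact this.symm
    have hf : FiniteDimensional k (W m) := Submodule.finiteDimensional_of_le hle
    refine ⟨hf, (Submodule.finrank_mono hle).trans ((LinearMap.finrank_range_le L).trans ?_)⟩
    simp
  -- the functions w
  let Lw : (Fin D × Fin j' → k) →ₗ[k] PowerSeries k :=
    (ev (PowerSeries.X : PowerSeries k) y).toLinearMap.comp (toP k D j')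
  have hLw : Function.Injective Lw := by
    rw [injective_iff_map_eq_zero]
    intro v hv
    by_contra hne
    have hne' : toP k D j' v ≠ 0 := fun h => hne (toP_injective D j' (by rw [h, map_zero]))
    obtain ⟨o, -, ho⟩ := order_bound hD hΦ hirr hdeg hκ y hy _ hne' (toP_natDegree hD v)
      (toP_coeff_natDegree v)
    apply ho
    have : ev PowerSeries.X y (toP k D j' v) = 0 := hv
    rw [this, map_zero]
  have hfr : Module.finrank k (LinearMap.range Lw) = D * j' := by
    rw [LinearMap.finrank_range_of_inj hLw]; simp
  obtain ⟨f, o, hfV, homono, hfo⟩ := echelon (D * j') (LinearMap.range Lw) hfr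
  choose wv hwv using hfV
  let w : Fin (D * j') → k[X][X] := fun i => toP k D j' (wv i)
  have hw : ∀ i, ev PowerSeries.X y (w i) = f i := hwv
  let frob : k →+* k := iterateFrobenius k p e0
  have hfrob : ∀ x, frob x = x ^ q := fun x => by simp [frob, iterateFrobenius_def, hq]
  let ŵ : Fin (D * j') → k[X][X] := fun i =>
    ∑ b ∈ Finset.range D, C (((w i).coeff b).map frob) * Q ^ b * (derivative Φ) ^ (D - 1 - b)
  have hŵ : ∀ i, ŵ i ∈ Wt k κ (j' + D * E) := by
    intro i
    refine Submodule.sum_mem _ fun b hb => ?_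
    rw [Finset.mem_range] at hb
    have h1 := Wt_mul (Wt_mul (Wt_C (k := k) (κ := κ) (c := ((w i).coeff b).map frob) (m := j')
      (natDegree_map_le.trans (toP_coeff_natDegree _ _))) (Wt_pow hQE b))
      (Wt_pow (derivative_mem_Wt hΦE) (D - 1 - b))
    refine Wt_mono ?_ h1
    have : b * E + (D - 1 - b) * E = (D - 1) * E := by
      rw [← add_mul]; congr 1; omega
    have h2 : (D - 1) * E ≤ D * E := Nat.mul_le_mul_right _ (by omega)
    omega
  -- linear conditions
  let mm := a' + E + 3 * E * M + j' + D * E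
  have := (hWfin mm).1
  let Λ0 : Fin M → (Fin (D * j') → (Fin D × Fin a' → k)) →ₗ[k] B := fun r =>
    ∑ i, (LinearMap.mulRight k (π (ŵ i))).comp ((Ψ r).comp ((toP k D a').comp (LinearMap.proj i)))
  have hΛ0 : ∀ r v, Λ0 r v = ∑ i, Ψ r (toP k D a' (v i)) * π (ŵ i) := by
    intro r v
    simp [Λ0]
  have hΛ0W : ∀ r v, Λ0 r v ∈ W mm := by
    intro r v
    rw [hΛ0]
    refine Submodule.sum_mem _ fun i _ => ?_
    have h1 := hmul _ _ _ _ (hΨ r _ _ (toP_mem_Wt (κ := κ) (v i))) (memW _ _ (hŵ i))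
    refine hmono _ _ ?_ h1
    simp only [mm]
    have : 3 * E * (r : ℕ) ≤ 3 * E * M := Nat.mul_le_mul_left _ r.2.le
    omega
  let Λ : (Fin (D * j') → (Fin D × Fin a' → k)) →ₗ[k] (Fin M → W mm) :=
    LinearMap.pi fun r => (Λ0 r).codRestrict (W mm) (hΛ0W r)
  have hker : LinearMap.ker Λ ≠ ⊥ := by
    apply LinearMap.ker_ne_bot_of_finrank_lt
    have e1 : Module.finrank k (Fin M → W mm) = M * Module.finrank k (W mm) := by
      rw [Module.finrank_pi_fintype]; simp
    have e2 : Module.finrank k (Fin (D * j') → (Fin D × Fin a' → k)) = (D * j') * (D * a') := by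
      rw [Module.finrank_pi_fintype]; simp
    rw [e1, e2]
    refine lt_of_le_of_lt (Nat.mul_le_mul_left _ (hWfin mm).2) ?_
    simpa [mm] using h3
  obtain ⟨v, hvker, hv0⟩ := Submodule.exists_mem_ne_zero_of_ne_bot hker
  have hcond : ∀ r < M, ∑ i, Ψ r (toP k D a' (v i)) * π (ŵ i) = 0 := by
    intro r hr
    have h := congrFun (LinearMap.mem_ker.1 hvker) ⟨r, hr⟩
    have h' := congrArg Subtype.val h
    have : Λ0 ⟨r, hr⟩ v = 0 := h'
    rwa [hΛ0] at this
  let c : Fin (D * j') → k[X][X] := fun i => toP k D a' (v i)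
  let h : k[X][X] := ∑ i, c i * w i ^ q
  have hq0 : 0 < q := by rw [hq]; exact pow_pos (Fact.out : p.Prime).pos _
  -- h does not vanish on the curve
  have hne : ev PowerSeries.X y h ≠ 0 := by
    have hex : ∃ i, v i ≠ 0 := by
      by_contra hcon; push Not at hcon; exact hv0 (funext hcon)
    let S := Finset.univ.filter fun i => v i ≠ 0
    have hS : S.Nonempty := by
      obtain ⟨i, hi⟩ := hex; exact ⟨i, by simp [S, hi]⟩
    let i0 := S.min' hS
    have hi0 : v i0 ≠ 0 := by
      have := S.min'_mem hS; simpa [S] using this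
    have hlt : ∀ i < i0, v i = 0 := by
      intro i hi
      by_contra hcon
      exact absurd (S.min'_le i (by simp [S, hcon])) (not_le.2 hi)
    have hci0 : c i0 ≠ 0 := fun hc => hi0 (toP_injective D a' (by
      rw [map_zero]; exact hc))
    have hob := order_bound hD hΦ hirr hdeg hκ y hy _ hci0 (toP_natDegree hD _)
      (toP_coeff_natDegree _)
    have hex2 : ∃ n, PowerSeries.coeff n (ev PowerSeries.X y (c i0)) ≠ 0 := ⟨_, hob.choose_spec.2⟩
    let n0 := Nat.find hex2
    have hn0 : PowerSeries.coeff n0 (ev PowerSeries.X y (c i0)) ≠ 0 := Nat.find_spec hex2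
    have hn0q : n0 < q := by
      have h5 : n0 ≤ hob.choose := Nat.find_min' hex2 hob.choose_spec.2
      have := hob.choose_spec.1
      omega
    -- factor out powers of X
    have hfac : ∀ i, ∃ g : PowerSeries k, f i = PowerSeries.X ^ (o i) * g ∧
        PowerSeries.constantCoeff g = PowerSeries.coeff (o i) (f i) := by
      intro i
      obtain ⟨g, hg⟩ := PowerSeries.X_pow_dvd_iff.2 (hfo i).2
      refine ⟨g, hg, ?_⟩
      have h6 : PowerSeries.coeff (0 + o i) (PowerSeries.X ^ (o i) * g) = PowerSeries.coeff 0 g :=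
        PowerSeries.coeff_X_pow_mul g (o i) 0
      rw [← hg, zero_add] at h6
      rw [h6]; simp
    choose g hg hg0 using hfac
    have hcfac : ∃ d : PowerSeries k, ev PowerSeries.X y (c i0) = PowerSeries.X ^ n0 * d ∧
        PowerSeries.constantCoeff d ≠ 0 := by
      obtain ⟨d, hd⟩ : PowerSeries.X ^ n0 ∣ ev PowerSeries.X y (c i0) := by
        rw [PowerSeries.X_pow_dvd_iff]
        intro m hm
        by_contra hcon
        exact Nat.find_min hex2 hm hcon
      refine ⟨d, hd, ?_⟩
      have h6 : PowerSeries.coeff (0 + n0) (PowerSeries.X ^ n0 * d) = PowerSeries.coeff 0 d :=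
        PowerSeries.coeff_X_pow_mul d n0 0
      rw [← hd, zero_add] at h6
      rw [← PowerSeries.coeff_zero_eq_constantCoeff_apply, ← h6]
      exact hn0
    obtain ⟨d, hd, hd0⟩ := hcfac
    intro hzero
    have hexp : ev PowerSeries.X y h = ∑ i, ev PowerSeries.X y (c i) * (f i) ^ q := by
      simp only [h, map_sum, map_mul, map_pow, hw]
    have hdiv : (PowerSeries.X : PowerSeries k) ^ (q * o i0 + n0 + 1) ∣
        ev PowerSeries.X y (c i0) * (f i0) ^ q := by
      have h7 : ev PowerSeries.X y (c i0) * (f i0) ^ q =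
          - ∑ i ∈ Finset.univ.erase i0, ev PowerSeries.X y (c i) * (f i) ^ q := by
        rw [hexp, ← Finset.add_sum_erase _ _ (Finset.mem_univ i0)] at hzero
        exact eq_neg_of_add_eq_zero_left hzero
      rw [h7, dvd_neg]
      refine Finset.dvd_sum fun i hi => ?_
      rcases lt_trichotomy i i0 with hlt' | heq | hgt
      · have : c i = 0 := by simp only [c]; rw [hlt i hlt', map_zero]
        rw [this, map_zero, zero_mul]; exact dvd_zero _
      · exact absurd heq (Finset.ne_of_mem_erase hi)
      · refine Dvd.dvd.mul_left ?_ _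
        rw [hg i, mul_pow, ← pow_mul]
        refine Dvd.dvd.mul_right (pow_dvd_pow _ ?_) _
        have h8 : o i0 + 1 ≤ o i := homono hgt
        have h9 : (o i0 + 1) * q ≤ o i * q := Nat.mul_le_mul_right _ h8
        rw [add_mul, mul_comm (o i0) q] at h9
        omega
    rw [hd, hg i0, mul_pow, ← pow_mul] at hdiv
    have e : PowerSeries.X ^ n0 * d * (PowerSeries.X ^ (o i0 * q) * g i0 ^ q) =
      PowerSeries.X ^ (q * o i0 + n0) * (d * g i0 ^ q) := by ring
    rw [e, pow_succ (PowerSeries.X : PowerSeries k) (q * o i0 + n0)] at hdiv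
    have h10 := (mul_dvd_mul_iff_left (pow_ne_zero _ PowerSeries.X_ne_zero)).1 hdiv
    rw [PowerSeries.X_dvd_iff, map_mul, map_pow, hg0] at h10
    exact mul_ne_zero hd0 (pow_ne_zero _ (hfo i0).1) h10
  have hndvd : ¬ Φ ∣ h := by
    rintro ⟨u, hu⟩
    apply hne
    rw [hu, map_mul, hy, zero_mul]
  have hRne := resultant_ne_zero_of_irred Φ h hΦ hirr hndvd
  -- degree of the resultant
  have hhdeg : h.natDegree ≤ (q + 1) * D := by
    refine natDegree_sum_le_of_forall_le _ _ fun i _ => ?_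
    refine natDegree_mul_le.trans ?_
    have e1 := (toP_natDegree hD (v i)).le
    have e2 := (natDegree_pow_le (p := w i) (n := q)).trans
      (Nat.mul_le_mul_left q (toP_natDegree hD (wv i)).le)
    have e3 : (c i).natDegree ≤ D := e1
    rw [add_mul]; omega
  have hhcoef : ∀ b, (h.coeff b).natDegree ≤ a' + q * j' := by
    have bd : ∀ (P R : k[X][X]) (m n : ℕ), (∀ b, (P.coeff b).natDegree ≤ m) →
        (∀ b, (R.coeff b).natDegree ≤ n) → ∀ b, ((P * R).coeff b).natDegree ≤ m + n := by
      intro P R m n hP hR b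
      rw [coeff_mul]
      refine natDegree_sum_le_of_forall_le _ _ fun x _ => ?_
      exact natDegree_mul_le.trans (add_le_add (hP _) (hR _))
    have bdp : ∀ (P : k[X][X]) (m n : ℕ), (∀ b, (P.coeff b).natDegree ≤ m) →
        ∀ b, ((P ^ n).coeff b).natDegree ≤ n * m := by
      intro P m n hP
      induction n with
      | zero => intro b; rw [pow_zero, coeff_one]; split_ifs <;> simp
      | succ n ih => rw [pow_succ, add_mul, one_mul]; exact bd _ _ _ _ ih hP
    intro b
    simp only [h, finsetSum_coeff]
    refine natDegree_sum_le_of_forall_le _ _ fun i _ => ?_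
    exact bd _ _ _ _ (toP_coeff_natDegree _) (bdp _ _ _ (toP_coeff_natDegree _)) b
  have hRd := natDegree_resultant_le Φ h Φ.natDegree h.natDegree κ _ hκ hhcoef
  -- vanishing at the points
  have hvan : ∀ z ∈ Z, ∃ η' : PowerSeries k, PowerSeries.constantCoeff η' = z.2 ∧
      ev (PowerSeries.C z.1 + PowerSeries.X) η' Φ = 0 ∧
      (PowerSeries.X : PowerSeries k) ^ M ∣ ev (PowerSeries.C z.1 + PowerSeries.X) η' h := by
    rintro ⟨s0, y0⟩ hz
    obtain ⟨hz1, hz2, hz3, hz4⟩ := hZ _ hz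
    simp only at hz1 hz2 hz3 hz4 ⊢
    set U0 := ev s0 y0 (derivative Φ) with hU0
    let θ : B →ₐ[k] k := AdjoinRoot.liftAlgHom Φ (aeval s0) y0 (by
      have := hz2; rw [ev_eq_eval₂] at this; exact this)
    have hθ : ∀ P, θ (π P) = ev s0 y0 P := by
      intro P
      rw [ev_eq_eval₂]
      exact AdjoinRoot.liftAlgHom_mk _ _ _ _ _
    let u : k := (U0 ^ 2)⁻¹
    let Θ : PowerSeries B →ₐ[k] PowerSeries k :=
      (PowerSeries.rescaleAlgHom u).comp (PowerSeries.mapAlgHom θ)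
    have hΘ : ∀ F r, PowerSeries.coeff r (Θ F) = u ^ r * θ (PowerSeries.coeff r F) := by
      intro F r
      have : Θ F = PowerSeries.rescale u (PowerSeries.map (θ : B →+* k) F) := by
        simp only [Θ, AlgHom.comp_apply, PowerSeries.mapAlgHom_apply]
        rw [← PowerSeries.coe_rescaleAlgHom]; rfl
      rw [this, PowerSeries.coeff_rescale, PowerSeries.coeff_map]; rfl
    have hΘs : Θ ŝ = PowerSeries.C s0 + PowerSeries.X := by
      ext r
      rw [hΘ]
      simp only [ŝ, map_add, PowerSeries.coeff_C, PowerSeries.coeff_C_mul, PowerSeries.coeff_X]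
      rcases r with _ | _ | r
      · simp [σ, hθ]
      · simp [U, hθ, map_pow, ← hU0, u, hz3]
      · simp
    have hη0 : PowerSeries.constantCoeff (Θ ŷ) = y0 := by
      rw [← PowerSeries.coeff_zero_eq_constantCoeff_apply, hΘ,
        PowerSeries.coeff_zero_eq_constantCoeff_apply, hŷ0]
      simp [η, hθ]
    refine ⟨Θ ŷ, hη0, ?_, ?_⟩
    · rw [← hΘs, ← hom_ev Θ]
      have : ev ŝ ŷ Φ = 0 := hŷ2
      rw [this, map_zero]
    · rw [PowerSeries.X_pow_dvd_iff]
      intro r hr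
      have hcoef : ∀ P, PowerSeries.coeff r (ev (PowerSeries.C s0 + PowerSeries.X) (Θ ŷ) P) =
          u ^ r * θ (Ψ r P) := by
        intro P
        rw [← hΘs, ← hom_ev Θ, hΘ, hΨa]
      let wz : Fin (D * j') → k := fun i => ev s0 y0 (w i)
      have hwq : ∀ i, (PowerSeries.X : PowerSeries k) ^ q ∣
          (ev (PowerSeries.C s0 + PowerSeries.X) (Θ ŷ) (w i)) ^ q - PowerSeries.C (wz i ^ q) := by
        intro i
        rw [map_pow]
        have : CharP (PowerSeries k) p := by
          refine charP_of_injective_ringHom (f := (PowerSeries.C : k →+* PowerSeries k)) PowerSeries.C_injective p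
        rw [hq, ← sub_pow_char_pow]
        refine pow_dvd_pow_of_dvd ?_ _
        rw [PowerSeries.X_dvd_iff, map_sub, PowerSeries.constantCoeff_C, sub_eq_zero]
        let cc : PowerSeries k →ₐ[k] k :=
          { (PowerSeries.constantCoeff (R := k)) with
            commutes' := by
              intro x
              change PowerSeries.constantCoeff (algebraMap k (PowerSeries k) x) = x
              rw [PowerSeries.algebraMap_apply]; simp }
        have := hom_ev cc (PowerSeries.C s0 + PowerSeries.X) (Θ ŷ) (w i)
        have hc1 : cc (PowerSeries.C s0 + PowerSeries.X) = s0 := by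
          change PowerSeries.constantCoeff _ = _
          simp
        have hc2 : cc (Θ ŷ) = y0 := hη0
        rw [hc1, hc2] at this
        exact this
      have hwhat : ∀ i, wz i ^ q * U0 ^ (D - 1) = θ (π (ŵ i)) := by
        intro i
        rw [hθ]
        simp only [ŵ, map_sum, map_mul, map_pow, ev_C, ← hU0, ← hz4]
        have : wz i = ∑ b ∈ Finset.range D, aeval s0 ((w i).coeff b) * y0 ^ b := by
          simp only [wz]
          rw [ev_eq_eval₂, eval₂_eq_sum_range' _ (toP_natDegree hD (wv i))]
          rfl
        rw [this, ← hfrob, map_sum, Finset.sum_mul]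
        refine Finset.sum_congr rfl fun b hb => ?_
        rw [Finset.mem_range] at hb
        rw [map_mul, map_pow, hfrob y0]
        have e1 : frob (aeval s0 ((w i).coeff b)) = aeval s0 (((w i).coeff b).map frob) := by
          rw [Polynomial.coe_aeval_eq_eval, ← Polynomial.coe_aeval_eq_eval]
          simp only [Polynomial.coe_aeval_eq_eval]
          conv_rhs => rw [← hz1, ← hfrob]
          exact (Polynomial.eval_map_apply frob s0).symm
        rw [e1]
        have e2 : U0 ^ (D - 1) = U0 ^ b * U0 ^ (D - 1 - b) := by
          rw [← pow_add]; congr 1; omega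
        rw [e2, mul_pow]; ring
      have hred : PowerSeries.coeff r (ev (PowerSeries.C s0 + PowerSeries.X) (Θ ŷ) h) =
          ∑ i, u ^ r * θ (Ψ r (c i)) * wz i ^ q := by
        simp only [h, map_sum, map_mul, map_pow]
        refine Finset.sum_congr rfl fun i _ => ?_
        obtain ⟨t, ht⟩ := hwq i
        have : (ev (PowerSeries.C s0 + PowerSeries.X) (Θ ŷ) (w i)) ^ q =
          PowerSeries.C (wz i ^ q) + PowerSeries.X ^ q * t := by rw [← ht]; ring
        rw [this, mul_add, map_add]
        have z1 : PowerSeries.coeff r (ev (PowerSeries.C s0 + PowerSeries.X) (Θ ŷ) (c i) *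
            (PowerSeries.X ^ q * t)) = 0 :=
          PowerSeries.X_pow_dvd_iff.1 (Dvd.dvd.mul_left (Dvd.intro _ rfl) _) r (by omega)
        rw [z1, add_zero, PowerSeries.coeff_mul_C, hcoef]
      have hfin : PowerSeries.coeff r (ev (PowerSeries.C s0 + PowerSeries.X) (Θ ŷ) h) * U0 ^ (D - 1) = 0 := by
        rw [hred, Finset.sum_mul]
        have := congrArg θ (hcond r hr)
        rw [map_sum, map_zero] at this
        calc _ = u ^ r * ∑ i, θ (Ψ r (c i) * π (ŵ i)) := by
              rw [Finset.mul_sum]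
              refine Finset.sum_congr rfl fun i _ => ?_
              rw [map_mul θ, ← hwhat]; ring
          _ = 0 := by rw [this, mul_zero]
      exact (mul_eq_zero.1 hfin).resolve_right (pow_ne_zero _ hz3)
  -- counting
  have hcnt : Z.card * M ≤ (Φ.resultant h).natDegree := by
    let S := Z.image Prod.fst
    let Y : k → Finset k := fun s => (Z.filter fun z => z.1 = s).image Prod.snd
    have hYc : ∀ s, (Y s).card = (Z.filter fun z => z.1 = s).card := by
      intro s
      refine Finset.card_image_of_injOn ?_
      rintro ⟨a, b⟩ ha ⟨a2, b2⟩ hb hab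
      simp at ha hb hab
      rw [Prod.mk.injEq]
      exact ⟨ha.2.trans hb.2.symm, hab⟩
    have hdv : ∏ s ∈ S, (X - C s) ^ ((Y s).card * M) ∣ Φ.resultant h := by
      refine Finset.prod_dvd_of_coprime ?_ ?_
      · intro a _ b _ hab
        refine IsCoprime.pow (Polynomial.isCoprime_X_sub_C_of_isUnit_sub (sub_ne_zero.2 hab).isUnit)
      · intro s _
        refine mult_resultant Φ h hΦ s (Y s) M ?_
        intro y0 hy0
        simp only [Y, Finset.mem_image, Finset.mem_filter] at hy0
        obtain ⟨z, ⟨hz, rfl⟩, rfl⟩ := hy0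
        exact hvan z hz
    have hle := natDegree_le_of_dvd hdv hRne
    rw [natDegree_prod _ _ (fun s _ => pow_ne_zero _ (X_sub_C_ne_zero s))] at hle
    simp only [natDegree_pow, natDegree_X_sub_C, mul_one, hYc] at hle
    rw [← Finset.sum_mul, ← Finset.card_eq_sum_card_image] at hle
    exact hle
  have : h.natDegree * κ ≤ (q + 1) * D * κ := Nat.mul_le_mul_right _ hhdeg
  rw [hdeg] at hRd
  rw [hdeg] at hcnt
  omega

end Stepanov
end BH

namespace BH

set_option maxHeartbeats 1000000 in
lemma stepanov_aux (D κ : ℕ) (hD : 0 < D) : ∃ q0 K : ℕ, ∀ (k : Type) [Field k] (p : ℕ) [Fact p.Prime] [CharP k p]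
    (e0 : ℕ) (Φ Q : k[X][X]) (_ : Φ.Monic) (_ : Irreducible Φ) (_ : Φ.natDegree = D)
    (_ : ∀ b, (Φ.coeff b).natDegree ≤ κ) (_ : Q.natDegree < D) (_ : ∀ b, (Q.coeff b).natDegree ≤ κ)
    (y : PowerSeries k) (_ : ev PowerSeries.X y Φ = 0) (Z : Finset (k × k))
    (_ : ∀ z ∈ Z, z.1 ^ (p ^ e0) = z.1 ∧ ev z.1 z.2 Φ = 0 ∧ ev z.1 z.2 (derivative Φ) ≠ 0 ∧
      z.2 ^ (p ^ e0) * ev z.1 z.2 (derivative Φ) = ev z.1 z.2 Q),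
    q0 ≤ p ^ e0 → Z.card ≤ p ^ e0 + K * Nat.sqrt (p ^ e0) := by
  set E := κ * D with hE
  set c := 2 * D * (3 * E * D + 4) with hc
  set R := c + E + D * E + 1 + D + 2 * D * (κ + 2) with hR
  refine ⟨R ^ 2, 4 * (1 + c + 2 * κ), ?_⟩
  intro k _ p _ _ e0 Φ Q hΦ hirr hdeg hκ hQD hQκ y hy Z hZ hq0
  set q := p ^ e0 with hq
  set r := Nat.sqrt q with hr
  have hrR : R ≤ r := by rw [hr, Nat.le_sqrt']; exact hq0
  have hr1 : r ^ 2 ≤ q := Nat.sqrt_le' q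
  have hr2 : q < (r + 1) ^ 2 := Nat.lt_succ_sqrt' q
  have hrpos : 0 < r := by omega
  have hrq : r ≤ q := Nat.sqrt_le_self q
  obtain ⟨a', ha'⟩ : ∃ a', a' = q / D - κ - 1 := ⟨_, rfl⟩
  have hdm := Nat.div_add_mod q D
  have hml := Nat.mod_lt q hD
  have hqD : κ + 2 ≤ q / D := by
    rw [Nat.le_div_iff_mul_le hD]
    have : 2 * D * (κ + 2) ≤ q := by omega
    linarith [Nat.zero_le (D * (κ + 2))]
  have ha2 : a' + κ + 1 = q / D := by omega
  have ha3 : D * a' + D * κ + D + q % D = q := by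
    rw [← ha2] at hdm; linarith
  have ha4 : q ≤ 2 * (D * a') := by
    have : 2 * D * (κ + 2) ≤ q := by omega
    linarith
  have h1 : D * a' + D * κ < q := by omega
  have h2 : D * r ≤ q := by
    have : D ≤ r := by omega
    calc D * r ≤ r * r := Nat.mul_le_mul_right _ this
      _ ≤ q := by rw [← pow_two]; exact hr1
  have h3 : (D * r) * (D * (a' + κ * D + 3 * (κ * D) * (D * r) + (r + c) + D * (κ * D) + 1)) <
      (D * (r + c)) * (D * a') := by
    rw [← hE]
    have key : r * (3 * E * D * r + r + c + E + D * E + 1) < c * a' := by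
      have e1 : (3 * E * D + 4) * r ^ 2 ≤ c * a' := by
        rw [hc]
        calc (3 * E * D + 4) * r ^ 2 ≤ (3 * E * D + 4) * (2 * (D * a')) :=
              Nat.mul_le_mul_left _ (hr1.trans ha4)
          _ = _ := by ring
      have e2 : r * (c + E + D * E + 1) ≤ r * r := Nat.mul_le_mul_left _ (by omega)
      have : 0 < r ^ 2 := by positivity
      linarith
    have : (D * D) * (r * (3 * E * D * r + r + c + E + D * E + 1)) < (D * D) * (c * a') :=
      Nat.mul_lt_mul_of_pos_left key (by positivity)
    linarith
  have main := stepanov_core (p := p) e0 D κ hD Φ Q hΦ hirr hdeg hκ hQD hQκ y hy Z hZ a' (r + c) (D * r)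
    h1 h2 h3
  rw [← hq] at main
  have m1 : Z.card * r ≤ a' + q * (r + c) + (q + 1) * κ := by
    refine Nat.le_of_mul_le_mul_left (c := D) ?_ hD
    linarith
  have haq : a' ≤ q := by
    have : a' ≤ D * a' := Nat.le_mul_of_pos_left _ hD
    omega
  have hq1 : 1 ≤ q := by omega
  have m2 : Z.card * r ≤ q * r + q * (1 + c + 2 * κ) := by
    have : (q + 1) * κ ≤ q * (2 * κ) := by nlinarith
    nlinarith
  have m3 : q ≤ 4 * r ^ 2 := by nlinarith
  have m4 : Z.card * r ≤ (q + 4 * (1 + c + 2 * κ) * r) * r := by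
    have : q * (1 + c + 2 * κ) ≤ 4 * r ^ 2 * (1 + c + 2 * κ) := Nat.mul_le_mul_right _ m3
    nlinarith
  exact Nat.le_of_mul_le_mul_right m4 hrpos

theorem stepanov (D0 κ : ℕ) : ∃ q0 K : ℕ, ∀ (k : Type) [Field k] (p : ℕ) [Fact p.Prime] [CharP k p]
    (e0 D : ℕ) (_ : 0 < D) (_ : D ≤ D0)
    (Φ Q : k[X][X]) (_ : Φ.Monic) (_ : Irreducible Φ) (_ : Φ.natDegree = D)
    (_ : ∀ b, (Φ.coeff b).natDegree ≤ κ) (_ : Q.natDegree < D) (_ : ∀ b, (Q.coeff b).natDegree ≤ κ)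
    (y : PowerSeries k) (_ : ev PowerSeries.X y Φ = 0) (Z : Finset (k × k))
    (_ : ∀ z ∈ Z, z.1 ^ (p ^ e0) = z.1 ∧ ev z.1 z.2 Φ = 0 ∧ ev z.1 z.2 (derivative Φ) ≠ 0 ∧
      z.2 ^ (p ^ e0) * ev z.1 z.2 (derivative Φ) = ev z.1 z.2 Q),
    q0 ≤ p ^ e0 → Z.card ≤ p ^ e0 + K * Nat.sqrt (p ^ e0) := by
  choose q0 K h using stepanov_aux
  refine ⟨∑ D ∈ Finset.range (D0 + 1), if hD : 0 < D then q0 D κ hD else 0,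
    ∑ D ∈ Finset.range (D0 + 1), if hD : 0 < D then K D κ hD else 0, ?_⟩
  intro k _ p _ _ e0 D hD hD0 Φ Q a1 a2 a3 a4 a5 a6 y hy Z hZ hq
  have l1 := Finset.single_le_sum (f := fun D => if hD : 0 < D then q0 D κ hD else 0)
    (fun i _ => Nat.zero_le _) (Finset.mem_range.2 (Nat.lt_succ_of_le hD0))
  have l2 := Finset.single_le_sum (f := fun D => if hD : 0 < D then K D κ hD else 0)
    (fun i _ => Nat.zero_le _) (Finset.mem_range.2 (Nat.lt_succ_of_le hD0))
  simp only [hD, dif_pos] at l1 l2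
  refine (h D κ hD k p e0 Φ Q a1 a2 a3 a4 a5 a6 y hy Z hZ (l1.trans hq)).trans ?_
  exact Nat.add_le_add_left (Nat.mul_le_mul_right _ l2) _

end BH

namespace BH

section Gal
set_option linter.unusedSectionVars false
variable {K L J Ω : Type*} [Field K] [Field L] [Algebra K L] [Fintype J] [DecidableEq J]
  [Fintype Ω] [DecidableEq Ω]

lemma prod_labels {R : Type*} [CommRing R] (ℓ : Ω → J) (τ : Ω → R) :
    ∏ j, ∏ ω with ℓ ω = j, (X - C (τ ω)) = ∏ ω, (X - C (τ ω)) :=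
  Finset.prod_fiberwise _ _ _

lemma eval_prod_label {R : Type*} [CommRing R] [IsDomain R] (ℓ : Ω → J) (τ : Ω → R) (j : J) (z : R) :
    (∏ ω with ℓ ω = j, (X - C (τ ω))).eval z = 0 ↔ ∃ ω, ℓ ω = j ∧ z = τ ω := by
  rw [eval_prod, Finset.prod_eq_zero_iff]
  simp [sub_eq_zero]

/-- a self-map preserving each root set induces a label preserving permutation -/
lemma exists_perm {R : Type*} [CommRing R] [IsDomain R] (ℓ : Ω → J) (τ : Ω → R)
    (hτ : Function.Injective τ) (g : R → R) (hg : Function.Injective g)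
    (h : ∀ ω, (∏ ω' with ℓ ω' = ℓ ω, (X - C (τ ω'))).eval (g (τ ω)) = 0) :
    ∃ σ : Equiv.Perm Ω, (∀ ω, ℓ (σ ω) = ℓ ω) ∧ ∀ ω, g (τ ω) = τ (σ ω) := by
  have h' : ∀ ω, ∃ ω', ℓ ω' = ℓ ω ∧ g (τ ω) = τ ω' := fun ω =>
    (eval_prod_label ℓ τ (ℓ ω) _).1 (h ω)
  choose σ hσ1 hσ2 using h'
  have hinj : Function.Injective σ := by
    intro a b hab
    apply hτ; apply hg
    rw [hσ2, hσ2, hab]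
  exact ⟨Equiv.ofBijective σ (Finite.injective_iff_bijective.1 hinj), hσ1, hσ2⟩

lemma isSplitting_adjoin (P : J → K[X]) (ℓ : Ω → J) (τ : Ω → L)
    (hP : ∀ j, (P j).map (algebraMap K L) = ∏ ω with ℓ ω = j, (X - C (τ ω))) :
    (∏ j, P j).map (algebraMap K L) = ∏ ω, (X - C (τ ω)) := by
  rw [Polynomial.map_prod, ← prod_labels ℓ]
  exact Finset.prod_congr rfl fun j _ => hP j

lemma galois_descent (P : J → K[X]) (ℓ : Ω → J) (τ : Ω → L) (hτ : Function.Injective τ)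
    (hP : ∀ j, (P j).map (algebraMap K L) = ∏ ω with ℓ ω = j, (X - C (τ ω)))
    (H : MvPolynomial Ω K)
    (hH : ∀ σ : Equiv.Perm Ω, (∀ ω, ℓ (σ ω) = ℓ ω) →
      MvPolynomial.aeval (τ ∘ σ) H = MvPolynomial.aeval τ H) :
    ∃ x : K, algebraMap K L x = MvPolynomial.aeval τ H := by
  have hall := isSplitting_adjoin P ℓ τ hP
  have hspl : ((∏ j, P j).map (algebraMap K L)).Splits := by
    rw [hall]
    exact Splits.prod fun ω _ => Splits.X_sub_C _
  have hsep : (∏ j, P j).Separable := by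
    rw [← separable_map (algebraMap K L), hall]
    exact separable_prod_X_sub_C_iff.2 hτ
  have := IntermediateField.adjoin_rootSet_isSplittingField hspl
  let E := IntermediateField.adjoin K ((∏ j, P j).rootSet L)
  have hGal : IsGalois K E := IsGalois.of_separable_splitting_field hsep
  have hfin : FiniteDimensional K E := IsSplittingField.finiteDimensional E (∏ j, P j)
  have hmem : ∀ ω, τ ω ∈ E := by
    intro ω
    apply IntermediateField.subset_adjoin
    rw [mem_rootSet']
    refine ⟨by rw [hall]; exact Finset.prod_ne_zero_iff.2 fun _ _ => X_sub_C_ne_zero _, ?_⟩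
    rw [aeval_def, ← eval_map, hall, eval_prod, Finset.prod_eq_zero_iff]
    exact ⟨ω, Finset.mem_univ _, by simp⟩
  let τE : Ω → E := fun ω => ⟨τ ω, hmem ω⟩
  have hval : ∀ (t : Ω → E) (G : MvPolynomial Ω K), ((MvPolynomial.aeval t G : E) : L) =
      MvPolynomial.aeval (fun ω => (t ω : L)) G := by
    intro t G
    have := MvPolynomial.comp_aeval_apply (φ := E.val) t G
    exact this
  have hz : MvPolynomial.aeval τE H ∈ (⊥ : IntermediateField K E) := by
    rw [IsGalois.mem_bot_iff_fixed]
    intro f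
    have hPE : ∀ j, (P j).map (algebraMap K E) = ∏ ω with ℓ ω = j, (X - C (τE ω)) := by
      intro j
      apply map_injective (algebraMap E L) (algebraMap E L).injective
      rw [Polynomial.map_map, ← IsScalarTower.algebraMap_eq, hP, Polynomial.map_prod]
      refine Finset.prod_congr rfl fun ω _ => ?_
      simp [τE]
    obtain ⟨σ, h1, h2⟩ := exists_perm ℓ τE (fun a b h => hτ (congrArg Subtype.val h)) f f.injective (by
      intro ω
      have haa := aeval_algHom_apply f.toAlgHom (τE ω) (P (ℓ ω))
      rw [← hPE, eval_map, ← aeval_def]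
      refine haa.trans ?_
      rw [aeval_def, ← eval_map, hPE]
      have : (∏ ω' with ℓ ω' = ℓ ω, (X - C (τE ω'))).eval (τE ω) = 0 :=
        (eval_prod_label ℓ τE (ℓ ω) _).2 ⟨ω, rfl, rfl⟩
      rw [this, map_zero])
    have h3 : f (MvPolynomial.aeval τE H) = MvPolynomial.aeval (τE ∘ σ) H := by
      have := MvPolynomial.comp_aeval_apply (φ := f.toAlgHom) τE H
      rw [show (τE ∘ σ) = fun ω => f.toAlgHom (τE ω) from funext fun ω => (h2 ω).symm]
      exact this
    rw [h3]
    apply Subtype.ext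
    rw [hval, hval]
    exact hH σ h1
  rw [IntermediateField.mem_bot] at hz
  obtain ⟨x, hx⟩ := hz
  refine ⟨x, ?_⟩
  have := congrArg Subtype.val hx
  rw [hval] at this
  exact this

variable (K) in
/-- `σ` is induced by an element of the Galois group. -/
def IsGal (τ : Ω → L) (σ : Equiv.Perm Ω) : Prop :=
  ∀ H : MvPolynomial Ω K, MvPolynomial.aeval τ H = 0 → MvPolynomial.aeval (τ ∘ σ) H = 0

lemma IsGal.mul {τ : Ω → L} {σ σ' : Equiv.Perm Ω} (h : IsGal K τ σ) (h' : IsGal K τ σ') :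
    IsGal K τ (σ * σ') := by
  intro H hH
  have h1 := h (MvPolynomial.rename σ' H) (by
    rw [MvPolynomial.aeval_rename]; exact h' H hH)
  rw [MvPolynomial.aeval_rename] at h1
  exact h1

lemma IsGal.one {τ : Ω → L} : IsGal K τ 1 := fun _ h => h

lemma IsGal.pow {τ : Ω → L} {σ : Equiv.Perm Ω} (h : IsGal K τ σ) (n : ℕ) :
    IsGal K τ (σ ^ n) := by
  induction n with
  | zero => exact IsGal.one
  | succ n ih => rw [pow_succ]; exact ih.mul h

lemma IsGal.inv {τ : Ω → L} {σ : Equiv.Perm Ω} (h : IsGal K τ σ) : IsGal K τ σ⁻¹ := by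
  have : σ⁻¹ = σ ^ (orderOf σ - 1) := by
    rw [inv_eq_iff_mul_eq_one, ← pow_succ', Nat.sub_add_cancel (orderOf_pos σ), pow_orderOf_eq_one]
  rw [this]; exact h.pow _

lemma transfer (P : J → K[X]) (ℓ : Ω → J) (τ : Ω → L) (hτ : Function.Injective τ)
    (hP : ∀ j, (P j).map (algebraMap K L) = ∏ ω with ℓ ω = j, (X - C (τ ω)))
    {M M' : Type*} [Field M] [Field M'] [Algebra M M'] [IsAlgClosed M'] (φ : K →+* M) :
    ∃ τ' : Ω → M', Function.Injective τ' ∧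
      (∀ j, (P j).map ((algebraMap M M').comp φ) = ∏ ω with ℓ ω = j, (X - C (τ' ω))) ∧
      ∀ g : M' ≃ₐ[M] M', ∃ σ : Equiv.Perm Ω, IsGal K τ σ ∧ (∀ ω, ℓ (σ ω) = ℓ ω) ∧
        ∀ ω, g (τ' ω) = τ' (σ ω) := by
  let E := IntermediateField.adjoin K (Set.range τ)
  have hmem : ∀ ω, τ ω ∈ E := fun ω => IntermediateField.subset_adjoin _ _ ⟨ω, rfl⟩
  have hintg : ∀ ω, IsIntegral K (τ ω) := by
    intro ω
    rw [← isAlgebraic_iff_isIntegral]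
    refine ⟨P (ℓ ω), ?_, ?_⟩
    · intro h0
      have := hP (ℓ ω)
      rw [h0, Polynomial.map_zero] at this
      exact (Finset.prod_ne_zero_iff.2 fun ω' _ => X_sub_C_ne_zero (τ ω')) this.symm
    · rw [aeval_def, ← eval_map, hP]
      exact (eval_prod_label ℓ τ (ℓ ω) _).2 ⟨ω, rfl, rfl⟩
  have halg : Algebra.IsAlgebraic K E := by
    apply IntermediateField.isAlgebraic_adjoin
    rintro _ ⟨ω, rfl⟩; exact hintg ω
  let τE : Ω → E := fun ω => ⟨τ ω, hmem ω⟩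
  have hPE : ∀ j, (P j).map (algebraMap K E) = ∏ ω with ℓ ω = j, (X - C (τE ω)) := by
    intro j
    apply map_injective (algebraMap E L) (algebraMap E L).injective
    rw [Polynomial.map_map, ← IsScalarTower.algebraMap_eq, hP, Polynomial.map_prod]
    refine Finset.prod_congr rfl fun ω _ => ?_
    simp [τE]
  let _ : Algebra K M' := ((algebraMap M M').comp φ).toAlgebra
  have hKM : algebraMap K M' = (algebraMap M M').comp φ := rfl
  let ι : E →ₐ[K] M' := IsAlgClosed.lift
  have hfac : ∀ j, (P j).map ((algebraMap M M').comp φ) =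
      ∏ ω with ℓ ω = j, (X - C (ι (τE ω))) := by
    intro j
    have : (P j).map (algebraMap K M') = ((P j).map (algebraMap K E)).map (ι : E →+* M') := by
      rw [Polynomial.map_map]; congr 1; exact ι.comp_algebraMap.symm
    rw [← hKM, this, hPE, Polynomial.map_prod]
    refine Finset.prod_congr rfl fun ω _ => ?_
    simp
  have hinj : Function.Injective fun ω => ι (τE ω) := fun a b h =>
    hτ (congrArg Subtype.val (ι.injective h))
  refine ⟨fun ω => ι (τE ω), hinj, hfac, ?_⟩
  intro g
  let gK : M' →ₐ[K] M' :=
    { (g : M' →+* M') with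
      commutes' := fun x => g.commutes (φ x) }
  obtain ⟨σ, h1, h2⟩ := exists_perm ℓ (fun ω => ι (τE ω)) hinj g g.injective (by
    intro ω
    have haa := aeval_algHom_apply gK (ι (τE ω)) (P (ℓ ω))
    rw [← hfac, ← hKM, eval_map, ← aeval_def]
    refine haa.trans ?_
    have h0 : (aeval (ι (τE ω))) (P (ℓ ω)) = 0 := by
      rw [aeval_def, ← eval_map, hKM, hfac]
      exact (eval_prod_label ℓ (fun ω => ι (τE ω)) (ℓ ω) _).2 ⟨ω, rfl, rfl⟩
    rw [h0, map_zero])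
  refine ⟨σ, ?_, h1, h2⟩
  intro H hH
  have hval : ∀ (t : Ω → E) (G : MvPolynomial Ω K), ((MvPolynomial.aeval t G : E) : L) =
      MvPolynomial.aeval (fun ω => (t ω : L)) G := by
    intro t G
    exact MvPolynomial.comp_aeval_apply (φ := E.val) t G
  have e1 : MvPolynomial.aeval τE H = 0 := by
    apply Subtype.ext
    rw [hval]; exact hH
  have e2 : MvPolynomial.aeval (fun ω => ι (τE ω)) H = 0 := by
    rw [← MvPolynomial.comp_aeval_apply, e1, map_zero]
  have e3 : MvPolynomial.aeval (fun ω => gK (ι (τE ω))) H = 0 := by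
    rw [← MvPolynomial.comp_aeval_apply, e2, map_zero]
  have e4 : ι (MvPolynomial.aeval (τE ∘ σ) H) = 0 := by
    rw [MvPolynomial.comp_aeval_apply, ← e3]
    congr 2
    funext ω
    exact (h2 ω).symm
  have e5 : MvPolynomial.aeval (τE ∘ σ) H = 0 :=
    ι.injective (e4.trans (map_zero ι).symm)
  have e6 := congrArg Subtype.val e5
  rw [hval] at e6
  exact e6

end Gal
end BH

namespace BH

section Sym
set_option linter.unusedSectionVars false
variable {k S J Ω : Type*} [Field k] [CommRing S] [IsDomain S] [Fintype J] [DecidableEq J]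
  [Fintype Ω] [DecidableEq Ω]

open Classical in
/-- symmetric functions of the roots are polynomials of bounded degree -/
lemma sym_descent (ψ : k[X] →+* S) (hψ : Function.Injective ψ) (δ : ℕ) (P : J → k[X][X])
    (hm : ∀ j, (P j).Monic) (hδ : ∀ j i, ((P j).coeff i).natDegree ≤ δ)
    (ℓ : Ω → J) (τ : Ω → S) (hτ : Function.Injective τ)
    (hP : ∀ j, (P j).map ψ = ∏ ω with ℓ ω = j, (X - C (τ ω)))
    (H : MvPolynomial Ω k) (m : ℕ) (hm' : H.totalDegree ≤ m)
    (hH : ∀ σ : Equiv.Perm Ω, (∀ ω, ℓ (σ ω) = ℓ ω) → MvPolynomial.rename σ H = H) :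
    ∃ c : k[X], c.natDegree ≤ δ * m ∧ ψ c = MvPolynomial.eval₂ (ψ.comp C) τ H := by
  let L := FractionRing S
  let K := RatFunc k
  let ψL : k[X] →+* L := (algebraMap S L).comp ψ
  have hSL : Function.Injective (algebraMap S L) := IsFractionRing.injective S L
  have hψL : Function.Injective ψL := hSL.comp hψ
  let φ : K →+* L := IsFractionRing.lift hψL
  have hφ : ∀ c, φ (algebraMap k[X] K c) = ψL c := fun c => IsFractionRing.lift_algebraMap hψL c
  have hφ' : φ.comp (algebraMap k[X] K) = ψL := RingHom.ext hφ
  let _ : Algebra K L := φ.toAlgebra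
  have hKL : algebraMap K L = φ := rfl
  let τL : Ω → L := fun ω => algebraMap S L (τ ω)
  have hτL : Function.Injective τL := hSL.comp hτ
  have hPL : ∀ j, ((P j).map (algebraMap k[X] K)).map (algebraMap K L) =
      ∏ ω with ℓ ω = j, (X - C (τL ω)) := by
    intro j
    rw [Polynomial.map_map, hKL, hφ', ← Polynomial.map_map, hP, Polynomial.map_prod]
    refine Finset.prod_congr rfl fun ω _ => by simp [τL]
  let kK : k →+* K := (algebraMap k[X] K).comp C
  have haev : ∀ (t : Ω → L), MvPolynomial.aeval t (MvPolynomial.map kK H) =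
      MvPolynomial.eval₂ (ψL.comp C) t H := by
    intro t
    rw [MvPolynomial.aeval_def, MvPolynomial.eval₂_map]
    congr 1
    ext c; simp only [RingHom.comp_apply, hKL, kK, hφ]
  obtain ⟨x, hx⟩ := galois_descent (K := K) (fun j => (P j).map (algebraMap k[X] K)) ℓ τL hτL hPL
    (MvPolynomial.map kK H) (by
      intro σ hσ
      rw [haev, haev]
      conv_rhs => rw [← hH σ hσ]
      rw [MvPolynomial.eval₂_rename])
  rw [haev] at hx
  have hroot : ∀ ω, eval₂ ψL (τL ω) (P (ℓ ω)) = 0 := by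
    intro ω
    have h1 := (eval_prod_label ℓ τL (ℓ ω) (τL ω)).2 ⟨ω, rfl, rfl⟩
    rw [← hPL, hKL, Polynomial.map_map, hφ', eval_map] at h1
    exact h1
  -- integrality over `k[X]`
  have hx1 : ∃ c : k[X], algebraMap k[X] K c = x := by
    have : IsIntegrallyClosed k[X] := inferInstance
    rw [← IsIntegrallyClosed.isIntegral_iff]
    let _ : Algebra k[X] L := ψL.toAlgebra
    have : IsScalarTower k[X] K L := IsScalarTower.of_algebraMap_eq fun c => (hφ c).symm
    rw [← isIntegral_algebraMap_iff (B := L) φ.injective, hx, MvPolynomial.eval₂_eq']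
    refine IsIntegral.sum _ fun d _ => IsIntegral.mul ?_ (IsIntegral.prod _ fun ω _ => IsIntegral.pow ?_ _)
    · exact isIntegral_algebraMap (R := k[X]) (A := L)
    · exact ⟨P (ℓ ω), hm _, hroot ω⟩
  obtain ⟨c, hc⟩ := hx1
  have hψc : ψL c = MvPolynomial.eval₂ (ψL.comp C) τL H := by
    rw [← hx, ← hc]; exact (hφ c).symm
  refine ⟨c, ?_, ?_⟩
  swap
  · apply hSL
    rw [MvPolynomial.eval₂_comp_left]
    exact hψc
  by_cases hc0 : c = 0
  · simp [hc0]
  let V := RatFunc.inftyValuation k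
  let O := V.integer
  let s : K := RatFunc.X
  have hs : V s = WithZero.exp (1 : ℤ) := RatFunc.inftyValuation.X k
  have hs0 : s ≠ 0 := RatFunc.X_ne_zero
  have hpol : ∀ a : k[X], ∀ e : ℕ, a.natDegree ≤ e → (s⁻¹) ^ e * algebraMap k[X] K a ∈ O := by
    intro a e he
    change V _ ≤ 1
    by_cases ha : a = 0
    · simp [ha]
    rw [map_mul, map_pow, map_inv₀, hs, RatFunc.inftyValuation_apply, RatFunc.inftyValuation.polynomial k ha,
      ← WithZero.exp_neg, ← WithZero.exp_nsmul, ← WithZero.exp_add, ← WithZero.exp_zero, WithZero.exp_le_exp]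
    simp; omega
  have : IsScalarTower O K L := inferInstance
  have hτint : ∀ ω, IsIntegral O (φ (s⁻¹ ^ δ) * τL ω) := by
    intro ω
    let PK := (P (ℓ ω)).map (algebraMap k[X] K)
    have hPKm : PK.Monic := (hm _).map _
    let R := PK.scaleRoots (s⁻¹ ^ δ)
    have hR : R.Monic := (monic_scaleRoots_iff _).2 hPKm
    have hRc : (↑R.coeffs : Set K) ⊆ O := by
      intro z hz
      rw [Finset.mem_coe, mem_coeffs_iff] at hz
      obtain ⟨i, hi, rfl⟩ := hz
      rw [coeff_scaleRoots, mul_comm, ← pow_mul]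
      by_cases hi' : i < PK.natDegree
      · have hpos : 0 < PK.natDegree - i := by omega
        simp only [PK, coeff_map]
        refine hpol _ _ ((hδ _ _).trans ?_)
        exact Nat.le_mul_of_pos_right _ hpos
      · rcases eq_or_lt_of_le (not_lt.1 hi') with h | h
        · rw [← h, Nat.sub_self, mul_zero, pow_zero, hPKm.coeff_natDegree, one_mul]; exact O.one_mem
        · rw [coeff_eq_zero_of_natDegree_lt h, mul_zero]; exact O.zero_mem
    refine ⟨R.toSubring O hRc, (monic_toSubring _ _ _).2 hR, ?_⟩
    have h1 : eval₂ φ (φ (s⁻¹ ^ δ) * τL ω) R = 0 := by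
      apply scaleRoots_eval₂_eq_zero
      rw [eval₂_map, hφ', hroot]
    rw [IsScalarTower.algebraMap_eq O K L, ← eval₂_map]
    have : (R.toSubring O hRc).map (algebraMap O K) = R := map_toSubring R O hRc
    rw [this]; exact h1
  have hyint : IsIntegral O (φ ((s⁻¹) ^ (δ * m) * algebraMap k[X] K c)) := by
    rw [map_mul, hφ, hψc, MvPolynomial.eval₂_eq', Finset.mul_sum]
    refine IsIntegral.sum _ fun d hd => ?_
    have hdm : ∑ ω, d ω ≤ m := by
      have := (MvPolynomial.le_totalDegree hd).trans hm'
      rwa [Finsupp.sum_fintype _ _ (fun _ => rfl)] at this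
    have e1 : φ (s⁻¹ ^ (δ * m)) * ((ψL.comp C) (MvPolynomial.coeff d H) * ∏ i, τL i ^ d i) =
        φ (s⁻¹ ^ (δ * (m - ∑ ω, d ω)) * algebraMap k[X] K (C (MvPolynomial.coeff d H))) *
          ∏ i, (φ (s⁻¹ ^ δ) * τL i) ^ d i := by
      simp_rw [mul_pow]
      rw [Finset.prod_mul_distrib, Finset.prod_pow_eq_pow_sum, map_mul, hφ]
      have : φ (s⁻¹ ^ (δ * m)) = φ (s⁻¹ ^ (δ * (m - ∑ ω, d ω))) * φ (s⁻¹ ^ δ) ^ (∑ ω, d ω) := by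
        rw [← map_pow, ← map_mul, ← pow_mul, ← pow_add, ← mul_add, Nat.sub_add_cancel hdm]
      rw [this]; simp only [RingHom.comp_apply]; ring
    rw [e1]
    refine IsIntegral.mul ?_ (IsIntegral.prod _ fun ω _ => (hτint ω).pow _)
    have := hpol (C (MvPolynomial.coeff d H)) (δ * (m - ∑ ω, d ω)) (by simp)
    exact isIntegral_algebraMap (R := O) (A := L) (x := ⟨_, this⟩)
  have hyK : IsIntegral O ((s⁻¹) ^ (δ * m) * algebraMap k[X] K c) :=
    (isIntegral_algebraMap_iff (B := L) φ.injective).1 hyint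
  have hfin := (Valuation.integer.integers V).mem_of_integral hyK
  change V _ ≤ 1 at hfin
  rw [map_mul, map_pow, map_inv₀, hs, RatFunc.inftyValuation_apply, RatFunc.inftyValuation.polynomial k hc0,
      ← WithZero.exp_neg, ← WithZero.exp_nsmul, ← WithZero.exp_add, ← WithZero.exp_zero, WithZero.exp_le_exp] at hfin
  simp at hfin
  exact_mod_cast hfin

end Sym
end BH

namespace BH

section Res
set_option linter.unusedSectionVars false
variable {k S J Ω : Type*} [Field k] [CommRing S] [IsDomain S] [Fintype J] [DecidableEq J]
  [Fintype Ω] [DecidableEq Ω]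

/-- label preserving permutations -/
def SL (ℓ : Ω → J) : Subgroup (Equiv.Perm Ω) where
  carrier := {σ | ∀ ω, ℓ (σ ω) = ℓ ω}
  mul_mem' := by
    intro a b ha hb ω
    rw [Equiv.Perm.mul_apply, ha, hb]
  one_mem' := fun ω => rfl
  inv_mem' := by
    intro a ha ω
    exact (ha (a⁻¹ ω)).symm.trans (congrArg ℓ (a.apply_symm_apply ω))

lemma mem_SL {ℓ : Ω → J} {σ : Equiv.Perm Ω} : σ ∈ SL ℓ ↔ ∀ ω, ℓ (σ ω) = ℓ ω := Iff.rfl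

instance (ℓ : Ω → J) : DecidablePred (· ∈ SL ℓ) := fun σ =>
  decidable_of_iff (∀ ω, ℓ (σ ω) = ℓ ω) Iff.rfl

lemma sym_descent_poly (ψ : k[X] →+* S) (hψ : Function.Injective ψ) (δ : ℕ) (P : J → k[X][X])
    (hm : ∀ j, (P j).Monic) (hδ : ∀ j i, ((P j).coeff i).natDegree ≤ δ)
    (ℓ : Ω → J) (τ : Ω → S) (hτ : Function.Injective τ)
    (hP : ∀ j, (P j).map ψ = ∏ ω with ℓ ω = j, (X - C (τ ω)))
    (A : (MvPolynomial Ω k)[X]) (m : ℕ) (hm' : ∀ i, (A.coeff i).totalDegree ≤ m)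
    (hA : ∀ σ ∈ SL ℓ, A.map (MvPolynomial.rename σ : MvPolynomial Ω k →ₐ[k] MvPolynomial Ω k).toRingHom = A) :
    ∃ B : k[X][X], (∀ i, (B.coeff i).natDegree ≤ δ * m) ∧
      B.map ψ = A.map (MvPolynomial.eval₂Hom (ψ.comp C) τ) := by
  have h : ∀ i, ∃ c : k[X], c.natDegree ≤ δ * m ∧
      ψ c = MvPolynomial.eval₂ (ψ.comp C) τ (A.coeff i) := by
    intro i
    refine sym_descent ψ hψ δ P hm hδ ℓ τ hτ hP _ m (hm' i) ?_
    intro σ hσ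
    have := congrArg (fun B => B.coeff i) (hA σ hσ)
    simpa [coeff_map] using this
  choose c hc1 hc2 using h
  let B : k[X][X] := ∑ i ∈ Finset.range (A.natDegree + 1), monomial i (c i)
  have hB : ∀ i, B.coeff i = if i < A.natDegree + 1 then c i else 0 := by
    intro i
    simp only [B, finsetSum_coeff, coeff_monomial, Finset.sum_ite_eq', Finset.mem_range]
  refine ⟨B, ?_, ?_⟩
  · intro i
    rw [hB]; split_ifs
    · exact hc1 i
    · simp
  · ext i
    rw [coeff_map, coeff_map, hB]
    split_ifs with h
    · exact hc2 i
    · rw [coeff_eq_zero_of_natDegree_lt (p := A) (by omega)]; simp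

/-- `Σ λ_ω X_{gω}` -/
noncomputable def YF (lam : Ω → k) (g : Equiv.Perm Ω) : MvPolynomial Ω k :=
  ∑ ω, MvPolynomial.C (lam ω) * MvPolynomial.X (g ω)

lemma rename_YF (lam : Ω → k) (σ g : Equiv.Perm Ω) :
    MvPolynomial.rename σ (YF lam g) = YF lam (σ * g) := by
  simp [YF, map_sum]

lemma totalDegree_YF (lam : Ω → k) (g : Equiv.Perm Ω) : (YF lam g).totalDegree ≤ 1 := by
  refine MvPolynomial.totalDegree_finsetSum_le fun ω _ => ?_
  refine (MvPolynomial.totalDegree_mul _ _).trans ?_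
  simp

lemma eval_YF {R : Type*} [CommRing R] (f : k →+* R) (τ : Ω → R) (lam : Ω → k) (g : Equiv.Perm Ω) :
    MvPolynomial.eval₂Hom f τ (YF lam g) = ∑ ω, f (lam ω) * τ (g ω) := by
  simp [YF, map_sum]

/-- coefficientwise total degree bound -/
def TD (A : (MvPolynomial Ω k)[X]) (m : ℕ) : Prop := ∀ i, (A.coeff i).totalDegree ≤ m

lemma TD.mul {A B : (MvPolynomial Ω k)[X]} {m m' : ℕ} (hA : TD A m) (hB : TD B m') :
    TD (A * B) (m + m') := by
  intro i
  rw [coeff_mul]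
  refine MvPolynomial.totalDegree_finsetSum_le fun x _ => ?_
  exact (MvPolynomial.totalDegree_mul _ _).trans (Nat.add_le_add (hA _) (hB _))

lemma TD.sum {ι : Type*} (s : Finset ι) (A : ι → (MvPolynomial Ω k)[X]) {m : ℕ}
    (hA : ∀ i ∈ s, TD (A i) m) : TD (∑ i ∈ s, A i) m := by
  intro i
  rw [finsetSum_coeff]
  exact MvPolynomial.totalDegree_finsetSum_le fun x hx => hA x hx i

lemma TD_C {a : MvPolynomial Ω k} {m : ℕ} (h : a.totalDegree ≤ m) : TD (C a) m := by
  intro i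
  rw [coeff_C]; split_ifs
  · exact h
  · simp

lemma TD.prod {ι : Type*} (s : Finset ι) (A : ι → (MvPolynomial Ω k)[X])
    (hA : ∀ i ∈ s, TD (A i) 1) : TD (∏ i ∈ s, A i) s.card := by
  classical
  induction s using Finset.induction_on with
  | empty => simpa using TD_C (k := k) (Ω := Ω) (a := 1) (m := 0) (by simp)
  | insert a s ha ih =>
    rw [Finset.prod_insert ha, Finset.card_insert_of_notMem ha, add_comm]
    exact (hA a (by simp)).mul (ih fun i hi => hA i (by simp [hi]))

lemma TD_lin {a : MvPolynomial Ω k} (h : a.totalDegree ≤ 1) : TD (X - C a) 1 := by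
  intro i
  rw [coeff_sub, coeff_C, coeff_X]
  refine (MvPolynomial.totalDegree_sub _ _).trans (max_le ?_ ?_)
  · split_ifs <;> simp
  · split_ifs
    · exact h
    · simp

/-- the resolvent -/
noncomputable def PhiF (ℓ : Ω → J) (lam : Ω → k) : (MvPolynomial Ω k)[X] :=
  ∏ g : SL ℓ, (X - C (YF lam g))

/-- the interpolating polynomial of the Frobenius -/
noncomputable def QF (ℓ : Ω → J) (lam lam' : Ω → k) (π : Equiv.Perm Ω) : (MvPolynomial Ω k)[X] :=
  ∑ g : SL ℓ, C (YF lam' (g * π)) * ∏ g' ∈ Finset.univ.erase g, (X - C (YF lam g'))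

lemma TD_PhiF (ℓ : Ω → J) (lam : Ω → k) : TD (PhiF ℓ lam) (Fintype.card (SL ℓ)) := by
  unfold PhiF
  exact TD.prod _ _ fun g _ => TD_lin (totalDegree_YF _ _)

lemma TD_QF (ℓ : Ω → J) (lam lam' : Ω → k) (π : Equiv.Perm Ω) :
    TD (QF ℓ lam lam' π) (Fintype.card (SL ℓ)) := by
  unfold QF
  refine TD.sum _ _ fun g _ => ?_
  have h1 := (TD_C (totalDegree_YF lam' (g * π))).mul
    (TD.prod (Finset.univ.erase g) (fun g' : SL ℓ => X - C (YF lam (g' : Equiv.Perm Ω)))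
      fun g' _ => TD_lin (totalDegree_YF _ _))
  have h2 : 1 + (Finset.univ.erase g).card = Fintype.card (SL ℓ) := by
    rw [Finset.card_erase_of_mem (Finset.mem_univ _), Finset.card_univ]
    have := Fintype.card_pos_iff.2 ⟨g⟩
    omega
  rwa [h2] at h1

lemma PhiF_inv (ℓ : Ω → J) (lam : Ω → k) (σ : Equiv.Perm Ω) (hσ : σ ∈ SL ℓ) :
    (PhiF ℓ lam).map (MvPolynomial.rename σ : MvPolynomial Ω k →ₐ[k] MvPolynomial Ω k).toRingHom =
      PhiF ℓ lam := by
  unfold PhiF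
  rw [Polynomial.map_prod]
  refine Fintype.prod_equiv (Equiv.mulLeft ⟨σ, hσ⟩) _ _ fun g => ?_
  simp [rename_YF]

lemma QF_inv (ℓ : Ω → J) (lam lam' : Ω → k) (π σ : Equiv.Perm Ω) (hσ : σ ∈ SL ℓ) :
    (QF ℓ lam lam' π).map (MvPolynomial.rename σ : MvPolynomial Ω k →ₐ[k] MvPolynomial Ω k).toRingHom =
      QF ℓ lam lam' π := by
  unfold QF
  rw [Polynomial.map_sum]
  refine Fintype.sum_equiv (Equiv.mulLeft ⟨σ, hσ⟩) _ _ fun g => ?_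
  rw [Polynomial.map_mul, Polynomial.map_prod]
  congr 1
  · simp [rename_YF, mul_assoc]
  · refine Finset.prod_equiv (Equiv.mulLeft ⟨σ, hσ⟩) ?_ ?_
    · intro i; simp
    · intro i _; simp [rename_YF]

/-- the discriminant-like polynomial -/
noncomputable def DF (ℓ : Ω → J) (lam : Ω → k) : MvPolynomial Ω k :=
  (∏ x ∈ (Finset.univ : Finset (SL ℓ × SL ℓ)).filter (fun x => x.1 ≠ x.2),
    (YF lam x.1 - YF lam x.2)) *
  ∏ x ∈ (Finset.univ : Finset (Ω × Ω)).filter (fun x => x.1 ≠ x.2),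
    (MvPolynomial.X x.1 - MvPolynomial.X x.2)

lemma DF_inv (ℓ : Ω → J) (lam : Ω → k) (σ : Equiv.Perm Ω) (hσ : σ ∈ SL ℓ) :
    MvPolynomial.rename σ (DF ℓ lam) = DF ℓ lam := by
  unfold DF
  rw [map_mul, map_prod, map_prod]
  congr 1
  · refine Finset.prod_equiv ((Equiv.mulLeft (⟨σ, hσ⟩ : SL ℓ)).prodCongr (Equiv.mulLeft ⟨σ, hσ⟩)) ?_ ?_
    · intro i; simp
    · intro i _; simp [rename_YF]
  · refine Finset.prod_equiv (σ.prodCongr σ) ?_ ?_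
    · intro i; simp
    · intro i _; simp

lemma totalDegree_DF (ℓ : Ω → J) (lam : Ω → k) :
    (DF ℓ lam).totalDegree ≤ Fintype.card (SL ℓ) ^ 2 + Fintype.card Ω ^ 2 := by
  unfold DF
  refine (MvPolynomial.totalDegree_mul _ _).trans (Nat.add_le_add ?_ ?_)
  · refine (MvPolynomial.totalDegree_finsetProd _ _).trans ?_
    refine (Finset.sum_le_card_nsmul _ _ 1 fun x _ => ?_).trans ?_
    · exact (MvPolynomial.totalDegree_sub _ _).trans (max_le (totalDegree_YF _ _) (totalDegree_YF _ _))
    · refine (Nat.mul_one _).le.trans ((Finset.card_filter_le _ _).trans ?_)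
      rw [Finset.card_univ, Fintype.card_prod, pow_two]
  · refine (MvPolynomial.totalDegree_finsetProd _ _).trans ?_
    refine (Finset.sum_le_card_nsmul _ _ 1 fun x _ => ?_).trans ?_
    · exact (MvPolynomial.totalDegree_sub _ _).trans (by simp)
    · refine (Nat.mul_one _).le.trans ((Finset.card_filter_le _ _).trans ?_)
      rw [Finset.card_univ, Fintype.card_prod, pow_two]

end Res
end BH

namespace BH

section Line
set_option linter.unusedSectionVars false
variable {k S J Ω : Type*} [Field k] [CommRing S] [IsDomain S] [Fintype J] [DecidableEq J]
  [Fintype Ω] [DecidableEq Ω]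

/-- specialisation of the roots -/
lemma exists_spec [IsAlgClosed k] (ψ : k[X] →+* S) (hψ : Function.Injective ψ) (τ : Ω → S)
    (hintg : ∀ ω, ψ.IsIntegralElem (τ ω)) (s0 : k) :
    ∃ e : Ω → k, ∀ (c : k[X]) (H : MvPolynomial Ω k),
      ψ c = MvPolynomial.eval₂ (ψ.comp C) τ H → c.eval s0 = MvPolynomial.eval e H := by
  let _ : Algebra k[X] S := ψ.toAlgebra
  have hψa : algebraMap k[X] S = ψ := rfl
  let B := integralClosure k[X] S
  let I : Ideal k[X] := RingHom.ker (evalRingHom s0)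
  have hImax : I.IsMaximal := RingHom.ker_isMaximal_of_surjective _ (fun x => ⟨C x, by simp⟩)
  have hinjB : Function.Injective (algebraMap k[X] B) := by
    intro a b h
    apply hψ
    exact congrArg Subtype.val h
  obtain ⟨Q, hQ, hQI⟩ := Ideal.exists_ideal_over_maximal_of_isIntegral (S := B) I (by
    rw [(RingHom.injective_iff_ker_eq_bot _).1 hinjB]; exact bot_le)
  let F := B ⧸ Q
  let _ : Field F := Ideal.Quotient.field Q
  let mk : B →+* F := Ideal.Quotient.mk Q
  let f : k →+* F := mk.comp ((algebraMap k[X] B).comp C)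
  have hf : ∀ c : k[X], mk (algebraMap k[X] B c) = f (c.eval s0) := by
    intro c
    have h1 : c - C (c.eval s0) ∈ I := by
      change evalRingHom s0 _ = 0
      simp
    rw [← hQI, Ideal.mem_comap] at h1
    have h2 : mk (algebraMap k[X] B (c - C (c.eval s0))) = 0 := Ideal.Quotient.eq_zero_iff_mem.2 h1
    rw [map_sub, map_sub, sub_eq_zero] at h2
    exact h2
  have hf' : mk.comp (algebraMap k[X] B) = f.comp (evalRingHom s0) := RingHom.ext hf
  have hfint : f.IsIntegral := by
    intro x
    obtain ⟨b, rfl⟩ := Ideal.Quotient.mk_surjective x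
    have hb : IsIntegral k[X] b := integralClosure.isIntegral b
    obtain ⟨P, hP, hP0⟩ := hb
    refine ⟨P.map (evalRingHom s0), hP.map _, ?_⟩
    rw [eval₂_map, ← hf']
    have := congrArg mk hP0
    rw [hom_eval₂, map_zero] at this
    exact this
  have hbij := IsAlgClosed.ringHom_bijective_of_isIntegral f hfint
  let fe : k ≃+* F := RingEquiv.ofBijective f hbij
  let τB : Ω → B := fun ω => ⟨τ ω, hintg ω⟩
  refine ⟨fun ω => fe.symm (mk (τB ω)), ?_⟩
  intro c H h
  have h1 : algebraMap k[X] B c = MvPolynomial.eval₂ ((algebraMap k[X] B).comp C) τB H := by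
    apply Subtype.ext
    have := MvPolynomial.eval₂_comp_left (algebraMap B S) ((algebraMap k[X] B).comp C) τB H
    exact h.trans this.symm
  have h2 := congrArg mk h1
  rw [hf, MvPolynomial.eval₂_comp_left] at h2
  apply hbij.1
  rw [h2]
  have h3 := MvPolynomial.eval₂_comp_left f (RingHom.id k) (fun ω => fe.symm (mk (τB ω))) H
  rw [MvPolynomial.eval₂_id] at h3
  rw [h3]
  congr 1
  funext ω
  exact (fe.apply_symm_apply _).symm

/-- coefficientwise version -/
lemma spec_poly (ψ : k[X] →+* S) (τ : Ω → S) (s0 : k) (e : Ω → k)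
    (he : ∀ (c : k[X]) (H : MvPolynomial Ω k),
      ψ c = MvPolynomial.eval₂ (ψ.comp C) τ H → c.eval s0 = MvPolynomial.eval e H)
    (B : k[X][X]) (A : (MvPolynomial Ω k)[X])
    (h : B.map ψ = A.map (MvPolynomial.eval₂Hom (ψ.comp C) τ)) :
    B.map (evalRingHom s0) = A.map (MvPolynomial.eval e) := by
  ext i
  rw [coeff_map, coeff_map]
  refine he _ _ ?_
  have := congrArg (fun p => p.coeff i) h
  simpa [coeff_map] using this

lemma eval_derivative_prod {ι R : Type*} [DecidableEq ι] [CommRing R] (s : Finset ι) (a : ι → R) (i : ι)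
    (hi : i ∈ s) : (derivative (∏ j ∈ s, (X - C (a j)))).eval (a i) =
      ∏ j ∈ s.erase i, (a i - a j) := by
  rw [← Finset.mul_prod_erase s _ hi, derivative_mul]
  simp [eval_prod]

/-- Frobenius permutation at a rational point -/
lemma exists_frob {p e0 : ℕ} [Fact p.Prime] [CharP k p] (P : J → k[X][X]) (ρ : Equiv.Perm J)
    (hF : ∀ j, (P j).map (mapRingHom (iterateFrobenius k p e0)) = P (ρ j))
    (ℓ : Ω → J) (s0 : k) (hs0 : s0 ^ p ^ e0 = s0) (e : Ω → k) (he : Function.Injective e)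
    (hPe : ∀ j, (P j).map (evalRingHom s0) = ∏ ω with ℓ ω = j, (X - C (e ω))) :
    ∃ σ : Equiv.Perm Ω, (∀ ω, ℓ (σ ω) = ρ (ℓ ω)) ∧ ∀ ω, e ω ^ p ^ e0 = e (σ ω) := by
  have h : ∀ ω, ∃ ω', ℓ ω' = ρ (ℓ ω) ∧ e ω ^ p ^ e0 = e ω' := by
    intro ω
    rw [← eval_prod_label ℓ e, ← hPe, ← hF, Polynomial.map_map]
    have h1 : (evalRingHom s0).comp (mapRingHom (iterateFrobenius k p e0)) =
        (iterateFrobenius k p e0).comp (evalRingHom s0) := by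
      ext c
      · simp
      · simp [iterateFrobenius_def, hs0]
    rw [h1, ← Polynomial.map_map, hPe, ← iterateFrobenius_def, eval_map_apply,
      (eval_prod_label ℓ e (ℓ ω) _).2 ⟨ω, rfl, rfl⟩, map_zero]
  choose σ h1 h2 using h
  have hinj : Function.Injective σ := by
    intro a b hab
    apply he
    apply (iterateFrobenius k p e0).injective
    rw [iterateFrobenius_def, iterateFrobenius_def, h2, h2, hab]
  exact ⟨Equiv.ofBijective σ (Finite.injective_iff_bijective.1 hinj), h1, h2⟩

end Line
end BH

namespace BH

lemma ev_eq_eval_map' {k : Type*} [Field k] (a b : k) (P : k[X][X]) :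
    ev a b P = (P.map (evalRingHom a)).eval b := by
  rw [ev_eq_eval_map]
  congr 2

section Line
set_option linter.unusedSectionVars false
variable {k S J Ω : Type*} [Field k] [CommRing S] [IsDomain S] [Fintype J] [DecidableEq J]
  [Fintype Ω] [DecidableEq Ω]

lemma DF_eval_ne {R : Type*} [CommRing R] [IsDomain R] (f : k →+* R) (ℓ : Ω → J) (lam : Ω → k) (τ : Ω → R) :
    MvPolynomial.eval₂Hom f τ (DF ℓ lam) ≠ 0 ↔ Function.Injective τ ∧
      Function.Injective (fun g : SL ℓ => ∑ ω, f (lam ω) * τ ((g : Equiv.Perm Ω) ω)) := by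
  unfold DF
  rw [map_mul, map_prod, map_prod, mul_ne_zero_iff, Finset.prod_ne_zero_iff, Finset.prod_ne_zero_iff]
  simp only [map_sub, eval_YF, Finset.mem_filter, Finset.mem_univ, true_and, sub_ne_zero,
    Prod.forall, MvPolynomial.eval₂Hom_X']
  constructor
  · rintro ⟨h1, h2⟩
    exact ⟨fun a b h => by_contra fun hh => h2 a b hh h, fun a b h => by_contra fun hh => h1 a b hh h⟩
  · rintro ⟨h1, h2⟩
    exact ⟨fun a b hh h => hh (h2 h), fun a b hh h => hh (h1 h)⟩

/-- the situation at a good point -/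
lemma good_point (ψ : k[X] →+* S) (P : J → k[X][X])
    (ℓ : Ω → J) (τ : Ω → S)
    (hP : ∀ j, (P j).map ψ = ∏ ω with ℓ ω = j, (X - C (τ ω)))
    (lam : Ω → k) (Φ : k[X][X])
    (hΦ : Φ.map ψ = (PhiF ℓ lam).map (MvPolynomial.eval₂Hom (ψ.comp C) τ))
    (c0 : k[X]) (hc0 : ψ c0 = MvPolynomial.eval₂ (ψ.comp C) τ (DF ℓ lam))
    (s0 : k) (hs : c0.eval s0 ≠ 0) (e : Ω → k)
    (he : ∀ (c : k[X]) (H : MvPolynomial Ω k),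
      ψ c = MvPolynomial.eval₂ (ψ.comp C) τ H → c.eval s0 = MvPolynomial.eval e H) :
    Function.Injective e ∧
    Function.Injective (fun g : SL ℓ => ∑ ω, lam ω * e ((g : Equiv.Perm Ω) ω)) ∧
    (∀ j, (P j).map (evalRingHom s0) = ∏ ω with ℓ ω = j, (X - C (e ω))) ∧
    (∀ g : SL ℓ, ev s0 (∑ ω, lam ω * e ((g : Equiv.Perm Ω) ω)) Φ = 0) ∧
    (∀ g : SL ℓ, ev s0 (∑ ω, lam ω * e ((g : Equiv.Perm Ω) ω)) (derivative Φ) =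
      ∏ g' ∈ Finset.univ.erase g, ((∑ ω, lam ω * e ((g : Equiv.Perm Ω) ω)) -
        ∑ ω, lam ω * e ((g' : Equiv.Perm Ω) ω))) ∧
    (∀ (Q : k[X][X]) (lam' : Ω → k) (π : Equiv.Perm Ω),
      Q.map ψ = (QF ℓ lam lam' π).map (MvPolynomial.eval₂Hom (ψ.comp C) τ) →
      ∀ g : SL ℓ, ev s0 (∑ ω, lam ω * e ((g : Equiv.Perm Ω) ω)) Q =
        (∑ ω, lam' ω * e ((g : Equiv.Perm Ω) (π ω))) *
      ∏ g' ∈ Finset.univ.erase g, ((∑ ω, lam ω * e ((g : Equiv.Perm Ω) ω)) -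
        ∑ ω, lam ω * e ((g' : Equiv.Perm Ω) ω))) := by
  have hev : (MvPolynomial.eval e : MvPolynomial Ω k →+* k) = MvPolynomial.eval₂Hom (RingHom.id k) e := rfl
  have h1 := (DF_eval_ne (RingHom.id k) ℓ lam e).1 (by
    rw [← hev, ← he _ _ hc0]; exact hs)
  have hΦ' : Φ.map (evalRingHom s0) = ∏ g : SL ℓ, (X - C (∑ ω, lam ω * e ((g : Equiv.Perm Ω) ω))) := by
    rw [spec_poly ψ τ s0 e he _ _ hΦ, hev]
    unfold PhiF
    rw [Polynomial.map_prod]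
    simp only [Polynomial.map_sub, map_X, map_C, eval_YF, RingHom.id_apply]
  refine ⟨h1.1, h1.2, ?_, ?_, ?_, ?_⟩
  · intro j
    rw [spec_poly ψ τ s0 e he (P j) (∏ ω with ℓ ω = j, (X - C (MvPolynomial.X ω)))]
    · simp [Polynomial.map_prod]
    · rw [hP, Polynomial.map_prod]; simp
  · intro g
    rw [ev_eq_eval_map', hΦ', eval_prod]
    exact Finset.prod_eq_zero (Finset.mem_univ g) (by rw [eval_sub, eval_X, eval_C, sub_self])
  · intro g
    rw [ev_eq_eval_map', ← derivative_map, hΦ',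
      eval_derivative_prod Finset.univ (fun g : SL ℓ => ∑ ω, lam ω * e ((g : Equiv.Perm Ω) ω)) g (Finset.mem_univ _)]
  · intro Q lam' π hQ g
    rw [ev_eq_eval_map', spec_poly ψ τ s0 e he _ _ hQ, hev]
    unfold QF
    rw [Polynomial.map_sum, eval_finsetSum, Finset.sum_eq_single g]
    · simp only [Polynomial.map_mul, Polynomial.map_prod, Polynomial.map_sub, map_X, map_C, eval_YF,
        RingHom.id_apply, eval_mul, eval_C, eval_prod, eval_sub, eval_X, Equiv.Perm.mul_apply]
    · intro g' _ hg'
      simp only [Polynomial.map_mul, Polynomial.map_prod, Polynomial.map_sub, map_X, map_C, eval_YF,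
        RingHom.id_apply, eval_mul, eval_C, eval_prod, eval_sub, eval_X]
      rw [Finset.prod_eq_zero (i := g), mul_zero]
      · simp [Ne.symm hg']
      · simp
    · simp

/-- purely combinatorial counting -/
lemma line_count {ι : Type*} [DecidableEq ι] (ℓ : Ω → J) (ρ : Equiv.Perm J) (G A B : Finset ι) (hGB : G ⊆ B)
    (hAB : A ⊆ B)
    (σ : ι → Equiv.Perm Ω) (T : Finset (Equiv.Perm Ω))
    (hTC : ∀ π ∈ T, ∀ ω, ℓ (π ω) = ρ (ℓ ω))
    (hTconj : ∀ π ∈ T, ∀ g ∈ SL ℓ, g⁻¹ * π * g ∈ T)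
    (hσ : ∀ s ∈ G, ∀ ω, ℓ (σ s ω) = ρ (ℓ ω))
    (hA : ∀ s ∈ G, (s ∈ A ↔ σ s ∈ T)) (q r K1 C2 : ℕ)
    (hB : B.card = q) (hG : q ≤ G.card + C2)
    (hW : ∀ π : Equiv.Perm Ω,
      ((G ×ˢ (Finset.univ : Finset (SL ℓ))).filter (fun x => (x.2 : Equiv.Perm Ω)⁻¹ * σ x.1 * x.2 = π)).card ≤ q + K1 * r) :
    Fintype.card (SL ℓ) * A.card ≤ T.card * q + Fintype.card (SL ℓ) * (K1 * r + C2) ∧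
    T.card * q ≤ Fintype.card (SL ℓ) * A.card + Fintype.card (SL ℓ) * (K1 * r + C2) := by
  classical
  set D := Fintype.card (SL ℓ) with hD
  let Co : Finset (Equiv.Perm Ω) := Finset.univ.filter fun π => ∀ ω, ℓ (π ω) = ρ (ℓ ω)
  have hCo : Co.card ≤ D := by
    by_cases hne : Co.Nonempty
    · obtain ⟨π0, h0⟩ := hne
      have h0' : ∀ ω, ℓ (π0 ω) = ρ (ℓ ω) := (Finset.mem_filter.1 h0).2
      rw [hD, ← Finset.card_univ]
      have : ∀ π ∈ Co, π0⁻¹ * π ∈ SL ℓ := by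
        intro π hπ ω
        have hπ' : ∀ ω, ℓ (π ω) = ρ (ℓ ω) := (Finset.mem_filter.1 hπ).2
        apply ρ.injective
        rw [← h0', ← hπ', Equiv.Perm.mul_apply]
        simp
      refine Finset.card_le_card_of_injOn (fun π => if h : π0⁻¹ * π ∈ SL ℓ then ⟨_, h⟩ else 1)
        (fun _ _ => Finset.mem_coe.2 (Finset.mem_univ _)) ?_
      intro a ha b hb hab
      simp only [this a ha, this b hb, dif_pos, Subtype.mk.injEq] at hab
      exact mul_left_cancel hab
    · rw [Finset.not_nonempty_iff_eq_empty.1 hne]; simp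
  have hTCo : T ⊆ Co := fun π hπ => Finset.mem_filter.2 ⟨Finset.mem_univ _, hTC π hπ⟩
  let W := G ×ˢ (Finset.univ : Finset (SL ℓ))
  let fr : ι × SL ℓ → Equiv.Perm Ω := fun x => (x.2 : Equiv.Perm Ω)⁻¹ * σ x.1 * x.2
  have hfib : ∀ U : Finset (Equiv.Perm Ω), (W.filter fun x => fr x ∈ U).card =
      ∑ π ∈ U, (W.filter fun x => fr x = π).card := by
    intro U
    rw [Finset.card_eq_sum_card_fiberwise (f := fr) (t := U)]
    · refine Finset.sum_congr rfl fun π hπ => ?_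
      congr 1
      ext x
      simp only [Finset.mem_filter]
      constructor
      · rintro ⟨⟨a, b⟩, c⟩; exact ⟨a, c⟩
      · rintro ⟨a, c⟩; exact ⟨⟨a, c ▸ hπ⟩, c⟩
    · intro x hx
      exact (Finset.mem_filter.1 (Finset.mem_coe.1 hx)).2
  have hTW : (W.filter fun x => fr x ∈ T) = (A ∩ G) ×ˢ (Finset.univ : Finset (SL ℓ)) := by
    ext ⟨s, g⟩
    simp only [W, fr, Finset.mem_filter, Finset.mem_product, Finset.mem_univ, and_true, Finset.mem_inter]
    constructor
    · rintro ⟨hs, h⟩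
      refine ⟨(hA s hs).2 ?_, hs⟩
      have := hTconj _ h (g : Equiv.Perm Ω)⁻¹ (inv_mem g.2)
      simpa [mul_assoc] using this
    · rintro ⟨hs, h⟩
      exact ⟨h, hTconj _ ((hA s h).1 hs) _ g.2⟩
  have hCW : (W.filter fun x => fr x ∈ Co) = W := by
    apply Finset.filter_true_of_mem
    rintro ⟨s, g⟩ hx
    have hs : s ∈ G := (Finset.mem_product.1 hx).1
    refine Finset.mem_filter.2 ⟨Finset.mem_univ _, fun ω => ?_⟩
    simp only [fr, Equiv.Perm.mul_apply]
    rw [(mem_SL.1 (inv_mem g.2)), hσ s hs, (mem_SL.1 g.2)]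
  have e1 : (A ∩ G).card * D = ∑ π ∈ T, (W.filter fun x => fr x = π).card := by
    rw [← hfib, hTW, Finset.card_product, Finset.card_univ]
  have e2 : G.card * D = ∑ π ∈ Co, (W.filter fun x => fr x = π).card := by
    rw [← hfib, hCW, Finset.card_product, Finset.card_univ]
  rw [← Finset.sum_sdiff hTCo, ← e1] at e2
  have b1 : ∑ π ∈ T, (W.filter fun x => fr x = π).card ≤ T.card * (q + K1 * r) := by
    rw [← smul_eq_mul]; exact Finset.sum_le_card_nsmul _ _ _ fun π _ => hW π
  have b2 : ∑ π ∈ Co \ T, (W.filter fun x => fr x = π).card ≤ (Co \ T).card * (q + K1 * r) := by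
    rw [← smul_eq_mul]; exact Finset.sum_le_card_nsmul _ _ _ fun π _ => hW π
  have c1 : (Co \ T).card + T.card = Co.card := Finset.card_sdiff_add_card_eq_card hTCo
  have c2 : A.card ≤ (A ∩ G).card + C2 := by
    have h1 : A.card ≤ (A ∩ G).card + (A \ G).card := by
      rw [Finset.card_inter_add_card_sdiff]
    have h2 : (A \ G).card ≤ (B \ G).card := Finset.card_le_card (Finset.sdiff_subset_sdiff hAB le_rfl)
    have h3 : (B \ G).card + G.card = B.card := Finset.card_sdiff_add_card_eq_card hGB
    omega
  have c3 : (A ∩ G).card ≤ A.card := Finset.card_le_card Finset.inter_subset_left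
  have c4 : T.card ≤ D := by omega
  constructor
  · nlinarith [Nat.mul_le_mul_right (K1 * r) c4, Nat.mul_le_mul_left D c2]
  · have := Nat.mul_le_mul_right (q + K1 * r) (show (Co \ T).card + T.card ≤ D by omega)
    nlinarith [Nat.mul_le_mul_left D hG, Nat.mul_le_mul_left D c3, Nat.zero_le (T.card * (K1 * r))]

end Line

lemma psiX_inj {k : Type*} [Field k] : Function.Injective (aeval (PowerSeries.X : PowerSeries k) : k[X] →ₐ[k] PowerSeries k).toRingHom := by
  intro a b h
  apply Polynomial.coe_injective k
  have : ∀ c : k[X], aeval (PowerSeries.X : PowerSeries k) c = (c : PowerSeries k) := by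
    intro c
    have h1 : (aeval (PowerSeries.X : PowerSeries k) : k[X] →ₐ[k] PowerSeries k) = Polynomial.coeToPowerSeries.algHom k := by
      ext; simp
    rw [h1]; simp
  rw [← this, ← this]; exact h

/-- equidistribution of Frobenius elements on a line -/
theorem line_thm (D0 N0 δ : ℕ) : ∃ q0 K : ℕ, ∀ (k J Ω : Type) [Field k] [IsAlgClosed k]
    [Fintype J] [DecidableEq J] [Fintype Ω] [DecidableEq Ω] (p : ℕ) [Fact p.Prime] [CharP k p] (e0 : ℕ)
    (_ : q0 ≤ p ^ e0) (ℓ : Ω → J) (ρ : Equiv.Perm J) (_ : Fintype.card Ω ≤ N0) (_ : Fintype.card (SL ℓ) ≤ D0)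
    (P : J → k[X][X]) (_ : ∀ j, (P j).Monic) (_ : ∀ j i, ((P j).coeff i).natDegree ≤ δ)
    (_ : ∀ j, (P j).map (mapRingHom (iterateFrobenius k p e0)) = P (ρ j))
    (τ : Ω → PowerSeries k) (_ : Function.Injective τ)
    (_ : ∀ j, (P j).map (aeval (PowerSeries.X : PowerSeries k) : k[X] →ₐ[k] PowerSeries k).toRingHom =
      ∏ ω with ℓ ω = j, (X - C (τ ω)))
    (lam : Ω → k)
    (_ : Function.Injective (fun g : SL ℓ => ∑ ω, algebraMap k (PowerSeries k) (lam ω) * τ ((g : Equiv.Perm Ω) ω)))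
    (Φ : k[X][X])
    (_ : Φ.map (aeval (PowerSeries.X : PowerSeries k) : k[X] →ₐ[k] PowerSeries k).toRingHom =
      ∏ g : SL ℓ, (X - C (∑ ω, algebraMap k (PowerSeries k) (lam ω) * τ ((g : Equiv.Perm Ω) ω))))
    (_ : Irreducible Φ)
    (B A : Finset k) (_ : ∀ s ∈ B, s ^ p ^ e0 = s) (_ : B.card = p ^ e0) (_ : A ⊆ B)
    (T : Finset (Equiv.Perm Ω)) (_ : ∀ π ∈ T, ∀ ω, ℓ (π ω) = ρ (ℓ ω))
    (_ : ∀ π ∈ T, ∀ g ∈ SL ℓ, g⁻¹ * π * g ∈ T)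
    (_ : ∀ s ∈ B, ∀ e : Ω → k, Function.Injective e →
      (∀ j, (P j).map (evalRingHom s) = ∏ ω with ℓ ω = j, (X - C (e ω))) →
      ∀ σ : Equiv.Perm Ω, (∀ ω, ℓ (σ ω) = ρ (ℓ ω)) → (∀ ω, e ω ^ p ^ e0 = e (σ ω)) → (s ∈ A ↔ σ ∈ T)),
    Fintype.card (SL ℓ) * A.card ≤ T.card * p ^ e0 + K * Nat.sqrt (p ^ e0) ∧
    T.card * p ^ e0 ≤ Fintype.card (SL ℓ) * A.card + K * Nat.sqrt (p ^ e0) := by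
  obtain ⟨q0, K1, hst⟩ := stepanov D0 (δ * D0)
  set C2 := δ * (D0 ^ 2 + N0 ^ 2) with hC2
  refine ⟨q0, D0 * (K1 + C2), ?_⟩
  intro k J Ω _ _ _ _ _ _ p _ _ e0 hq ℓ ρ hN0 hD0 P hPm hPδ hF τ hτ hP lam hlam Φ hΦ hirr B A hB hBc hAB T hT hTc hAT
  classical
  set ψ := (aeval (PowerSeries.X : PowerSeries k) : k[X] →ₐ[k] PowerSeries k).toRingHom with hψd
  have hψ : Function.Injective ψ := psiX_inj
  have hψC : ψ.comp C = algebraMap k (PowerSeries k) := by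
    ext1 x; exact aeval_C _ _
  have hΦ' : Φ.map ψ = (PhiF ℓ lam).map (MvPolynomial.eval₂Hom (ψ.comp C) τ) := by
    rw [hΦ]; unfold PhiF; rw [Polynomial.map_prod]
    simp only [Polynomial.map_sub, map_X, map_C, eval_YF, hψC]
  have hDpos : 0 < Fintype.card (SL ℓ) := Fintype.card_pos
  have hΦm : Φ.Monic := by
    apply Polynomial.monic_of_injective hψ
    rw [hΦ]; exact monic_prod_of_monic _ _ fun _ _ => monic_X_sub_C _
  have hΦd : Φ.natDegree = Fintype.card (SL ℓ) := by
    rw [← natDegree_map_eq_of_injective hψ, hΦ, natDegree_prod_of_monic _ _ fun _ _ => monic_X_sub_C _]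
    simp only [natDegree_X_sub_C, Finset.sum_const, Finset.card_univ, smul_eq_mul, mul_one]
  have hΦc : ∀ b, (Φ.coeff b).natDegree ≤ δ * D0 := by
    obtain ⟨Φ', h1, h2⟩ := sym_descent_poly ψ hψ δ P hPm hPδ ℓ τ hτ hP (PhiF ℓ lam) _ (TD_PhiF ℓ lam)
      (PhiF_inv ℓ lam)
    have : Φ' = Φ := Polynomial.map_injective ψ hψ (h2.trans hΦ'.symm)
    intro b
    rw [← this]
    exact (h1 b).trans (Nat.mul_le_mul_left _ hD0)
  obtain ⟨c0, hc0d, hc0⟩ := sym_descent ψ hψ δ P hPm hPδ ℓ τ hτ hP (DF ℓ lam) _ (totalDegree_DF ℓ lam)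
    (fun σ hσ => DF_inv ℓ lam σ hσ)
  have hc00 : c0 ≠ 0 := by
    rintro rfl
    rw [map_zero] at hc0
    refine (DF_eval_ne (ψ.comp C) ℓ lam τ).2 ⟨hτ, ?_⟩ hc0.symm
    rw [hψC]; exact hlam
  have hc0d' : c0.natDegree ≤ C2 := by
    refine hc0d.trans (Nat.mul_le_mul_left _ (Nat.add_le_add (Nat.pow_le_pow_left hD0 _) (Nat.pow_le_pow_left hN0 _)))
  have hintg : ∀ ω, ψ.IsIntegralElem (τ ω) := by
    intro ω
    refine ⟨P (ℓ ω), hPm _, ?_⟩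
    rw [← eval_map, hP]
    exact (eval_prod_label ℓ τ _ _).2 ⟨ω, rfl, rfl⟩
  choose e he using fun s0 => exists_spec ψ hψ τ hintg s0
  let G := B.filter fun s => c0.eval s ≠ 0
  have hGB : G ⊆ B := Finset.filter_subset _ _
  have hG : p ^ e0 ≤ G.card + C2 := by
    have h1 := Finset.card_filter_add_card_filter_not (s := B) (fun s => c0.eval s ≠ 0)
    have h2 : (B.filter fun s => ¬ c0.eval s ≠ 0).card ≤ C2 := by
      refine le_trans (Finset.card_le_card (t := c0.roots.toFinset) ?_) ?_
      · intro s hs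
        simp only [Finset.mem_filter, not_not] at hs
        simp [hc00, hs.2]
      · exact (Multiset.toFinset_card_le _).trans ((card_roots' _).trans hc0d')
    rw [← hBc]; change _ ≤ (B.filter fun s => c0.eval s ≠ 0).card + C2
    omega
  have hgp := fun s (hs : s ∈ G) => good_point ψ P ℓ τ hP lam Φ hΦ' c0 hc0 s (Finset.mem_filter.1 hs).2 (e s) (he s)
  have hfr : ∀ s, ∃ σ : Equiv.Perm Ω, s ∈ G → (∀ ω, ℓ (σ ω) = ρ (ℓ ω)) ∧ ∀ ω, e s ω ^ p ^ e0 = e s (σ ω) := by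
    intro s
    by_cases hs : s ∈ G
    · obtain ⟨σ, h⟩ := exists_frob P ρ hF ℓ s (hB s (hGB hs)) (e s) (hgp s hs).1 (hgp s hs).2.2.1
      exact ⟨σ, fun _ => h⟩
    · exact ⟨1, fun h => absurd h hs⟩
  choose σ hσ using hfr
  have key := line_count ℓ ρ G A B hGB hAB σ T hT hTc (fun s hs => (hσ s hs).1)
    (fun s hs => hAT s (hGB hs) (e s) (hgp s hs).1 (hgp s hs).2.2.1 (σ s) (hσ s hs).1 (hσ s hs).2)
    (p ^ e0) (Nat.sqrt (p ^ e0)) K1 C2 hBc hG ?_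
  · have hr : 1 ≤ Nat.sqrt (p ^ e0) := by
      rw [Nat.le_sqrt]; simpa using Nat.one_le_pow _ _ (Fact.out : p.Prime).pos
    have : Fintype.card (SL ℓ) * (K1 * Nat.sqrt (p ^ e0) + C2) ≤ D0 * (K1 + C2) * Nat.sqrt (p ^ e0) := by
      rw [mul_assoc]
      refine Nat.mul_le_mul hD0 ?_
      nlinarith
    exact ⟨key.1.trans (Nat.add_le_add_left this _), key.2.trans (Nat.add_le_add_left this _)⟩
  · intro π
    obtain ⟨Q, hQ1, hQ2⟩ := sym_descent_poly ψ hψ δ P hPm hPδ ℓ τ hτ hP (QF ℓ lam (fun ω => lam ω ^ p ^ e0) π) _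
      (TD_QF ℓ lam _ π) (QF_inv ℓ lam _ π)
    let yv : k × SL ℓ → k × k := fun x => (x.1, ∑ ω, lam ω * e x.1 ((x.2 : Equiv.Perm Ω) ω))
    have hinj : Set.InjOn yv ((G ×ˢ (Finset.univ : Finset (SL ℓ))).filter
        (fun x => (x.2 : Equiv.Perm Ω)⁻¹ * σ x.1 * x.2 = π)) := by
      rintro ⟨s, g⟩ hx ⟨s', g'⟩ hx' hh
      have h1 : s = s' := congrArg Prod.fst hh
      subst h1
      have hs : s ∈ G := by
        have := (Finset.mem_filter.1 (Finset.mem_coe.1 hx)).1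
        exact (Finset.mem_product.1 this).1
      have := (hgp s hs).2.1 (congrArg Prod.snd hh)
      exact congrArg (Prod.mk s) this
    rw [← Finset.card_image_of_injOn hinj]
    refine hst k p e0 _ hDpos hD0 Φ Q hΦm hirr hΦd hΦc ?_ (fun b => (hQ1 b).trans (Nat.mul_le_mul_left _ hD0))
      (∑ ω, algebraMap k (PowerSeries k) (lam ω) * τ ω) ?_ _ ?_ hq
    · rw [← natDegree_map_eq_of_injective hψ, hQ2]
      refine lt_of_le_of_lt natDegree_map_le ?_
      unfold QF
      refine lt_of_le_of_lt (natDegree_sum_le_of_forall_le (n := Fintype.card (SL ℓ) - 1) _ _ fun g _ => ?_) (by omega)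
      refine (natDegree_C_mul_le _ _).trans ?_
      rw [natDegree_prod_of_monic _ _ fun _ _ => monic_X_sub_C _]
      simp only [natDegree_X_sub_C, Finset.sum_const, smul_eq_mul, mul_one, Finset.card_erase_of_mem (Finset.mem_univ _), Finset.card_univ]
      exact le_rfl
    · rw [ev_eq_eval_map, ← hψd, hΦ, eval_prod]
      exact Finset.prod_eq_zero (Finset.mem_univ 1) (by rw [eval_sub, eval_X, eval_C]; simp)
    · intro z hz
      obtain ⟨⟨s, g⟩, hx, rfl⟩ := Finset.mem_image.1 hz
      obtain ⟨hx1, hx2⟩ := Finset.mem_filter.1 hx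
      have hs : s ∈ G := (Finset.mem_product.1 hx1).1
      obtain ⟨i1, i2, i3, i4, i5, i6⟩ := hgp s hs
      refine ⟨hB s (hGB hs), i4 g, ?_, ?_⟩
      · simp only [yv]
        rw [i5 g]
        refine Finset.prod_ne_zero_iff.2 fun g' hg' => sub_ne_zero.2 fun h => ?_
        exact (Finset.mem_erase.1 hg').1 (i2 h).symm
      · simp only [yv]
        rw [i6 Q _ π hQ2 g, i5 g]
        congr 1
        have : ∀ z : k, z ^ p ^ e0 = iterateFrobenius k p e0 z := fun z => rfl
        rw [this, map_sum]
        refine Finset.sum_congr rfl fun ω _ => ?_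
        rw [map_mul, ← this, ← this, (hσ s hs).2, ← hx2]
        simp [Equiv.Perm.mul_apply]

end BH

namespace BH

section Irr
variable {k : Type*} [Field k]

lemma ev_taylor {S : Type*} [CommRing S] [Algebra k S] (a b h : S) (G : k[X][X]) :
    ∃ r : S, ev a (b + h) G = ev a b G + ev a b (derivative G) * h + r * h ^ 2 := by
  obtain ⟨r, hr⟩ := binomExpansion (G.map (aeval a : k[X] →ₐ[k] S).toRingHom) b h
  refine ⟨r, ?_⟩
  rw [ev_eq_eval_map, ev_eq_eval_map, ev_eq_eval_map, hr, derivative_map]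

lemma ev_C_X (P : k[X][X]) (f : k[X][X]) : ev (k := k) (C X) f P = P.comp f := by
  rw [ev_eq_eval₂, Polynomial.comp]
  congr 1
  ext x
  simp
  simp

lemma irr_affine {K : Type*} [Field K] (G : K[X]) (hG : Irreducible G) (A B : K) (hB : B ≠ 0) :
    Irreducible (G.comp (C B * X + C A)) := by
  have : Invertible B := invertibleOfNonzero hB
  have h := (MulEquiv.irreducible_iff (algEquivCMulXAddC B A) (x := G)).2 hG
  have h2 : algEquivCMulXAddC B A G = G.comp (C B * X + C A) := by
    simp [algEquivCMulXAddC, comp, aeval_def, eval₂_eq_eval_map]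
  rwa [h2] at h

lemma irr_core (G : k[X][X]) (hG : Irreducible G) (hdeg : G.natDegree ≠ 0) (A : k[X]) (c t0 : k) (hc : c ≠ 0)
    (a b : ℕ) (H : k[X][X])
    (hH : C ((X - C t0) ^ a) * H = G.comp (C (C c * (X - C t0) ^ b) * X + C A))
    (h0 : H.map (evalRingHom t0) ≠ 0) : Irreducible H := by
  set B : k[X] := C c * (X - C t0) ^ b with hBd
  have hB : B ≠ 0 := mul_ne_zero (by simpa using hc) (pow_ne_zero _ (X_sub_C_ne_zero _))
  have hGp := hG.isPrimitive hdeg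
  have hH0 : H ≠ 0 := by rintro rfl; simp at h0
  have hprim : H.IsPrimitive := by
    rw [isPrimitive_iff_isUnit_of_C_dvd]
    intro r hr
    by_contra hu
    have hr0 : r ≠ 0 := by
      rintro rfl
      apply hH0
      simpa using hr
    obtain ⟨π, hπ, hπr⟩ := WfDvdMonoid.exists_irreducible_factor hu hr0
    have hπH : C π ∣ H := (_root_.map_dvd C hπr).trans hr
    by_cases ht : π ∣ X - C t0
    · have hev : π.eval t0 = 0 := by
        have h1 : X - C t0 ∣ π := by
          have := (hπ.associated_of_dvd (irreducible_X_sub_C t0) ht)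
          exact this.symm.dvd
        obtain ⟨e, rfl⟩ := h1
        simp
      obtain ⟨e, rfl⟩ := hπH
      apply h0
      simp [hev]
    · have hp : Prime π := hπ.prime
      let I := Ideal.span {π}
      have hI : I.IsPrime := (Ideal.span_singleton_prime hp.ne_zero).2 hp
      let mk := Ideal.Quotient.mk I
      have hmk : ∀ x, mk x = 0 ↔ π ∣ x := by
        intro x
        rw [Ideal.Quotient.eq_zero_iff_mem, Ideal.mem_span_singleton]
      have h1 : (G.map mk).comp (C (mk B) * X + C (mk A)) = 0 := by
        have := congrArg (Polynomial.map mk) hH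
        obtain ⟨e, rfl⟩ := hπH
        rw [map_comp, Polynomial.map_mul, Polynomial.map_mul, map_C mk (a := π), (hmk π).2 dvd_rfl] at this
        simp only [map_zero, zero_mul, mul_zero] at this
        rw [this]
        simp
      have hBm : mk B ≠ 0 := by
        rw [Ne, hmk, hBd]
        intro h
        rcases hp.dvd_or_dvd h with h | h
        · exact hp.not_isUnit (isUnit_of_dvd_unit h (by simpa using hc))
        · exact ht (hp.dvd_of_dvd_pow h)
      rw [comp_eq_zero_iff] at h1
      rcases h1 with h1 | ⟨_, h1⟩
      · apply hp.not_isUnit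
        refine isPrimitive_iff_isUnit_of_C_dvd.1 hGp π ?_
        rw [C_dvd_iff_dvd_coeff]
        intro i
        rw [← hmk, ← coeff_map, h1, coeff_zero]
      · apply hBm
        have := congrArg (fun p => p.coeff 1) h1
        simpa using this
  let K := RatFunc k
  have hinj : Function.Injective (algebraMap k[X] K) := IsFractionRing.injective _ _
  rw [hprim.irreducible_iff_irreducible_map_fraction_map (K := K)]
  have hGK := (hGp.irreducible_iff_irreducible_map_fraction_map (K := K)).1 hG
  have hBK : algebraMap k[X] K B ≠ 0 := by
    rw [Ne, map_eq_zero_iff _ hinj]; exact hB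
  have h2 := irr_affine _ hGK (algebraMap k[X] K A) (algebraMap k[X] K B) hBK
  have h3 := congrArg (Polynomial.map (algebraMap k[X] K)) hH
  rw [map_comp] at h3
  simp only [Polynomial.map_mul, map_C, Polynomial.map_add, map_X] at h3
  rw [← h3] at h2
  rw [irreducible_isUnit_mul] at h2
  · exact h2
  · rw [isUnit_C]
    refine IsUnit.mk0 _ ?_
    rw [Ne, map_eq_zero_iff _ hinj]
    exact pow_ne_zero _ (X_sub_C_ne_zero _)

lemma swap_eval (t0 : k) (H : k[X][X]) :
    (Bivariate.swap H).map (evalRingHom t0) = H.eval (C t0) := by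
  have h : ((mapAlgHom (aeval t0 : k[X] →ₐ[k] k)).comp (Bivariate.swap (R := k)).toAlgHom) =
      (ev (k := k) (X : k[X]) (C t0)) := by
    refine Polynomial.algHom_ext' ?_ ?_
    · ext1
      change Polynomial.map (aeval t0 : k[X] →ₐ[k] k).toRingHom (Bivariate.swap (C X)) = ev (k := k) (X : k[X]) (C t0) (C X)
      rw [Bivariate.swap_X]; simp
    · change Polynomial.map (aeval t0 : k[X] →ₐ[k] k).toRingHom (Bivariate.swap X) = ev (k := k) (X : k[X]) (C t0) X
      rw [Bivariate.swap_Y]; simp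
  have h1 := DFunLike.congr_fun h H
  have h2 : (Bivariate.swap H).map (evalRingHom t0) = (ev (k := k) (X : k[X]) (C t0)) H := by
    rw [← h1]; rfl
  rw [h2, ev_eq_eval_map]
  congr 1
  have : (aeval (X : k[X]) : k[X] →ₐ[k] k[X]).toRingHom = RingHom.id _ := by
    ext x <;> simp
  rw [this, Polynomial.map_id]

lemma swap_ev (G : k[X][X]) (A : k[X]) (c t0 : k) (b : ℕ) :
    Bivariate.swap (ev (k := k) (X : k[X][X]) (A.map C + C X * (C (C c) * (X - C (C t0)) ^ b)) G) =
      G.comp (C (C c * (X - C t0) ^ b) * X + C A) := by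
  have := hom_ev (Bivariate.swap (R := k)).toAlgHom (X : k[X][X]) (A.map C + C X * (C (C c) * (X - C (C t0)) ^ b)) G
  have h2 : ∀ x, (Bivariate.swap (R := k)).toAlgHom x = Bivariate.swap x := fun _ => rfl
  rw [h2, h2, h2, Bivariate.swap_Y, ev_C_X] at this
  rw [this]
  congr 1
  rw [map_add, Bivariate.swap_map_C, map_mul, map_mul, map_pow, map_sub, Bivariate.swap_Y,
    Bivariate.swap_C_C, Bivariate.swap_C_C, Bivariate.swap_X]
  simp only [C_mul, C_pow, C_sub]
  ring

/-- irreducibility after substitution of a pencil -/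
lemma irr_T (G : k[X][X]) (hG : Irreducible G) (hdeg : G.natDegree ≠ 0) (A : k[X]) (c t0 : k) (hc : c ≠ 0)
    (a b : ℕ) (H : k[X][X])
    (hH : (X - C (C t0)) ^ a * H = ev (k := k) (X : k[X][X]) (A.map C + C X * (C (C c) * (X - C (C t0)) ^ b)) G)
    (h0 : H.eval (C t0) ≠ 0) : Irreducible H := by
  rw [← MulEquiv.irreducible_iff (Bivariate.swap (R := k))]
  refine irr_core G hG hdeg A c t0 hc a b _ ?_ ?_
  · rw [← swap_ev, ← hH]
    simp only [map_mul, map_pow, map_sub, Bivariate.swap_Y, Bivariate.swap_C_C]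
  · rwa [swap_eval]

lemma H_ne (G : k[X][X]) (A : k[X]) (c t0 : k) (hc : c ≠ 0) (b : ℕ) (H : k[X][X])
    (hH : (X - C (C t0)) ^ b * H = ev (k := k) (X : k[X][X]) (A.map C + C X * (C (C c) * (X - C (C t0)) ^ b)) G)
    (hx : ev t0 (A.eval t0) (derivative G) ≠ 0) : H.eval (C t0) ≠ 0 := by
  rw [← swap_eval]
  have h1 : C ((X - C t0) ^ b) * Bivariate.swap H = G.comp (C (C c * (X - C t0) ^ b) * X + C A) := by
    rw [← swap_ev, ← hH]
    simp only [map_mul, map_pow, map_sub, Bivariate.swap_Y, Bivariate.swap_C_C]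
  have h2 : (derivative (G.comp (C (C c * (X - C t0) ^ b) * X + C A))).eval 0 =
      (derivative G).eval A * (C c * (X - C t0) ^ b) := by
    rw [derivative_comp]
    simp [eval_comp]
    ring
  have h3 : (Bivariate.swap H).coeff 1 = C c * (derivative G).eval A := by
    have h4 := h2
    rw [← h1, ← coeff_zero_eq_eval_zero, coeff_derivative, coeff_C_mul] at h4
    have h5 : (X - C t0) ^ b ≠ 0 := pow_ne_zero _ (X_sub_C_ne_zero _)
    apply mul_left_cancel₀ h5
    simp only [zero_add, Nat.cast_zero, mul_one] at h4
    rw [h4]; ring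
  intro h
  have h6 := congrArg (fun P => P.coeff 1) h
  simp only [coeff_map, h3, coeff_zero] at h6
  apply hx
  rw [ev_eq_eval_map']
  rw [map_mul] at h6
  simp only [coe_evalRingHom, eval_C, mul_eq_zero, hc, false_or] at h6
  have h7 : (evalRingHom t0) ((derivative G).eval A) = ((derivative G).map (evalRingHom t0)).eval (evalRingHom t0 A) :=
    (eval_map_apply (evalRingHom t0) A).symm
  simpa [h6] using h7.symm

end Irr

section Deg
variable {k : Type*} [Field k]

/-- degree of `G(T, f)` for generic `f` of degree `n` -/
noncomputable def NN (n : ℕ) (G : k[X][X]) : ℕ := G.support.sup fun i => (G.coeff i).natDegree + i * n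

/-- leading coefficient of `G(T,f)` -/
noncomputable def uu (n : ℕ) (G : k[X][X]) : k[X] :=
  ∑ i ∈ Finset.range (G.natDegree + 1), C (if i * n ≤ NN n G then (G.coeff i).coeff (NN n G - i * n) else 0) * X ^ i

lemma NN_le (n : ℕ) (G : k[X][X]) (i : ℕ) (hi : G.coeff i ≠ 0) : (G.coeff i).natDegree + i * n ≤ NN n G :=
  Finset.le_sup (f := fun i => (G.coeff i).natDegree + i * n) (mem_support_iff.2 hi)

lemma le_NN (n : ℕ) (G : k[X][X]) (hG : G ≠ 0) : G.natDegree * n ≤ NN n G :=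
  (Nat.le_add_left _ _).trans (NN_le n G G.natDegree (by simpa using hG))

lemma uu_coeff (n : ℕ) (G : k[X][X]) (i : ℕ) : (uu n G).coeff i =
    if i * n ≤ NN n G then (G.coeff i).coeff (NN n G - i * n) else 0 := by
  unfold uu
  simp only [finsetSum_coeff, coeff_C_mul, coeff_X_pow, mul_ite, mul_one, mul_zero, Finset.sum_ite_eq, Finset.mem_range]
  split_ifs with h1 h2 h2
  · rfl
  · rfl
  · rw [coeff_eq_zero_of_natDegree_lt (p := G)]; simp
    simpa using h1
  · rfl

lemma uu_ne (n : ℕ) (G : k[X][X]) (hG : G ≠ 0) : uu n G ≠ 0 := by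
  have hne : G.support.Nonempty := by simpa [Finset.nonempty_iff_ne_empty] using hG
  obtain ⟨i, hi, he⟩ := Finset.exists_mem_eq_sup G.support hne (fun i => (G.coeff i).natDegree + i * n)
  have he' : NN n G = (G.coeff i).natDegree + i * n := he
  intro h
  have h1 := uu_coeff n G i
  rw [h, coeff_zero, if_pos (by omega), he', Nat.add_sub_cancel] at h1
  exact mem_support_iff.1 hi (leadingCoeff_eq_zero.1 h1.symm)

lemma uu_natDegree_le (n : ℕ) (G : k[X][X]) : (uu n G).natDegree ≤ G.natDegree := by
  rw [natDegree_le_iff_coeff_eq_zero]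
  intro i hi
  rw [uu_coeff, coeff_eq_zero_of_natDegree_lt hi]; simp

lemma ev_natDegree_le {R : Type*} [CommRing R] [Algebra k R] (n : ℕ) (G : k[X][X]) (f : R[X]) (hf : f.natDegree ≤ n) :
    (ev (k := k) (X : R[X]) f G).natDegree ≤ NN n G := by
  rw [ev_sum]
  refine natDegree_sum_le_of_forall_le _ _ fun i _ => ?_
  by_cases hi : G.coeff i = 0
  · simp [hi]
  refine natDegree_mul_le.trans (le_trans (Nat.add_le_add ?_ ?_) (NN_le n G i hi))
  · rw [aeval_X_left_eq_map]; exact natDegree_map_le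
  · exact natDegree_pow_le.trans (Nat.mul_le_mul_left _ hf)

lemma ev_coeff_NN {R : Type*} [CommRing R] [Algebra k R] (n : ℕ) (G : k[X][X]) (f : R[X]) (hf : f.natDegree ≤ n)
    (α : k) (hα : f.coeff n = algebraMap k R α) :
    (ev (k := k) (X : R[X]) f G).coeff (NN n G) = algebraMap k R ((uu n G).eval α) := by
  rw [ev_sum, finsetSum_coeff, eval_eq_sum_range' (n := G.natDegree + 1)
    (Nat.lt_succ_of_le (uu_natDegree_le n G)), map_sum]
  refine Finset.sum_congr rfl fun i _ => ?_
  rw [uu_coeff]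
  by_cases hi : G.coeff i = 0
  · simp [hi]
  have h1 := NN_le n G i hi
  rw [if_pos (by omega)]
  have h2 : NN n G = (NN n G - i * n) + i * n := by omega
  conv_lhs => rw [h2]
  rw [coeff_mul_add_eq_of_natDegree_le]
  · rw [aeval_X_left_eq_map, coeff_map, map_mul, map_pow, ← hα]
    congr 1
    have := coeff_pow_of_natDegree_le (m := i) hf
    rw [← this]
  · rw [aeval_X_left_eq_map]; exact natDegree_map_le.trans (by omega)
  · exact natDegree_pow_le.trans (Nat.mul_le_mul_left _ hf)

/-- normalised -/
noncomputable def PP {R : Type*} [CommRing R] [Algebra k R] (u : k) (f : R[X]) (G : k[X][X]) : R[X] :=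
  C (algebraMap k R u⁻¹) * ev (k := k) (X : R[X]) f G

lemma PP_monic {R : Type*} [CommRing R] [Nontrivial R] [Algebra k R] (n : ℕ) (G : k[X][X]) (f : R[X]) (hf : f.natDegree ≤ n)
    (α : k) (hα : f.coeff n = algebraMap k R α) (hu : (uu n G).eval α ≠ 0) :
    (PP ((uu n G).eval α) f G).Monic ∧ (PP ((uu n G).eval α) f G).natDegree = NN n G := by
  have h1 : (PP ((uu n G).eval α) f G).natDegree ≤ NN n G :=
    (natDegree_C_mul_le _ _).trans (ev_natDegree_le n G f hf)
  have h2 : (PP ((uu n G).eval α) f G).coeff (NN n G) = 1 := by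
    unfold PP
    rw [coeff_C_mul, ev_coeff_NN n G f hf α hα, ← map_mul, inv_mul_cancel₀ hu, map_one]
  exact ⟨monic_of_natDegree_le_of_coeff_eq_one _ h1 h2,
    natDegree_eq_of_le_of_coeff_ne_zero h1 (by rw [h2]; exact one_ne_zero)⟩

lemma PP_map {R R' : Type*} [CommRing R] [Algebra k R] [CommRing R'] [Algebra k R'] (φ : R →ₐ[k] R') (u : k) (f : R[X]) (G : k[X][X]) :
    (PP u f G).map (φ : R →+* R') = PP u (f.map (φ : R →+* R')) G := by
  unfold PP
  rw [Polynomial.map_mul, map_C]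
  congr 1
  · simp
  · have := hom_ev (mapAlgHom φ) (X : R[X]) f G
    simpa using this

lemma C_mul_PP {R : Type*} [CommRing R] [Algebra k R] {u : k} (hu : u ≠ 0) (f : R[X]) (G : k[X][X]) :
    C (algebraMap k R u) * PP u f G = ev (k := k) (X : R[X]) f G := by
  unfold PP
  rw [← mul_assoc, ← C_mul, ← map_mul, mul_inv_cancel₀ hu]; simp

end Deg
end BH

namespace BH

section GalMove
set_option linter.unusedSectionVars false
variable {K L J Ω : Type*} [Field K] [Field L] [Algebra K L] [Fintype J] [DecidableEq J]
  [Fintype Ω] [DecidableEq Ω]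

lemma move_irr {M M' : Type*} [Field M] [Field M'] [Algebra M M'] [IsAlgClosure M M'] (R : M[X]) (hR : Irreducible R)
    (x y : M') (hx : aeval x R = 0) (hy : aeval y R = 0) : ∃ g : M' ≃ₐ[M] M', g x = y := by
  have : Normal M M' := IsAlgClosure.normal M M'
  have h1 := minpoly.eq_of_irreducible hR hx
  have h2 := minpoly.eq_of_irreducible hR hy
  have h3 : IsConjRoot M y x := by
    unfold IsConjRoot
    rw [← h1, ← h2]
  exact isConjRoot_iff_exists_algEquiv.1 h3

/-- transitivity from irreducibility -/
lemma gal_B1 (P : J → K[X]) (ℓ : Ω → J) (τ : Ω → L) (hτ : Function.Injective τ)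
    (hP : ∀ j, (P j).map (algebraMap K L) = ∏ ω with ℓ ω = j, (X - C (τ ω)))
    {M : Type*} [Field M] (φ : K →+* M) (j : J) (hirr : Irreducible ((P j).map φ)) :
    ∀ ω ω', ℓ ω = j → ℓ ω' = j → ∃ σ, IsGal K τ σ ∧ (∀ ω, ℓ (σ ω) = ℓ ω) ∧ σ ω = ω' := by
  obtain ⟨τ', h1, h2, h3⟩ := transfer P ℓ τ hτ hP (M' := AlgebraicClosure M) φ
  intro ω ω' hω hω'
  have hroot : ∀ ω, ℓ ω = j → aeval (τ' ω) ((P j).map φ) = 0 := by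
    intro ω hω
    rw [aeval_def, eval₂_map, ← eval_map, h2]
    exact (eval_prod_label ℓ τ' _ _).2 ⟨ω, hω, rfl⟩
  obtain ⟨g, hg⟩ := move_irr _ hirr (τ' ω) (τ' ω') (hroot _ hω) (hroot _ hω')
  obtain ⟨σ, h4, h5, h6⟩ := h3 g
  exact ⟨σ, h4, h5, h1 (by rw [← h6, hg])⟩

/-- transitivity of the stabiliser -/
lemma gal_B2 (P : J → K[X]) (ℓ : Ω → J) (τ : Ω → L) (hτ : Function.Injective τ)
    (hP : ∀ j, (P j).map (algebraMap K L) = ∏ ω with ℓ ω = j, (X - C (τ ω)))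
    {M : Type*} [Field M] (φ : K →+* M) (j : J) (z : M) (R : M[X]) (hR : (P j).map φ = (X - C z) * R) (hirr : Irreducible R) :
    ∃ ω0, ℓ ω0 = j ∧ ∀ ω ω', ℓ ω = j → ℓ ω' = j → ω ≠ ω0 → ω' ≠ ω0 →
      ∃ σ, IsGal K τ σ ∧ (∀ ω, ℓ (σ ω) = ℓ ω) ∧ σ ω0 = ω0 ∧ σ ω = ω' := by
  obtain ⟨τ', h1, h2, h3⟩ := transfer P ℓ τ hτ hP (M' := AlgebraicClosure M) φ
  have h2' : ∀ x, (∃ ω, ℓ ω = j ∧ x = τ' ω) ↔ x = algebraMap M _ z ∨ aeval x R = 0 := by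
    intro x
    rw [← eval_prod_label ℓ τ', ← h2, ← Polynomial.map_map, hR, eval_map_algebraMap]
    simp [sub_eq_zero]
  obtain ⟨ω0, hω0, hz⟩ := (h2' (algebraMap M _ z)).2 (Or.inl rfl)
  refine ⟨ω0, hω0, ?_⟩
  intro ω ω' hω hω' hne hne'
  have hroot : ∀ ω, ℓ ω = j → ω ≠ ω0 → aeval (τ' ω) R = 0 := by
    intro ω hω hne
    rcases (h2' (τ' ω)).1 ⟨ω, hω, rfl⟩ with h | h
    · exact absurd (h1 (h.trans hz)) hne
    · exact h
  obtain ⟨g, hg⟩ := move_irr _ hirr (τ' ω) (τ' ω') (hroot _ hω hne) (hroot _ hω' hne')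
  obtain ⟨σ, h4, h5, h6⟩ := h3 g
  refine ⟨σ, h4, h5, h1 ?_, h1 (by rw [← h6, hg])⟩
  rw [← h6, ← hz, AlgEquiv.commutes]

/-- a swap -/
lemma gal_B3 (P : J → K[X]) (ℓ : Ω → J) (τ : Ω → L) (hτ : Function.Injective τ)
    (hP : ∀ j, (P j).map (algebraMap K L) = ∏ ω with ℓ ω = j, (X - C (τ ω)))
    {M : Type*} [Field M] [DecidableEq M] (φ : K →+* M) (j : J)
    (hi : ∀ i, i ≠ j → ((P i).map φ).Splits)
    (hj : ((P j).map φ).roots.toFinset.card + 2 = (P j).natDegree) :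
    ∃ ω1 ω2, ℓ ω1 = j ∧ ℓ ω2 = j ∧ ω1 ≠ ω2 ∧ IsGal K τ (Equiv.swap ω1 ω2) := by
  classical
  obtain ⟨τ', h1, h2, h3⟩ := transfer P ℓ τ hτ hP (M' := AlgebraicClosure M) φ
  let rat : Ω → Prop := fun ω => ∃ z, algebraMap M (AlgebraicClosure M) z = τ' ω
  have hev : ∀ j (x : AlgebraicClosure M), aeval x ((P j).map φ) = 0 ↔ ∃ ω, ℓ ω = j ∧ x = τ' ω := by
    intro j x
    rw [← eval_prod_label ℓ τ', ← h2, ← Polynomial.map_map, eval_map_algebraMap]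
  have hPne : ∀ j, (P j).map φ ≠ 0 := by
    intro j h
    have := h2 j
    rw [← Polynomial.map_map, h, Polynomial.map_zero] at this
    exact Finset.prod_ne_zero_iff.2 (fun ω _ => X_sub_C_ne_zero _) this.symm
  have hdegj : (P j).natDegree = (Finset.univ.filter fun ω => ℓ ω = j).card := by
    rw [← natDegree_map (algebraMap K L), hP, natDegree_prod_of_monic _ _ fun _ _ => monic_X_sub_C _]
    simp
  -- rational elements of block j
  let A := Finset.univ.filter fun ω => ℓ ω = j
  have hcard : (A.filter rat).card = ((P j).map φ).roots.toFinset.card := by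
    refine Finset.card_bij (fun ω h => Classical.choose (Finset.mem_filter.1 h).2) ?_ ?_ ?_
    · intro ω h
      have hs := Classical.choose_spec (Finset.mem_filter.1 h).2
      set z := Classical.choose (Finset.mem_filter.1 h).2
      rw [Multiset.mem_toFinset, mem_roots (hPne j), IsRoot.def]
      have h4 := (hev j (τ' ω)).2 ⟨ω, (Finset.mem_filter.1 (Finset.mem_filter.1 h).1).2, rfl⟩
      rw [← hs, aeval_algebraMap_apply] at h4
      simpa using h4
    · intro ω h ω' h' hh
      apply h1
      rw [← Classical.choose_spec (Finset.mem_filter.1 h).2, ← Classical.choose_spec (Finset.mem_filter.1 h').2, hh]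
    · intro z hz
      rw [Multiset.mem_toFinset, mem_roots (hPne j), IsRoot.def] at hz
      obtain ⟨ω, hω, hzω⟩ := (hev j (algebraMap M _ z)).1 (by rw [aeval_algebraMap_apply]; simp [hz])
      have hmem : ω ∈ A.filter rat := Finset.mem_filter.2 ⟨Finset.mem_filter.2 ⟨Finset.mem_univ _, hω⟩, z, hzω⟩
      refine ⟨ω, hmem, ?_⟩
      apply (algebraMap M (AlgebraicClosure M)).injective
      rw [Classical.choose_spec (Finset.mem_filter.1 hmem).2, hzω]
  have hnr : (A.filter fun ω => ¬ rat ω).card = 2 := by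
    have := Finset.card_filter_add_card_filter_not (s := A) rat
    have h5 : A.card = (P j).natDegree := hdegj.symm
    omega
  obtain ⟨ω1, ω2, hne, hset⟩ := Finset.card_eq_two.1 hnr
  have hω1 : ω1 ∈ A.filter fun ω => ¬ rat ω := by rw [hset]; simp
  have hω2 : ω2 ∈ A.filter fun ω => ¬ rat ω := by rw [hset]; simp
  rw [Finset.mem_filter, Finset.mem_filter] at hω1 hω2
  have hother : ∀ ω, ω ≠ ω1 → ω ≠ ω2 → rat ω := by
    intro ω a1 a2
    by_cases hℓ : ℓ ω = j
    · by_contra hr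
      have : ω ∈ A.filter fun ω => ¬ rat ω := Finset.mem_filter.2 ⟨Finset.mem_filter.2 ⟨Finset.mem_univ _, hℓ⟩, hr⟩
      rw [hset] at this
      simp [a1, a2] at this
    · have hs := hi _ hℓ
      have h6 := (hev (ℓ ω) (τ' ω)).2 ⟨ω, rfl, rfl⟩
      have hr : (((P (ℓ ω)).map φ).map (algebraMap M (AlgebraicClosure M))).IsRoot (τ' ω) := by
        rw [IsRoot.def, eval_map_algebraMap]; exact h6
      obtain ⟨z, hz⟩ := hs.mem_range_of_isRoot (hPne _) hr
      exact ⟨z, hz⟩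
  -- a moving automorphism
  obtain ⟨g, hg⟩ : ∃ g : AlgebraicClosure M ≃ₐ[M] AlgebraicClosure M, g (τ' ω1) ≠ τ' ω1 := by
    have hintg : IsIntegral M (τ' ω1) := Algebra.IsIntegral.isIntegral _
    have hdvd : minpoly M (τ' ω1) ∣ (P j).map φ := minpoly.dvd _ _ ((hev j _).2 ⟨ω1, hω1.1.2, rfl⟩)
    have hsep : (minpoly M (τ' ω1)).Separable := by
      refine Separable.of_dvd ?_ hdvd
      rw [← separable_map (algebraMap M (AlgebraicClosure M)), Polynomial.map_map, h2]
      rw [separable_prod_X_sub_C_iff']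
      intro a _ b _ h
      exact h1 h
    have hdeg : (minpoly M (τ' ω1)).natDegree ≠ 1 := by
      intro h
      rw [minpoly.natDegree_eq_one_iff] at h
      exact hω1.2 h
    have hpos := minpoly.natDegree_pos hintg
    have hc := card_rootSet_eq_natDegree (K := AlgebraicClosure M) hsep (IsAlgClosed.splits _)
    have h1lt : 1 < Fintype.card ((minpoly M (τ' ω1)).rootSet (AlgebraicClosure M)) := by omega
    have hmem1 : τ' ω1 ∈ (minpoly M (τ' ω1)).rootSet (AlgebraicClosure M) := by
      rw [mem_rootSet]; exact ⟨minpoly.ne_zero hintg, minpoly.aeval _ _⟩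
    obtain ⟨y, hy⟩ := Fintype.exists_ne_of_one_lt_card h1lt ⟨τ' ω1, hmem1⟩
    obtain ⟨g, hg⟩ := move_irr _ (minpoly.irreducible hintg) (τ' ω1) y (minpoly.aeval _ _) (mem_rootSet.1 y.2).2
    refine ⟨g, ?_⟩
    rw [hg]
    intro h
    exact hy (Subtype.ext h)
  obtain ⟨σ, h4, h5, h6⟩ := h3 g
  have hfix : ∀ ω, rat ω → σ ω = ω := by
    rintro ω ⟨z, hz⟩
    apply h1
    rw [← h6, ← hz, AlgEquiv.commutes]
  have hσ1 : σ ω1 ≠ ω1 := by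
    intro h
    exact hg (by rw [h6, h])
  have hσ12 : σ ω1 = ω2 := by
    by_contra h
    exact hσ1 (σ.injective (hfix _ (hother _ hσ1 h)))
  have hσ21 : σ ω2 = ω1 := by
    by_contra h
    have hh : σ ω2 ≠ ω2 := by
      intro h'
      exact hne (σ.injective (hσ12.trans h'.symm))
    exact hh (σ.injective (hfix _ (hother _ h hh)))
  have : σ = Equiv.swap ω1 ω2 := by
    ext ω
    by_cases a1 : ω = ω1
    · rw [a1, hσ12, Equiv.swap_apply_left]
    by_cases a2 : ω = ω2
    · rw [a2, hσ21, Equiv.swap_apply_right]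
    rw [Equiv.swap_apply_of_ne_of_ne a1 a2, hfix _ (hother _ a1 a2)]
  exact ⟨ω1, ω2, hω1.1.2, hω2.1.2, hne, this ▸ h4⟩

/-- full monodromy -/
lemma gal_full (ℓ : Ω → J) (τ : Ω → L)
    (h1 : ∀ ω ω', ℓ ω = ℓ ω' → ∃ σ, IsGal K τ σ ∧ (∀ ω, ℓ (σ ω) = ℓ ω) ∧ σ ω = ω')
    (h2 : ∀ j, ∃ ω0, ℓ ω0 = j ∧ ∀ ω ω', ℓ ω = j → ℓ ω' = j → ω ≠ ω0 → ω' ≠ ω0 →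
      ∃ σ, IsGal K τ σ ∧ (∀ ω, ℓ (σ ω) = ℓ ω) ∧ σ ω0 = ω0 ∧ σ ω = ω')
    (h3 : ∀ j, ∃ ω1 ω2, ℓ ω1 = j ∧ ℓ ω2 = j ∧ ω1 ≠ ω2 ∧ IsGal K τ (Equiv.swap ω1 ω2)) :
    ∀ σ ∈ SL ℓ, IsGal K τ σ := by
  have hswap : ∀ a b, ℓ a = ℓ b → a ≠ b → IsGal K τ (Equiv.swap a b) := by
    intro a b hab hne
    obtain ⟨ω0, hω0, h2'⟩ := h2 (ℓ a)
    obtain ⟨ω1, ω2, l1, l2, h12, hs⟩ := h3 (ℓ a)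
    -- move ω1 to ω0 and a to ω0
    obtain ⟨s, hs1, hs2, hs3⟩ := h1 ω1 ω0 (by rw [l1, hω0])
    obtain ⟨t, ht1, ht2, ht3⟩ := h1 a ω0 (by rw [hω0])
    obtain ⟨r, hr1, hr2, hr3, hr4⟩ := h2' (s ω2) (t b) (by rw [hs2, l2]) (by rw [ht2, hab])
      (by rw [← hs3]; exact fun h => h12 (s.injective h).symm)
      (by rw [← ht3]; exact fun h => hne (t.injective h).symm)
    have hg : IsGal K τ (t⁻¹ * r * s) := (ht1.inv.mul hr1).mul hs1
    have e1 : (t⁻¹ * r * s) ω1 = a := by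
      simp only [Equiv.Perm.mul_apply, hs3, hr3]
      rw [Equiv.Perm.inv_eq_iff_eq, ht3]
    have e2 : (t⁻¹ * r * s) ω2 = b := by
      simp only [Equiv.Perm.mul_apply, hr4]
      rw [Equiv.Perm.inv_eq_iff_eq]
    have := (hg.mul hs).mul hg.inv
    rwa [Equiv.mul_swap_eq_swap_mul, e1, e2, mul_assoc, mul_inv_cancel, mul_one] at this
  have key : ∀ m, ∀ σ ∈ SL ℓ, σ.support.card ≤ m → IsGal K τ σ := by
    intro m
    induction m with
    | zero =>
      intro σ _ hc
      have : σ = 1 := by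
        rw [← Equiv.Perm.support_eq_empty_iff]; exact Finset.card_eq_zero.1 (Nat.le_zero.1 hc)
      rw [this]; exact IsGal.one
    | succ m ih =>
      intro σ hσ hc
      by_cases h : σ = 1
      · rw [h]; exact IsGal.one
      obtain ⟨x, hx⟩ : ∃ x, σ x ≠ x := by
        by_contra hh
        push Not at hh
        exact h (Equiv.ext hh)
      have hlt := Equiv.Perm.card_support_swap_mul hx
      have hsw := hswap x (σ x) (hσ x).symm (Ne.symm hx)
      have hmem : Equiv.swap x (σ x) ∈ SL ℓ := by
        intro ω
        by_cases a1 : ω = x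
        · rw [a1, Equiv.swap_apply_left, hσ]
        by_cases a2 : ω = σ x
        · rw [a2, Equiv.swap_apply_right, hσ]
        rw [Equiv.swap_apply_of_ne_of_ne a1 a2]
      have h4 := ih (Equiv.swap x (σ x) * σ) ((SL ℓ).mul_mem hmem hσ) (by omega)
      have h5 := hsw.mul h4
      rwa [← mul_assoc, Equiv.swap_mul_self, one_mul] at h5
  intro σ hσ
  exact key _ σ hσ le_rfl

end GalMove
end BH

namespace BH

lemma irr_spec {A B : Type*} [CommRing A] [IsDomain A] [IsIntegrallyClosed A] [CommRing B] [IsDomain B]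
    (P : A[X]) (hP : P.Monic) (φ : A →+* B) (h : Irreducible (P.map φ)) :
    Irreducible (P.map (algebraMap A (FractionRing A))) :=
  (hP.irreducible_iff_irreducible_map_fraction_map).1 (hP.irreducible_of_irreducible_map φ P h)

lemma sep_of_irr {F : Type*} [Field F] (p : ℕ) [CharP F p] (Q : F[X]) (hQ : Q.Monic) (hirr : Irreducible Q)
    (hd : Q.natDegree < p) : Q.Separable := by
  rw [separable_iff_derivative_ne_zero hirr]
  intro h
  have hpos : 0 < Q.natDegree := hirr.natDegree_pos
  have h1 := coeff_derivative Q (Q.natDegree - 1)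
  rw [h, Nat.sub_add_cancel hpos, hQ.coeff_natDegree, coeff_zero, one_mul] at h1
  have h2 : ((Q.natDegree : ℕ) : F) = 0 := by
    rw [← Nat.sub_add_cancel hpos]; push_cast; exact h1.symm
  rw [CharP.cast_eq_zero_iff F p] at h2
  exact absurd (Nat.le_of_dvd hpos h2) (by omega)

lemma ps_roots {F : Type*} [Field F] [IsAlgClosed F] [DecidableEq (FractionRing (PowerSeries F))]
    (P : (PowerSeries F)[X]) (hP : P.Monic) (U Q : F[X]) (hQ : Q.Separable)
    (hUQ : P.map PowerSeries.constantCoeff = U * Q)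
    (h1 : ∀ z, P.eval z = 0 → Q.eval (PowerSeries.constantCoeff z) = 0)
    (h2 : ∀ a, Q.eval a = 0 → U.eval a ≠ 0) :
    (P.map (algebraMap _ (FractionRing (PowerSeries F)))).roots.toFinset.card = Q.natDegree := by
  classical
  have hQ0 : Q ≠ 0 := hQ.ne_zero
  have hc : Q.roots.toFinset.card = Q.natDegree := by
    rw [Multiset.toFinset_card_of_nodup (nodup_roots hQ)]
    exact splits_iff_card_roots.1 (IsAlgClosed.splits Q)
  have hPne : P.map (algebraMap _ (FractionRing (PowerSeries F))) ≠ 0 := (hP.map _).ne_zero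
  have hd : ∀ z : PowerSeries F, Q.eval (PowerSeries.constantCoeff z) = 0 →
      IsUnit (PowerSeries.constantCoeff (P.derivative.eval z)) := by
    intro z hz
    rw [← eval_map_apply, ← derivative_map, hUQ, derivative_mul, eval_add, eval_mul, eval_mul, hz, mul_zero, zero_add]
    rw [isUnit_iff_ne_zero]
    refine mul_ne_zero (h2 _ hz) ?_
    obtain ⟨a, b, hab⟩ := hQ
    intro h
    have := congrArg (eval (PowerSeries.constantCoeff z)) hab
    simp [hz, h] at this
  rw [← hc]
  symm
  have hex : ∀ a ∈ Q.roots.toFinset, ∃ z : PowerSeries F, PowerSeries.constantCoeff z = a ∧ P.eval z = 0 := by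
    intro a ha
    rw [Multiset.mem_toFinset, mem_roots hQ0, IsRoot.def] at ha
    have hd' := hd (PowerSeries.C a) (by simpa using ha)
    obtain ⟨w, hw⟩ := hd'.exists_right_inv
    refine ps_hensel P a w ?_ hw
    rw [← eval_map_apply, hUQ]; simp [ha]
  choose! Z hZ1 hZ2 using hex
  refine Finset.card_bij (fun a _ => algebraMap _ (FractionRing (PowerSeries F)) (Z a)) ?_ ?_ ?_
  · intro a ha
    rw [Multiset.mem_toFinset, mem_roots hPne, IsRoot.def, eval_map_apply, hZ2 a ha, map_zero]
  · intro a ha b hb h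
    have := IsFractionRing.injective (PowerSeries F) (FractionRing (PowerSeries F)) h
    rw [← hZ1 a ha, this, hZ1 b hb]
  · intro x hx
    rw [Multiset.mem_toFinset, mem_roots hPne, IsRoot.def] at hx
    have hintg : IsIntegral (PowerSeries F) x := ⟨P, hP, by rw [← eval_map]; exact hx⟩
    obtain ⟨z, hz⟩ := IsIntegrallyClosed.isIntegral_iff.1 hintg
    rw [← hz, eval_map_apply] at hx
    have hPz : P.eval z = 0 := IsFractionRing.injective (PowerSeries F) (FractionRing (PowerSeries F)) (by rw [hx, map_zero])
    have hq := h1 z hPz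
    have hmem : PowerSeries.constantCoeff z ∈ Q.roots.toFinset := by
      rw [Multiset.mem_toFinset, mem_roots hQ0]; exact hq
    refine ⟨_, hmem, ?_⟩
    rw [← hz]
    congr 1
    refine ps_hensel_unique P _ _ (hZ1 _ hmem) (hZ2 _ hmem) hPz (hd _ ?_)
    rw [hZ1 _ hmem]; exact hq

section Fam
variable {k : Type*} [Field k]

/-- `f_u + s (1 + ∑ v_i (T-t0)^{i+1})` -/
noncomputable def VV {R : Type*} [CommRing R] [Algebra k R] {m : ℕ} (t0 : k) (v : Fin m → R) : R[X] :=
  1 + ∑ i : Fin m, C (v i) * (X - C (algebraMap k R t0)) ^ ((i : ℕ) + 1)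

noncomputable def FF {R : Type*} [CommRing R] [Algebra k R] {m : ℕ} (fu : k[X]) (t0 : k) (s : R) (v : Fin m → R) : R[X] :=
  fu.map (algebraMap k R) + C s * VV t0 v

variable {R R' : Type*} [CommRing R] [Algebra k R] [CommRing R'] [Algebra k R'] {m : ℕ} (fu : k[X]) (t0 : k) (s : R) (v : Fin m → R)

lemma VV_map (φ : R →ₐ[k] R') : (VV t0 v).map (φ : R →+* R') = VV t0 (fun i => φ (v i)) := by
  unfold VV
  simp [Polynomial.map_sum]

lemma FF_map (φ : R →ₐ[k] R') : (FF fu t0 s v).map (φ : R →+* R') = FF fu t0 (φ s) (fun i => φ (v i)) := by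
  unfold FF
  rw [Polynomial.map_add, Polynomial.map_mul, VV_map, Polynomial.map_map, map_C]
  congr 2
  exact φ.comp_algebraMap

lemma VV_natDegree : (VV t0 v).natDegree ≤ m := by
  unfold VV
  refine natDegree_add_le_of_degree_le (by simp) ?_
  refine natDegree_sum_le_of_forall_le _ _ fun i _ => ?_
  refine (natDegree_C_mul_le _ _).trans (natDegree_pow_le.trans ?_)
  have h1 : (X - C (algebraMap k R t0)).natDegree ≤ 1 := natDegree_X_sub_C_le _
  calc _ ≤ ((i : ℕ) + 1) * 1 := Nat.mul_le_mul_left _ h1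
    _ ≤ m := by omega

lemma FF_natDegree {n : ℕ} (hf : fu.natDegree ≤ n) (hm : m < n) : (FF fu t0 s v).natDegree ≤ n := by
  unfold FF
  refine natDegree_add_le_of_degree_le (natDegree_map_le.trans hf) ?_
  exact (natDegree_C_mul_le _ _).trans ((VV_natDegree t0 v).trans hm.le)

lemma FF_coeff {n : ℕ} (hm : m < n) : (FF fu t0 s v).coeff n = algebraMap k R (fu.coeff n) := by
  unfold FF
  rw [coeff_add, coeff_map, coeff_C_mul, coeff_eq_zero_of_natDegree_lt ((VV_natDegree t0 v).trans_lt hm)]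
  simp

lemma FF_eval : (FF fu t0 s v).eval (algebraMap k R t0) = algebraMap k R (fu.eval t0) + s := by
  unfold FF VV
  simp [eval_finsetSum]
  rw [← Polynomial.eval₂_at_apply, eval₂_eq_eval_map, eval_map_algebraMap]

end Fam
end BH

namespace BH

section Gen
set_option linter.unusedSectionVars false
variable {k : Type*} [Field k]

lemma PP_eval {R : Type*} [CommRing R] [Algebra k R] (u : k) (f : R[X]) (G : k[X][X]) (a : R) :
    (PP u f G).eval a = algebraMap k R u⁻¹ * ev a (f.eval a) G := by
  unfold PP
  rw [eval_mul, eval_C]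
  congr 1
  have := hom_ev (((aeval a : R[X] →ₐ[R] R)).restrictScalars k) (X : R[X]) f G
  simpa using this

lemma ev_algebraMap {R : Type*} [CommRing R] [Algebra k R] (a b : k) (G : k[X][X]) :
    ev (algebraMap k R a) (algebraMap k R b) G = algebraMap k R (ev a b G) :=
  (hom_ev (Algebra.ofId k R) a b G).symm

/-- the normalised substituted polynomial -/
noncomputable def PF {R : Type*} [CommRing R] [Algebra k R] {m : ℕ} (n : ℕ) (fu : k[X]) (t0 : k) (G : k[X][X])
    (s : R) (v : Fin m → R) : R[X] := PP ((uu n G).eval (fu.coeff n)) (FF fu t0 s v) G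

lemma PF_monic {R : Type*} [CommRing R] [Nontrivial R] [Algebra k R] {m n : ℕ} (fu : k[X]) (t0 : k) (G : k[X][X])
    (s : R) (v : Fin m → R) (hfu : fu.natDegree ≤ n) (hm : m < n) (hu : (uu n G).eval (fu.coeff n) ≠ 0) :
    (PF n fu t0 G s v).Monic ∧ (PF n fu t0 G s v).natDegree = NN n G :=
  PP_monic n G _ (FF_natDegree fu t0 s v hfu hm) _ (FF_coeff fu t0 s v hm) hu

lemma PF_map {R R' : Type*} [CommRing R] [Algebra k R] [CommRing R'] [Algebra k R'] {m : ℕ} (n : ℕ) (fu : k[X]) (t0 : k) (G : k[X][X])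
    (s : R) (v : Fin m → R) (φ : R →ₐ[k] R') :
    (PF n fu t0 G s v).map (φ : R →+* R') = PF n fu t0 G (φ s) (fun i => φ (v i)) := by
  unfold PF
  rw [PP_map, FF_map]

lemma FF_cons {R : Type*} [CommRing R] [Algebra k R] {m : ℕ} (fu : k[X]) (t0 : k) (s a b : R) :
    FF fu t0 s (Fin.cons a (Fin.cons b (fun _ => 0)) : Fin (m + 2) → R) =
      fu.map (algebraMap k R) + C s * (1 + C a * (X - C (algebraMap k R t0)) + C b * (X - C (algebraMap k R t0)) ^ 2) := by
  unfold FF VV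
  simp [Fin.sum_univ_succ, add_assoc]

lemma irr_T' (G : k[X][X]) (hG : Irreducible G) (hdeg : G.natDegree ≠ 0) (A : k[X]) (c t0 : k) (hc : c ≠ 0)
    (a b : ℕ) (H f : k[X][X]) (u : k) (hu : u ≠ 0) (hf : f = A.map C + C X * (C (C c) * (X - C (C t0)) ^ b))
    (hH : (X - C (C t0)) ^ a * H = PP u f G)
    (h0 : H.eval (C t0) ≠ 0) : Irreducible H := by
  have h1 : (X - C (C t0)) ^ a * (C (C u) * H) = ev (k := k) (X : k[X][X]) (A.map C + C X * (C (C c) * (X - C (C t0)) ^ b)) G := by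
    rw [← hf, ← C_mul_PP hu, ← hH]
    rw [Polynomial.algebraMap_eq]; ring
  have h2 := irr_T G hG hdeg A c t0 hc a b _ h1 (by simp [hu, h0])
  have h3 : IsUnit (C (C u) : k[X][X]) := by
    rw [Polynomial.isUnit_C, Polynomial.isUnit_C]; exact isUnit_iff_ne_zero.2 hu
  exact (irreducible_isUnit_mul h3).1 h2

lemma H_ne' (G : k[X][X]) (A : k[X]) (c t0 : k) (hc : c ≠ 0)
    (b : ℕ) (H f : k[X][X]) (u : k) (hu : u ≠ 0) (hf : f = A.map C + C X * (C (C c) * (X - C (C t0)) ^ b))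
    (hH : (X - C (C t0)) ^ b * H = PP u f G)
    (hx : ev t0 (A.eval t0) (derivative G) ≠ 0) : H.eval (C t0) ≠ 0 := by
  have h1 : (X - C (C t0)) ^ b * (C (C u) * H) = ev (k := k) (X : k[X][X]) (A.map C + C X * (C (C c) * (X - C (C t0)) ^ b)) G := by
    rw [← hf, ← C_mul_PP hu, ← hH]
    rw [Polynomial.algebraMap_eq]; ring
  have h2 := H_ne G A c t0 hc b _ h1 hx
  rw [eval_mul] at h2
  exact right_ne_zero_of_mul h2

/-- homomorphisms out of `k[v][s]` -/
noncomputable def hRX {m : ℕ} {S : Type*} [CommRing S] [Algebra k S] (s : S) (v : Fin m → S) :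
    (MvPolynomial (Fin m) k)[X] →ₐ[k] S :=
  { Polynomial.eval₂RingHom (MvPolynomial.aeval v : MvPolynomial (Fin m) k →ₐ[k] S).toRingHom s with
    commutes' := fun r => by
      change Polynomial.eval₂ _ _ _ = _
      rw [Polynomial.algebraMap_apply, eval₂_C]
      exact AlgHom.commutes _ r }

variable {m : ℕ} {S S' : Type*} [CommRing S] [Algebra k S] [CommRing S'] [Algebra k S'] (s : S) (v : Fin m → S)

@[simp] lemma hRX_X : hRX (k := k) s v X = s := by
  change Polynomial.eval₂ _ _ _ = _
  rw [eval₂_X]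

@[simp] lemma hRX_C (r) : hRX (k := k) s v (C r) = MvPolynomial.aeval v r := by
  change Polynomial.eval₂ _ _ _ = _
  rw [eval₂_C]; rfl


lemma hRX_comp (φ : S →ₐ[k] S') : φ.comp (hRX (k := k) s v) = hRX (k := k) (φ s) (fun i => φ (v i)) := by
  refine Polynomial.algHom_ext' ?_ ?_
  · ext i; simp
  · simp

lemma hRX_apply (φ : S →ₐ[k] S') (x) : φ (hRX (k := k) s v x) = hRX (k := k) (φ s) (fun i => φ (v i)) x :=
  DFunLike.congr_fun (hRX_comp s v φ) x

lemma hRX_id (x : (MvPolynomial (Fin m) k)[X]) : hRX (k := k) (X : (MvPolynomial (Fin m) k)[X]) (fun i => C (MvPolynomial.X i)) x = x := by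
  have : hRX (k := k) (X : (MvPolynomial (Fin m) k)[X]) (fun i => C (MvPolynomial.X i)) = AlgHom.id _ _ := by
    refine Polynomial.algHom_ext' ?_ ?_
    · ext i; simp
    · simp
  rw [this]; rfl

lemma hRX_retract (φ : S →ₐ[k] S') {ι : (MvPolynomial (Fin m) k)[X] →ₐ[k] S'} (hι : Function.Injective ι)
    (h1 : φ s = ι X) (h2 : ∀ i, φ (v i) = ι (C (MvPolynomial.X i))) : Function.Injective (hRX (k := k) s v) := by
  have : φ.comp (hRX (k := k) s v) = ι := by
    refine Polynomial.algHom_ext' ?_ ?_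
    · ext i; simp [h2]
    · simp [h1]
  intro x y h
  apply hι
  rw [← this, AlgHom.comp_apply, AlgHom.comp_apply, h]

lemma hRX_ps {E : Type*} [Field E] [Algebra k E] (ι0 : MvPolynomial (Fin m) k →ₐ[k] E) (h : Function.Injective ι0) :
    Function.Injective (hRX (k := k) (PowerSeries.X : PowerSeries E) (fun i => PowerSeries.C (ι0 (MvPolynomial.X i)))) := by
  have : ∀ x, hRX (k := k) (PowerSeries.X : PowerSeries E) (fun i => PowerSeries.C (ι0 (MvPolynomial.X i))) x =
      ((x.map (ι0 : MvPolynomial (Fin m) k →+* E) : E[X]) : PowerSeries E) := by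
    intro x
    have h1 : (hRX (k := k) (PowerSeries.X : PowerSeries E) (fun i => PowerSeries.C (ι0 (MvPolynomial.X i)))).toRingHom =
      (Polynomial.coeToPowerSeries.ringHom).comp (mapRingHom (ι0 : MvPolynomial (Fin m) k →+* E)) := by
      refine Polynomial.ringHom_ext' ?_ ?_
      · refine MvPolynomial.ringHom_ext ?_ ?_
        · intro r
          simp [PowerSeries.algebraMap_apply]
        · intro i
          simp
      · simp
    exact DFunLike.congr_fun h1 x
  intro x y hxy
  rw [this, this] at hxy
  exact Polynomial.map_injective _ h (Polynomial.coe_injective _ hxy)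

end Gen
end BH

namespace BH

section B
set_option linter.unusedSectionVars false
variable {k : Type*} [Field k]

abbrev RV (k : Type*) [Field k] (m : ℕ) := MvPolynomial (Fin m) k

/-- generic parameters -/
noncomputable def gv (k : Type*) [Field k] (m : ℕ) : Fin m → (MvPolynomial (Fin m) k)[X] := fun i => C (MvPolynomial.X i)

lemma PF_gen_map {m n : ℕ} {S : Type*} [CommRing S] [Algebra k S] (s : S) (v : Fin m → S) (fu : k[X]) (t0 : k) (G : k[X][X]) :
    (PF n fu t0 G X (gv k m)).map (hRX (k := k) s v : (MvPolynomial (Fin m) k)[X] →+* S) = PF n fu t0 G s v := by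
  rw [PF_map]
  simp [gv]

lemma B1 {m n : ℕ} (hm : m + 2 < n) (fu : k[X]) (hfu : fu.natDegree ≤ n) (t0 x0 : k) (G : k[X][X]) (hG : Irreducible G)
    (hdeg : G.natDegree ≠ 0) (hu : (uu n G).eval (fu.coeff n) ≠ 0) (hx : ev t0 x0 (derivative G) ≠ 0) :
    Irreducible ((PF n fu t0 G X (gv k (m + 2))).map (algebraMap _ (FractionRing ((RV k (m + 2))[X])))) := by
  refine irr_spec _ (PF_monic fu t0 G _ _ hfu hm hu).1
    (hRX (k := k) (X : k[X]) (Fin.cons 0 (Fin.cons 0 (fun _ => 0)) : Fin (m + 2) → k[X]) : (RV k (m + 2))[X] →+* k[X]) ?_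
  rw [PF_gen_map]
  refine irr_T' G hG hdeg fu 1 t0 one_ne_zero 0 0 _ (FF fu t0 X (Fin.cons 0 (Fin.cons 0 (fun _ => 0)) : Fin (m + 2) → k[X])) _ hu (by rw [FF_cons]; simp [Polynomial.algebraMap_eq]) (by rw [pow_zero, one_mul]; rfl) ?_
  unfold PF
  rw [PP_eval]
  refine mul_ne_zero (by simpa using hu) ?_
  have h1 := FF_eval fu t0 (X : k[X]) (Fin.cons 0 (Fin.cons 0 (fun _ => 0)) : Fin (m + 2) → k[X])
  rw [Polynomial.algebraMap_eq] at h1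
  rw [h1]
  intro h
  -- specialise X to every value
  have h2 : ∀ x : k, ev t0 x G = 0 := by
    intro x
    have := hom_ev (aeval (x - fu.eval t0) : k[X] →ₐ[k] k) (C t0) (C (fu.eval t0) + X) G
    rw [h] at this
    simpa using this.symm
  have h3 := ev_taylor (k := k) (C t0 : k[X]) (C x0) X G
  obtain ⟨r, hr⟩ := h3
  have h4 : ev (k := k) (C t0 : k[X]) (C x0 + X) G = 0 := by
    have := hom_ev (aeval (X + C (x0 - fu.eval t0)) : k[X] →ₐ[k] k[X]) (C t0) (C (fu.eval t0) + X) G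
    rw [h, map_zero] at this
    have e1 : aeval (X + C (x0 - fu.eval t0)) (C (fu.eval t0) + X : k[X]) = C x0 + X := by
      simp [Polynomial.algebraMap_eq]
      ring
    have e2 : aeval (X + C (x0 - fu.eval t0)) (C t0 : k[X]) = C t0 := by simp [Polynomial.algebraMap_eq]
    rw [e1, e2] at this
    exact this.symm
  have e3 := ev_algebraMap (R := k[X]) t0 x0 G
  have e4 := ev_algebraMap (R := k[X]) t0 x0 (derivative G)
  rw [Polynomial.algebraMap_eq] at e3 e4
  rw [h4, e3, e4, h2] at hr
  have := congrArg (fun q => coeff q 1) hr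
  simp [pow_two, ← mul_assoc, coeff_mul_X] at this
  exact hx (by simpa using this.symm)

/-- homomorphism of fraction fields -/
lemma lift_frac {A E : Type*} [CommRing A] [IsDomain A] [CommRing E] [IsDomain E] (θ : A →+* E) (hθ : Function.Injective θ) :
    ∃ φ : FractionRing A →+* FractionRing E, ∀ P : A[X], (P.map (algebraMap _ (FractionRing A))).map φ =
      (P.map θ).map (algebraMap E (FractionRing E)) := by
  have hinj : Function.Injective ((algebraMap E (FractionRing E)).comp θ) :=
    (IsFractionRing.injective E (FractionRing E)).comp hθ
  refine ⟨IsFractionRing.lift hinj, fun P => ?_⟩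
  rw [Polynomial.map_map, Polynomial.map_map]
  congr 1
  ext x
  simp

lemma inj_shift2 {m : ℕ} {E : Type*} [Field E] [Algebra k E] (ι0 : RV k m →ₐ[k] E) (hι0 : Function.Injective ι0) (c : k) :
    Function.Injective (hRX (k := k) (PowerSeries.C (algebraMap k E c) + PowerSeries.X) (fun i => PowerSeries.C (ι0 (MvPolynomial.X i)))) := by
  have h1 : Function.Injective (hRX (k := k) (X + algebraMap k (RV k m)[X] c) (gv k m)) := by
    refine hRX_retract _ _ (hRX (k := k) (X - algebraMap k (RV k m)[X] c) (gv k m)) (ι := AlgHom.id _ _) Function.injective_id ?_ ?_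
    · rw [map_add, hRX_X, AlgHom.commutes]; simp
    · simp [gv]
  have h2 := (hRX_ps ι0 hι0).comp h1
  convert h2 using 1
  funext x
  simp only [Function.comp_apply]
  rw [hRX_apply, map_add, hRX_X, AlgHom.commutes, add_comm]
  congr 1
  simp [gv]
  rw [PowerSeries.algebraMap_apply]

lemma B2 {m n : ℕ} (hm : m + 2 < n) (fu : k[X]) (hfu : fu.natDegree ≤ n) (t0 x0 : k) (G : k[X][X]) (hG : Irreducible G)
    (hdeg : G.natDegree ≠ 0) (hu : (uu n G).eval (fu.coeff n) ≠ 0) (hx0 : ev t0 x0 G = 0) (hx : ev t0 x0 (derivative G) ≠ 0)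
    (hne : x0 ≠ fu.eval t0) :
    ∃ (φ : FractionRing ((RV k (m + 2))[X]) →+* FractionRing (PowerSeries (FractionRing (RV k (m + 2)))))
      (z : FractionRing (PowerSeries (FractionRing (RV k (m + 2))))) (R : _),
      ((PF n fu t0 G X (gv k (m + 2))).map (algebraMap _ (FractionRing ((RV k (m + 2))[X])))).map φ = (X - C z) * R ∧ Irreducible R := by
  set c := x0 - fu.eval t0 with hc
  have hc0 : c ≠ 0 := sub_ne_zero.2 hne
  let ι0 : (RV k (m + 2)) →ₐ[k] (FractionRing (RV k (m + 2))) := Algebra.algHom k (RV k (m + 2)) (FractionRing (RV k (m + 2)))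
  have hι0 : Function.Injective ι0 := IsFractionRing.injective (RV k (m + 2)) (FractionRing (RV k (m + 2)))
  -- the reduction
  set P0 : (RV k (m + 2))[X] := PF n fu t0 G (algebraMap k (RV k (m + 2)) c) (fun i => MvPolynomial.X i) with hP0
  have hP0m : P0.Monic := (PF_monic fu t0 G _ _ hfu hm hu).1
  have hroot : P0.eval (algebraMap k (RV k (m + 2)) t0) = 0 := by
    rw [hP0, PF, PP_eval, FF_eval, ← map_add, hc, add_sub_cancel, ev_algebraMap, hx0]; simp
  obtain ⟨Q0, hQ0⟩ := dvd_iff_isRoot.2 hroot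
  have hQ0m : Q0.Monic := (monic_X_sub_C _).of_mul_monic_left (hQ0 ▸ hP0m)
  let χ : (RV k (m + 2)) →ₐ[k] k[X] := MvPolynomial.aeval (Fin.cons X (Fin.cons 0 (fun _ => 0)) : Fin (m + 2) → k[X])
  have hspec : (X - C (C t0)) ^ 1 * Q0.map (χ : (RV k (m + 2)) →+* k[X]) = PP ((uu n G).eval (fu.coeff n)) (FF fu t0 (C c) (Fin.cons X (Fin.cons 0 (fun _ => 0)) : Fin (m + 2) → k[X])) G := by
    have h1 := congrArg (Polynomial.map (χ : (RV k (m + 2)) →+* k[X])) hQ0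
    rw [hP0, PF_map] at h1
    have h2 : χ (algebraMap k (RV k (m + 2)) c) = C c := χ.commutes c
    have h3 : χ (algebraMap k (RV k (m + 2)) t0) = C t0 := χ.commutes t0
    have h4 : (fun i => χ (MvPolynomial.X i)) = (Fin.cons X (Fin.cons 0 (fun _ => 0)) : Fin (m + 2) → k[X]) := by
      funext i; simp [χ]
    rw [h2, h4, Polynomial.map_mul, Polynomial.map_sub, map_X, map_C] at h1
    rw [pow_one, ← h3]
    exact h1.symm
  have hf : FF fu t0 (C c) (Fin.cons X (Fin.cons 0 (fun _ => 0)) : Fin (m + 2) → k[X]) = (fu + C c).map C + C X * (C (C c) * (X - C (C t0)) ^ 1) := by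
    rw [FF_cons]; simp [Polynomial.algebraMap_eq]; ring
  have hnz := H_ne' G (fu + C c) c t0 hc0 1 _ _ _ hu hf hspec (by simpa [hc] using hx)
  have hirr0 := irr_T' G hG hdeg (fu + C c) c t0 hc0 1 1 _ _ _ hu hf hspec hnz
  have hirrF : Irreducible (Q0.map (algebraMap (RV k (m + 2)) (FractionRing (RV k (m + 2))))) := irr_spec Q0 hQ0m _ hirr0
  have hnz0 : Q0.eval (algebraMap k (RV k (m + 2)) t0) ≠ 0 := by
    intro h
    apply hnz
    have h3 : χ (algebraMap k (RV k (m + 2)) t0) = C t0 := χ.commutes t0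
    rw [← h3]
    have := eval_map_apply (χ : (RV k (m + 2)) →+* k[X]) (p := Q0) (algebraMap k (RV k (m + 2)) t0)
    rw [h, map_zero] at this
    exact this
  -- power series side
  let sE : PowerSeries (FractionRing (RV k (m + 2))) := PowerSeries.C (algebraMap k (FractionRing (RV k (m + 2))) c) + PowerSeries.X
  let vE : Fin (m + 2) → PowerSeries (FractionRing (RV k (m + 2))) := fun i => PowerSeries.C (ι0 (MvPolynomial.X i))
  have hinj : Function.Injective (hRX (k := k) sE vE) := by
    exact inj_shift2 ι0 hι0 c
  obtain ⟨φ, hφ⟩ := lift_frac (hRX (k := k) sE vE : (RV k (m + 2))[X] →+* PowerSeries (FractionRing (RV k (m + 2)))) hinj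
  set P : (PowerSeries (FractionRing (RV k (m + 2))))[X] := PF n fu t0 G sE vE with hP
  have hPm : P.Monic := (PF_monic fu t0 G _ _ hfu hm hu).1
  let cc : PowerSeries (FractionRing (RV k (m + 2))) →ₐ[k] (FractionRing (RV k (m + 2))) := { (PowerSeries.constantCoeff : PowerSeries (FractionRing (RV k (m + 2))) →+* (FractionRing (RV k (m + 2)))) with
    commutes' := fun r => by simp [PowerSeries.algebraMap_apply] }
  have hcc : ∀ x, cc x = PowerSeries.constantCoeff x := fun _ => rfl
  have hccr : (cc : PowerSeries (FractionRing (RV k (m + 2))) →+* (FractionRing (RV k (m + 2)))) = PowerSeries.constantCoeff := rfl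
  have hred : P.map PowerSeries.constantCoeff = P0.map (algebraMap (RV k (m + 2)) (FractionRing (RV k (m + 2)))) := by
    have h1 := PF_map n fu t0 G sE vE cc
    have h2 := PF_map n fu t0 G (algebraMap k (RV k (m + 2)) c) (fun i : Fin (m + 2) => MvPolynomial.X i) ι0
    rw [hccr] at h1
    rw [hP, h1, hP0]
    refine Eq.trans ?_ h2.symm
    congr 1
    · simp [hcc, sE]
  have ht : algebraMap (RV k (m + 2)) (FractionRing (RV k (m + 2))) (algebraMap k (RV k (m + 2)) t0) = algebraMap k (FractionRing (RV k (m + 2))) t0 := (IsScalarTower.algebraMap_apply k (RV k (m + 2)) (FractionRing (RV k (m + 2))) t0).symm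
  have hred2 : P.map PowerSeries.constantCoeff = (X - C (algebraMap k (FractionRing (RV k (m + 2))) t0)) * Q0.map (algebraMap (RV k (m + 2)) (FractionRing (RV k (m + 2)))) := by
    rw [hred, hQ0, Polynomial.map_mul, Polynomial.map_sub, map_X, map_C, ht]
  have hev : (Q0.map (algebraMap (RV k (m + 2)) (FractionRing (RV k (m + 2))))).eval (algebraMap k (FractionRing (RV k (m + 2))) t0) ≠ 0 := by
    rw [← ht, eval_map_apply]
    intro h
    exact hnz0 (IsFractionRing.injective (RV k (m + 2)) (FractionRing (RV k (m + 2))) (by rw [h, map_zero]))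
  obtain ⟨z, hz1, hz2⟩ := ps_hensel P (algebraMap k (FractionRing (RV k (m + 2))) t0) ((Q0.map (algebraMap (RV k (m + 2)) (FractionRing (RV k (m + 2))))).eval (algebraMap k (FractionRing (RV k (m + 2))) t0))⁻¹
    (by rw [← eval_map_apply, hred2]; simp)
    (by rw [← eval_map_apply, ← derivative_map, hred2]; simp; exact mul_inv_cancel₀ (by simpa using hev))
  obtain ⟨Q, hQ⟩ := dvd_iff_isRoot.2 hz2
  have hQm : Q.Monic := (monic_X_sub_C _).of_mul_monic_left (hQ ▸ hPm)
  have hQr : Q.map PowerSeries.constantCoeff = Q0.map (algebraMap (RV k (m + 2)) (FractionRing (RV k (m + 2)))) := by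
    rw [hQ, Polynomial.map_mul, Polynomial.map_sub, map_X, map_C, hz1] at hred2
    exact mul_left_cancel₀ (X_sub_C_ne_zero _) hred2
  refine ⟨φ, algebraMap _ _ z, Q.map (algebraMap _ _), ?_, irr_spec Q hQm PowerSeries.constantCoeff (hQr ▸ hirrF)⟩
  rw [hφ, PF_gen_map, ← hP, hQ]
  simp

end B
end BH

namespace BH

section B
set_option linter.unusedSectionVars false
variable {k : Type*} [Field k]

lemma inj_shift3 {m : ℕ} {E : Type*} [Field E] [Algebra k E] (ι0 : RV k (m + 1) →ₐ[k] E) (hι0 : Function.Injective ι0) (c β : k) :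
    Function.Injective (hRX (k := k) (PowerSeries.C (algebraMap k E c) + PowerSeries.X)
      (Fin.cons (PowerSeries.C (algebraMap k E β) + PowerSeries.C (ι0 (MvPolynomial.X 0)) * PowerSeries.X)
        (fun i => PowerSeries.C (ι0 (MvPolynomial.X i.succ))) : Fin (m + 1) → PowerSeries E)) := by
  have h1 : Function.Injective (hRX (k := k) (X + algebraMap k (RV k (m + 1))[X] c)
      (Fin.cons (algebraMap k (RV k (m + 1))[X] β + C (MvPolynomial.X 0) * X) (fun i => C (MvPolynomial.X i.succ)) : Fin (m + 1) → (RV k (m + 1))[X])) := by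
    let K := FractionRing ((RV k (m + 1))[X])
    let ι : (RV k (m + 1))[X] →ₐ[k] K := Algebra.algHom k _ K
    have hι : Function.Injective ι := IsFractionRing.injective _ K
    have hne : ι X - algebraMap k K c ≠ 0 := by
      rw [← ι.commutes, ← map_sub]
      intro h
      have := hι (h.trans (map_zero ι).symm)
      exact X_sub_C_ne_zero (algebraMap k (RV k (m + 1)) c) this
    refine hRX_retract _ _ (hRX (k := k) (ι X - algebraMap k K c)
      (Fin.cons ((ι (C (MvPolynomial.X 0)) - algebraMap k K β) / (ι X - algebraMap k K c)) (fun i => ι (C (MvPolynomial.X i.succ))) : Fin (m + 1) → K)) (ι := ι) hι ?_ ?_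
    · rw [map_add, hRX_X, AlgHom.commutes]; ring
    · intro i
      refine Fin.cases ?_ (fun i => ?_) i
      · rw [Fin.cons_zero, map_add, map_mul, hRX_X, AlgHom.commutes, hRX_C, MvPolynomial.aeval_X, Fin.cons_zero, div_mul_cancel₀ _ hne]; ring
      · rw [Fin.cons_succ, hRX_C, MvPolynomial.aeval_X, Fin.cons_succ]
  have h2 := (hRX_ps ι0 hι0).comp h1
  convert h2 using 1
  funext x
  simp only [Function.comp_apply]
  rw [hRX_apply, map_add, hRX_X, AlgHom.commutes, add_comm (PowerSeries.X), PowerSeries.algebraMap_apply]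
  congr 2
  funext i
  refine Fin.cases ?_ (fun i => ?_) i
  · rw [Fin.cons_zero, Fin.cons_zero, map_add, map_mul, hRX_X, AlgHom.commutes, hRX_C, MvPolynomial.aeval_X]
    rw [PowerSeries.algebraMap_apply]
  · rw [Fin.cons_succ, Fin.cons_succ, hRX_C, MvPolynomial.aeval_X]

lemma tangent (A : k[X]) (c t0 x0 : k) (hc : c ≠ 0) (G : k[X][X]) (hA : A.eval t0 = x0) (hx0 : ev t0 x0 G = 0) (hx : ev t0 x0 (derivative G) ≠ 0) :
    ∃ β : k, (X - C t0) ^ 2 ∣ ev (k := k) (X : k[X]) (A + C (c * β) * (X - C t0)) G := by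
  have hev : ∀ G' : k[X][X], (ev (k := k) (X : k[X]) A G').eval t0 = ev t0 x0 G' := by
    intro G'
    have := hom_ev (aeval t0 : k[X] →ₐ[k] k) (X : k[X]) A G'
    simpa [hA] using this
  obtain ⟨g, hg⟩ := dvd_iff_isRoot.2 (show (ev (k := k) (X : k[X]) A G).IsRoot t0 by rw [IsRoot.def, hev, hx0])
  refine ⟨-(g.eval t0) / (c * ev t0 x0 (derivative G)), ?_⟩
  set β := -(g.eval t0) / (c * ev t0 x0 (derivative G)) with hβ
  obtain ⟨r, hr⟩ := ev_taylor (k := k) (X : k[X]) A (C (c * β) * (X - C t0)) G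
  rw [hr, hg]
  have h1 : (X - C t0) ∣ g + ev (k := k) (X : k[X]) A (derivative G) * C (c * β) := by
    rw [dvd_iff_isRoot, IsRoot.def, eval_add, eval_mul, hev, eval_C, hβ]
    field_simp
    ring
  obtain ⟨g', hg'⟩ := h1
  refine ⟨g' + r * C (c * β) ^ 2, ?_⟩
  linear_combination (X - C t0) * hg'

lemma FF_dec {R : Type*} [CommRing R] [Algebra k R] {m : ℕ} (fu : k[X]) (t0 : k) (s a : R) (w : Fin m → R) :
    ∃ D : R[X], FF fu t0 s (Fin.cons a w : Fin (m + 1) → R) = fu.map (algebraMap k R) + C s + C (s * a) * (X - C (algebraMap k R t0)) + (X - C (algebraMap k R t0)) ^ 2 * D := by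
  refine ⟨C s * ∑ i : Fin m, C (w i) * (X - C (algebraMap k R t0)) ^ (i : ℕ), ?_⟩
  unfold FF VV
  rw [Fin.sum_univ_succ]
  simp only [Fin.cons_zero, Fin.cons_succ, Fin.val_zero, Fin.val_succ, pow_succ, C_mul]
  have : ∑ i : Fin m, C (w i) * ((X - C (algebraMap k R t0)) ^ (i : ℕ) * (X - C (algebraMap k R t0)) * (X - C (algebraMap k R t0)))
    = (X - C (algebraMap k R t0)) ^ 2 * ∑ i : Fin m, C (w i) * (X - C (algebraMap k R t0)) ^ (i : ℕ) := by
    rw [Finset.mul_sum]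
    refine Finset.sum_congr rfl fun i _ => by ring
  rw [this]; ring

lemma sq_dvd {R : Type*} [CommRing R] [Algebra k R] {m : ℕ} (fu : k[X]) (t0 c β : k) (G : k[X][X]) (w : Fin m → R)
    (h : (X - C t0) ^ 2 ∣ ev (k := k) (X : k[X]) (fu + C c + C (c * β) * (X - C t0)) G) :
    (X - C (algebraMap k R t0)) ^ 2 ∣ ev (k := k) (X : R[X]) (FF fu t0 (algebraMap k R c) (Fin.cons (algebraMap k R β) w : Fin (m + 1) → R)) G := by
  obtain ⟨D, hD⟩ := FF_dec fu t0 (algebraMap k R c) (algebraMap k R β) w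
  rw [hD]
  obtain ⟨r, hr⟩ := ev_taylor (k := k) (X : R[X]) (fu.map (algebraMap k R) + C (algebraMap k R c) + C (algebraMap k R c * algebraMap k R β) * (X - C (algebraMap k R t0)))
    ((X - C (algebraMap k R t0)) ^ 2 * D) G
  rw [hr]
  obtain ⟨q, hq⟩ := h
  have h1 := hom_ev (mapAlgHom (Algebra.ofId k R)) (X : k[X]) (fu + C c + C (c * β) * (X - C t0)) G
  rw [hq] at h1
  have h2 : mapAlgHom (Algebra.ofId k R) (fu + C c + C (c * β) * (X - C t0)) =
    fu.map (algebraMap k R) + C (algebraMap k R c) + C (algebraMap k R c * algebraMap k R β) * (X - C (algebraMap k R t0)) := by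
    change Polynomial.map (algebraMap k R) _ = _
    simp
  have h3 : mapAlgHom (Algebra.ofId k R) (X : k[X]) = X := Polynomial.map_X _
  have h4 : mapAlgHom (Algebra.ofId k R) ((X - C t0) ^ 2 * q) = (X - C (algebraMap k R t0)) ^ 2 * q.map (algebraMap k R) := by
    change Polynomial.map (algebraMap k R) _ = _
    simp
  rw [h2, h3, h4] at h1
  rw [← h1]
  refine dvd_add (dvd_add (dvd_mul_right _ _) ?_) ?_
  · exact Dvd.dvd.mul_left (dvd_mul_right _ _) _
  · exact Dvd.dvd.mul_left ((dvd_mul_right _ _).trans (dvd_pow_self _ two_ne_zero)) _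

/-- no root near `t0` -/
lemma no_root {m : ℕ} {E : Type*} [Field E] [Algebra k E] (fu : k[X]) (t0 c β x0 : k) (G : k[X][X]) (hc : fu.eval t0 + c = x0)
    (h : (X - C t0) ^ 2 ∣ ev (k := k) (X : k[X]) (fu + C c + C (c * β) * (X - C t0)) G) (hx : ev t0 x0 (derivative G) ≠ 0)
    (v0 : E) (w : Fin m → PowerSeries E) (z : PowerSeries E) (hz : PowerSeries.constantCoeff z = algebraMap k E t0)
    (h0 : ev z ((FF fu t0 (PowerSeries.C (algebraMap k E c) + PowerSeries.X)
      (Fin.cons (PowerSeries.C (algebraMap k E β) + PowerSeries.C v0 * PowerSeries.X) w : Fin (m + 1) → PowerSeries E)).eval z) G = 0) : False := by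
  have ha : ∀ a : k, algebraMap k (PowerSeries E) a = PowerSeries.C (algebraMap k E a) := fun a => PowerSeries.algebraMap_apply
  obtain ⟨y, hy⟩ : PowerSeries.X ∣ z - algebraMap k (PowerSeries E) t0 := by
    rw [PowerSeries.X_dvd_iff, map_sub, hz, ha]; simp
  set fs := FF fu t0 (algebraMap k (PowerSeries E) c) (Fin.cons (algebraMap k (PowerSeries E) β) w : Fin (m + 1) → PowerSeries E) with hfs
  have hV : ∃ η : PowerSeries E, PowerSeries.constantCoeff η = 1 ∧
      (VV t0 (Fin.cons (algebraMap k (PowerSeries E) β) w : Fin (m + 1) → PowerSeries E)).eval z = η := by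
    refine ⟨_, ?_, rfl⟩
    unfold VV
    simp [eval_finsetSum, hy]
  obtain ⟨η0, hη0, hη0'⟩ := hV
  have hff : ∃ η : PowerSeries E, PowerSeries.constantCoeff η = 1 ∧
    (FF fu t0 (PowerSeries.C (algebraMap k E c) + PowerSeries.X)
      (Fin.cons (PowerSeries.C (algebraMap k E β) + PowerSeries.C v0 * PowerSeries.X) w : Fin (m + 1) → PowerSeries E)).eval z = fs.eval z + PowerSeries.X * η := by
    refine ⟨η0 + (PowerSeries.C (algebraMap k E c) + PowerSeries.X) * PowerSeries.C v0 * (PowerSeries.X * y), by simp [hη0], ?_⟩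
    rw [hfs, ← hη0']
    unfold FF VV
    rw [Fin.sum_univ_succ, Fin.sum_univ_succ]
    simp only [Fin.cons_zero, Fin.cons_succ, Fin.val_zero, eval_add, eval_mul, eval_C, eval_one, ← ha, zero_add, pow_one, eval_sub, eval_X, hy]
    ring
  obtain ⟨η, hη1, hη2⟩ := hff
  rw [hη2] at h0
  obtain ⟨r, hr⟩ := ev_taylor z (fs.eval z) (PowerSeries.X * η) G
  obtain ⟨q, hq⟩ := sq_dvd (R := PowerSeries E) fu t0 c β G w h
  have hev : ∀ (f : (PowerSeries E)[X]) (G' : k[X][X]), (ev (k := k) (X : (PowerSeries E)[X]) f G').eval z = ev z (f.eval z) G' := by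
    intro f G'
    have := hom_ev ((aeval z : (PowerSeries E)[X] →ₐ[PowerSeries E] PowerSeries E).restrictScalars k) (X : (PowerSeries E)[X]) f G'
    simpa using this
  have hq' := congrArg (eval z) hq
  rw [hev, eval_mul, eval_pow, eval_sub, eval_X, eval_C, hy] at hq'
  rw [hr, hq'] at h0
  have h1 : PowerSeries.X * (ev z (fs.eval z) (derivative G) * η + PowerSeries.X * (y ^ 2 * q.eval z + r * η ^ 2)) = 0 := by
    rw [← h0]; ring
  have h2 := (mul_eq_zero.1 h1).resolve_left PowerSeries.X_ne_zero
  have h3 := congrArg PowerSeries.constantCoeff h2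
  let cc : PowerSeries E →ₐ[k] E := { (PowerSeries.constantCoeff : PowerSeries E →+* E) with
    commutes' := fun r => by simp [PowerSeries.algebraMap_apply] }
  have hcc : ∀ x, PowerSeries.constantCoeff x = cc x := fun _ => rfl
  have h4 : PowerSeries.constantCoeff (ev z (fs.eval z) (derivative G)) = algebraMap k E (ev t0 x0 (derivative G)) := by
    rw [hcc, hom_ev, ← hcc, hz, ← ev_algebraMap]
    congr 2
    rw [← hcc]
    have : z = algebraMap k (PowerSeries E) t0 + PowerSeries.X * y := by rw [← hy]; ring
    rw [hfs]
    unfold FF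
    rw [eval_add, eval_mul, eval_C, hη0', map_add, map_mul, hη0, ha, ← hc, map_add]
    simp only [PowerSeries.constantCoeff_C, mul_one]
    congr 1
    rw [eval_map_algebraMap, hcc, ← aeval_algHom_apply, ← hcc, hz, aeval_algebraMap_apply]
    simp
  rw [map_add, map_mul, h4, hη1, map_mul, PowerSeries.constantCoeff_X, zero_mul, add_zero, mul_one, map_zero] at h3
  exact hx ((map_eq_zero _).1 h3)

end B
end BH

namespace BH

section B
set_option linter.unusedSectionVars false
variable {k : Type*} [Field k]

lemma B3 (p : ℕ) [CharP k p] {m n : ℕ} (hm : m + 2 < n) (fu : k[X]) (hfu : fu.natDegree ≤ n) (t0 x0 : k) (G : k[X][X]) (hG : Irreducible G)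
    (hdeg : G.natDegree ≠ 0) (hu : (uu n G).eval (fu.coeff n) ≠ 0) (hx0 : ev t0 x0 G = 0) (hx : ev t0 x0 (derivative G) ≠ 0)
    (hne : x0 ≠ fu.eval t0) (hp : NN n G < p) {E : Type*} [Field E] [IsAlgClosed E] [Algebra k E] [Algebra (FractionRing (RV k (m + 2))) E]
    [IsScalarTower k (FractionRing (RV k (m + 2))) E] [DecidableEq (FractionRing (PowerSeries E))] :
    ∃ (φ : FractionRing ((RV k (m + 2))[X]) →+* FractionRing (PowerSeries E)),
      ((((PF n fu t0 G X (gv k (m + 2))).map (algebraMap _ (FractionRing ((RV k (m + 2))[X])))).map φ).roots.toFinset.card + 2 = NN n G) ∧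
      ∀ G' : k[X][X], Irreducible G' → G'.natDegree ≠ 0 → (uu n G').eval (fu.coeff n) ≠ 0 → NN n G' < p → ev t0 x0 G' ≠ 0 →
        (((PF n fu t0 G' X (gv k (m + 2))).map (algebraMap _ (FractionRing ((RV k (m + 2))[X])))).map φ).Splits := by
  set c := x0 - fu.eval t0 with hc
  have hc0 : c ≠ 0 := sub_ne_zero.2 hne
  have hcx : fu.eval t0 + c = x0 := by rw [hc]; ring
  obtain ⟨β, hβ⟩ := tangent (fu + C c) c t0 x0 hc0 G (by simp [hcx]) hx0 hx
  let ι1 : RV k (m + 2) →ₐ[k] FractionRing (RV k (m + 2)) := Algebra.algHom k _ _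
  have hι1 : Function.Injective ι1 := IsFractionRing.injective (RV k (m + 2)) (FractionRing (RV k (m + 2)))
  let ι0 : RV k (m + 2) →ₐ[k] E := (Algebra.algHom k (FractionRing (RV k (m + 2))) E).comp ι1
  have hι0 : Function.Injective ι0 := (algebraMap (FractionRing (RV k (m + 2))) E).injective.comp hι1
  have hι0c : (ι0 : RV k (m + 2) →+* E) = (algebraMap (FractionRing (RV k (m + 2))) E).comp (algebraMap (RV k (m + 2)) (FractionRing (RV k (m + 2)))) := rfl
  have : CharP (FractionRing (RV k (m + 2))) p := charP_of_injective_algebraMap (algebraMap k (FractionRing (RV k (m + 2)))).injective p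
  -- reduction
  let vR : Fin (m + 2) → RV k (m + 2) := Fin.cons (algebraMap k _ β) (fun i => MvPolynomial.X i.succ)
  let P0 : k[X][X] → (RV k (m + 2))[X] := fun G => PF n fu t0 G (algebraMap k _ c) vR
  let vX : Fin (m + 2) → k[X] := Fin.cons (C β) (Fin.cons X (fun _ => 0))
  let χ : RV k (m + 2) →ₐ[k] k[X] := MvPolynomial.aeval (Fin.cons 0 (Fin.cons X (fun _ => 0)) : Fin (m + 2) → k[X])
  have hχ : ∀ a, χ (algebraMap k _ a) = C a := fun a => χ.commutes a
  have hPchi : ∀ G, (P0 G).map (χ : RV k (m + 2) →+* k[X]) = PP ((uu n G).eval (fu.coeff n)) (FF fu t0 (C c) vX) G := by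
    intro G
    simp only [P0]
    rw [PF_map, PF, hχ]
    congr 2
    funext i
    refine Fin.cases ?_ (fun i => ?_) i
    · simp only [vR, vX, Fin.cons_zero, hχ]
    · simp only [vR, vX, Fin.cons_succ, χ, MvPolynomial.aeval_X]
  have hFX : FF fu t0 (C c) vX = (fu + C c + C (c * β) * (X - C t0)).map C + C X * (C (C c) * (X - C (C t0)) ^ 2) := by
    rw [FF_cons]; simp [Polynomial.algebraMap_eq]; ring
  -- power series side
  let sE : PowerSeries E := PowerSeries.C (algebraMap k E c) + PowerSeries.X
  let vE : Fin (m + 2) → PowerSeries E := Fin.cons (PowerSeries.C (algebraMap k E β) + PowerSeries.C (ι0 (MvPolynomial.X 0)) * PowerSeries.X)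
        (fun i => PowerSeries.C (ι0 (MvPolynomial.X i.succ)))
  have hinj : Function.Injective (hRX (k := k) sE vE) := inj_shift3 ι0 hι0 c β
  obtain ⟨φ, hφ⟩ := lift_frac (hRX (k := k) sE vE : (RV k (m + 2))[X] →+* PowerSeries E) hinj
  let cc : PowerSeries E →ₐ[k] E := { (PowerSeries.constantCoeff : PowerSeries E →+* E) with
    commutes' := fun r => by simp [PowerSeries.algebraMap_apply] }
  have hcc : ∀ x, cc x = PowerSeries.constantCoeff x := fun _ => rfl
  have hccr : (cc : PowerSeries E →+* E) = PowerSeries.constantCoeff := rfl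
  have hred : ∀ G, (PF n fu t0 G sE vE).map PowerSeries.constantCoeff = (P0 G).map (ι0 : RV k (m + 2) →+* E) := by
    intro G
    have h1 := PF_map n fu t0 G sE vE cc
    have h2 := PF_map n fu t0 G (algebraMap k _ c) vR ι0
    rw [hccr] at h1
    rw [h1]
    refine Eq.trans ?_ h2.symm
    congr 1
    · simp [hcc, sE]
    · funext i
      refine Fin.cases ?_ (fun i => ?_) i
      · simp [vE, vR, hcc]
      · simp [vE, vR, hcc]
  have hPm : ∀ G, (uu n G).eval (fu.coeff n) ≠ 0 → (PF n fu t0 G sE vE).Monic := fun G hu => (PF_monic fu t0 G _ _ hfu hm hu).1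
  have hP0m : ∀ G, (uu n G).eval (fu.coeff n) ≠ 0 → (P0 G).Monic ∧ (P0 G).natDegree = NN n G := fun G hu => (PF_monic fu t0 G _ _ hfu hm hu)
  refine ⟨φ, ?_, ?_⟩
  · rw [hφ, PF_gen_map]
    obtain ⟨H, hH⟩ : (X - C (algebraMap k (RV k (m + 2)) t0)) ^ 2 ∣ P0 G := by
      simp only [P0, PF, PP]
      exact Dvd.dvd.mul_left (sq_dvd fu t0 c β G _ hβ) _
    have hmq : ((X - C (algebraMap k (RV k (m + 2)) t0)) ^ 2).Monic := (monic_X_sub_C _).pow 2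
    have hHm : H.Monic := hmq.of_mul_monic_left (hH ▸ (hP0m G hu).1)
    have hHd : H.natDegree + 2 = NN n G := by
      rw [← (hP0m G hu).2, hH, hmq.natDegree_mul hHm, (monic_X_sub_C _).natDegree_pow, natDegree_X_sub_C]; omega
    have hsp : (X - C (C t0)) ^ 2 * H.map (χ : RV k (m + 2) →+* k[X]) = PP ((uu n G).eval (fu.coeff n)) (FF fu t0 (C c) vX) G := by
      rw [← hPchi, hH, Polynomial.map_mul, Polynomial.map_pow, Polynomial.map_sub, map_X, map_C]
      congr 4
      exact (hχ t0).symm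
    have hnz := H_ne' G _ c t0 hc0 2 _ _ _ hu hFX hsp (by simpa [hcx] using hx)
    have hirr := irr_T' G hG hdeg _ c t0 hc0 2 2 _ _ _ hu hFX hsp hnz
    have hirrF := irr_spec H hHm _ hirr
    have hsepF := sep_of_irr p _ (hHm.map _) hirrF (by rw [hHm.natDegree_map]; omega)
    have hsepE : (H.map (ι0 : RV k (m + 2) →+* E)).Separable := by
      rw [hι0c, ← Polynomial.map_map]; exact hsepF.map
    have hHt : (H.map (ι0 : RV k (m + 2) →+* E)).eval (algebraMap k E t0) ≠ 0 := by
      have h1 : (ι0 : RV k (m + 2) →+* E) (algebraMap k _ t0) = algebraMap k E t0 := ι0.commutes t0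
      rw [← h1, eval_map_apply]
      intro h
      have h2 : H.eval (algebraMap k (RV k (m + 2)) t0) = 0 := hι0 (h.trans (map_zero ι0).symm)
      apply hnz
      have h3 := eval_map_apply (χ : RV k (m + 2) →+* k[X]) (p := H) (algebraMap k _ t0)
      rw [h2, map_zero] at h3
      rw [← hχ t0]; exact h3
    have hred2 : (PF n fu t0 G sE vE).map PowerSeries.constantCoeff = (X - C (algebraMap k E t0)) ^ 2 * H.map (ι0 : RV k (m + 2) →+* E) := by
      rw [hred, hH, Polynomial.map_mul, Polynomial.map_pow, Polynomial.map_sub, map_X, map_C]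
      congr 4
      exact ι0.commutes t0
    rw [ps_roots _ (hPm G hu) _ _ hsepE hred2, hHm.natDegree_map, hHd]
    · intro z hz
      have h1 := eval_map_apply (PowerSeries.constantCoeff : PowerSeries E →+* E) (p := PF n fu t0 G sE vE) z
      rw [hz, map_zero, hred2, eval_mul, mul_eq_zero] at h1
      rcases h1 with h1 | h1
      · exfalso
        have h2 : PowerSeries.constantCoeff z = algebraMap k E t0 := by
          simpa [sub_eq_zero] using h1
        rw [PF, PP_eval, mul_eq_zero] at hz
        refine no_root fu t0 c β x0 G hcx hβ hx _ _ z h2 (hz.resolve_left ?_)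
        simpa using hu
      · exact h1
    · intro a ha h
      have : a = algebraMap k E t0 := by simpa [sub_eq_zero] using h
      rw [this] at ha
      exact hHt ha
  · intro G' hG' hdeg' hu' hp' hx0'
    rw [hφ, PF_gen_map]
    have hirr : Irreducible ((P0 G').map (χ : RV k (m + 2) →+* k[X])) := by
      refine irr_T' G' hG' hdeg' _ c t0 hc0 0 2 _ _ _ hu' hFX (by rw [pow_zero, one_mul, hPchi]) ?_
      rw [hPchi, PP_eval]
      refine mul_ne_zero (by simpa using hu') ?_
      have h1 := FF_eval fu t0 (C c : k[X]) vX
      have h2 := ev_algebraMap (R := k[X]) t0 x0 G'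
      rw [Polynomial.algebraMap_eq] at h1 h2
      rw [h1, ← C_add, hcx, h2]
      simpa using hx0'
    have hirrF := irr_spec _ (hP0m G' hu').1 _ hirr
    have hsepF := sep_of_irr p _ ((hP0m G' hu').1.map _) hirrF (by rw [(hP0m G' hu').1.natDegree_map, (hP0m G' hu').2]; exact hp')
    have hsepE : ((P0 G').map (ι0 : RV k (m + 2) →+* E)).Separable := by
      rw [hι0c, ← Polynomial.map_map]; exact hsepF.map
    have h1 := ps_roots (PF n fu t0 G' sE vE) (hPm G' hu') 1 _ hsepE (by rw [one_mul, hred]) (by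
      intro z hz
      rw [← hred, eval_map_apply, hz, map_zero]) (by simp)
    rw [splits_iff_card_roots]
    refine le_antisymm (card_roots' _) ?_
    refine le_trans (le_of_eq ?_) (Multiset.toFinset_card_le _)
    rw [h1, (hPm G' hu').natDegree_map, (hP0m G' hu').1.natDegree_map, (hP0m G' hu').2]
    exact (PF_monic fu t0 G' sE vE hfu hm hu').2

end B
end BH

namespace BH

section L
set_option linter.unusedSectionVars false
variable {k : Type*} [Field k]

lemma ev_mem {S : Type*} [CommRing S] [Algebra k S] (T : Subring S) (hk : ∀ c : k, algebraMap k S c ∈ T) {a b : S}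
    (ha : a ∈ T) (hb : b ∈ T) (P : k[X][X]) : ev a b P ∈ T := by
  rw [ev_eq_eval_map]
  refine eval_mem_subring T _ (fun i => ?_) b hb
  rw [coeff_map]
  change aeval a _ ∈ T
  rw [← eval_map_algebraMap]
  refine eval_mem_subring T _ (fun i => ?_) a ha
  rw [coeff_map]; exact hk _

/-- the degree filtration -/
def WD (k : Type*) [Field k] (m : ℕ) (i : ℕ) : AddSubgroup (RV k m) where
  carrier := {a | a.totalDegree ≤ i}
  add_mem' := fun {a b} ha hb => (MvPolynomial.totalDegree_add a b).trans (max_le ha hb)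
  zero_mem' := by simp
  neg_mem' := fun {a} ha => by simpa using ha

lemma WD_mul {m : ℕ} : ∀ i j (a b : RV k m), a ∈ WD k m i → b ∈ WD k m j → a * b ∈ WD k m (i + j) :=
  fun _ _ a b ha hb => (MvPolynomial.totalDegree_mul a b).trans (add_le_add ha hb)

lemma WD_one {m : ℕ} : (1 : RV k m) ∈ WD k m 0 := by
  change MvPolynomial.totalDegree _ ≤ 0
  simp

lemma WD_C {m : ℕ} (c : k) : (MvPolynomial.C c : RV k m) ∈ WD k m 0 := by
  change MvPolynomial.totalDegree _ ≤ 0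
  simp

lemma prod_of_roots {S : Type*} [CommRing S] [IsDomain S] {Ω : Type*} [DecidableEq Ω] (s : Finset Ω) (τ : Ω → S) (hτ : Set.InjOn τ s) (P : S[X]) (hP : P.Monic)
    (hd : P.natDegree = s.card) (h : ∀ ω ∈ s, P.eval (τ ω) = 0) : P = ∏ ω ∈ s, (X - C (τ ω)) := by
  classical
  refine (eq_of_monic_of_dvd_of_natDegree_le (monic_prod_X_sub_C _ _) hP ?_ ?_)
  · rw [← Finset.prod_image (g := τ) (f := fun x => X - C x) (by intro a ha b hb h; exact hτ ha hb h)]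
    have h2 : (s.image τ).val ≤ P.roots := by
      rw [Multiset.le_iff_subset (Finset.nodup _)]
      intro x hx
      rw [Finset.mem_val, Finset.mem_image] at hx
      obtain ⟨ω, hω, rfl⟩ := hx
      rw [mem_roots hP.ne_zero]
      exact h ω hω
    have := (Multiset.prod_X_sub_C_dvd_iff_le_roots hP.ne_zero (s.image τ).val).2 h2
    exact this
  · rw [natDegree_prod_of_monic _ _ (fun _ _ => monic_X_sub_C _)]
    simp [hd]

variable {J Ω : Type*} [Fintype J] [DecidableEq J] [Fintype Ω] [DecidableEq Ω]

lemma lift_roots {m n : ℕ} (hm : m < n) (fu : k[X]) (hfu : fu.natDegree ≤ n) (t0 : k) (G : J → k[X][X])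
    (hu : ∀ j, (uu n (G j)).eval (fu.coeff n) ≠ 0) (ℓ : Ω → J) (r : Ω → k) (hr : Function.Injective r)
    (hP : ∀ j, PF n fu t0 (G j) (0 : k) (fun _ : Fin m => (0 : k)) = ∏ ω with ℓ ω = j, (X - C (r ω))) :
    ∃ τ : Ω → PowerSeries (RV k m), (∀ ω i, (PowerSeries.coeff i (τ ω)).totalDegree ≤ i) ∧
      (∀ ω, PowerSeries.constantCoeff (τ ω) = MvPolynomial.C (r ω)) ∧
      ∀ j, PF n fu t0 (G j) (PowerSeries.X : PowerSeries (RV k m)) (fun i => PowerSeries.C (MvPolynomial.X i)) =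
        ∏ ω with ℓ ω = j, (X - C (τ ω)) := by
  set P : J → (PowerSeries (RV k m))[X] := fun j =>
    PF n fu t0 (G j) (PowerSeries.X : PowerSeries (RV k m)) (fun i => PowerSeries.C (MvPolynomial.X i)) with hPdef
  have hPm : ∀ j, (P j).Monic ∧ (P j).natDegree = NN n (G j) := fun j => PF_monic fu t0 (G j) _ _ hfu hm (hu j)
  let cc : PowerSeries (RV k m) →ₐ[k] RV k m := { (PowerSeries.constantCoeff : PowerSeries (RV k m) →+* RV k m) with
    commutes' := fun r => by simp [PowerSeries.algebraMap_apply] }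
  have hccr : (cc : PowerSeries (RV k m) →+* RV k m) = PowerSeries.constantCoeff := rfl
  have hFF0 : ∀ (R : Type _) [CommRing R] [Algebra k R] (v : Fin m → R), FF fu t0 (0 : R) v = fu.map (algebraMap k R) := by
    intro R _ _ v; simp [FF]
  have hred : ∀ j, (P j).map PowerSeries.constantCoeff = ∏ ω with ℓ ω = j, (X - C (MvPolynomial.C (r ω) : RV k m)) := by
    intro j
    have h1 := PF_map n fu t0 (G j) (PowerSeries.X : PowerSeries (RV k m)) (fun i => PowerSeries.C (MvPolynomial.X i)) cc
    have h2 := PF_map n fu t0 (G j) (0 : k) (fun _ : Fin m => (0 : k)) (Algebra.ofId k (RV k m))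
    rw [hccr] at h1
    simp only [hPdef]
    rw [h1]
    have h3 : cc (PowerSeries.X) = 0 := by change PowerSeries.constantCoeff _ = 0; simp
    have h4 : (∏ ω with ℓ ω = j, (X - C (r ω))).map (Algebra.ofId k (RV k m) : k →+* RV k m) =
      ∏ ω with ℓ ω = j, (X - C (MvPolynomial.C (r ω) : RV k m)) := by
      rw [Polynomial.map_prod]
      refine Finset.prod_congr rfl fun ω _ => ?_
      rw [Polynomial.map_sub, map_X, map_C]; rfl
    rw [← h4, ← hP j, h2, h3, map_zero]
    unfold PF
    rw [hFF0, hFF0]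
  have hT : ∀ j i, (P j).coeff i ∈ FS (WD k m) WD_mul WD_one := by
    intro j
    set T := FS (WD k m) WD_mul WD_one with hT
    have hk : ∀ c : k, algebraMap k (PowerSeries (RV k m)) c ∈ T := by
      intro c
      rw [PowerSeries.algebraMap_apply]
      exact C_mem_FS (WD_C c)
    have key : P j ∈ liftsRing T.subtype := by
      have hC : ∀ z ∈ T, C z ∈ liftsRing T.subtype := fun z hz => ⟨C ⟨z, hz⟩, by simp⟩
      have hX : (X : (PowerSeries (RV k m))[X]) ∈ liftsRing T.subtype := ⟨X, by simp⟩
      simp only [hPdef, PF, PP]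
      refine mul_mem (hC _ (hk _)) ?_
      refine ev_mem _ (fun c => ?_) hX ?_ _
      · rw [Polynomial.algebraMap_apply]; exact hC _ (hk _)
      · unfold FF
        refine add_mem ?_ ?_
        · rw [← lifts_iff_liftsRing]
          rw [lifts_iff_coeff_lifts]
          intro i
          rw [coeff_map]
          exact ⟨⟨_, hk _⟩, rfl⟩
        · unfold VV
          rw [mul_add, mul_one, Finset.mul_sum]
          refine add_mem (hC _ ?_) (sum_mem fun i _ => ?_)
          · intro r
            rw [PowerSeries.coeff_X]
            split_ifs with h
            · rw [h]; change MvPolynomial.totalDegree _ ≤ 1; simp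
            · exact zero_mem _
          · rw [← mul_assoc, ← C_mul]
            refine mul_mem (hC _ ?_) (pow_mem (sub_mem hX (hC _ (hk _))) _)
            intro r
            rw [PowerSeries.coeff_mul_C, PowerSeries.coeff_X]
            split_ifs with h
            · rw [h, one_mul]; change MvPolynomial.totalDegree _ ≤ 1; simp
            · rw [zero_mul]; exact zero_mem _
    intro i
    rw [← lifts_iff_liftsRing, lifts_iff_coeff_lifts] at key
    obtain ⟨z, hz⟩ := key i
    rw [← hz]; exact z.2
  have hex : ∀ ω, ∃ z ∈ FS (WD k m) WD_mul WD_one, PowerSeries.constantCoeff z = MvPolynomial.C (r ω) ∧ (P (ℓ ω)).eval z = 0 := by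
    intro ω
    set D := ∏ ω' ∈ (Finset.univ.filter fun ω' => ℓ ω' = ℓ ω).erase ω, (r ω - r ω') with hD
    have hD0 : D ≠ 0 := by
      rw [hD, Finset.prod_ne_zero_iff]
      intro ω' h
      exact sub_ne_zero.2 fun h' => (Finset.ne_of_mem_erase h) (hr h').symm
    have hmem : ω ∈ Finset.univ.filter (fun ω' => ℓ ω' = ℓ ω) := by simp
    refine filtered_hensel WD_mul WD_one (P (ℓ ω)) (hT _) (MvPolynomial.C (r ω)) (MvPolynomial.C D⁻¹) (WD_C _) (WD_C _) ?_ ?_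
    · rw [← eval_map_apply, hred, eval_prod, PowerSeries.constantCoeff_C]
      exact Finset.prod_eq_zero hmem (by simp)
    · rw [← eval_map_apply, ← derivative_map, hred, PowerSeries.constantCoeff_C]
      rw [eval_derivative_prod _ (fun ω => (MvPolynomial.C (r ω) : RV k m)) _ hmem]
      have : (∏ ω' ∈ (Finset.univ.filter fun ω' => ℓ ω' = ℓ ω).erase ω, ((MvPolynomial.C (r ω) : RV k m) - MvPolynomial.C (r ω'))) = MvPolynomial.C D := by
        rw [hD, map_prod]; simp
      rw [this, ← map_mul, mul_inv_cancel₀ hD0, map_one]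
  choose τ hτ1 hτ2 hτ3 using hex
  refine ⟨τ, fun ω i => hτ1 ω i, hτ2, fun j => ?_⟩
  refine prod_of_roots _ τ ?_ _ (hPm j).1 ?_ ?_
  · intro a _ b _ h
    apply hr
    have := hτ2 a
    rw [h, hτ2 b] at this
    exact (MvPolynomial.C_injective _ _ this).symm
  · have h1 := PF_monic (R := k) fu t0 (G j) (0 : k) (fun _ : Fin m => (0 : k)) hfu hm (hu j)
    rw [(hPm j).2, ← h1.2, hP j, natDegree_prod_of_monic _ _ (fun _ _ => monic_X_sub_C _)]
    simp
  · intro ω hω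
    simp only [Finset.mem_filter, Finset.mem_univ, true_and] at hω
    rw [← hω]
    exact hτ3 ω
end L
end BH

namespace BH

section L
set_option linter.unusedSectionVars false
variable {k : Type*} [Field k]
variable {J Ω : Type*} [Fintype J] [DecidableEq J] [Fintype Ω] [DecidableEq Ω]

abbrev KV (k : Type*) [Field k] (m : ℕ) := FractionRing (RV k m)

noncomputable def iotaV (k : Type*) [Field k] (m : ℕ) : RV k m →ₐ[k] KV k m := Algebra.algHom k _ _

lemma iotaV_inj (k : Type*) [Field k] (m : ℕ) : Function.Injective (iotaV k m) := IsFractionRing.injective (RV k m) (KV k m)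

/-- the geometric data -/
structure GDat (k J : Type*) [Field k] (n p : ℕ) (fu : k[X]) (t0 : k) (G : J → k[X][X]) : Prop where
  hfu : fu.natDegree ≤ n
  irr : ∀ j, Irreducible (G j)
  deg : ∀ j, (G j).natDegree ≠ 0
  hu : ∀ j, (uu n (G j)).eval (fu.coeff n) ≠ 0
  hp : ∀ j, NN n (G j) < p
  hx : ∀ j, ∃ x0 : k, ev t0 x0 (G j) = 0 ∧ ev t0 x0 (derivative (G j)) ≠ 0 ∧ x0 ≠ fu.eval t0 ∧ ∀ i, i ≠ j → ev t0 x0 (G i) ≠ 0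

/-- the normalised polynomial over the power series ring -/
lemma PF_ps {m n : ℕ} (fu : k[X]) (t0 : k) (G : k[X][X]) {R : Type*} [CommRing R] [Algebra k R] (h : RV k m →ₐ[k] R) :
    (PF n fu t0 G (PowerSeries.X : PowerSeries (RV k m)) (fun i => PowerSeries.C (MvPolynomial.X i))).map (PowerSeries.map (h : RV k m →+* R)) =
      PF n fu t0 G (PowerSeries.X : PowerSeries R) (fun i => PowerSeries.C (h (MvPolynomial.X i))) := by
  have := PF_map n fu t0 G (PowerSeries.X : PowerSeries (RV k m)) (fun i => PowerSeries.C (MvPolynomial.X i)) (PowerSeries.mapAlgHom h)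
  have e : ((PowerSeries.mapAlgHom h : PowerSeries (RV k m) →ₐ[k] PowerSeries R) : PowerSeries (RV k m) →+* PowerSeries R) = PowerSeries.map (h : RV k m →+* R) := rfl
  rw [e] at this
  rw [this]
  have e2 : ∀ x, PowerSeries.mapAlgHom h x = PowerSeries.map (h : RV k m →+* R) x := fun _ => rfl
  simp [e2]

theorem all_gal {m n p : ℕ} [CharP k p] (hm : m + 2 < n) (fu : k[X]) (t0 : k) (G : J → k[X][X]) (hD : GDat k J n p fu t0 G)
    (ℓ : Ω → J) (τ : Ω → PowerSeries (KV k (m + 2))) (hτ : Function.Injective τ)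
    (hP : ∀ j, PF n fu t0 (G j) (PowerSeries.X : PowerSeries (KV k (m + 2))) (fun i => PowerSeries.C (iotaV k (m + 2) (MvPolynomial.X i))) =
        ∏ ω with ℓ ω = j, (X - C (τ ω))) :
    ∃ φ : FractionRing ((RV k (m + 2))[X]) →+* FractionRing (PowerSeries (KV k (m + 2))),
      (∀ x, φ (algebraMap _ _ x) = algebraMap _ (FractionRing (PowerSeries (KV k (m + 2))))
        (hRX (k := k) (PowerSeries.X : PowerSeries (KV k (m + 2))) (fun i => PowerSeries.C (iotaV k (m + 2) (MvPolynomial.X i))) x)) ∧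
      ∀ σ ∈ SL ℓ, ∀ H : MvPolynomial Ω (FractionRing ((RV k (m + 2))[X])),
        MvPolynomial.eval₂Hom φ (fun ω => algebraMap _ (FractionRing (PowerSeries (KV k (m + 2)))) (τ ω)) H = 0 →
        MvPolynomial.eval₂Hom φ (fun ω => algebraMap _ (FractionRing (PowerSeries (KV k (m + 2)))) (τ (σ ω))) H = 0 := by
  classical
  have hinj := hRX_ps (iotaV k (m + 2)) (iotaV_inj k (m + 2))
  have hinj' : Function.Injective ((algebraMap (PowerSeries (KV k (m + 2))) (FractionRing (PowerSeries (KV k (m + 2))))).comp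
      (hRX (k := k) (PowerSeries.X : PowerSeries (KV k (m + 2))) (fun i => PowerSeries.C (iotaV k (m + 2) (MvPolynomial.X i))) : (RV k (m + 2))[X] →+* _)) :=
    (IsFractionRing.injective _ _).comp hinj
  let φ : FractionRing ((RV k (m + 2))[X]) →+* FractionRing (PowerSeries (KV k (m + 2))) := IsFractionRing.lift hinj'
  have hφ : ∀ x, φ (algebraMap _ _ x) = algebraMap _ (FractionRing (PowerSeries (KV k (m + 2))))
        (hRX (k := k) (PowerSeries.X : PowerSeries (KV k (m + 2))) (fun i => PowerSeries.C (iotaV k (m + 2) (MvPolynomial.X i))) x) := by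
    intro x
    exact IsFractionRing.lift_algebraMap hinj' x
  refine ⟨φ, hφ, ?_⟩
  letI := φ.toAlgebra
  have hφa : algebraMap (FractionRing ((RV k (m + 2))[X])) (FractionRing (PowerSeries (KV k (m + 2)))) = φ := rfl
  set τL : Ω → FractionRing (PowerSeries (KV k (m + 2))) := fun ω => algebraMap _ _ (τ ω) with hτL
  have hτLi : Function.Injective τL := (IsFractionRing.injective (PowerSeries (KV k (m + 2))) _).comp hτ
  set PK : J → (FractionRing ((RV k (m + 2))[X]))[X] := fun j => (PF n fu t0 (G j) X (gv k (m + 2))).map (algebraMap _ _) with hPK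
  have hPL : ∀ j, (PK j).map (algebraMap _ (FractionRing (PowerSeries (KV k (m + 2))))) = ∏ ω with ℓ ω = j, (X - C (τL ω)) := by
    intro j
    have e1 : (PK j).map φ = ((PF n fu t0 (G j) X (gv k (m + 2))).map (hRX (k := k) (PowerSeries.X : PowerSeries (KV k (m + 2)))
        (fun i => PowerSeries.C (iotaV k (m + 2) (MvPolynomial.X i))) : (RV k (m + 2))[X] →+* PowerSeries (KV k (m + 2)))).map (algebraMap _ _) := by
      simp only [hPK]
      rw [Polynomial.map_map, Polynomial.map_map]
      congr 1
      ext x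
      · simp [hφ]
      · simp [hφ]
      · simp [hφ]
    rw [hφa, e1, PF_gen_map, hP, Polynomial.map_prod]
    simp [hτL]
  have hPKd : ∀ j, (PK j).natDegree = NN n (G j) := by
    intro j
    have := PF_monic (R := (RV k (m + 2))[X]) fu t0 (G j) X (gv k (m + 2)) hD.hfu hm (hD.hu j)
    simp only [hPK]
    rw [this.1.natDegree_map, this.2]
  have main : ∀ σ ∈ SL ℓ, IsGal (FractionRing ((RV k (m + 2))[X])) τL σ := by
    refine gal_full ℓ τL ?_ ?_ ?_
    · intro ω ω' h
      obtain ⟨x0, h0, h1, h2, h3⟩ := hD.hx (ℓ ω)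
      refine gal_B1 PK ℓ τL hτLi hPL (RingHom.id _) (ℓ ω) ?_ ω ω' rfl h.symm
      rw [Polynomial.map_id]
      exact B1 hm fu hD.hfu t0 x0 (G _) (hD.irr _) (hD.deg _) (hD.hu _) h1
    · intro j
      obtain ⟨x0, h0, h1, h2, h3⟩ := hD.hx j
      obtain ⟨φ', z, R, hR, hirr⟩ := B2 hm fu hD.hfu t0 x0 (G _) (hD.irr _) (hD.deg _) (hD.hu _) h0 h1 h2
      exact gal_B2 PK ℓ τL hτLi hPL φ' j z R hR hirr
    · intro j
      obtain ⟨x0, h0, h1, h2, h3⟩ := hD.hx j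
      obtain ⟨φ', hc, hs⟩ := B3 p hm fu hD.hfu t0 x0 (G _) (hD.irr _) (hD.deg _) (hD.hu _) h0 h1 h2 (hD.hp j) (E := AlgebraicClosure (KV k (m + 2)))
      refine gal_B3 PK ℓ τL hτLi hPL φ' j ?_ ?_
      · intro i hi
        exact hs (G i) (hD.irr _) (hD.deg _) (hD.hu _) (hD.hp i) (h3 i hi)
      · rw [hPKd]; exact hc
  intro σ hσ H hH
  exact main σ hσ H hH
end L
end BH

namespace BH

section L
set_option linter.unusedSectionVars false
variable {k : Type*} [Field k]
variable {J Ω : Type*} [Fintype J] [DecidableEq J] [Fintype Ω] [DecidableEq Ω]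

noncomputable abbrev psiX (k : Type*) [Field k] : k[X] →+* PowerSeries k := (aeval PowerSeries.X : k[X] →ₐ[k] PowerSeries k).toRingHom

theorem gen_irr {m n p : ℕ} [CharP k p] (hm : m + 2 < n) (fu : k[X]) (t0 : k) (G : J → k[X][X]) (hD : GDat k J n p fu t0 G)
    (ℓ : Ω → J) (τ : Ω → PowerSeries (KV k (m + 2))) (hτ : Function.Injective τ)
    (hP : ∀ j, PF n fu t0 (G j) (PowerSeries.X : PowerSeries (KV k (m + 2))) (fun i => PowerSeries.C (iotaV k (m + 2) (MvPolynomial.X i))) =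
        ∏ ω with ℓ ω = j, (X - C (τ ω))) (lam : Ω → k)
    (hy : Function.Injective fun g : SL ℓ => ∑ ω, algebraMap k (PowerSeries (KV k (m + 2))) (lam ω) * τ (g.1 ω))
    (Φ : (KV k (m + 2))[X][X])
    (hΦ : Φ.map (psiX (KV k (m + 2))) = ∏ g : SL ℓ, (X - C (∑ ω, algebraMap k (PowerSeries (KV k (m + 2))) (lam ω) * τ (g.1 ω)))) :
    Φ.Monic ∧ Φ.natDegree = Fintype.card (SL ℓ) ∧ Irreducible Φ := by
  classical
  set y : SL ℓ → PowerSeries (KV k (m + 2)) := fun g => ∑ ω, algebraMap k (PowerSeries (KV k (m + 2))) (lam ω) * τ (g.1 ω) with hydef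
  change Φ.map _ = ∏ g : SL ℓ, (X - C (y g)) at hΦ
  have hψ : Function.Injective (psiX (KV k (m + 2))) := psiX_inj (k := KV k (m + 2))
  have hΦm : Φ.Monic := by
    refine monic_of_injective hψ ?_
    rw [hΦ]; exact monic_prod_X_sub_C _ _
  have hΦd : Φ.natDegree = Fintype.card (SL ℓ) := by
    rw [← natDegree_map_eq_of_injective hψ, hΦ, natDegree_prod_of_monic _ _ (fun _ _ => monic_X_sub_C _)]
    simp only [natDegree_X_sub_C, Finset.sum_const, smul_eq_mul, mul_one, Finset.card_univ]
  refine ⟨hΦm, hΦd, ?_⟩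
  obtain ⟨φ, hφ, hgal⟩ := all_gal hm fu t0 G hD ℓ τ hτ hP
  set aL := algebraMap (PowerSeries (KV k (m + 2))) (FractionRing (PowerSeries (KV k (m + 2)))) with haL
  have haLi : Function.Injective aL := IsFractionRing.injective _ _
  set aK := algebraMap ((RV k (m + 2))[X]) (FractionRing ((RV k (m + 2))[X])) with haK
  have hinjK : Function.Injective (aK.comp (C : RV k (m + 2) →+* (RV k (m + 2))[X])) := (IsFractionRing.injective ((RV k (m + 2))[X]) _).comp C_injective
  let j0 : KV k (m + 2) →+* FractionRing ((RV k (m + 2))[X]) := IsFractionRing.lift hinjK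
  have hj0 : ∀ x, j0 (algebraMap _ _ x) = aK (C x) := fun x => IsFractionRing.lift_algebraMap hinjK x
  let j : (KV k (m + 2))[X] →+* FractionRing ((RV k (m + 2))[X]) := eval₂RingHom j0 (aK X)
  have hRXC : ∀ x : RV k (m + 2), hRX (k := k) (PowerSeries.X : PowerSeries (KV k (m + 2))) (fun i => PowerSeries.C (iotaV k (m + 2) (MvPolynomial.X i))) (C x) =
      PowerSeries.C (algebraMap _ (KV k (m + 2)) x) := by
    intro x
    rw [hRX_C]
    have : (MvPolynomial.aeval (fun i => PowerSeries.C (iotaV k (m + 2) (MvPolynomial.X i))) : RV k (m + 2) →ₐ[k] PowerSeries (KV k (m + 2))) =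
      ((Algebra.ofId (KV k (m + 2)) (PowerSeries (KV k (m + 2)))).restrictScalars k).comp (iotaV k (m + 2)) := by
      refine MvPolynomial.algHom_ext fun i => ?_
      rw [MvPolynomial.aeval_X]; rfl
    rw [this]; rfl
  have hj : φ.comp j = aL.comp (psiX (KV k (m + 2))) := by
    refine Polynomial.ringHom_ext' ?_ ?_
    · refine IsLocalization.ringHom_ext (nonZeroDivisors (RV k (m + 2))) ?_
      refine RingHom.ext fun x => ?_
      change φ (j (C (algebraMap _ _ x))) = aL (psiX (KV k (m + 2)) (C (algebraMap _ _ x)))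
      have e1 : j (C (algebraMap _ _ x)) = aK (C x) := by
        rw [← hj0]; simp [j]
      rw [e1, hφ, hRXC]
      congr 1
      change _ = aeval PowerSeries.X (C (algebraMap _ _ x))
      rw [aeval_C]; rfl
    · change φ (j X) = aL (psiX (KV k (m + 2)) X)
      have e1 : j X = aK X := by simp [j]
      rw [e1, hφ, hRX_X]
      congr 1
      change _ = aeval PowerSeries.X X
      rw [aeval_X]
  -- factors vanish at all conjugates
  have key : ∀ A : (KV k (m + 2))[X][X], A ≠ 0 → (A.map (psiX (KV k (m + 2)))).eval (y 1) = 0 → Fintype.card (SL ℓ) ≤ A.natDegree := by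
    intro A hA0 hA
    have hA2 : ∀ g : SL ℓ, (A.map (psiX (KV k (m + 2)))).eval (y g) = 0 := by
      intro g
      let Y : MvPolynomial Ω (FractionRing ((RV k (m + 2))[X])) := ∑ ω, MvPolynomial.C (aK (C (MvPolynomial.C (lam ω)))) * MvPolynomial.X ω
      let H : MvPolynomial Ω (FractionRing ((RV k (m + 2))[X])) := A.eval₂ ((MvPolynomial.C).comp j) Y
      have hH : ∀ σ : SL ℓ, MvPolynomial.eval₂Hom φ (fun ω => aL (τ (σ.1 ω))) H = aL ((A.map (psiX (KV k (m + 2)))).eval (y σ)) := by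
        intro σ
        have e1 : (MvPolynomial.eval₂Hom φ (fun ω => aL (τ (σ.1 ω)))).comp ((MvPolynomial.C).comp j) = aL.comp (psiX (KV k (m + 2))) := by
          rw [← hj]
          ext <;> simp
        have e2 : MvPolynomial.eval₂Hom φ (fun ω => aL (τ (σ.1 ω))) Y = aL (y σ) := by
          simp only [Y, hydef, map_sum, map_mul]
          refine Finset.sum_congr rfl fun ω _ => ?_
          rw [MvPolynomial.coe_eval₂Hom, MvPolynomial.eval₂_C, MvPolynomial.eval₂_X, hφ, hRXC, PowerSeries.algebraMap_apply]
          congr 3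
        rw [Polynomial.hom_eval₂, e1, e2, eval_map, Polynomial.hom_eval₂]
      have h1 := hH 1
      rw [hA, map_zero] at h1
      have h2 := hgal g.1 g.2 H h1
      apply haLi
      rw [map_zero, ← hH g, h2]
    have hAm : A.map (psiX (KV k (m + 2))) ≠ 0 := (Polynomial.map_ne_zero_iff hψ).2 hA0
    rw [← natDegree_map_eq_of_injective hψ]
    refine le_trans ?_ (card_roots' _)
    have : (Finset.univ.image y).val ≤ (A.map (psiX (KV k (m + 2)))).roots := by
      rw [Multiset.le_iff_subset (Finset.nodup _)]
      intro x hx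
      rw [Finset.mem_val, Finset.mem_image] at hx
      obtain ⟨g, -, rfl⟩ := hx
      rw [mem_roots hAm]
      exact hA2 g
    have h2 := Multiset.card_le_card this
    rw [Finset.card_val, Finset.card_image_of_injective _ hy] at h2
    simpa using h2
  refine (Monic.irreducible_iff_natDegree hΦm).2 ⟨?_, ?_⟩
  · intro h
    have h1 : Fintype.card (SL ℓ) ≠ 0 := Fintype.card_ne_zero
    rw [h, natDegree_one] at hΦd
    exact h1 hΦd.symm
  · intro A B hAm hBm hAB
    have h1 : ((A * B).map (psiX (KV k (m + 2)))).eval (y 1) = 0 := by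
      rw [hAB, hΦ, eval_prod]
      exact Finset.prod_eq_zero (Finset.mem_univ (1 : SL ℓ)) (by simp only [eval_sub, eval_X, eval_C, sub_self])
    have h2 := hAm.natDegree_mul hBm
    rw [hAB, hΦd] at h2
    rw [Polynomial.map_mul, eval_mul, mul_eq_zero] at h1
    rcases h1 with h1 | h1
    · right; have := key A hAm.ne_zero h1; omega
    · left; have := key B hBm.ne_zero h1; omega
end L
end BH

namespace BH

lemma exists_minor {F I J : Type*} [Field F] [Fintype I] [DecidableEq I] [Fintype J] (M : Matrix I J F)
    (h : LinearIndependent F M.row) : ∃ e : I → J, (M.submatrix id e).det ≠ 0 := by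
  classical
  obtain ⟨κ, a, ha, hs, hl⟩ := exists_linearIndependent' F M.col
  have h1 := h.rank_matrix
  rw [Matrix.rank_eq_finrank_span_cols, ← hs] at h1
  have : Fintype κ := Fintype.ofInjective a ha
  rw [finrank_span_eq_card hl] at h1
  let f : I ≃ κ := Fintype.equivOfCardEq h1.symm
  refine ⟨a ∘ f, ?_⟩
  have h2 : LinearIndependent F (M.submatrix id (a ∘ f)).col := by
    have := hl.comp f f.injective
    exact this
  rw [Matrix.linearIndependent_cols_iff_isUnit, Matrix.isUnit_iff_isUnit_det] at h2
  exact h2.ne_zero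

section B
set_option linter.unusedSectionVars false

lemma coeff_ev_expand {F : Type*} [Field F] (y : PowerSeries F) (c : F[X][X]) (D κ : ℕ) (hD : c.natDegree < D)
    (hκ : ∀ b, (c.coeff b).natDegree ≤ κ) (o : ℕ) :
    PowerSeries.coeff o (ev PowerSeries.X y c) =
      ∑ i : Fin (κ + 1) × Fin D, (c.coeff i.2).coeff i.1 * PowerSeries.coeff o (PowerSeries.X ^ (i.1 : ℕ) * y ^ (i.2 : ℕ)) := by
  have e1 : ev PowerSeries.X y c = ∑ b ∈ Finset.range D, aeval PowerSeries.X (c.coeff b) * y ^ b := by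
    rw [ev_sum]
    refine Finset.sum_subset (by intro x; simp; omega) ?_
    intro b _ hb
    rw [coeff_eq_zero_of_natDegree_lt (by simp at hb; omega)]; simp
  have e2 : ∀ b, aeval (PowerSeries.X : PowerSeries F) (c.coeff b) = ∑ a ∈ Finset.range (κ + 1), (c.coeff b).coeff a • (PowerSeries.X : PowerSeries F) ^ a := by
    intro b
    exact aeval_eq_sum_range' (by have := hκ b; omega) _
  rw [e1, map_sum, Fintype.sum_prod_type_right, Finset.sum_range]
  refine Finset.sum_congr rfl fun b _ => ?_
  rw [e2, Finset.sum_mul, map_sum, Finset.sum_range]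
  refine Finset.sum_congr rfl fun a _ => ?_
  rw [smul_mul_assoc, PowerSeries.coeff_smul]; rfl

variable {k : Type*} [Field k]

lemma bertini_core {M D κ : ℕ} (hD : 0 < D) (y : PowerSeries (RV k M)) (hy : ∀ i, (PowerSeries.coeff i y).totalDegree ≤ i)
    (Φ : (KV k M)[X][X]) (hΦ : Φ.Monic) (hirr : Irreducible Φ) (hdeg : Φ.natDegree = D) (hκ : ∀ b, (Φ.coeff b).natDegree ≤ κ)
    (hΦy : ev PowerSeries.X (PowerSeries.map (iotaV k M : RV k M →+* KV k M) y) Φ = 0) :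
    ∃ Δ : RV k M, Δ ≠ 0 ∧ Δ.totalDegree ≤ (κ + 1) * D * (D * κ + D * κ) ∧
      ∀ v : Fin M → k, MvPolynomial.eval v Δ ≠ 0 → ∀ c : k[X][X], c ≠ 0 → c.natDegree < D → (∀ b, (c.coeff b).natDegree ≤ κ) →
        ev PowerSeries.X (PowerSeries.map (MvPolynomial.eval v) y) c ≠ 0 := by
  classical
  let Mx : Matrix (Fin (κ + 1) × Fin D) (Fin (D * κ + D * κ + 1)) (RV k M) :=
    fun i o => PowerSeries.coeff (o : ℕ) (PowerSeries.X ^ (i.1 : ℕ) * y ^ (i.2 : ℕ))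
  have hmap : ∀ {F : Type _} [Field F] (h : RV k M →+* F) i (o : Fin (D * κ + D * κ + 1)),
      h (Mx i o) = PowerSeries.coeff (o : ℕ) (PowerSeries.X ^ (i.1 : ℕ) * (PowerSeries.map h y) ^ (i.2 : ℕ)) := by
    intro F _ h i o
    simp only [Mx]
    rw [← PowerSeries.coeff_map, map_mul, map_pow, map_pow, PowerSeries.map_X]
  have hdegM : ∀ i o, (Mx i o).totalDegree ≤ D * κ + D * κ := by
    intro i o
    have h1 : y ∈ FS (WD k M) WD_mul WD_one := hy
    have h2 : (PowerSeries.X : PowerSeries (RV k M)) ∈ FS (WD k M) WD_mul WD_one := by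
      intro r
      rw [PowerSeries.coeff_X]
      split_ifs with h
      · rw [h]; change MvPolynomial.totalDegree _ ≤ 1; simp
      · exact zero_mem _
    have h3 := mul_mem (pow_mem h2 (i.1 : ℕ)) (pow_mem h1 (i.2 : ℕ))
    have h4 : (Mx i o).totalDegree ≤ (o : ℕ) := h3 (o : ℕ)
    have := o.2
    omega
  have hind : LinearIndependent (KV k M) (Mx.map (iotaV k M)).row := by
    rw [Fintype.linearIndependent_iff]
    intro c hc
    by_contra hcon
    push Not at hcon
    obtain ⟨i0, hi0⟩ := hcon
    let P : (KV k M)[X][X] := ∑ i : Fin (κ + 1) × Fin D, C (C (c i) * X ^ (i.1 : ℕ)) * X ^ (i.2 : ℕ)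
    have hPc : ∀ b : Fin D, P.coeff b = ∑ a : Fin (κ + 1), C (c (a, b)) * X ^ (a : ℕ) := by
      intro b
      simp only [P]
      rw [finsetSum_coeff, Fintype.sum_prod_type]
      refine Finset.sum_congr rfl fun a _ => ?_
      rw [Finset.sum_eq_single b]
      · simp only [coeff_C_mul, coeff_X_pow, if_true, mul_one]
      · intro b' _ hb'
        rw [coeff_C_mul, coeff_X_pow, if_neg, mul_zero]
        intro h; exact hb' (Fin.ext h.symm)
      · simp
    have hPcc : ∀ i : Fin (κ + 1) × Fin D, (P.coeff i.2).coeff i.1 = c i := by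
      intro i
      rw [hPc, finsetSum_coeff, Finset.sum_eq_single i.1]
      · simp
      · intro b' _ hb'
        rw [coeff_C_mul, coeff_X_pow, if_neg, mul_zero]
        intro h; exact hb' (Fin.ext h.symm)
      · simp
    have hP0 : P ≠ 0 := by
      intro h
      apply hi0
      rw [← hPcc, h]; simp
    have hPD : P.natDegree < D := by
      have : P.natDegree ≤ D - 1 := by
        refine natDegree_sum_le_of_forall_le _ _ fun i _ => ?_
        refine (natDegree_C_mul_X_pow_le _ _).trans ?_
        have := i.2.2; omega
      omega
    have hPκ : ∀ b, (P.coeff b).natDegree ≤ κ := by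
      intro b
      by_cases hb : b < D
      · rw [hPc ⟨b, hb⟩]
        refine natDegree_sum_le_of_forall_le _ _ fun i _ => ?_
        refine (natDegree_C_mul_X_pow_le _ _).trans ?_
        have := i.2; omega
      · rw [coeff_eq_zero_of_natDegree_lt (by omega)]; simp
    obtain ⟨o, ho, hne⟩ := order_bound hD hΦ hirr hdeg hκ _ hΦy P hP0 hPD hPκ
    apply hne
    rw [coeff_ev_expand _ P D κ hPD hPκ]
    have h1 := congrFun hc ⟨o, by omega⟩
    rw [Finset.sum_apply] at h1
    refine Eq.trans (Finset.sum_congr rfl fun i _ => ?_) h1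
    rw [hPcc]
    change _ = c i * (iotaV k M : RV k M →+* KV k M) (Mx i _)
    rw [hmap]
  obtain ⟨e, he⟩ := exists_minor _ hind
  refine ⟨(Mx.submatrix id e).det, ?_, ?_, ?_⟩
  · intro h
    apply he
    have := congrArg (iotaV k M) h
    rw [AlgHom.map_det, map_zero] at this
    exact this
  · rw [Matrix.det_apply]
    refine MvPolynomial.totalDegree_finsetSum_le fun σ _ => ?_
    refine le_trans (b := (∏ i, (Mx.submatrix id e) (σ i) i).totalDegree) ?_ ?_
    · rcases Int.units_eq_one_or (Equiv.Perm.sign σ) with h | h <;> rw [h] <;> simp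
    · refine (MvPolynomial.totalDegree_finsetProd _ _).trans ?_
      refine (Finset.sum_le_card_nsmul _ _ (D * κ + D * κ) (fun i _ => hdegM _ _)).trans ?_
      simp
  · intro v hv c hc hcD hcκ h0
    have hdet : ((Mx.submatrix id e).map (MvPolynomial.eval v)).det ≠ 0 := by
      intro h
      apply hv
      rw [RingHom.map_det]; exact h
    have h1 : Matrix.vecMul (fun i : Fin (κ + 1) × Fin D => (c.coeff i.2).coeff i.1) ((Mx.submatrix id e).map (MvPolynomial.eval v)) = 0 := by
      funext i
      change ∑ j : Fin (κ + 1) × Fin D, (c.coeff j.2).coeff j.1 * (MvPolynomial.eval v) (Mx j (e i)) = 0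
      simp only [hmap]
      rw [← coeff_ev_expand _ c D κ hcD hcκ, h0, map_zero]
    have h2 := Matrix.eq_zero_of_vecMul_eq_zero hdet h1
    apply hc
    ext b a
    by_cases hb : b < D
    · by_cases ha : a < κ + 1
      · exact congrFun h2 (⟨a, ha⟩, ⟨b, hb⟩)
      · rw [coeff_eq_zero_of_natDegree_lt (p := c.coeff b)]; simp
        have := hcκ b; omega
    · rw [coeff_eq_zero_of_natDegree_lt (p := c) (by omega)]; simp
end B
end BH

namespace BH

section S
variable {R : Type*} [CommRing R]

lemma coeff_swap (p : R[X][X]) (i j : ℕ) : ((Bivariate.swap p).coeff i).coeff j = (p.coeff j).coeff i := by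
  induction p using Polynomial.induction_on' with
  | add p q hp hq => simp [hp, hq]
  | monomial a f =>
    induction f using Polynomial.induction_on' with
    | add p q hp hq => simp only [map_add, coeff_add, hp, hq]
    | monomial b r =>
      rw [Bivariate.swap_monomial_monomial]
      simp only [coeff_monomial]
      split_ifs <;> simp_all [coeff_monomial]

def SD (p : R[X][X]) (d : ℕ) : Prop := ∀ i, (p.coeff i).natDegree ≤ d

lemma SD_iff (p : R[X][X]) (d : ℕ) : SD p d ↔ (Bivariate.swap p).natDegree ≤ d := by
  constructor
  · intro h
    rw [natDegree_le_iff_coeff_eq_zero]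
    intro N hN
    ext j
    rw [coeff_swap, coeff_eq_zero_of_natDegree_lt (lt_of_le_of_lt (h j) hN), coeff_zero]
  · intro h i
    rw [natDegree_le_iff_coeff_eq_zero]
    intro N hN
    rw [← coeff_swap, coeff_eq_zero_of_natDegree_lt (lt_of_le_of_lt h hN), coeff_zero]

lemma SD.mul {p q : R[X][X]} {d e : ℕ} (hp : SD p d) (hq : SD q e) : SD (p * q) (d + e) := by
  rw [SD_iff] at *
  rw [map_mul]
  exact natDegree_mul_le.trans (add_le_add hp hq)

lemma SD.pow {p : R[X][X]} {d : ℕ} (hp : SD p d) (e : ℕ) : SD (p ^ e) (e * d) := by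
  rw [SD_iff] at *
  rw [map_pow]
  exact natDegree_pow_le.trans (Nat.mul_le_mul_left _ hp)

lemma SD.add {p q : R[X][X]} {d : ℕ} (hp : SD p d) (hq : SD q d) : SD (p + q) d := by
  rw [SD_iff] at *
  rw [map_add]
  exact natDegree_add_le_of_degree_le hp hq

lemma SD.sum {ι : Type*} (s : Finset ι) (f : ι → R[X][X]) {d : ℕ} (h : ∀ i ∈ s, SD (f i) d) : SD (∑ i ∈ s, f i) d := by
  rw [SD_iff, map_sum]
  exact natDegree_sum_le_of_forall_le _ _ fun i hi => (SD_iff _ _).1 (h i hi)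

lemma SD.mono {p : R[X][X]} {d e : ℕ} (hp : SD p d) (h : d ≤ e) : SD p e := fun i => (hp i).trans h

lemma SD_map_C (f : R[X]) : SD (f.map C) 0 := by
  intro i; rw [coeff_map]; simp

lemma SD_C {f : R[X]} {d : ℕ} (h : f.natDegree ≤ d) : SD (C f) d := by
  rw [SD_iff, Bivariate.swap_C]
  exact natDegree_map_le.trans h

lemma SD_X : SD (X : R[X][X]) 0 := by
  rw [SD_iff, Bivariate.swap_Y]; simp

lemma SD_one : SD (1 : R[X][X]) 0 := by
  rw [SD_iff, map_one]; simp

lemma SD.of_mul {F : Type*} [Field F] {p q : F[X][X]} {d : ℕ} (h : SD (p * q) d) (hp : p ≠ 0) (hq : q ≠ 0) : SD p d := by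
  rw [SD_iff, map_mul, natDegree_mul (by simpa using hp) (by simpa using hq)] at h
  rw [SD_iff]; omega

end S

section B
set_option linter.unusedSectionVars false
variable {k : Type*} [Field k]

lemma SD_ev {F : Type*} [Field F] [Algebra k F] (f : F[X][X]) (hf : SD f 1) (G : k[X][X]) :
    SD (ev (k := k) (X : F[X][X]) f G) G.natDegree := by
  rw [ev_sum]
  refine SD.sum _ _ fun b hb => ?_
  have h1 : SD (aeval (X : F[X][X]) (G.coeff b)) 0 := by
    rw [aeval_eq_sum_range]
    refine SD.sum _ _ fun a _ => ?_
    rw [Algebra.smul_def, Polynomial.algebraMap_apply, Polynomial.algebraMap_apply]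
    have := (SD_C (f := (algebraMap F F[X] (algebraMap k F ((G.coeff b).coeff a)))) (d := 0) (by simp)).mul (SD_X.pow a)
    simpa using this
  refine (h1.mul (hf.pow b)).mono ?_
  simp at hb; omega

lemma PF_SD {F : Type*} [Field F] [Algebra k F] {M n : ℕ} (fu : k[X]) (t0 : k) (G : k[X][X]) (v : Fin M → F) :
    SD (PF n fu t0 G (X : F[X]) (fun i => C (v i))) G.natDegree := by
  unfold PF PP
  have h0 : ∀ c : k, SD (C (algebraMap k F[X] c)) 0 := by
    intro c
    refine SD_C ?_
    rw [Polynomial.algebraMap_apply]; simp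
  have h1 := (h0 ((uu n G).eval (fu.coeff n))⁻¹).mul (SD_ev (FF fu t0 (X : F[X]) (fun i => C (v i))) ?_ G)
  · simpa using h1
  · unfold FF VV
    refine SD.add ?_ ?_
    · have e : fu.map (algebraMap k F[X]) = (fu.map (algebraMap k F)).map C := by
        rw [Polynomial.map_map]; rfl
      rw [e]
      exact (SD_map_C _).mono (by omega)
    · refine (SD.mul (d := 1) (e := 0) (SD_C (by simp)) ?_)
      refine SD_one.add (SD.sum _ _ fun i _ => ?_)
      refine SD.mul (d := 0) (e := 0) (SD_C (by simp)) ?_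
      have : SD (X - C (algebraMap k F[X] t0)) 0 := by
        rw [sub_eq_add_neg, ← C_neg, ← map_neg]
        exact SD_X.add (h0 _)
      simpa using this.pow (i + 1)

lemma PF_psi {F : Type*} [Field F] [Algebra k F] {M n : ℕ} (fu : k[X]) (t0 : k) (G : k[X][X]) (v : Fin M → F) :
    (PF n fu t0 G (X : F[X]) (fun i => C (v i))).map (psiX F) = PF n fu t0 G (PowerSeries.X : PowerSeries F) (fun i => PowerSeries.C (v i)) := by
  have := PF_map n fu t0 G (X : F[X]) (fun i => C (v i)) ((aeval PowerSeries.X : F[X] →ₐ[F] PowerSeries F).restrictScalars k)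
  have e : (((aeval PowerSeries.X : F[X] →ₐ[F] PowerSeries F).restrictScalars k : F[X] →ₐ[k] PowerSeries F) : F[X] →+* PowerSeries F) = psiX F := rfl
  rw [e] at this
  rw [this]
  simp [PowerSeries.algebraMap_apply]

variable {J Ω : Type*} [Fintype J] [DecidableEq J] [Fintype Ω] [DecidableEq Ω]

/-- descend the resolvent -/
lemma phi_exists {F : Type*} [Field F] [Algebra k F] {M n : ℕ} (hm : M < n) (fu : k[X]) (hfu : fu.natDegree ≤ n) (t0 : k) (G : J → k[X][X])
    (hu : ∀ j, (uu n (G j)).eval (fu.coeff n) ≠ 0) (δ : ℕ) (hδ : ∀ j, (G j).natDegree ≤ δ) (v : Fin M → F)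
    (ℓ : Ω → J) (τ : Ω → PowerSeries F) (hτ : Function.Injective τ)
    (hP : ∀ j, PF n fu t0 (G j) (PowerSeries.X : PowerSeries F) (fun i => PowerSeries.C (v i)) = ∏ ω with ℓ ω = j, (X - C (τ ω)))
    (lam : Ω → k) :
    ∃ Φ : F[X][X], SD Φ (δ * Fintype.card (SL ℓ)) ∧
      Φ.map (psiX F) = ∏ g : SL ℓ, (X - C (∑ ω, algebraMap k (PowerSeries F) (lam ω) * τ (g.1 ω))) := by
  obtain ⟨B, hB1, hB2⟩ := sym_descent_poly (psiX F) psiX_inj δ (fun j => PF n fu t0 (G j) (X : F[X]) (fun i => C (v i)))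
    (fun j => (PF_monic fu t0 (G j) _ _ hfu hm (hu j)).1) (fun j i => (PF_SD fu t0 (G j) v i).trans (hδ j)) ℓ τ hτ
    (fun j => by rw [PF_psi, hP]) (PhiF ℓ (fun ω => algebraMap k F (lam ω))) (Fintype.card (SL ℓ)) (TD_PhiF ℓ _) (PhiF_inv ℓ _)
  refine ⟨B, hB1, ?_⟩
  rw [hB2, PhiF, Polynomial.map_prod]
  refine Finset.prod_congr rfl fun g _ => ?_
  rw [Polynomial.map_sub, map_X, map_C, eval_YF]
  congr 2
  refine Finset.sum_congr rfl fun ω _ => ?_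
  congr 1
  change aeval PowerSeries.X (C (algebraMap k F (lam ω))) = _
  rw [aeval_C, PowerSeries.algebraMap_apply, PowerSeries.algebraMap_apply]; rfl

theorem good_v {m n p : ℕ} [CharP k p] (hm : m + 2 < n) (fu : k[X]) (t0 : k) (G : J → k[X][X]) (hD : GDat k J n p fu t0 G)
    (ℓ : Ω → J) (r : Ω → k) (hr : Function.Injective r)
    (hP : ∀ j, PF n fu t0 (G j) (0 : k) (fun _ : Fin (m + 2) => (0 : k)) = ∏ ω with ℓ ω = j, (X - C (r ω)))
    (lam : Ω → k) (hlam : Function.Injective fun g : SL ℓ => ∑ ω, lam ω * r (g.1 ω))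
    (δ : ℕ) (hδ : ∀ j, (G j).natDegree ≤ δ) (D κ : ℕ) (hDe : D = Fintype.card (SL ℓ)) (hκ : κ = δ * D) :
    ∃ Δ : RV k (m + 2), Δ ≠ 0 ∧ Δ.totalDegree ≤ (κ + 1) * D * (D * κ + D * κ) ∧
      ∀ v : Fin (m + 2) → k, MvPolynomial.eval v Δ ≠ 0 → ∃ τ : Ω → PowerSeries k, Function.Injective τ ∧
        (∀ j, (PF n fu t0 (G j) (X : k[X]) (fun i => C (v i))).map (psiX k) = ∏ ω with ℓ ω = j, (X - C (τ ω))) ∧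
        (Function.Injective fun g : SL ℓ => ∑ ω, algebraMap k (PowerSeries k) (lam ω) * τ (g.1 ω)) ∧
        ∃ Φ : k[X][X], Irreducible Φ ∧ Φ.map (psiX k) = ∏ g : SL ℓ, (X - C (∑ ω, algebraMap k (PowerSeries k) (lam ω) * τ (g.1 ω))) := by
  classical
  obtain ⟨τ, hτ1, hτ2, hτ3⟩ := lift_roots hm fu hD.hfu t0 G hD.hu ℓ r hr hP
  -- specialisations
  have hcs : ∀ {F : Type _} [Field F] [Algebra k F] (h : RV k (m + 2) →ₐ[k] F) ω,
      PowerSeries.constantCoeff (PowerSeries.map (h : RV k (m + 2) →+* F) (τ ω)) = algebraMap k F (r ω) := by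
    intro F _ _ h ω
    rw [← PowerSeries.coeff_zero_eq_constantCoeff_apply, PowerSeries.coeff_map, PowerSeries.coeff_zero_eq_constantCoeff_apply, hτ2]
    exact h.commutes _
  have hinj : ∀ {F : Type _} [Field F] [Algebra k F] (h : RV k (m + 2) →ₐ[k] F),
      Function.Injective fun ω => PowerSeries.map (h : RV k (m + 2) →+* F) (τ ω) := by
    intro F _ _ h ω ω' e
    apply hr
    apply (algebraMap k F).injective
    rw [← hcs h, ← hcs h]
    exact congrArg _ e
  have hyinj : ∀ {F : Type _} [Field F] [Algebra k F] (h : RV k (m + 2) →ₐ[k] F),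
      Function.Injective fun g : SL ℓ => ∑ ω, algebraMap k (PowerSeries F) (lam ω) * PowerSeries.map (h : RV k (m + 2) →+* F) (τ (g.1 ω)) := by
    intro F _ _ h g g' e
    apply hlam
    apply (algebraMap k F).injective
    have := congrArg PowerSeries.constantCoeff e
    have hg : ∀ g : SL ℓ, PowerSeries.constantCoeff (∑ ω, algebraMap k (PowerSeries F) (lam ω) * PowerSeries.map (h : RV k (m + 2) →+* F) (τ (g.1 ω))) = algebraMap k F (∑ ω, lam ω * r (g.1 ω)) := by
      intro g
      rw [map_sum, map_sum]
      refine Finset.sum_congr rfl fun ω _ => ?_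
      rw [map_mul, map_mul, hcs h, PowerSeries.algebraMap_apply, PowerSeries.constantCoeff_C]
    exact (hg g).symm.trans (this.trans (hg g'))
  have hPF : ∀ {F : Type _} [Field F] [Algebra k F] (h : RV k (m + 2) →ₐ[k] F) j,
      PF n fu t0 (G j) (PowerSeries.X : PowerSeries F) (fun i => PowerSeries.C (h (MvPolynomial.X i))) =
        ∏ ω with ℓ ω = j, (X - C (PowerSeries.map (h : RV k (m + 2) →+* F) (τ ω))) := by
    intro F _ _ h j
    rw [← PF_ps, hτ3, Polynomial.map_prod]
    refine Finset.prod_congr rfl fun ω _ => ?_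
    rw [Polynomial.map_sub, map_X, map_C]
  -- generic
  obtain ⟨Φ, hΦ1, hΦ2⟩ := phi_exists hm fu hD.hfu t0 G hD.hu δ hδ _ ℓ _ (hinj (iotaV k (m + 2))) (hPF (iotaV k (m + 2))) lam
  obtain ⟨hΦm, hΦd, hΦi⟩ := gen_irr hm fu t0 G hD ℓ _ (hinj (iotaV k (m + 2))) (hPF (iotaV k (m + 2))) lam (hyinj (iotaV k (m + 2))) Φ hΦ2
  rw [← hDe] at hΦ1 hΦd
  rw [← hκ] at hΦ1
  have hD0 : 0 < D := by rw [hDe]; exact Fintype.card_pos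
  set y : PowerSeries (RV k (m + 2)) := ∑ ω, algebraMap k (PowerSeries (RV k (m + 2))) (lam ω) * τ ω with hydef
  have hymap : ∀ {F : Type _} [Field F] [Algebra k F] (h : RV k (m + 2) →ₐ[k] F), PowerSeries.map (h : RV k (m + 2) →+* F) y =
      ∑ ω, algebraMap k (PowerSeries F) (lam ω) * PowerSeries.map (h : RV k (m + 2) →+* F) (τ ω) := by
    intro F _ _ h
    rw [hydef, map_sum]
    refine Finset.sum_congr rfl fun ω _ => ?_
    rw [map_mul]
    congr 1
    exact (PowerSeries.mapAlgHom h).commutes (lam ω)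
  have hvan : ∀ {F : Type _} [Field F] [Algebra k F] (h : RV k (m + 2) →ₐ[k] F) (Ψ : F[X][X]),
      Ψ.map (psiX F) = ∏ g : SL ℓ, (X - C (∑ ω, algebraMap k (PowerSeries F) (lam ω) * PowerSeries.map (h : RV k (m + 2) →+* F) (τ (g.1 ω)))) →
      ev PowerSeries.X (PowerSeries.map (h : RV k (m + 2) →+* F) y) Ψ = 0 := by
    intro F _ _ h Ψ e
    rw [ev_eq_eval_map]
    change (Ψ.map (psiX F)).eval _ = 0
    rw [e, eval_prod]
    refine Finset.prod_eq_zero (Finset.mem_univ (1 : SL ℓ)) ?_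
    rw [eval_sub, eval_X, eval_C, hymap, sub_eq_zero]
    rfl
  have hydeg : ∀ i, (PowerSeries.coeff i y).totalDegree ≤ i := by
    have : y ∈ FS (WD k (m + 2)) WD_mul WD_one := by
      refine sum_mem fun ω _ => mul_mem ?_ (hτ1 ω)
      rw [PowerSeries.algebraMap_apply]
      exact C_mem_FS (WD_C _)
    exact this
  obtain ⟨Δ, hΔ0, hΔd, hΔ⟩ := bertini_core hD0 y hydeg Φ hΦm hΦi hΦd hΦ1 (hvan (iotaV k (m + 2)) Φ hΦ2)
  refine ⟨Δ, hΔ0, hΔd, fun v hv => ?_⟩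
  let h : RV k (m + 2) →ₐ[k] k := MvPolynomial.aeval v
  have hh : (h : RV k (m + 2) →+* k) = MvPolynomial.eval v := by
    ext <;> simp [h]
  have hv' : (fun i => h (MvPolynomial.X i)) = v := by funext i; simp [h]
  refine ⟨fun ω => PowerSeries.map (h : RV k (m + 2) →+* k) (τ ω), hinj h, ?_, hyinj h, ?_⟩
  · intro j
    rw [PF_psi, ← hPF h]
    simp only [h, MvPolynomial.aeval_X]
  · obtain ⟨Ψ, hΨ1, hΨ2⟩ := phi_exists hm fu hD.hfu t0 G hD.hu δ hδ _ ℓ _ (hinj h) (hPF h) lam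
    refine ⟨Ψ, ?_, hΨ2⟩
    rw [← hDe, ← hκ] at hΨ1
    have hψ : Function.Injective (psiX k) := psiX_inj
    have hΨm : Ψ.Monic := by
      refine monic_of_injective hψ ?_
      rw [hΨ2]; exact monic_prod_X_sub_C _ _
    have hΨd : Ψ.natDegree = D := by
      rw [← natDegree_map_eq_of_injective hψ, hΨ2, natDegree_prod_of_monic _ _ (fun _ _ => monic_X_sub_C _)]
      simp only [natDegree_X_sub_C, Finset.sum_const, smul_eq_mul, mul_one, Finset.card_univ, hDe]
    have hΨv := hvan h Ψ hΨ2
    rw [hh] at hΨv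
    refine (Monic.irreducible_iff_natDegree hΨm).2 ⟨?_, ?_⟩
    · intro e
      rw [e, natDegree_one] at hΨd
      omega
    · intro A B hAm hBm hAB
      have h2 := hAm.natDegree_mul hBm
      rw [hAB, hΨd] at h2
      have hA : SD A κ := by rw [← hAB] at hΨ1; exact hΨ1.of_mul hAm.ne_zero hBm.ne_zero
      have hB : SD B κ := by rw [← hAB, mul_comm] at hΨ1; exact hΨ1.of_mul hBm.ne_zero hAm.ne_zero
      rw [← hAB, map_mul, mul_eq_zero] at hΨv
      by_contra hcon
      push Not at hcon
      rcases hΨv with h3 | h3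
      · exact hΔ v hv A hAm.ne_zero (by omega) hA h3
      · exact hΔ v hv B hBm.ne_zero (by omega) hB h3
end B
end BH

namespace BH

section A
variable {k : Type*} [Field k]

lemma bad_pts (Φ h : k[X][X]) (hirr : Irreducible Φ) (hd : Φ.natDegree ≠ 0) (hdvd : ¬ Φ ∣ h) (e1 e2 : ℕ)
    (h1 : SD Φ e1) (h2 : SD h e2) :
    ∃ R : k[X], R ≠ 0 ∧ R.natDegree ≤ Φ.natDegree * e2 + h.natDegree * e1 ∧
      ∀ s y : k, ev s y Φ = 0 → ev s y h = 0 → R.eval s = 0 := by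
  refine ⟨Φ.resultant h, ?_, natDegree_resultant_le _ _ _ _ _ _ h1 h2, ?_⟩
  · let K := FractionRing k[X]
    let φ := algebraMap k[X] K
    have hinj : Function.Injective φ := IsFractionRing.injective _ _
    have hpr : Φ.IsPrimitive := hirr.isPrimitive hd
    have h1 : Irreducible (Φ.map φ) :=
      (hpr.irreducible_iff_irreducible_map_fraction_map).1 hirr
    have h2 : ¬ Φ.map φ ∣ h.map φ := by rwa [← hpr.dvd_iff_fraction_map_dvd_fraction_map K]
    have h3 : IsCoprime (Φ.map φ) (h.map φ) := (h1.coprime_iff_not_dvd).2 h2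
    have h4 := resultant_ne_zero _ _ h3
    rw [natDegree_map_eq_of_injective hinj, natDegree_map_eq_of_injective hinj,
      resultant_map_map] at h4
    intro h0; rw [h0, map_zero] at h4; exact h4 rfl
  · intro s y hs hy
    obtain ⟨A, B, -, -, hAB⟩ := exists_mul_add_mul_eq_C_resultant Φ h (le_refl Φ.natDegree) (le_refl h.natDegree) (Or.inl hd)
    have := congrArg (ev s y) hAB
    rw [map_add, map_mul, map_mul, hs, hy, zero_mul, zero_mul, add_zero, ev_C] at this
    rw [← coe_aeval_eq_eval]; exact this.symm

/-- avoid finitely many polynomial conditions -/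
lemma exists_lam [Infinite k] {J Ω : Type*} [Fintype J] [DecidableEq J] [Fintype Ω] [DecidableEq Ω] (ℓ : Ω → J) (r : Ω → k)
    (hr : Function.Injective r) : ∃ lam : Ω → k, Function.Injective fun g : SL ℓ => ∑ ω, lam ω * r (g.1 ω) := by
  classical
  let Q : MvPolynomial Ω k := ∏ x ∈ (Finset.univ : Finset (SL ℓ × SL ℓ)).filter (fun x => x.1 ≠ x.2),
    (∑ ω, MvPolynomial.X ω * MvPolynomial.C (r (x.1.1 ω) - r (x.2.1 ω)))
  have hQ : Q ≠ 0 := by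
    refine Finset.prod_ne_zero_iff.2 fun x hx => ?_
    intro h0
    have hne := (Finset.mem_filter.1 hx).2
    apply hne
    refine Subtype.ext (Equiv.ext fun ω => ?_)
    apply hr
    have := congrArg (MvPolynomial.eval (Pi.single ω (1 : k))) h0
    rw [map_sum, Finset.sum_eq_single ω] at this
    · simpa [sub_eq_zero] using this
    · intro b _ hb; simp [Pi.single_apply, hb]
    · simp
  obtain ⟨lam, hl⟩ : ∃ lam, MvPolynomial.eval lam Q ≠ 0 := by
    by_contra hcon
    push Not at hcon
    exact hQ (MvPolynomial.funext fun x => by rw [hcon x, map_zero])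
  refine ⟨lam, fun g g' e => ?_⟩
  by_contra hne
  apply hl
  rw [map_prod]
  refine Finset.prod_eq_zero (i := (g, g')) (Finset.mem_filter.2 ⟨Finset.mem_univ _, hne⟩) ?_
  rw [map_sum]
  simp only at e
  simp only [map_mul, MvPolynomial.eval_X, MvPolynomial.eval_C, mul_sub, Finset.sum_sub_distrib, e, sub_self]

lemma not_dvd_deriv {p : ℕ} [CharP k p] (P : k[X][X]) (h0 : P.natDegree ≠ 0) (hp : P.natDegree < p) : ¬ P ∣ derivative P := by
  intro h
  have hd : derivative P ≠ 0 := by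
    intro hd
    have := congrArg (fun Q => Q.coeff (P.natDegree - 1)) hd
    simp only [coeff_derivative, coeff_zero] at this
    rw [Nat.sub_add_cancel (Nat.pos_of_ne_zero h0), mul_eq_zero] at this
    rcases this with h1 | h1
    · rw [coeff_natDegree, leadingCoeff_eq_zero] at h1; simp [h1] at h0
    · have h2 : ((P.natDegree : ℕ) : k[X]) = 0 := by
        rw [← h1, ← Nat.cast_one (R := k[X]), ← Nat.cast_add, Nat.sub_add_cancel (Nat.pos_of_ne_zero h0)]
      rw [CharP.cast_eq_zero_iff k[X] p] at h2
      exact absurd (Nat.le_of_dvd (Nat.pos_of_ne_zero h0) h2) (by omega)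
  have := natDegree_le_of_dvd h hd
  have := natDegree_derivative_lt h0
  omega

end A
end BH

namespace BH

section A
variable {k : Type*} [Field k]

/-- the family of geometric factors -/
structure GFam (k J : Type*) [Field k] [Fintype J] (n p N0 : ℕ) (G : J → k[X][X]) : Prop where
  irr : ∀ j, Irreducible (G j)
  deg : ∀ j, (G j).natDegree ≠ 0
  hp : ∀ j, NN n (G j) < p
  na : ∀ i j, i ≠ j → ¬ Associated (G i) (G j)
  cJ : Fintype.card J ≤ N0
  cN : ∀ j, NN n (G j) ≤ N0

lemma SD.derivative {P : k[X][X]} {d : ℕ} (h : SD P d) : SD (derivative P) d := by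
  intro i
  rw [coeff_derivative]
  refine natDegree_mul_le.trans ?_
  have : ((i : k[X]) + 1).natDegree = 0 := by
    rw [← Nat.cast_one, ← Nat.cast_add]; exact natDegree_natCast _
  rw [this]; exact h _

variable {J : Type*} [Fintype J] [DecidableEq J]

lemma GFam.deg_le {n p N0 : ℕ} {G : J → k[X][X]} (h : GFam k J n p N0 G) (hn : n ≠ 0) (j : J) : (G j).natDegree ≤ NN n (G j) :=
  (Nat.le_mul_of_pos_right _ (Nat.pos_of_ne_zero hn)).trans (le_NN n (G j) (h.irr j).ne_zero)

lemma SD_NN (n : ℕ) (G : k[X][X]) : SD G (NN n G) := by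
  intro i
  by_cases hi : G.coeff i = 0
  · rw [hi]; simp
  · exact (Nat.le_add_right _ _).trans (NN_le n G i hi)

/-- abstract: combined bad set for a family of irreducible polynomials -/
lemma bad_fam {p N0 : ℕ} [CharP k p] (H : J → k[X][X]) (irr : ∀ j, Irreducible (H j)) (deg : ∀ j, (H j).natDegree ≠ 0)
    (hp : ∀ j, (H j).natDegree < p) (na : ∀ i j, i ≠ j → ¬ Associated (H i) (H j)) (cJ : Fintype.card J ≤ N0)
    (cN : ∀ j, (H j).natDegree ≤ N0) (cS : ∀ j, SD (H j) N0) :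
    ∃ R : k[X], R ≠ 0 ∧ R.natDegree ≤ N0 * N0 * (N0 * N0 + N0 * N0) ∧ ∀ s, R.eval s ≠ 0 →
      ∀ j y, ev s y (H j) = 0 → ev s y (derivative (H j)) ≠ 0 ∧ ∀ i, i ≠ j → ev s y (H i) ≠ 0 := by
  have key : ∀ x : J × J, ∃ R : k[X], R ≠ 0 ∧ R.natDegree ≤ N0 * N0 + N0 * N0 ∧ ∀ s, R.eval s ≠ 0 → ∀ y, ev s y (H x.1) = 0 →
      (x.2 = x.1 → ev s y (derivative (H x.1)) ≠ 0) ∧ (x.2 ≠ x.1 → ev s y (H x.2) ≠ 0) := by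
    rintro ⟨j, i⟩
    by_cases hij : i = j
    · subst hij
      obtain ⟨R, h1, h2, h3⟩ := bad_pts (H i) (derivative (H i)) (irr i) (deg i) (not_dvd_deriv (p := p) _ (deg i) (hp i)) N0 N0 (cS i) (cS i).derivative
      refine ⟨R, h1, h2.trans ?_, fun s hs y hy => ⟨fun _ h => hs (h3 s y hy h), fun h => absurd rfl h⟩⟩
      exact add_le_add (Nat.mul_le_mul_right _ (cN i)) (Nat.mul_le_mul_right _ ((natDegree_derivative_le _).trans ((Nat.sub_le _ _).trans (cN i))))
    · obtain ⟨R, h1, h2, h3⟩ := bad_pts (H j) (H i) (irr j) (deg j)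
        (fun hd => na j i (Ne.symm hij) (((irr j).dvd_irreducible_iff_associated (irr i)).1 hd)) N0 N0 (cS j) (cS i)
      refine ⟨R, h1, h2.trans ?_, fun s hs y hy => ⟨fun h => absurd h hij, fun _ h => hs (h3 s y hy h)⟩⟩
      exact add_le_add (Nat.mul_le_mul_right _ (cN j)) (Nat.mul_le_mul_right _ (cN i))
  choose R h1 h2 h3 using key
  refine ⟨∏ x, R x, Finset.prod_ne_zero_iff.2 fun x _ => h1 x, ?_, ?_⟩
  · refine (natDegree_prod_le _ _).trans ((Finset.sum_le_card_nsmul _ _ _ fun x _ => h2 x).trans ?_)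
    rw [smul_eq_mul, Finset.card_univ, Fintype.card_prod]
    exact Nat.mul_le_mul_right _ (Nat.mul_le_mul cJ cJ)
  · intro s hs j y hy
    rw [eval_prod, Finset.prod_ne_zero_iff] at hs
    exact ⟨(h3 (j, j) s (hs _ (Finset.mem_univ _)) y hy).1 rfl, fun i hij => (h3 (j, i) s (hs _ (Finset.mem_univ _)) y hy).2 hij⟩

lemma choose_t0 [IsAlgClosed k] {n p N0 : ℕ} [CharP k p] (hn : n ≠ 0) {G : J → k[X][X]} (h : GFam k J n p N0 G) (fu : k[X]) (hfu : fu.natDegree ≤ n)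
    (hu : ∀ j, (uu n (G j)).eval (fu.coeff n) ≠ 0) :
    ∃ R : k[X], R ≠ 0 ∧ R.natDegree ≤ N0 * N0 * (N0 * N0 + N0 * N0) + N0 * (N0 + N0) ∧ ∀ t0, R.eval t0 ≠ 0 → GDat k J n p fu t0 G := by
  obtain ⟨R, h1, h2, h3⟩ := bad_fam (p := p) G h.irr h.deg (fun j => (h.deg_le hn j).trans_lt (h.hp j)) h.na h.cJ
    (fun j => (h.deg_le hn j).trans (h.cN j)) (fun j => (SD_NN n (G j)).mono (h.cN j))
  have hE : ∀ j, ev (k := k) (X : k[X]) fu (G j) ≠ 0 := by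
    intro j h0
    have := ev_coeff_NN n (G j) fu hfu (fu.coeff n) rfl
    rw [h0, coeff_zero] at this
    exact hu j this.symm
  refine ⟨R * ∏ j, ((G j).leadingCoeff * ev (k := k) (X : k[X]) fu (G j)), ?_, ?_, ?_⟩
  · refine mul_ne_zero h1 (Finset.prod_ne_zero_iff.2 fun j _ => mul_ne_zero (leadingCoeff_ne_zero.2 (h.irr j).ne_zero) (hE j))
  · refine natDegree_mul_le.trans (add_le_add h2 ((natDegree_prod_le _ _).trans ((Finset.sum_le_card_nsmul _ _ (N0 + N0) fun j _ => ?_).trans ?_)))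
    · refine natDegree_mul_le.trans (add_le_add ((SD_NN n (G j) _).trans (h.cN j)) ((ev_natDegree_le n _ _ hfu).trans (h.cN j)))
    · rw [smul_eq_mul, Finset.card_univ]
      exact Nat.mul_le_mul_right _ h.cJ
  · intro t0 ht
    rw [eval_mul] at ht
    have ht1 := left_ne_zero_of_mul ht
    have ht2 := right_ne_zero_of_mul ht
    rw [eval_prod, Finset.prod_ne_zero_iff] at ht2
    refine ⟨hfu, h.irr, h.deg, hu, h.hp, fun j => ?_⟩
    have ht3 := ht2 j (Finset.mem_univ _)
    rw [eval_mul] at ht3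
    have hl := left_ne_zero_of_mul ht3
    have he := right_ne_zero_of_mul ht3
    obtain ⟨x0, hx0⟩ : ∃ x0, ev t0 x0 (G j) = 0 := by
      have hd : ((G j).map (evalRingHom t0)).natDegree = (G j).natDegree :=
        natDegree_map_of_leadingCoeff_ne_zero _ hl
      obtain ⟨x, hx⟩ := IsAlgClosed.exists_root ((G j).map (evalRingHom t0)) (by
        intro h0
        have := natDegree_eq_zero_iff_degree_le_zero.2 h0.le
        exact h.deg j (hd ▸ this))
      refine ⟨x, ?_⟩
      rw [ev_eq_eval_map]
      exact hx
    obtain ⟨h4, h5⟩ := h3 t0 ht1 j x0 hx0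
    refine ⟨x0, hx0, h4, ?_, h5⟩
    rintro rfl
    apply he
    have := hom_ev (aeval t0 : k[X] →ₐ[k] k) (X : k[X]) fu (G j)
    rw [aeval_X, coe_aeval_eq_eval] at this
    rw [this]; exact hx0

/-- shear automorphism `G(T,x) ↦ G(T, A(T)+b)` in `k[b][T]` -/
noncomputable def shear (A : k[X]) : k[X][X] ≃ₐ[k] k[X][X] :=
  ((algEquivAevalXAddC A).restrictScalars k).trans (Bivariate.swap (R := k))

lemma shear_apply (A : k[X]) (G : k[X][X]) : shear A G = ev (k := k) (X : k[X][X]) (A.map C + C X) G := by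
  have h1 : ev (k := k) (C X : k[X][X]) X G = G := by rw [ev_C_X, comp_X]
  conv_lhs => rw [← h1]
  have := hom_ev (shear A).toAlgHom (C X : k[X][X]) X G
  have h2 : (shear A).toAlgHom (C X) = X := by
    change Bivariate.swap (algEquivAevalXAddC A (C X)) = X
    rw [show (algEquivAevalXAddC A (C X) : k[X][X]) = C X from (algEquivAevalXAddC A).commutes X, Bivariate.swap_C]
    simp
  have h3 : (shear A).toAlgHom X = A.map C + C X := by
    change Bivariate.swap (algEquivAevalXAddC A X) = _
    rw [show (algEquivAevalXAddC A X : k[X][X]) = X + C A by simp [algEquivAevalXAddC], map_add, Bivariate.swap_Y, Bivariate.swap_C, add_comm]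
  rw [h2, h3] at this
  exact this

lemma choose_b {n p N0 : ℕ} [CharP k p] (hn : n ≠ 0) {G : J → k[X][X]} (h : GFam k J n p N0 G) (α : k)
    (hu : ∀ j, (uu n (G j)).eval α ≠ 0) :
    ∃ R : k[X], R ≠ 0 ∧ R.natDegree ≤ N0 * N0 * (N0 * N0 + N0 * N0) ∧ ∀ b, R.eval b ≠ 0 →
      ∀ j y, (ev (k := k) (X : k[X]) (C α * X ^ n + C b) (G j)).eval y = 0 →
        (derivative (ev (k := k) (X : k[X]) (C α * X ^ n + C b) (G j))).eval y ≠ 0 ∧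
        ∀ i, i ≠ j → (ev (k := k) (X : k[X]) (C α * X ^ n + C b) (G i)).eval y ≠ 0 := by
  set A : k[X] := C α * X ^ n with hA
  have hm : ∀ b j, (shear A (G j)).map (evalRingHom b) = ev (k := k) (X : k[X]) (A + C b) (G j) := by
    intro b j
    rw [shear_apply]
    have := hom_ev (mapAlgHom (aeval b : k[X] →ₐ[k] k)) (X : k[X][X]) (A.map C + C X) (G j)
    have e1 : (mapAlgHom (aeval b : k[X] →ₐ[k] k)) (X : k[X][X]) = X := by simp
    have e2 : (mapAlgHom (aeval b : k[X] →ₐ[k] k)) (A.map C + C X : k[X][X]) = A + C b := by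
      rw [hA]; simp
    rw [e1, e2] at this
    exact this
  have hev : ∀ b y (Q : k[X][X]), ev b y Q = (Q.map (evalRingHom b)).eval y := fun b y Q => ev_eq_eval_map _ _ _
  have hdeg : ∀ j, (shear A (G j)).natDegree = NN n (G j) := by
    intro j
    have hf1 : (A.map C + C X : k[X][X]).natDegree ≤ n := by
      refine natDegree_add_le_of_degree_le (natDegree_map_le.trans (natDegree_C_mul_X_pow_le _ _)) (by simp)
    have hf2 : (A.map C + C X : k[X][X]).coeff n = algebraMap k k[X] α := by
      rw [hA]; simp [coeff_C, hn]
    have h2 := (PP_monic n (G j) (A.map C + C X : k[X][X]) hf1 α hf2 (hu j)).2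
    rw [shear_apply, ← C_mul_PP (hu j), natDegree_C_mul]
    · exact h2
    · simpa using hu j
  obtain ⟨R, h1, h2, h3⟩ := bad_fam (p := p) (N0 := N0) (fun j => shear A (G j)) (fun j => (MulEquiv.irreducible_iff (shear A)).2 (h.irr j))
    (fun j => by rw [hdeg]; exact (lt_of_lt_of_le (Nat.pos_of_ne_zero (h.deg j)) (h.deg_le hn j)).ne')
    (fun j => by rw [hdeg]; exact h.hp j)
    (fun i j hij hass => h.na i j hij (by
      have := hass.map (shear A).symm.toAlgHom.toRingHom.toMonoidHom
      simpa using this)) h.cJ (fun j => by rw [hdeg]; exact h.cN j)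
    (fun j => by
      rw [shear_apply]
      refine (SD_ev (k := k) _ ?_ (G j)).mono ((h.deg_le hn j).trans (h.cN j))
      exact ((SD_map_C A).mono (by simp)).add (SD_C (by simp)))
  refine ⟨R, h1, h2, fun b hb j y hy => ?_⟩
  have := h3 b hb j y (by rw [hev, hm]; exact hy)
  rw [hev, ← derivative_map, hm] at this
  refine ⟨this.1, fun i hi => ?_⟩
  have := this.2 i hi
  rwa [hev, hm] at this

end A
end BH

namespace BH

section A
variable {k : Type*} [Field k]
variable {J Ω : Type*} [Fintype J] [DecidableEq J] [Fintype Ω] [DecidableEq Ω]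

lemma enum_roots [IsAlgClosed k] (ℓ : Ω → J) (Q : J → k[X]) (hQ : ∀ j, (Q j).Monic)
    (hc : ∀ j, (Q j).natDegree = (Finset.univ.filter fun ω => ℓ ω = j).card)
    (hs : ∀ j y, (Q j).eval y = 0 → (derivative (Q j)).eval y ≠ 0 ∧ ∀ i, i ≠ j → (Q i).eval y ≠ 0) :
    ∃ r : Ω → k, Function.Injective r ∧ ∀ j, Q j = ∏ ω with ℓ ω = j, (X - C (r ω)) := by
  classical
  have hcard : ∀ j, ((Q j).roots.toFinset).card = (Finset.univ.filter fun ω => ℓ ω = j).card := by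
    intro j
    rw [← hc, Multiset.toFinset_card_of_nodup]
    · exact (IsAlgClosed.splits (Q j)).natDegree_eq_card_roots.symm
    · rw [Multiset.nodup_iff_count_le_one]
      intro a
      rw [count_roots]
      by_contra hcon
      push Not at hcon
      have h1 := (one_lt_rootMultiplicity_iff_isRoot (hQ j).ne_zero).1 hcon
      exact (hs j a h1.1).1 h1.2
  have hE : ∀ j, Nonempty ({ω // ω ∈ Finset.univ.filter fun ω => ℓ ω = j} ≃ {x // x ∈ (Q j).roots.toFinset}) := fun j =>
    ⟨Finset.equivOfCardEq (hcard j).symm⟩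
  let E := fun j => (hE j).some
  let r : Ω → k := fun ω => (E (ℓ ω) ⟨ω, by simp⟩).1
  have hr0 : ∀ ω, (Q (ℓ ω)).eval (r ω) = 0 := by
    intro ω
    have := (E (ℓ ω) ⟨ω, by simp⟩).2
    rw [Multiset.mem_toFinset, mem_roots (hQ _).ne_zero] at this
    exact this
  have hr1 : ∀ j ω (h : ℓ ω = j), r ω = (E j ⟨ω, by simpa using h⟩).1 := by
    rintro j ω rfl; rfl
  have hr : Function.Injective r := by
    intro a b hab
    by_cases hl : ℓ a = ℓ b
    · rw [hr1 (ℓ b) a hl, hr1 (ℓ b) b rfl] at hab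
      have := (E (ℓ b)).injective (Subtype.ext hab)
      exact congrArg Subtype.val this
    · exfalso
      have h1 := hr0 a
      have h2 := hr0 b
      rw [hab] at h1
      exact (hs (ℓ b) _ h2).2 _ hl h1
  refine ⟨r, hr, fun j => ?_⟩
  refine prod_of_roots _ r hr.injOn (Q j) (hQ j) (hc j) fun ω hω => ?_
  rw [← (Finset.mem_filter.1 hω).2]
  exact hr0 ω

lemma exists_ne {Fq : Type*} [Field Fq] [Fintype Fq] [Algebra Fq k] (R : k[X]) (hR : R ≠ 0) (h : R.natDegree < Fintype.card Fq) :
    ∃ a : Fq, R.eval (algebraMap Fq k a) ≠ 0 := by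
  classical
  by_contra hcon
  push Not at hcon
  have h1 : (Finset.univ.image (algebraMap Fq k)) ⊆ R.roots.toFinset := by
    intro x hx
    obtain ⟨a, -, rfl⟩ := Finset.mem_image.1 hx
    rw [Multiset.mem_toFinset, mem_roots hR]
    exact hcon a
  have h2 := Finset.card_le_card h1
  rw [Finset.card_image_of_injective _ (algebraMap Fq k).injective, Finset.card_univ] at h2
  have := (Multiset.toFinset_card_le R.roots).trans (card_roots' R)
  omega

theorem exists_base [IsAlgClosed k] {Fq : Type*} [Field Fq] [Fintype Fq] [Algebra Fq k] {M n p N0 : ℕ} [CharP k p] (hn : n ≠ 0)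
    {G : J → k[X][X]} (h : GFam k J n p N0 G) (α : Fq)
    (hu : ∀ j, (uu n (G j)).eval (algebraMap Fq k α) ≠ 0) (hq : N0 * N0 * (N0 * N0 + N0 * N0) + N0 * (N0 + N0) < Fintype.card Fq)
    (ℓ : Ω → J) (hc : ∀ j, (Finset.univ.filter fun ω => ℓ ω = j).card = NN n (G j)) :
    ∃ (fu : Fq[X]) (t0 : Fq) (r : Ω → k) (lam : Ω → k), fu.natDegree ≤ n ∧ fu.coeff n = α ∧
      GDat k J n p (fu.map (algebraMap Fq k)) (algebraMap Fq k t0) G ∧ Function.Injective r ∧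
      (∀ j, PF n (fu.map (algebraMap Fq k)) (algebraMap Fq k t0) (G j) (0 : k) (fun _ : Fin M => (0 : k)) = ∏ ω with ℓ ω = j, (X - C (r ω))) ∧
      Function.Injective fun g : SL ℓ => ∑ ω, lam ω * r (g.1 ω) := by
  obtain ⟨R, hR1, hR2, hR3⟩ := choose_b hn h _ hu
  obtain ⟨b, hb⟩ := exists_ne (Fq := Fq) R hR1 (by omega)
  have hb' := hR3 _ hb
  set fu : Fq[X] := C α * X ^ n + C b with hfu
  have hfm : fu.map (algebraMap Fq k) = C (algebraMap Fq k α) * X ^ n + C (algebraMap Fq k b) := by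
    rw [hfu]; simp
  have hfd : fu.natDegree ≤ n := natDegree_add_le_of_degree_le (natDegree_C_mul_X_pow_le _ _) (by simp)
  have hfc : fu.coeff n = α := by rw [hfu]; simp [coeff_C, hn]
  have hfc' : (fu.map (algebraMap Fq k)).coeff n = algebraMap Fq k α := by rw [coeff_map, hfc]
  have hfd' : (fu.map (algebraMap Fq k)).natDegree ≤ n := natDegree_map_le.trans hfd
  obtain ⟨R', hR1', hR2', hR3'⟩ := choose_t0 hn h (fu.map (algebraMap Fq k)) hfd' (fun j => by rw [hfc']; exact hu j)
  obtain ⟨t0, ht0⟩ := exists_ne (Fq := Fq) R' hR1' (by omega)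
  have hpf : ∀ j, PF n (fu.map (algebraMap Fq k)) (algebraMap Fq k t0) (G j) (0 : k) (fun _ : Fin M => (0 : k)) =
      C ((uu n (G j)).eval (algebraMap Fq k α))⁻¹ * ev (k := k) (X : k[X]) (C (algebraMap Fq k α) * X ^ n + C (algebraMap Fq k b)) (G j) := by
    intro j
    unfold PF PP FF
    rw [hfc', C_0, zero_mul, add_zero, Algebra.algebraMap_self, Polynomial.map_id, hfm]
    rfl
  have hm : ∀ j, (C ((uu n (G j)).eval (algebraMap Fq k α))⁻¹ * ev (k := k) (X : k[X]) (C (algebraMap Fq k α) * X ^ n + C (algebraMap Fq k b)) (G j)).Monic ∧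
     (C ((uu n (G j)).eval (algebraMap Fq k α))⁻¹ * ev (k := k) (X : k[X]) (C (algebraMap Fq k α) * X ^ n + C (algebraMap Fq k b)) (G j)).natDegree = NN n (G j) := by
    intro j
    exact PP_monic n (G j) _ (hfm ▸ hfd') (algebraMap Fq k α) (hfm ▸ hfc') (hu j)
  obtain ⟨r, hr1, hr2⟩ := enum_roots ℓ (fun j => C ((uu n (G j)).eval (algebraMap Fq k α))⁻¹ * ev (k := k) (X : k[X]) (C (algebraMap Fq k α) * X ^ n + C (algebraMap Fq k b)) (G j))
    (fun j => (hm j).1) (fun j => by rw [(hm j).2, hc]) (by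
      intro j y hy
      simp only [eval_mul, eval_C, mul_eq_zero, inv_eq_zero, hu j, false_or] at hy
      have := hb' j y hy
      refine ⟨?_, fun i hi => ?_⟩
      · rw [derivative_C_mul, eval_mul, eval_C]
        exact mul_ne_zero (inv_ne_zero (hu j)) this.1
      · rw [eval_mul, eval_C]
        exact mul_ne_zero (inv_ne_zero (hu i)) (this.2 i hi))
  obtain ⟨lam, hlam⟩ := exists_lam ℓ r hr1
  exact ⟨fu, t0, r, lam, hfd, hfc, hR3' _ ht0, hr1, fun j => by rw [hpf, hr2], hlam⟩

end A
end BH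

namespace BH

section A
set_option linter.unusedSectionVars false
variable {Fq k : Type*} [Field Fq] [Fintype Fq] [Field k] [IsAlgClosed k] [Algebra Fq k]
variable {p : ℕ} [Fact p.Prime] [CharP k p] {e0 : ℕ}

variable (Fq k) in
noncomputable abbrev bc : Fq[X][X] →+* k[X][X] := mapRingHom (mapRingHom (algebraMap Fq k))

variable (k p e0) in
noncomputable abbrev Fr : k[X][X] →+* k[X][X] := mapRingHom (mapRingHom (iterateFrobenius k p e0))

lemma bc_inj : Function.Injective (bc Fq k) :=
  Polynomial.map_injective _ (Polynomial.map_injective _ (algebraMap Fq k).injective)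


lemma frob_alg (hq : Fintype.card Fq = p ^ e0) (a : Fq) : iterateFrobenius k p e0 (algebraMap Fq k a) = algebraMap Fq k a := by
  rw [iterateFrobenius_def, ← hq, ← map_pow, FiniteField.pow_card]

lemma frob_fixed (hq : Fintype.card Fq = p ^ e0) (x : k) (hx : x ^ p ^ e0 = x) : ∃ a : Fq, algebraMap Fq k a = x := by
  classical
  by_contra hcon
  push Not at hcon
  have h1 : 1 < Fintype.card Fq := Fintype.one_lt_card
  have hne : (X ^ Fintype.card Fq - X : k[X]) ≠ 0 := FiniteField.X_pow_card_sub_X_ne_zero k h1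
  have hs : insert x (Finset.univ.image (algebraMap Fq k)) ⊆ (X ^ Fintype.card Fq - X : k[X]).roots.toFinset := by
    intro y hy
    rw [Multiset.mem_toFinset, mem_roots hne]
    rcases Finset.mem_insert.1 hy with rfl | hy
    · simp [hq, hx]
    · obtain ⟨a, -, rfl⟩ := Finset.mem_image.1 hy
      simp [← map_pow, FiniteField.pow_card]
  have h2 := Finset.card_le_card hs
  rw [Finset.card_insert_of_notMem (by simpa using hcon), Finset.card_image_of_injective _ (algebraMap Fq k).injective, Finset.card_univ] at h2
  have h3 := (Multiset.toFinset_card_le (X ^ Fintype.card Fq - X : k[X]).roots).trans (card_roots' _)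
  rw [FiniteField.X_pow_card_sub_X_natDegree_eq k h1] at h3
  omega

lemma descend1 (hq : Fintype.card Fq = p ^ e0) (P : k[X]) (hP : P.map (iterateFrobenius k p e0) = P) : ∃ H : Fq[X], H.map (algebraMap Fq k) = P := by
  rw [← mem_lifts, lifts_iff_coeff_lifts]
  intro i
  refine frob_fixed hq _ ?_
  have := congrArg (fun Q => Q.coeff i) hP
  simp only [coeff_map, iterateFrobenius_def] at this
  exact this

lemma descend2 (hq : Fintype.card Fq = p ^ e0) (P : k[X][X]) (hP : Fr k p e0 P = P) : ∃ H : Fq[X][X], bc Fq k H = P := by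
  have : P ∈ lifts (mapRingHom (algebraMap Fq k)) := by
    rw [lifts_iff_coeff_lifts]
    intro i
    refine descend1 hq _ ?_
    have := congrArg (fun Q => Q.coeff i) hP
    simp only [coe_mapRingHom, coeff_map] at this
    exact this
  exact (mem_lifts _).1 this

lemma Fr_bc (hq : Fintype.card Fq = p ^ e0) (F : Fq[X][X]) : Fr k p e0 (bc Fq k F) = bc Fq k F := by
  ext i j
  simp only [coe_mapRingHom, coeff_map, frob_alg hq]


instance : PerfectRing k p := inferInstance

variable (k p e0) in
noncomputable def FrE : k[X][X] ≃+* k[X][X] := mapEquiv (mapEquiv (iterateFrobeniusEquiv k p e0))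

lemma FrE_apply (G : k[X][X]) : FrE k p e0 G = Fr k p e0 G := by
  ext i j
  simp [FrE, coe_iterateFrobeniusEquiv]

/-- normalisation -/
noncomputable def lc2 (G : k[X][X]) : k := G.leadingCoeff.leadingCoeff

lemma lc2_ne {G : k[X][X]} (h : G ≠ 0) : lc2 G ≠ 0 := by
  unfold lc2; simpa using h

lemma lc2_C_mul (c : k) (G : k[X][X]) : lc2 (C (C c) * G) = c * lc2 G := by
  unfold lc2; simp [leadingCoeff_mul]

lemma isUnit_CC {G : k[X][X]} : IsUnit G ↔ ∃ c : k, c ≠ 0 ∧ C (C c) = G := by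
  rw [Polynomial.isUnit_iff]
  constructor
  · rintro ⟨r, hr, rfl⟩
    obtain ⟨c, hc, rfl⟩ := Polynomial.isUnit_iff.1 hr
    exact ⟨c, hc.ne_zero, rfl⟩
  · rintro ⟨c, hc, rfl⟩
    exact ⟨C c, Polynomial.isUnit_C.2 hc.isUnit, rfl⟩

lemma assoc_eq {G G' : k[X][X]} (h : Associated G G') (h1 : lc2 G = 1) (h2 : lc2 G' = 1) : G = G' := by
  obtain ⟨u, hu⟩ := h
  obtain ⟨c, hc, hcu⟩ := isUnit_CC.1 u.isUnit
  rw [← hcu, mul_comm] at hu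
  have := lc2_C_mul c G
  rw [hu, h1, h2, mul_one] at this
  rw [← hu, ← this]; simp

lemma lc2_Fr (G : k[X][X]) : lc2 (Fr k p e0 G) = iterateFrobenius k p e0 (lc2 G) := by
  unfold lc2
  have h1 : Function.Injective (mapRingHom (iterateFrobenius k p e0)) := Polynomial.map_injective _ (iterateFrobenius k p e0).injective
  rw [coe_mapRingHom, leadingCoeff_map_of_injective h1, coe_mapRingHom, leadingCoeff_map_of_injective (iterateFrobenius k p e0).injective]

open Classical in
/-- the normalised geometric factors -/
noncomputable def SS (P : k[X][X]) : Finset k[X][X] :=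
  (UniqueFactorizationMonoid.factors P).toFinset.image fun G => C (C (lc2 G)⁻¹) * G

lemma mem_SS {P : k[X][X]} (hP : P ≠ 0) (G : k[X][X]) : G ∈ SS P ↔ lc2 G = 1 ∧ Irreducible G ∧ G ∣ P := by
  classical
  unfold SS
  simp only [Finset.mem_image, Multiset.mem_toFinset]
  have hass : ∀ G : k[X][X], G ≠ 0 → Associated G (C (C (lc2 G)⁻¹) * G) := fun G hG =>
    (associated_unit_mul_left G _ (isUnit_CC.2 ⟨_, inv_ne_zero (lc2_ne hG), rfl⟩)).symm
  constructor
  · rintro ⟨G', hG', rfl⟩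
    have hirr := UniqueFactorizationMonoid.irreducible_of_factor _ hG'
    refine ⟨?_, ?_, ?_⟩
    · rw [lc2_C_mul, inv_mul_cancel₀ (lc2_ne hirr.ne_zero)]
    · exact (hass G' hirr.ne_zero).irreducible hirr
    · exact (hass G' hirr.ne_zero).symm.dvd.trans (UniqueFactorizationMonoid.dvd_of_mem_factors hG')
  · rintro ⟨h1, h2, h3⟩
    obtain ⟨G', hG', ha⟩ := UniqueFactorizationMonoid.exists_mem_factors_of_dvd hP h2 h3
    have hirr := UniqueFactorizationMonoid.irreducible_of_factor _ hG'
    refine ⟨G', hG', (assoc_eq (ha.trans (hass _ hirr.ne_zero)) h1 ?_).symm⟩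
    rw [lc2_C_mul, inv_mul_cancel₀ (lc2_ne hirr.ne_zero)]


lemma Fr_mem (hq : Fintype.card Fq = p ^ e0) {F : Fq[X][X]} (hF : F ≠ 0) {G : k[X][X]} (hG : G ∈ SS (bc Fq k F)) : Fr k p e0 G ∈ SS (bc Fq k F) := by
  have hF' : bc Fq k F ≠ 0 := by rwa [Ne, map_eq_zero_iff _ bc_inj]
  rw [mem_SS hF'] at hG ⊢
  refine ⟨by rw [lc2_Fr, hG.1, map_one], ?_, ?_⟩
  · rw [← FrE_apply, MulEquiv.irreducible_iff]; exact hG.2.1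
  · rw [← Fr_bc (k := k) (p := p) hq F]; exact _root_.map_dvd _ hG.2.2

lemma Fr_inj (hq : Fintype.card Fq = p ^ e0) : Function.Injective (Fr k p e0) :=
  Polynomial.map_injective _ (Polynomial.map_injective _ (iterateFrobenius k p e0).injective)

/-- a stable set of factors gives everything -/
lemma stable_assoc (hq : Fintype.card Fq = p ^ e0) {F : Fq[X][X]} (hF : Irreducible F) (s : Finset k[X][X]) (hs : s ⊆ SS (bc Fq k F)) (hne : s.Nonempty)
    (hst : ∀ G ∈ s, Fr k p e0 G ∈ s) : ∃ H : Fq[X][X], bc Fq k H = ∏ G ∈ s, G ∧ Associated H F := by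
  classical
  have hF' : bc Fq k F ≠ 0 := by rw [Ne, map_eq_zero_iff _ bc_inj]; exact hF.ne_zero
  have hs' := fun G (h : G ∈ s) => (mem_SS hF' G).1 (hs h)
  have hdvd : ∏ G ∈ s, G ∣ bc Fq k F := by
    refine Finset.prod_dvd_of_isRelPrime ?_ fun G hG => (hs' G hG).2.2
    intro a ha b hb hab
    refine ((hs' a ha).2.1.isRelPrime_iff_not_dvd).2 fun hd => hab ?_
    exact assoc_eq (((hs' a ha).2.1.dvd_irreducible_iff_associated (hs' b hb).2.1).1 hd) (hs' a ha).1 (hs' b hb).1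
  have hfix : Fr k p e0 (∏ G ∈ s, G) = ∏ G ∈ s, G := by
    rw [map_prod, ← Finset.prod_image (g := Fr k p e0) (f := fun x => x) (fun a _ b _ h => Fr_inj hq h)]
    congr 1
    refine Finset.eq_of_subset_of_card_le ?_ ?_
    · intro x hx
      obtain ⟨a, ha, rfl⟩ := Finset.mem_image.1 hx
      exact hst a ha
    · rw [Finset.card_image_of_injective _ (Fr_inj hq)]
  have hP0 : ∏ G ∈ s, G ≠ 0 := by
    rw [Finset.prod_ne_zero_iff]; exact fun G hG => (hs' G hG).2.1.ne_zero
  have hPd : ∀ G ∈ s, G ∣ ∏ G ∈ s, G := fun G hG => Finset.dvd_prod_of_mem _ hG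
  generalize (∏ G ∈ s, G) = Q at *
  obtain ⟨H, hH⟩ := descend2 hq _ hfix
  refine ⟨H, hH, ?_⟩
  obtain ⟨M, hM⟩ := hdvd
  have hMfix : Fr k p e0 M = M := by
    have := congrArg (Fr k p e0) hM
    rw [Fr_bc hq, map_mul, hfix, hM] at this
    exact (mul_left_cancel₀ hP0 this).symm
  obtain ⟨M', hM'⟩ := descend2 hq _ hMfix
  have hFH : F = H * M' := by
    apply bc_inj (k := k)
    rw [map_mul, hH, hM', hM]
  rcases hF.isUnit_or_isUnit hFH with h | h
  · exfalso
    have h2 := h.map (bc Fq k)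
    rw [hH] at h2
    obtain ⟨G, hG⟩ := hne
    exact (hs' G hG).2.1.not_isUnit (isUnit_of_dvd_unit (hPd G hG) h2)
  · have h3 := (associated_mul_unit_left H M' h).symm
    rwa [← hFH] at h3

lemma SS_nonempty (hq : Fintype.card Fq = p ^ e0) {F : Fq[X][X]} (hF : Irreducible F) (hd : 0 < F.natDegree) : (SS (bc Fq k F)).Nonempty := by
  classical
  have hF' : bc Fq k F ≠ 0 := by rw [Ne, map_eq_zero_iff _ bc_inj]; exact hF.ne_zero
  have hnu : ¬ IsUnit (bc Fq k F) := by
    intro h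
    have := natDegree_eq_zero_of_isUnit h
    rw [coe_mapRingHom, natDegree_map_eq_of_injective (Polynomial.map_injective _ (algebraMap Fq k).injective)] at this
    omega
  obtain ⟨G, hG⟩ := UniqueFactorizationMonoid.exists_mem_factors hF' hnu
  exact ⟨_, Finset.mem_image_of_mem _ (Multiset.mem_toFinset.2 hG)⟩

lemma SS_prod (hq : Fintype.card Fq = p ^ e0) {F : Fq[X][X]} (hF : Irreducible F) (hd : 0 < F.natDegree) : ∃ c : k, c ≠ 0 ∧ bc Fq k F = C (C c) * ∏ G ∈ SS (bc Fq k F), G := by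
  obtain ⟨H, h1, h2⟩ := stable_assoc (k := k) (p := p) hq hF (SS (bc Fq k F)) subset_rfl (SS_nonempty hq hF hd) (fun G hG => Fr_mem hq hF.ne_zero hG)
  obtain ⟨u, hu⟩ := h2.map (bc Fq k).toMonoidHom
  obtain ⟨c, hc, hcu⟩ := isUnit_CC.1 u.isUnit
  refine ⟨c, hc, ?_⟩
  rw [hcu, ← h1, mul_comm]
  exact hu.symm

lemma SS_card (hq : Fintype.card Fq = p ^ e0) {F : Fq[X][X]} (hF : Irreducible F) (hd : 0 < F.natDegree) :
    Multiset.card (UniqueFactorizationMonoid.factors (bc Fq k F)) = (SS (bc Fq k F)).card := by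
  have hF' : bc Fq k F ≠ 0 := by rw [Ne, map_eq_zero_iff _ bc_inj]; exact hF.ne_zero
  obtain ⟨c, hc, h⟩ := SS_prod (k := k) hq hF hd
  refine Multiset.card_eq_card_of_rel (UniqueFactorizationMonoid.factors_unique (f := UniqueFactorizationMonoid.factors (bc Fq k F)) (g := (SS (bc Fq k F)).val)
    (fun x hx => UniqueFactorizationMonoid.irreducible_of_factor x hx) (fun x hx => ((mem_SS hF' x).1 hx).2.1) ?_)
  refine (UniqueFactorizationMonoid.factors_prod hF').trans ?_
  rw [Finset.prod_val]
  conv_lhs => rw [h]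
  exact associated_unit_mul_left _ _ (isUnit_CC.2 ⟨c, hc, rfl⟩)

lemma SS_trans (hq : Fintype.card Fq = p ^ e0) {F : Fq[X][X]} (hF : Irreducible F) {G G' : k[X][X]} (hG : G ∈ SS (bc Fq k F)) (hG' : G' ∈ SS (bc Fq k F)) :
    ∃ a, (Fr k p e0)^[a] G = G' := by
  classical
  have hF' : bc Fq k F ≠ 0 := by rw [Ne, map_eq_zero_iff _ bc_inj]; exact hF.ne_zero
  obtain ⟨H, h1, h2⟩ := stable_assoc (k := k) (p := p) hq hF ((SS (bc Fq k F)).filter fun G' => ∃ a, (Fr k p e0)^[a] G = G')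
    (Finset.filter_subset _ _) ⟨G, Finset.mem_filter.2 ⟨hG, 0, rfl⟩⟩ (by
      intro x hx
      obtain ⟨h3, a, ha⟩ := Finset.mem_filter.1 hx
      refine Finset.mem_filter.2 ⟨Fr_mem hq hF.ne_zero h3, a + 1, ?_⟩
      rw [Function.iterate_succ_apply', ha])
  have h3 := (mem_SS hF' G').1 hG'
  have h4 : G' ∣ bc Fq k H := h3.2.2.trans (_root_.map_dvd _ h2.symm.dvd)
  rw [h1] at h4
  obtain ⟨x, hx, hd⟩ := h3.2.1.prime.exists_mem_finset_dvd h4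
  obtain ⟨h5, a, ha⟩ := Finset.mem_filter.1 hx
  have h6 := (mem_SS hF' x).1 h5
  have := assoc_eq ((h3.2.1.dvd_irreducible_iff_associated h6.2.1).1 hd) h3.1 h6.1
  exact ⟨a, ha.trans this.symm⟩

lemma SS_disj (hq : Fintype.card Fq = p ^ e0) {F F' : Fq[X][X]} (hF : Irreducible F) (hF' : Irreducible F') (hna : ¬ Associated F F') {G G' : k[X][X]}
    (hG : G ∈ SS (bc Fq k F)) (hG' : G' ∈ SS (bc Fq k F')) : ¬ Associated G G' := by
  classical
  intro ha
  have h0 : bc Fq k F ≠ 0 := by rw [Ne, map_eq_zero_iff _ bc_inj]; exact hF.ne_zero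
  have h0' : bc Fq k F' ≠ 0 := by rw [Ne, map_eq_zero_iff _ bc_inj]; exact hF'.ne_zero
  have : G = G' := assoc_eq ha ((mem_SS h0 _).1 hG).1 ((mem_SS h0' _).1 hG').1
  subst this
  have hst : ∀ x ∈ SS (bc Fq k F) ∩ SS (bc Fq k F'), Fr k p e0 x ∈ SS (bc Fq k F) ∩ SS (bc Fq k F') := by
    intro x hx
    rw [Finset.mem_inter] at hx ⊢
    exact ⟨Fr_mem hq hF.ne_zero hx.1, Fr_mem hq hF'.ne_zero hx.2⟩
  obtain ⟨H, h1, h2⟩ := stable_assoc (k := k) (p := p) hq hF _ Finset.inter_subset_left ⟨G, Finset.mem_inter.2 ⟨hG, hG'⟩⟩ hst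
  obtain ⟨H', h1', h2'⟩ := stable_assoc (k := k) (p := p) hq hF' _ Finset.inter_subset_right ⟨G, Finset.mem_inter.2 ⟨hG, hG'⟩⟩ hst
  have : H = H' := bc_inj (h1.trans h1'.symm)
  subst this
  exact hna (h2.symm.trans h2')

lemma SS_deg (hq : Fintype.card Fq = p ^ e0) {F : Fq[X][X]} (hF : Irreducible F) (hd : 0 < F.natDegree) {G : k[X][X]} (hG : G ∈ SS (bc Fq k F)) : G.natDegree ≠ 0 := by
  classical
  have hF' : bc Fq k F ≠ 0 := by rw [Ne, map_eq_zero_iff _ bc_inj]; exact hF.ne_zero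
  intro h0
  have hall : ∀ G' ∈ SS (bc Fq k F), G'.natDegree = 0 := by
    intro G' hG'
    obtain ⟨a, ha⟩ := SS_trans (p := p) hq hF hG hG'
    rw [← ha, ← h0]
    clear ha
    induction a with
    | zero => rfl
    | succ a ih =>
      rw [Function.iterate_succ_apply', coe_mapRingHom, natDegree_map_eq_of_injective (Polynomial.map_injective _ (iterateFrobenius k p e0).injective)]
      exact ih
  obtain ⟨c, hc, h⟩ := SS_prod (k := k) hq hF hd
  have h2 : (bc Fq k F).natDegree = 0 := by
    rw [h, natDegree_C_mul (by simpa using hc), natDegree_prod _ _ (fun G hG => ((mem_SS hF' G).1 hG).2.1.ne_zero)]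
    exact Finset.sum_eq_zero hall
  rw [coe_mapRingHom, natDegree_map_eq_of_injective (Polynomial.map_injective _ (algebraMap Fq k).injective)] at h2
  omega

end A
end BH

namespace BH

section Grp
set_option linter.unusedSectionVars false
variable {I J Ω : Type*} [Fintype I] [DecidableEq I] [Fintype J] [DecidableEq J] [Fintype Ω] [DecidableEq Ω]

lemma pm_ai (g : Equiv.Perm Ω) (x : Ω) : g (g⁻¹ x) = x := by
  rw [← Equiv.Perm.mul_apply, mul_inv_cancel, Equiv.Perm.one_apply]

lemma pm_ia (g : Equiv.Perm Ω) (x : Ω) : g⁻¹ (g x) = x := by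
  rw [← Equiv.Perm.mul_apply, inv_mul_cancel, Equiv.Perm.one_apply]

open Classical in
/-- permutations lying over `ρ`, transitive on all blocks -/
noncomputable def TT (β : J → I) (ℓ : Ω → J) (ρ : Equiv.Perm J) : Finset (Equiv.Perm Ω) :=
  Finset.univ.filter fun π => (∀ ω, ℓ (π ω) = ρ (ℓ ω)) ∧ ∀ ω ω', β (ℓ ω) = β (ℓ ω') → π.SameCycle ω ω'

lemma mem_TT (β : J → I) (ℓ : Ω → J) (ρ : Equiv.Perm J) (π : Equiv.Perm Ω) : π ∈ TT β ℓ ρ ↔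
    (∀ ω, ℓ (π ω) = ρ (ℓ ω)) ∧ ∀ ω ω', β (ℓ ω) = β (ℓ ω') → π.SameCycle ω ω' := by
  unfold TT; simp

lemma lab_zpow {ℓ : Ω → J} {ρ : Equiv.Perm J} {π : Equiv.Perm Ω} (h : ∀ ω, ℓ (π ω) = ρ (ℓ ω)) (a : ℤ) (ω : Ω) :
    ℓ ((π ^ a) ω) = (ρ ^ a) (ℓ ω) := by
  induction a using Int.induction_on generalizing ω with
  | zero => simp
  | succ a ih => rw [zpow_add_one, zpow_add_one, Equiv.Perm.mul_apply, Equiv.Perm.mul_apply, ih, h]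
  | pred a ih =>
    rw [zpow_sub_one, zpow_sub_one, Equiv.Perm.mul_apply, Equiv.Perm.mul_apply, ih]
    congr 1
    rw [Equiv.Perm.eq_inv_iff_eq, ← h, pm_ai]

lemma bl_zpow {I' : Type*} {β : J → I'} {ρ : Equiv.Perm J} (h : ∀ j, β (ρ j) = β j) (a : ℤ) (j : J) :
    β ((ρ ^ a) j) = β j := by
  induction a using Int.induction_on generalizing j with
  | zero => simp
  | succ a ih => rw [zpow_add_one, Equiv.Perm.mul_apply, ih, h]
  | pred a ih =>
    rw [zpow_sub_one, Equiv.Perm.mul_apply, ih, ← h, pm_ai]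

lemma TT_conj (β : J → I) (ℓ : Ω → J) (ρ : Equiv.Perm J) (π : Equiv.Perm Ω) (hπ : π ∈ TT β ℓ ρ) (g : Equiv.Perm Ω) (hg : g ∈ SL ℓ) :
    g * π * g⁻¹ ∈ TT β ℓ ρ := by
  rw [mem_SL] at hg
  have hg' : ∀ ω, ℓ (g⁻¹ ω) = ℓ ω := fun ω => by rw [← hg (g⁻¹ ω), pm_ai]
  rw [mem_TT] at hπ ⊢
  refine ⟨fun ω => ?_, fun ω ω' h => ?_⟩
  · rw [Equiv.Perm.mul_apply, Equiv.Perm.mul_apply, hg, hπ.1, hg']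
  · rw [Equiv.Perm.sameCycle_conj]
    exact hπ.2 _ _ (by rwa [hg', hg'])

lemma per_key {β : J → I} {ℓ : Ω → J} {ρ : Equiv.Perm J} (hρ : ∀ j, β (ρ j) = β j) (σ : Equiv.Perm Ω) (x : Ω)
    (h1 : ∀ ω, ℓ (σ ω) = ρ (ℓ ω)) (h2 : ∀ ω ω', β (ℓ ω) = β (ℓ ω') → σ.SameCycle ω ω') (a b : ℤ) :
    (σ ^ a) x = (σ ^ b) x ↔ (((Finset.univ.filter fun y => β (ℓ y) = β (ℓ x)).card : ℕ) : ℤ) ∣ a - b := by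
  classical
  have h3 : Function.minimalPeriod (σ • ·) x = (Finset.univ.filter fun y => β (ℓ y) = β (ℓ x)).card := by
    rw [MulAction.minimalPeriod_eq_card, ← Fintype.card_subtype]
    refine Fintype.card_congr (Equiv.subtypeEquivRight fun y => ?_)
    constructor
    · rintro ⟨⟨_, c, rfl⟩, rfl⟩
      change β (ℓ ((σ ^ c) x)) = _
      rw [lab_zpow h1, bl_zpow hρ]
    · intro hy
      obtain ⟨c, hc⟩ := h2 x y hy.symm
      exact ⟨⟨σ ^ c, c, rfl⟩, hc⟩
  rw [← h3, ← MulAction.zpow_smul_eq_iff_minimalPeriod_dvd]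
  rw [sub_eq_add_neg, add_comm, zpow_add, mul_smul, zpow_neg, inv_smul_eq_iff]
  rfl

/-- periods -/
lemma period_eq {β : J → I} {ℓ : Ω → J} {ρ : Equiv.Perm J} (hρ : ∀ j, β (ρ j) = β j) {π π' : Equiv.Perm Ω}
    (hπ : π ∈ TT β ℓ ρ) (hπ' : π' ∈ TT β ℓ ρ) (ω ω' : Ω) (hω : β (ℓ ω) = β (ℓ ω')) (a b : ℤ) :
    (π ^ a) ω = (π ^ b) ω ↔ (π' ^ a) ω' = (π' ^ b) ω' := by
  rw [mem_TT] at hπ hπ'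
  rw [per_key hρ π ω hπ.1 hπ.2, per_key hρ π' ω' hπ'.1 hπ'.2, hω]

lemma rot_zero {N : ℕ} (a : ℕ) (ha : a < N + 1) : ((finRotate (N + 1) ^ a) 0 : Fin (N + 1)) = ⟨a, ha⟩ := by
  induction a with
  | zero => simp
  | succ a ih =>
    rw [pow_succ', Equiv.Perm.mul_apply, ih (by omega)]
    refine Fin.ext ?_
    rw [coe_finRotate, if_neg]
    intro h
    have := congrArg Fin.val h
    simp at this; omega

lemma rot_sc {N : ℕ} (x y : Fin N) : (finRotate N).SameCycle x y := by
  cases N with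
  | zero => exact x.elim0
  | succ N =>
    have h : ∀ x : Fin (N + 1), (finRotate (N + 1)).SameCycle 0 x := fun x => ⟨(x : ℕ), by
      rw [zpow_natCast, rot_zero _ x.2]⟩
    exact (h x).symm.trans (h y)

theorem exists_Omega {I J : Type} [Fintype I] [DecidableEq I] [Fintype J] [DecidableEq J] (β : J → I) (ρ : Equiv.Perm J) (hρ : ∀ j, β (ρ j) = β j)
    (htr : ∀ j j', β j = β j' → ρ.SameCycle j j')
    (j0 : I → J) (hj0 : ∀ i, β (j0 i) = i) (NJ : J → ℕ) (hNJ : ∀ j, NJ (ρ j) = NJ j) (hpos : ∀ j, 0 < NJ j) :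
    ∃ (Ω : Type) (_ : Fintype Ω) (_ : DecidableEq Ω) (ℓ : Ω → J) (π0 : Equiv.Perm Ω) (w : I → Ω), π0 ∈ TT β ℓ ρ ∧
      (∀ i, β (ℓ (w i)) = i) ∧ (∀ j, (Finset.univ.filter fun ω => ℓ ω = j).card = NJ j) := by
  classical
  let N : I → ℕ := fun i => ∑ j with β j = i, NJ j
  have hcon : ∀ j j', β j = β j' → NJ j = NJ j' := by
    intro j j' h
    obtain ⟨a, rfl⟩ := htr j j' h
    exact (bl_zpow hNJ a j).symm
  have hN : ∀ j, N (β j) = (Finset.univ.filter fun y => β y = β j).card * NJ j := by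
    intro j
    simp only [N]
    rw [Finset.sum_const_nat (m := NJ j)]
    intro x hx
    exact hcon _ _ (Finset.mem_filter.1 hx).2
  have hmu : ∀ j, 0 < (Finset.univ.filter fun y => β y = β j).card := fun j => Finset.card_pos.2 ⟨j, by simp⟩
  have hN0 : ∀ i, 0 < N i := fun i => by
    rw [← hj0 i, hN]; exact Nat.mul_pos (hmu _) (hpos _)
  have hper : ∀ i, (ρ ^ N i) (j0 i) = j0 i := by
    intro i
    have := (per_key (ℓ := id) hρ ρ (j0 i) (fun _ => rfl) htr (N i : ℤ) 0).2 (by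
      rw [sub_zero]
      have := hN (j0 i)
      rw [hj0] at this
      rw [this]
      simp only [id, hj0]
      exact Int.natCast_dvd_natCast.2 (Dvd.intro _ rfl))
    rwa [zpow_natCast, zpow_zero] at this
  let ℓ : (Σ i, Fin (N i)) → J := fun x => (ρ ^ (x.2 : ℕ)) (j0 x.1)
  let π0 : Equiv.Perm (Σ i, Fin (N i)) := Equiv.sigmaCongrRight fun i => finRotate (N i)
  have hβ : ∀ x, β (ℓ x) = x.1 := by
    intro x
    have := bl_zpow hρ ((x.2 : ℕ) : ℤ) (j0 x.1)
    rw [zpow_natCast, hj0] at this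
    exact this
  have hl : ∀ x, ℓ (π0 x) = ρ (ℓ x) := by
    rintro ⟨i, a⟩
    have h1 : ∀ (M : ℕ) (b : Fin M), (ρ ^ M) (j0 i) = j0 i → (ρ ^ (finRotate M b : ℕ)) (j0 i) = ρ ((ρ ^ (b : ℕ)) (j0 i)) := by
      intro M b hM
      cases M with
      | zero => exact b.elim0
      | succ M =>
        rw [coe_finRotate]
        split_ifs with hb
        · rw [hb, ← Equiv.Perm.mul_apply, ← pow_succ', Fin.val_last, hM]; simp
        · rw [pow_succ', Equiv.Perm.mul_apply]
    exact h1 (N i) a (hper i)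
  have hzp : ∀ (a : ℤ) i (b : Fin (N i)), (π0 ^ a) ⟨i, b⟩ = ⟨i, (finRotate (N i) ^ a) b⟩ := by
    intro a
    induction a using Int.induction_on with
    | zero => intros; simp
    | succ a ih =>
      intro i b
      rw [zpow_add_one, zpow_add_one, Equiv.Perm.mul_apply, Equiv.Perm.mul_apply, ← ih]; rfl
    | pred a ih =>
      intro i b
      rw [zpow_sub_one, zpow_sub_one, Equiv.Perm.mul_apply, Equiv.Perm.mul_apply, ← ih]
      congr 1
  have hπ : π0 ∈ TT β ℓ ρ := by
    rw [mem_TT]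
    refine ⟨hl, ?_⟩
    rintro ⟨i, a⟩ ⟨i', a'⟩ h
    rw [hβ, hβ] at h
    simp only at h
    subst h
    obtain ⟨c, hc⟩ := rot_sc a a'
    exact ⟨c, by rw [hzp, hc]⟩
  refine ⟨_, inferInstance, inferInstance, ℓ, π0, fun i => ⟨i, ⟨0, hN0 i⟩⟩, hπ, fun i => hβ _, ?_⟩
  let c : J → ℕ := fun j => (Finset.univ.filter fun ω => ℓ ω = j).card
  have hc : ∀ j, c (ρ j) = c j := by
    intro j
    symm
    refine Finset.card_equiv π0 fun x => ?_
    simp [hl]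
  have hcc : ∀ j j', β j = β j' → c j = c j' := by
    intro j j' h
    obtain ⟨a, rfl⟩ := htr j j' h
    exact (bl_zpow hc a j).symm
  intro j
  have h1 : ∑ y with β y = β j, c y = N (β j) := by
    have h2 := Finset.card_eq_sum_card_fiberwise (f := ℓ) (s := Finset.univ.filter fun ω => β (ℓ ω) = β j) (t := Finset.univ.filter fun y => β y = β j)
      (by intro x hx; simpa using hx)
    have h3 : (Finset.univ.filter fun ω => β (ℓ ω) = β j).card = N (β j) := by
      rw [← Finset.card_fin (N (β j)), eq_comm]
      refine Finset.card_bij (fun a _ => ⟨β j, a⟩) ?_ ?_ ?_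
      · intro a _; simp [hβ]
      · intro a _ b _ h; simpa using h
      · rintro ⟨i, b⟩ hb
        simp only [Finset.mem_filter, Finset.mem_univ, true_and, hβ] at hb
        subst hb
        exact ⟨b, by simp, rfl⟩
    rw [← h3, h2]
    refine Finset.sum_congr rfl fun y hy => ?_
    simp only [c]
    congr 1
    ext x
    simp only [Finset.mem_filter, Finset.mem_univ, true_and] at hy ⊢
    constructor
    · rintro rfl; exact ⟨hy, rfl⟩
    · exact fun h => h.2
  rw [hN, Finset.sum_const_nat (m := c j) (fun x hx => hcc _ _ (Finset.mem_filter.1 hx).2)] at h1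
  exact Nat.eq_of_mul_eq_mul_left (hmu j) h1

theorem coset_count (β : J → I) (ℓ : Ω → J) (ρ : Equiv.Perm J) (hρ : ∀ j, β (ρ j) = β j) (π0 : Equiv.Perm Ω) (h0 : π0 ∈ TT β ℓ ρ)
    (w : I → Ω) (hw : ∀ i, β (ℓ (w i)) = i) (M : I → ℕ) (hM : ∀ i, (Finset.univ.filter fun ω => ℓ ω = ℓ (w i)).card = M i) :
    Fintype.card (SL ℓ) = (TT β ℓ ρ).card * ∏ i, M i := by
  classical
  let Φ : SL ℓ → {π // π ∈ TT β ℓ ρ} × (∀ i, {ω // ω ∈ Finset.univ.filter fun ω => ℓ ω = ℓ (w i)}) := fun g =>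
    ⟨⟨g.1 * π0 * g.1⁻¹, TT_conj β ℓ ρ π0 h0 g.1 g.2⟩, fun i => ⟨g.1 (w i), by
      simp only [Finset.mem_filter, Finset.mem_univ, true_and]; exact (mem_SL.1 g.2) _⟩⟩
  have h0' := (mem_TT _ _ _ _).1 h0
  have hex : ∀ ω, ∃ a : ℤ, (π0 ^ a) (w (β (ℓ ω))) = ω := fun ω => h0'.2 _ _ (hw _)
  have hinj : Function.Injective Φ := by
    intro g h e
    have e1 : g.1 * π0 * g.1⁻¹ = h.1 * π0 * h.1⁻¹ := congrArg (fun x => x.1.1) e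
    have e2 : ∀ i, g.1 (w i) = h.1 (w i) := fun i => congrArg (fun x => (x.2 i).1) e
    refine Subtype.ext (Equiv.ext fun ω => ?_)
    obtain ⟨a, ha⟩ := hex ω
    have e3 := congrArg (· ^ a) e1
    simp only [conj_zpow] at e3
    have e4 := DFunLike.congr_fun e3 (g.1 (w (β (ℓ ω))))
    conv_rhs at e4 => rw [e2]
    simp only [Equiv.Perm.mul_apply, pm_ia, ha] at e4
    exact e4
  have hsurj : Function.Surjective Φ := by
    rintro ⟨⟨π, hπ⟩, w'⟩
    have hw' : ∀ i, ℓ (w' i).1 = ℓ (w i) := fun i => (Finset.mem_filter.1 (w' i).2).2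
    have hπ' := (mem_TT _ _ _ _).1 hπ
    choose a ha using hex
    let g : Ω → Ω := fun ω => (π ^ (a ω)) (w' (β (ℓ ω))).1
    have hper : ∀ i (b c : ℤ), (π0 ^ b) (w i) = (π0 ^ c) (w i) ↔ (π ^ b) (w' i).1 = (π ^ c) (w' i).1 := fun i b c =>
      period_eq hρ h0 hπ _ _ (by rw [hw']) b c
    have hg : ∀ i (b : ℤ), g ((π0 ^ b) (w i)) = (π ^ b) (w' i).1 := by
      intro i b
      have h1 : β (ℓ ((π0 ^ b) (w i))) = i := by rw [lab_zpow h0'.1, bl_zpow hρ, hw]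
      have h2 := ha ((π0 ^ b) (w i))
      rw [h1] at h2
      change (π ^ (a _)) (w' (β (ℓ ((π0 ^ b) (w i))))).1 = _
      rw [h1]
      exact (hper i _ _).1 h2
    have hgl : ∀ ω, ℓ (g ω) = ℓ ω := by
      intro ω
      change ℓ ((π ^ (a ω)) (w' (β (ℓ ω))).1) = _
      rw [lab_zpow hπ'.1, hw', ← lab_zpow h0'.1, ha]
    have hgi : Function.Injective g := by
      intro x y hxy
      have hb : β (ℓ x) = β (ℓ y) := by rw [← hgl x, hxy, hgl]
      have h1 := ha x
      have h2 := ha y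
      rw [← h1, ← h2, hb, hper]
      have h3 := hxy
      simp only [g] at h3
      rw [hb] at h3
      exact h3
    let ge : Equiv.Perm Ω := Equiv.ofBijective g (Finite.injective_iff_bijective.1 hgi)
    have hge : ∀ x, ge x = g x := fun _ => rfl
    refine ⟨⟨ge, mem_SL.2 hgl⟩, ?_⟩
    refine Prod.ext (Subtype.ext ?_) (funext fun i => Subtype.ext ?_)
    · change ge * π0 * ge⁻¹ = π
      rw [mul_inv_eq_iff_eq_mul]
      ext1 ω
      rw [Equiv.Perm.mul_apply, Equiv.Perm.mul_apply, hge, hge]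
      have h1 := ha ω
      rw [← h1, hg, ← Equiv.Perm.mul_apply, ← zpow_one_add, hg, zpow_one_add, Equiv.Perm.mul_apply]
    · change ge (w i) = _
      have := hg i 0
      rw [zpow_zero, zpow_zero] at this
      exact this
  rw [Fintype.card_of_bijective ⟨hinj, hsurj⟩, Fintype.card_prod, Fintype.card_coe, Fintype.card_pi]
  congr 1
  refine Finset.prod_congr rfl fun i _ => ?_
  rw [Fintype.card_coe, hM]

end Grp
end BH

namespace BH

section A
set_option linter.unusedSectionVars false
variable {Fq k : Type*} [Field Fq] [Fintype Fq] [Field k] [IsAlgClosed k] [Algebra Fq k]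
variable {p : ℕ} [Fact p.Prime] [CharP k p] {e0 : ℕ}
variable {Ω : Type*} [Fintype Ω] [DecidableEq Ω]

lemma eval_frob (hq : Fintype.card Fq = p ^ e0) (A : Fq[X]) (x : k) :
    (A.map (algebraMap Fq k)).eval (x ^ p ^ e0) = ((A.map (algebraMap Fq k)).eval x) ^ p ^ e0 := by
  have h : (A.map (algebraMap Fq k)).map (iterateFrobenius k p e0) = A.map (algebraMap Fq k) := by
    ext i; simp only [coeff_map, frob_alg hq]
  rw [← iterateFrobenius_def, ← iterateFrobenius_def]
  conv_lhs => rw [← h]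
  rw [eval_map_apply]

theorem irr_iff (hq : Fintype.card Fq = p ^ e0) (Q : Fq[X]) (c : k) (hc : c ≠ 0) (S : Finset Ω) (hS : S.Nonempty) (e : Ω → k)
    (he : Function.Injective e) (hQ : Q.map (algebraMap Fq k) = C c * ∏ ω ∈ S, (X - C (e ω)))
    (σ : Equiv.Perm Ω) (hσS : ∀ ω, σ ω ∈ S ↔ ω ∈ S) (hσ : ∀ ω, e ω ^ p ^ e0 = e (σ ω)) :
    Irreducible Q ↔ ∀ ω ∈ S, ∀ ω' ∈ S, σ.SameCycle ω ω' := by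
  classical
  have hdeg : Q.natDegree = S.card := by
    rw [← natDegree_map_eq_of_injective (algebraMap Fq k).injective Q, hQ, natDegree_C_mul hc, natDegree_finsetProd_X_sub_C_eq_card]
  have hpos : 0 < S.card := Finset.card_pos.2 hS
  have hQ0 : Q ≠ 0 := by rintro rfl; simp at hdeg; omega
  constructor
  · intro hirr ω hω ω' hω'
    set O := S.filter fun x => σ.SameCycle ω x with hO
    have hfix : (∏ x ∈ O, (X - C (e x))).map (iterateFrobenius k p e0) = ∏ x ∈ O, (X - C (e x)) := by
      rw [Polynomial.map_prod]
      refine Finset.prod_equiv σ ?_ ?_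
      · intro x
        simp only [hO, Finset.mem_filter, hσS, Equiv.Perm.sameCycle_apply_right]
      · intro x _
        rw [Polynomial.map_sub, map_X, map_C, iterateFrobenius_def, hσ]
    obtain ⟨H, hH⟩ := descend1 hq _ hfix
    have hHQ : H ∣ Q := by
      rw [← Polynomial.map_dvd_map' (algebraMap Fq k), hH, hQ]
      exact Dvd.dvd.mul_left (Finset.prod_dvd_prod_of_subset _ _ _ (Finset.filter_subset _ _)) _
    have hHd : H.natDegree = O.card := by
      rw [← natDegree_map_eq_of_injective (algebraMap Fq k).injective H, hH, natDegree_finsetProd_X_sub_C_eq_card]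
    have hωO : ω ∈ O := Finset.mem_filter.2 ⟨hω, Equiv.Perm.SameCycle.refl _ _⟩
    have hnu : ¬ IsUnit H := by
      intro h
      have := natDegree_eq_zero_of_isUnit h
      rw [hHd] at this
      exact absurd this (Finset.card_pos.2 ⟨ω, hωO⟩).ne'
    obtain ⟨B, hB⟩ := hHQ
    have hBu := (hirr.isUnit_or_isUnit hB).resolve_left hnu
    have hH0 : H ≠ 0 := by rintro rfl; exact hQ0 (by simpa using hB)
    have h1 : Q.natDegree = H.natDegree := by
      rw [hB, natDegree_mul hH0 hBu.ne_zero, natDegree_eq_zero_of_isUnit hBu, add_zero]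
    have h2 : O = S := Finset.eq_of_subset_of_card_le (Finset.filter_subset _ _) (by omega)
    rw [← h2] at hω'
    exact (Finset.mem_filter.1 hω').2
  · intro htr
    refine ⟨fun h => ?_, fun A B hAB => ?_⟩
    · have := natDegree_eq_zero_of_isUnit h; omega
    · by_contra hcon
      push Not at hcon
      have hA0 : A ≠ 0 := by rintro rfl; exact hQ0 (by simpa using hAB)
      have hB0 : B ≠ 0 := by rintro rfl; exact hQ0 (by simpa using hAB)
      have hA1 : A.natDegree ≠ 0 := fun h => hcon.1 (by
        rw [isUnit_iff_degree_eq_zero, degree_eq_natDegree hA0, h]; rfl)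
      have hB1 : B.natDegree ≠ 0 := fun h => hcon.2 (by
        rw [isUnit_iff_degree_eq_zero, degree_eq_natDegree hB0, h]; rfl)
      have hd : S.card = A.natDegree + B.natDegree := by rw [← hdeg, hAB, natDegree_mul hA0 hB0]
      set A' := A.map (algebraMap Fq k) with hA'
      have hA'd : A'.natDegree = A.natDegree := natDegree_map_eq_of_injective (algebraMap Fq k).injective A
      have hA'0 : A' ≠ 0 := fun h => hA1 (by rw [← hA'd, h, natDegree_zero])
      obtain ⟨z, hz⟩ := IsAlgClosed.exists_root A' (by
        rw [degree_eq_natDegree hA'0, hA'd]; exact_mod_cast hA1)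
      have hzQ : (Q.map (algebraMap Fq k)).eval z = 0 := by
        rw [hAB, Polynomial.map_mul, eval_mul, hz.eq_zero, zero_mul]
      rw [hQ, eval_mul, eval_C, eval_prod, mul_eq_zero, Finset.prod_eq_zero_iff] at hzQ
      obtain ⟨ω, hω, hzω⟩ := hzQ.resolve_left hc
      rw [eval_sub, eval_X, eval_C, sub_eq_zero] at hzω
      have hstep : ∀ a : ℕ, A'.eval (e ((σ ^ a) ω)) = 0 := by
        intro a
        induction a with
        | zero => rw [pow_zero, Equiv.Perm.one_apply, ← hzω]; exact hz
        | succ a ih =>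
          rw [pow_succ', Equiv.Perm.mul_apply, ← hσ, hA', eval_frob hq, ← hA', ih, zero_pow (pow_ne_zero _ (Fact.out : p.Prime).ne_zero)]
      have hall : ∀ ω' ∈ S, A'.eval (e ω') = 0 := by
        intro ω' hω'
        obtain ⟨a, ha⟩ := (htr ω hω ω' hω').exists_nat_pow_eq
        rw [← ha]; exact hstep a
      have hcard : S.card ≤ A'.natDegree := by
        rw [← Finset.card_image_of_injective S he]
        refine card_le_degree_of_subset_roots (fun x hx => ?_)
        obtain ⟨y, hy, rfl⟩ := Finset.mem_image.1 (Finset.mem_def.2 hx)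
        rw [mem_roots hA'0]; exact hall y hy
      omega
end A
end BH

namespace BH

section A
variable {k k' : Type*} [Field k] [Field k']

lemma NN_map (n : ℕ) (φ : k →+* k') (G : k[X][X]) : NN n (G.map (mapRingHom φ)) = NN n G := by
  unfold NN
  rw [support_map_of_injective _ (Polynomial.map_injective _ φ.injective)]
  refine Finset.sup_congr rfl fun i _ => ?_
  rw [coeff_map, coe_mapRingHom, natDegree_map]

lemma uu_map (n : ℕ) (φ : k →+* k') (G : k[X][X]) : uu n (G.map (mapRingHom φ)) = (uu n G).map φ := by
  ext i
  rw [coeff_map, uu_coeff, uu_coeff, NN_map]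
  split_ifs
  · rw [coeff_map, coe_mapRingHom, coeff_map]
  · rw [map_zero]

lemma ev_semi {S S' : Type*} [CommRing S] [CommRing S'] [Algebra k S] [Algebra k' S'] (φ : k →+* k') (ψ : S →+* S')
    (h : ∀ x, ψ (algebraMap k S x) = algebraMap k' S' (φ x)) (a b : S) (P : k[X][X]) :
    ψ (ev a b P) = ev (ψ a) (ψ b) (P.map (mapRingHom φ)) := by
  rw [ev_eq_eval₂, ev_eq_eval₂, hom_eval₂, eval₂_map]
  congr 1
  refine Polynomial.ringHom_ext ?_ ?_
  · intro x
    simp [h]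
  · simp

lemma eval_eq_ev (f : k[X]) (F : k[X][X]) : eval f F = ev (k := k) (X : k[X]) f F := by
  rw [ev_eq_eval_map]
  congr 1
  have : (aeval (X : k[X]) : k[X] →ₐ[k] k[X]).toRingHom = RingHom.id _ := by
    ext x <;> simp
  rw [this, Polynomial.map_id]

lemma ev_map_poly (φ : k →+* k') (f : k[X]) (F : k[X][X]) : (eval f F).map φ = ev (k := k') (X : k'[X]) (f.map φ) (F.map (mapRingHom φ)) := by
  rw [eval_eq_ev]
  have := ev_semi (S := k[X]) (S' := k'[X]) φ (mapRingHom φ) (by intro x; simp) X f F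
  simpa using this

lemma ev_natDegree_eq {R : Type*} [CommRing R] [Nontrivial R] [Algebra k R] (n : ℕ) (G : k[X][X]) (f : R[X]) (hf : f.natDegree ≤ n)
    (α : k) (hα : f.coeff n = algebraMap k R α) (hu : (uu n G).eval α ≠ 0) : (ev (k := k) (X : R[X]) f G).natDegree = NN n G := by
  refine natDegree_eq_of_le_of_coeff_ne_zero (ev_natDegree_le n G f hf) ?_
  rw [ev_coeff_NN n G f hf α hα]
  rw [Ne, map_eq_zero_iff _ (algebraMap k R).injective]
  exact hu

lemma NN_mul [Infinite k] (n : ℕ) (G H : k[X][X]) (hG : G ≠ 0) (hH : H ≠ 0) : NN n (G * H) = NN n G + NN n H := by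
  have hne : uu n (G * H) * (uu n G * uu n H) ≠ 0 := mul_ne_zero (uu_ne _ _ (mul_ne_zero hG hH)) (mul_ne_zero (uu_ne _ _ hG) (uu_ne _ _ hH))
  obtain ⟨α, hα⟩ : ∃ α, (uu n (G * H) * (uu n G * uu n H)).eval α ≠ 0 := by
    by_contra hcon
    push Not at hcon
    exact hne (Polynomial.funext fun x => by rw [hcon, eval_zero])
  simp only [eval_mul, mul_ne_zero_iff] at hα
  have key : ∀ G : k[X][X], (uu n G).eval α ≠ 0 → (ev (k := k) (X : k[X]) (C α * X ^ n) G).natDegree = NN n G := fun G hG =>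
    ev_natDegree_eq n G _ (natDegree_C_mul_X_pow_le _ _) α (by simp) hG
  have key0 : ∀ G : k[X][X], (uu n G).eval α ≠ 0 → ev (k := k) (X : k[X]) (C α * X ^ n) G ≠ 0 := by
    intro G hG h
    have := ev_coeff_NN (R := k) n G (C α * X ^ n) (natDegree_C_mul_X_pow_le _ _) α (by simp)
    rw [h, coeff_zero] at this
    exact hG this.symm
  rw [← key _ hα.1, ← key _ hα.2.1, ← key _ hα.2.2, map_mul, natDegree_mul (key0 _ hα.2.1) (key0 _ hα.2.2)]

lemma NN_CC (n : ℕ) (c : k) : NN n (C (C c) : k[X][X]) = 0 := by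
  unfold NN
  refine (Finset.sup_eq_bot_iff _ _).2 ?_
  · intro i hi
    have : i = 0 := by
      by_contra h
      rw [mem_support_iff, coeff_C, if_neg h] at hi
      exact hi rfl
    subst this
    simp

lemma NN_prod [Infinite k] {ι : Type*} (n : ℕ) (s : Finset ι) (G : ι → k[X][X]) (hG : ∀ i ∈ s, G i ≠ 0) : NN n (∏ i ∈ s, G i) = ∑ i ∈ s, NN n (G i) := by
  classical
  induction s using Finset.induction_on with
  | empty =>
    have := NN_CC n (1 : k)
    simpa using this
  | insert a s ha ih =>
    rw [Finset.prod_insert ha, Finset.sum_insert ha, NN_mul _ _ _ (hG a (by simp)), ih (fun i hi => hG i (by simp [hi]))]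
    rw [Finset.prod_ne_zero_iff]
    exact fun i hi => hG i (by simp [hi])

end A

lemma NN_le_totalDeg {K : Type} [Field K] (n : ℕ) (hn : n ≠ 0) (F : K[X][X]) : NN n F ≤ n * totalDeg F := by
  unfold NN
  refine Finset.sup_le fun i hi => ?_
  have h1 : i + (F.coeff i).natDegree ≤ totalDeg F := Finset.le_sup (f := fun j => j + (F.coeff j).natDegree)
    (Finset.mem_range.2 (Nat.lt_succ_of_le (le_natDegree_of_mem_supp i hi)))
  calc _ ≤ n * (F.coeff i).natDegree + n * i := by
        have : 1 * (F.coeff i).natDegree ≤ n * (F.coeff i).natDegree := Nat.mul_le_mul_right _ (by omega)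
        rw [Nat.mul_comm i n]; omega
    _ = n * (i + (F.coeff i).natDegree) := by ring
    _ ≤ _ := Nat.mul_le_mul_left _ h1

lemma fsharp_natDegree (K : Type) [Field K] (n : ℕ) : (fsharp K n).natDegree ≤ n := by
  unfold fsharp
  refine natDegree_sum_le_of_forall_le _ _ fun i _ => ?_
  exact (natDegree_C_mul_X_pow_le _ _).trans (by omega)

lemma fsharp_coeff (K : Type) [Field K] (n : ℕ) : (fsharp K n).coeff n = MvPolynomial.X (Fin.last n) := by
  unfold fsharp
  rw [finsetSum_coeff, Finset.sum_eq_single (Fin.last n)]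
  · simp
  · intro b _ hb
    rw [coeff_C_mul, coeff_X_pow, if_neg, mul_zero]
    intro h
    exact hb (Fin.ext (by simpa using h.symm))
  · simp

lemma substF_natDegree {K : Type} [Field K] (n : ℕ) (F : K[X][X]) (hF : F ≠ 0) : (substF n F).natDegree = NN n F := by
  have h0 : substF n F = ev (k := K) (X : (MvPolynomial (Fin (n + 1)) K)[X]) (fsharp K n) F := by
    unfold substF
    rw [ev_eq_eval_map]
    congr 2
  rw [h0]
  refine le_antisymm (ev_natDegree_le n F _ (fsharp_natDegree K n)) ?_
  let L := AlgebraicClosure K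
  obtain ⟨α, hα⟩ : ∃ α : L, (uu n (F.map (mapRingHom (algebraMap K L)))).eval α ≠ 0 := by
    by_contra hcon
    push Not at hcon
    refine uu_ne n (F.map (mapRingHom (algebraMap K L))) ?_ (Polynomial.funext fun x => by rw [hcon, eval_zero])
    rw [Ne, Polynomial.map_eq_zero_iff (Polynomial.map_injective _ (algebraMap K L).injective)]
    exact hF
  let φ : MvPolynomial (Fin (n + 1)) K →+* L := MvPolynomial.eval₂Hom (algebraMap K L) (fun i => if i = Fin.last n then α else 0)
  have h1 := ev_semi (S := (MvPolynomial (Fin (n + 1)) K)[X]) (S' := L[X]) (algebraMap K L) (mapRingHom φ) (by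
    intro x
    rw [Polynomial.algebraMap_apply, Polynomial.algebraMap_apply, coe_mapRingHom, map_C]
    congr 1
    simp [φ, MvPolynomial.algebraMap_eq]) X (fsharp K n) F
  have h2 : (mapRingHom φ (fsharp K n)).natDegree ≤ n := by
    rw [coe_mapRingHom]; exact natDegree_map_le.trans (fsharp_natDegree K n)
  have h3 : (mapRingHom φ (fsharp K n)).coeff n = algebraMap L L α := by
    rw [coe_mapRingHom, coeff_map, fsharp_coeff]; simp [φ]
  have h4 := ev_natDegree_eq n (F.map (mapRingHom (algebraMap K L))) _ h2 α h3 hα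
  rw [NN_map] at h4
  rw [← h4]
  have h5 : mapRingHom φ X = X := by simp
  rw [h5] at h1
  rw [← h1, coe_mapRingHom]
  exact natDegree_map_le
end BH

namespace BH

section A
variable {k k' : Type*} [Field k] [Field k']

lemma VV_semi {R R' : Type*} [CommRing R] [CommRing R'] [Algebra k R] [Algebra k' R'] {m : ℕ} (φ : k →+* k') (ψ : R →+* R')
    (h : ∀ x, ψ (algebraMap k R x) = algebraMap k' R' (φ x)) (t0 : k) (v : Fin m → R) :
    (VV t0 v).map ψ = VV (φ t0) (fun i => ψ (v i)) := by
  unfold VV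
  rw [Polynomial.map_add, Polynomial.map_one, Polynomial.map_sum]
  congr 1
  refine Finset.sum_congr rfl fun i _ => ?_
  rw [Polynomial.map_mul, Polynomial.map_pow, Polynomial.map_sub, map_C, map_C, map_X, h]

lemma FF_semi {R R' : Type*} [CommRing R] [CommRing R'] [Algebra k R] [Algebra k' R'] {m : ℕ} (φ : k →+* k') (ψ : R →+* R')
    (h : ∀ x, ψ (algebraMap k R x) = algebraMap k' R' (φ x)) (fu : k[X]) (t0 : k) (s : R) (v : Fin m → R) :
    (FF fu t0 s v).map ψ = FF (fu.map φ) (φ t0) (ψ s) (fun i => ψ (v i)) := by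
  unfold FF
  rw [Polynomial.map_add, Polynomial.map_mul, VV_semi φ ψ h, map_C, Polynomial.map_map, Polynomial.map_map]
  congr 2
  ext x; exact h x

lemma PP_semi {R R' : Type*} [CommRing R] [CommRing R'] [Algebra k R] [Algebra k' R'] (φ : k →+* k') (ψ : R →+* R')
    (h : ∀ x, ψ (algebraMap k R x) = algebraMap k' R' (φ x)) (u : k) (f : R[X]) (G : k[X][X]) :
    (PP u f G).map ψ = PP (φ u) (f.map ψ) (G.map (mapRingHom φ)) := by
  unfold PP
  rw [Polynomial.map_mul, map_C, h, map_inv₀]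
  congr 1
  have := ev_semi (S := R[X]) (S' := R'[X]) φ (mapRingHom ψ) (by
    intro x
    rw [Polynomial.algebraMap_apply, Polynomial.algebraMap_apply, coe_mapRingHom, map_C, h]) X f G
  simpa using this

lemma PF_semi {R R' : Type*} [CommRing R] [CommRing R'] [Algebra k R] [Algebra k' R'] {m : ℕ} (φ : k →+* k') (ψ : R →+* R')
    (h : ∀ x, ψ (algebraMap k R x) = algebraMap k' R' (φ x)) (n : ℕ) (fu : k[X]) (t0 : k) (G : k[X][X]) (s : R) (v : Fin m → R) :
    (PF n fu t0 G s v).map ψ = PF n (fu.map φ) (φ t0) (G.map (mapRingHom φ)) (ψ s) (fun i => ψ (v i)) := by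
  unfold PF
  rw [PP_semi φ ψ h, FF_semi φ ψ h, uu_map, coeff_map, eval_map_apply]

end A

section B
set_option linter.unusedSectionVars false
variable {Fq k I J Ω : Type} [Field Fq] [Fintype Fq] [Field k] [IsAlgClosed k] [Algebra Fq k] [Fintype I] [DecidableEq I]
  [Fintype J] [DecidableEq J] [Fintype Ω] [DecidableEq Ω]

/-- the whole arithmetic family -/
structure XF (Fq k I J Ω : Type) [Field Fq] [Fintype Fq] [Field k] [Algebra Fq k] [Fintype I] [DecidableEq I]
    [Fintype J] [DecidableEq J] [Fintype Ω] [DecidableEq Ω] (n p e0 N0 : ℕ) [Fact p.Prime] [CharP k p] (F : I → Fq[X][X]) (G : J → k[X][X])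
    (β : J → I) (ρ : Equiv.Perm J) (ℓ : Ω → J) : Prop where
  fam : GFam k J n p N0 G
  frob : ∀ j, Fr k p e0 (G j) = G (ρ j)
  bl : ∀ j, β (ρ j) = β j
  fac : ∀ i, ∃ c : k, c ≠ 0 ∧ bc Fq k (F i) = C (C c) * ∏ j with β j = i, G j
  fib : ∀ j, (Finset.univ.filter fun ω => ℓ ω = j).card = NN n (G j)
  sur : ∀ i, ∃ ω, β (ℓ ω) = i
  cO : Fintype.card Ω ≤ N0

lemma line_irr {n p e0 N0 : ℕ} [Fact p.Prime] [CharP k p] {F : I → Fq[X][X]} {G : J → k[X][X]} {β : J → I} {ρ : Equiv.Perm J} {ℓ : Ω → J}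
    (h : XF Fq k I J Ω n p e0 N0 F G β ρ ℓ) (hq : Fintype.card Fq = p ^ e0) (f : Fq[X]) (u : J → k) (hu : ∀ j, u j ≠ 0)
    (e : Ω → k) (he : Function.Injective e) (hP : ∀ j, PP (u j) (f.map (algebraMap Fq k)) (G j) = ∏ ω with ℓ ω = j, (X - C (e ω)))
    (σ : Equiv.Perm Ω) (hσ1 : ∀ ω, ℓ (σ ω) = ρ (ℓ ω)) (hσ : ∀ ω, e ω ^ p ^ e0 = e (σ ω)) :
    (∀ i, Irreducible (eval f (F i))) ↔ σ ∈ TT β ℓ ρ := by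
  classical
  have key : ∀ i, Irreducible (eval f (F i)) ↔
      ∀ ω ∈ Finset.univ.filter (fun ω => β (ℓ ω) = i), ∀ ω' ∈ Finset.univ.filter (fun ω => β (ℓ ω) = i), σ.SameCycle ω ω' := by
    intro i
    obtain ⟨c, hc, hfac⟩ := h.fac i
    obtain ⟨ω, hω⟩ := h.sur i
    refine irr_iff (k := k) hq (eval f (F i)) (c * ∏ j with β j = i, u j) (mul_ne_zero hc (Finset.prod_ne_zero_iff.2 fun j _ => hu j)) _
      ⟨ω, by simpa using hω⟩ e he ?_ σ ?_ hσ
    · have hfac' : (F i).map (mapRingHom (algebraMap Fq k)) = C (C c) * ∏ j with β j = i, G j := hfac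
      rw [ev_map_poly, hfac', map_mul, map_prod, ev_C, aeval_C, C_mul, mul_assoc]
      congr 1
      rw [map_prod C, Finset.prod_congr rfl (fun j _ => (C_mul_PP (hu j) (f.map (algebraMap Fq k)) (G j)).symm), Finset.prod_mul_distrib]
      congr 1
      rw [Finset.prod_congr rfl fun j _ => hP j]
      rw [← Finset.prod_fiberwise_of_maps_to (s := Finset.univ.filter (fun ω => β (ℓ ω) = i)) (t := Finset.univ.filter (fun j => β j = i)) (g := ℓ)
        (by intro x hx; simpa using hx)]
      refine Finset.prod_congr rfl fun j hj => ?_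
      refine Finset.prod_congr ?_ fun _ _ => rfl
      ext x
      simp only [Finset.mem_filter, Finset.mem_univ, true_and] at hj ⊢
      constructor
      · rintro rfl; exact ⟨hj, rfl⟩
      · exact fun h => h.2
    · intro ω
      simp [hσ1, h.bl]
  rw [mem_TT]
  constructor
  · intro hirr
    refine ⟨hσ1, fun ω ω' hω => ?_⟩
    exact (key _).1 (hirr (β (ℓ ω))) ω (by simp) ω' (by simp [hω])
  · rintro ⟨-, h2⟩ i
    rw [key]
    intro ω hω ω' hω'
    simp only [Finset.mem_filter, Finset.mem_univ, true_and] at hω hω'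
    exact h2 _ _ (hω.trans hω'.symm)

open Classical in
/-- the good parameters on a line -/
noncomputable def AA {M : ℕ} (F : I → Fq[X][X]) (fu : Fq[X]) (t0 : Fq) (v : Fin M → Fq) : Finset Fq :=
  Finset.univ.filter fun s => ∀ i, Irreducible (eval (FF fu t0 s v) (F i))

theorem line_app (N0 : ℕ) : ∃ q0 K : ℕ, ∀ (Fq k I J Ω : Type) [Field Fq] [Fintype Fq] [Field k] [IsAlgClosed k] [Algebra Fq k] [Fintype I] [DecidableEq I]
    [Fintype J] [DecidableEq J] [Fintype Ω] [DecidableEq Ω] (n p e0 : ℕ) [Fact p.Prime] [CharP k p] (F : I → Fq[X][X]) (G : J → k[X][X])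
    (β : J → I) (ρ : Equiv.Perm J) (ℓ : Ω → J) (_ : XF Fq k I J Ω n p e0 N0 F G β ρ ℓ) (_ : Fintype.card Fq = p ^ e0) (_ : q0 ≤ Fintype.card Fq)
    (M : ℕ) (_ : M < n) (fu : Fq[X]) (_ : fu.natDegree ≤ n) (t0 : Fq) (_ : ∀ j, (uu n (G j)).eval (algebraMap Fq k (fu.coeff n)) ≠ 0)
    (v : Fin M → Fq) (lam : Ω → k)
    (_ : ∃ τ : Ω → PowerSeries k, Function.Injective τ ∧
        (∀ j, (PF n (fu.map (algebraMap Fq k)) (algebraMap Fq k t0) (G j) (X : k[X]) (fun i => C (algebraMap Fq k (v i)))).map (psiX k) = ∏ ω with ℓ ω = j, (X - C (τ ω))) ∧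
        (Function.Injective fun g : SL ℓ => ∑ ω, algebraMap k (PowerSeries k) (lam ω) * τ (g.1 ω)) ∧
        ∃ Φ : k[X][X], Irreducible Φ ∧ Φ.map (psiX k) = ∏ g : SL ℓ, (X - C (∑ ω, algebraMap k (PowerSeries k) (lam ω) * τ (g.1 ω)))),
    Fintype.card (SL ℓ) * (AA F fu t0 v).card ≤ (TT β ℓ ρ).card * Fintype.card Fq + K * Nat.sqrt (Fintype.card Fq) ∧
    (TT β ℓ ρ).card * Fintype.card Fq ≤ Fintype.card (SL ℓ) * (AA F fu t0 v).card + K * Nat.sqrt (Fintype.card Fq) := by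
  obtain ⟨q0, K, hline⟩ := line_thm N0.factorial N0 N0
  refine ⟨q0, K, ?_⟩
  intro Fq k I J Ω _ _ _ _ _ _ _ _ _ _ _ n p e0 _ _ F G β ρ ℓ h hq hq0 M hM fu hfu t0 hu v lam ⟨τ, hτ, hτP, hlam, Φ, hΦi, hΦ⟩
  classical
  have hn0 : n ≠ 0 := by omega
  have hcoe : ∀ s : Fq, s ∈ AA F fu t0 v ↔ ∀ i, Irreducible (eval (FF fu t0 s v) (F i)) := by
    intro s; unfold AA; simp
  have hfc : (fu.map (algebraMap Fq k)).coeff n = algebraMap Fq k (fu.coeff n) := coeff_map _ _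
  have hcard : Fintype.card (SL ℓ) ≤ N0.factorial := by
    calc Fintype.card (SL ℓ) ≤ Fintype.card (Equiv.Perm Ω) := Fintype.card_subtype_le _
      _ = (Fintype.card Ω).factorial := Fintype.card_perm
      _ ≤ _ := Nat.factorial_le h.cO
  have main := hline k J Ω p e0 (by rw [← hq]; exact hq0) ℓ ρ h.cO hcard
    (fun j => PF n (fu.map (algebraMap Fq k)) (algebraMap Fq k t0) (G j) (X : k[X]) (fun i => C (algebraMap Fq k (v i))))
    (fun j => (PF_monic _ _ _ _ _ (natDegree_map_le.trans hfu) hM (by rw [hfc]; exact hu j)).1)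
    (fun j i => ((PF_SD (fu.map (algebraMap Fq k)) (algebraMap Fq k t0) (G j) (fun i => algebraMap Fq k (v i))) i).trans
      ((h.fam.deg_le hn0 j).trans (h.fam.cN j)))
    (by
      intro j
      rw [PF_semi (iterateFrobenius k p e0) (mapRingHom (iterateFrobenius k p e0)) (by intro x; simp)]
      have h1 : (fu.map (algebraMap Fq k)).map (iterateFrobenius k p e0) = fu.map (algebraMap Fq k) := by
        ext i; simp only [coeff_map, frob_alg hq]
      have h2 : (G j).map (mapRingHom (iterateFrobenius k p e0)) = G (ρ j) := h.frob j
      rw [h1, h2, frob_alg hq]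
      simp only [coe_mapRingHom, map_X, map_C, frob_alg hq])
    τ hτ hτP lam hlam Φ hΦ hΦi (Finset.univ.image (algebraMap Fq k)) ((AA F fu t0 v).image (algebraMap Fq k))
    (by
      intro s hs
      obtain ⟨a, -, rfl⟩ := Finset.mem_image.1 hs
      rw [← hq, ← map_pow, FiniteField.pow_card])
    (by rw [Finset.card_image_of_injective _ (algebraMap Fq k).injective, Finset.card_univ, hq])
    (Finset.image_subset_image (Finset.subset_univ _))
    (TT β ℓ ρ) (fun π hπ => ((mem_TT _ _ _ _).1 hπ).1)
    (by
      intro π hπ g hg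
      have := TT_conj β ℓ ρ π hπ g⁻¹ (inv_mem hg)
      rwa [inv_inv] at this)
    (by
      intro s hs e he hP σ hσ1 hσ
      obtain ⟨a, -, rfl⟩ := Finset.mem_image.1 hs
      rw [Function.Injective.mem_finset_image (algebraMap Fq k).injective, hcoe]
      refine line_irr h hq _ (fun j => (uu n (G j)).eval (algebraMap Fq k (fu.coeff n))) hu e he ?_ σ hσ1 hσ
      intro j
      rw [← hP j, FF_semi (algebraMap Fq k) (algebraMap Fq k) (fun _ => rfl)]
      have := PF_map n (fu.map (algebraMap Fq k)) (algebraMap Fq k t0) (G j) (X : k[X]) (fun i => C (algebraMap Fq k (v i))) (aeval (algebraMap Fq k a) : k[X] →ₐ[k] k)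
      have e1 : ((aeval (algebraMap Fq k a) : k[X] →ₐ[k] k) : k[X] →+* k) = evalRingHom (algebraMap Fq k a) := by
        ext x <;> simp
      rw [e1] at this
      rw [this]
      unfold PF
      rw [hfc]
      simp)
  rw [← hq, Finset.card_image_of_injective _ (algebraMap Fq k).injective] at main
  exact main

end B
end BH

namespace BH

section A
set_option linter.unusedSectionVars false
variable {Fq k : Type} [Field Fq] [Fintype Fq] [Field k] [IsAlgClosed k] [Algebra Fq k]

theorem setup {m n p e0 N0 : ℕ} [Fact p.Prime] [CharP k p] (hq : Fintype.card Fq = p ^ e0) (hn : n ≠ 0) (F : Fin m → Fq[X][X])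
    (hF : ∀ i, Irreducible (F i)) (hd : ∀ i, 0 < (F i).natDegree) (hna : ∀ i j, i ≠ j → ¬ Associated (F i) (F j))
    (hN0 : ∑ i, NN n (F i) ≤ N0) (hp : ∀ i, NN n (F i) < p) :
    ∃ (J Ω : Type) (_ : Fintype J) (_ : DecidableEq J) (_ : Fintype Ω) (_ : DecidableEq Ω) (G : J → k[X][X]) (β : J → Fin m)
      (ρ : Equiv.Perm J) (ℓ : Ω → J), XF Fq k (Fin m) J Ω n p e0 N0 F G β ρ ℓ ∧
      Fintype.card (SL ℓ) * ∏ i, Multiset.card (UniqueFactorizationMonoid.factors (bc Fq k (F i))) =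
        (TT β ℓ ρ).card * ∏ i, NN n (F i) := by
  classical
  have : Infinite k := IsAlgClosed.instInfinite
  have hF0 : ∀ i, F i ≠ 0 := fun i => (hF i).ne_zero
  have hb0 : ∀ i, bc Fq k (F i) ≠ 0 := fun i => by
    rw [Ne, ← map_zero (bc Fq k)]
    exact fun h => hF0 i (bc_inj h)
  let J : Type := Σ i : Fin m, {G // G ∈ SS (bc Fq k (F i))}
  let G : J → k[X][X] := fun j => j.2.1
  let β : J → Fin m := fun j => j.1
  let ρ0 : J → J := fun j => ⟨j.1, ⟨Fr k p e0 j.2.1, Fr_mem hq (hF0 _) j.2.2⟩⟩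
  have hGβ : ∀ j j', β j = β j' → G j = G j' → j = j' := by
    rintro ⟨i, G1, h1⟩ ⟨i', G2, h2⟩ h1 h2
    simp only [β] at h1
    subst h1
    simp only [G] at h2
    subst h2; rfl
  have hρ0 : Function.Injective ρ0 := by
    intro j j' h
    have h1 : β (ρ0 j) = β (ρ0 j') := congrArg β h
    have h2 : G (ρ0 j) = G (ρ0 j') := congrArg G h
    exact hGβ _ _ h1 (Fr_inj (k := k) hq (show Fr k p e0 (G j) = Fr k p e0 (G j') from h2))
  let ρ : Equiv.Perm J := Equiv.ofBijective ρ0 (Finite.injective_iff_bijective.1 hρ0)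
  have hρ : ∀ j, β (ρ j) = β j := fun j => rfl
  have hGρ : ∀ j, Fr k p e0 (G j) = G (ρ j) := fun j => rfl
  have hGpow : ∀ (a : ℕ) j, G ((ρ ^ a) j) = (Fr k p e0)^[a] (G j) := by
    intro a
    induction a with
    | zero => intro j; rfl
    | succ a ih => intro j; rw [pow_succ, Equiv.Perm.mul_apply, ih, Function.iterate_succ_apply, hGρ]
  have hβpow : ∀ (a : ℕ) j, β ((ρ ^ a) j) = β j := by
    intro a
    induction a with
    | zero => intro j; rfl
    | succ a ih => intro j; rw [pow_succ, Equiv.Perm.mul_apply, ih, hρ]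
  have htr : ∀ j j', β j = β j' → ρ.SameCycle j j' := by
    intro j j' h
    have h2 : G j' ∈ SS (bc Fq k (F (β j))) := by rw [h]; exact j'.2.2
    obtain ⟨a, ha⟩ := SS_trans hq (hF (β j)) (G := G j) j.2.2 h2
    refine ⟨(a : ℤ), ?_⟩
    rw [zpow_natCast]
    exact hGβ _ _ (by rw [hβpow, h]) (by rw [hGpow, ha])
  have hne : ∀ i, (SS (bc Fq k (F i))).Nonempty := fun i => SS_nonempty (k := k) (p := p) hq (hF i) (hd i)
  let j0 : Fin m → J := fun i => ⟨i, ⟨(hne i).choose, (hne i).choose_spec⟩⟩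
  have hj0 : ∀ i, β (j0 i) = i := fun i => rfl
  have hGd : ∀ j, (G j).natDegree ≠ 0 := fun j => SS_deg (p := p) hq (hF _) (hd _) j.2.2
  have hGirr : ∀ j, Irreducible (G j) := fun j => ((mem_SS (hb0 _) _).1 j.2.2).2.1
  let NJ : J → ℕ := fun j => NN n (G j)
  have hNJ : ∀ j, NJ (ρ j) = NJ j := by
    intro j
    show NN n (G (ρ j)) = NN n (G j)
    rw [← hGρ]
    exact NN_map n _ _
  have hpos : ∀ j, 0 < NJ j := by
    intro j
    refine lt_of_lt_of_le ?_ (le_NN n (G j) (hGirr j).ne_zero)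
    exact Nat.mul_pos (Nat.pos_of_ne_zero (hGd j)) (Nat.pos_of_ne_zero hn)
  obtain ⟨Ω, i1, i2, ℓ, π0, w, h0, hw, hfib⟩ := exists_Omega β ρ hρ htr j0 hj0 NJ hNJ hpos
  have hcon : ∀ j j', β j = β j' → NJ j = NJ j' := by
    intro j j' h
    obtain ⟨a, rfl⟩ := htr j j' h
    exact (bl_zpow hNJ a j).symm
  have hNF : ∀ i, NN n (F i) = ∑ g ∈ SS (bc Fq k (F i)), NN n g := by
    intro i
    obtain ⟨c, hc, h⟩ := SS_prod (k := k) (p := p) hq (hF i) (hd i)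
    have h1 : NN n (bc Fq k (F i)) = NN n (F i) := NN_map n _ _
    have hne : ∀ g ∈ SS (bc Fq k (F i)), g ≠ 0 := fun g hg => ((mem_SS (hb0 _) _).1 hg).2.1.ne_zero
    rw [← h1]
    conv_lhs => rw [h]
    rw [NN_mul, NN_CC, zero_add, NN_prod n _ _ hne]
    all_goals first
      | exact Finset.prod_ne_zero_iff.2 hne
      | simpa using hc
  have hNF2 : ∀ i, NN n (F i) = Multiset.card (UniqueFactorizationMonoid.factors (bc Fq k (F i))) * NJ (j0 i) := by
    intro i
    rw [hNF, SS_card (p := p) hq (hF i) (hd i), Finset.sum_congr rfl (fun g hg => hcon ⟨i, g, hg⟩ (j0 i) rfl)]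
    simp
  have hSJ : ∑ j, NJ j = ∑ i, NN n (F i) := by
    rw [Fintype.sum_sigma]
    refine Finset.sum_congr rfl fun i _ => ?_
    rw [hNF]
    exact Finset.sum_coe_sort (SS (bc Fq k (F i))) (fun g => NN n g)
  refine ⟨J, Ω, inferInstance, inferInstance, i1, i2, G, β, ρ, ℓ, ?_, ?_⟩
  · refine ⟨⟨hGirr, hGd, ?_, ?_, ?_, ?_⟩, hGρ, hρ, ?_, hfib, fun i => ⟨w i, hw i⟩, ?_⟩
    · intro j
      refine lt_of_le_of_lt ?_ (hp (β j))
      rw [hNF]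
      exact Finset.single_le_sum (f := fun g => NN n g) (fun _ _ => Nat.zero_le _) j.2.2
    · intro i j hij hass
      by_cases h : β i = β j
      · apply hij
        refine hGβ _ _ h ?_
        exact assoc_eq hass ((mem_SS (hb0 _) _).1 i.2.2).1 ((mem_SS (hb0 _) _).1 j.2.2).1
      · exact SS_disj (p := p) hq (hF _) (hF _) (hna _ _ h) i.2.2 j.2.2 hass
    · calc Fintype.card J = ∑ j : J, 1 := by simp
        _ ≤ ∑ j, NJ j := Finset.sum_le_sum fun j _ => hpos j
        _ ≤ N0 := hSJ ▸ hN0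
    · intro j
      calc NJ j ≤ ∑ j, NJ j := Finset.single_le_sum (f := NJ) (fun _ _ => Nat.zero_le _) (Finset.mem_univ _)
        _ ≤ N0 := hSJ ▸ hN0
    · intro i
      obtain ⟨c, hc, h⟩ := SS_prod (k := k) (p := p) hq (hF i) (hd i)
      refine ⟨c, hc, h.trans ?_⟩
      congr 1
      symm
      refine Finset.prod_bij (fun j _ => G j) ?_ ?_ ?_ ?_
      · intro j hj
        simp only [Finset.mem_filter, Finset.mem_univ, true_and] at hj
        subst hj; exact j.2.2
      · intro a ha b hb h
        simp only [Finset.mem_filter, Finset.mem_univ, true_and] at ha hb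
        exact hGβ _ _ (ha.trans hb.symm) h
      · intro g hg
        exact ⟨⟨i, g, hg⟩, Finset.mem_filter.2 ⟨Finset.mem_univ _, rfl⟩, rfl⟩
      · intro _ _; rfl
    · calc Fintype.card Ω = ∑ j, (Finset.univ.filter fun ω => ℓ ω = j).card := by
            rw [← Finset.card_univ]; exact Finset.card_eq_sum_card_fiberwise (by intro _ _; simp)
        _ = ∑ j, NJ j := Finset.sum_congr rfl fun j _ => hfib j
        _ ≤ N0 := hSJ ▸ hN0
  · rw [coset_count β ℓ ρ hρ π0 h0 w hw (fun i => NJ (j0 i)) (fun i => by rw [hfib]; exact hcon _ _ (hw i)), mul_assoc, ← Finset.prod_mul_distrib]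
    congr 1
    refine Finset.prod_congr rfl fun i _ => ?_
    rw [hNF2, mul_comm]

end A
end BH

namespace BH

section A

lemma sum_est {V : Type*} [Fintype V] [DecidableEq V] (a : V → ℕ) (S T A E Z : ℕ) (bad : Finset V)
    (h1 : ∀ v, v ∉ bad → S * a v ≤ T * A + E) (h2 : ∀ v, v ∉ bad → T * A ≤ S * a v + E) (ha : ∀ v, a v ≤ A) (hS : S ≤ Z) (hT : T ≤ Z) :
    S * ∑ v, a v ≤ T * (Fintype.card V * A) + (Fintype.card V * E + bad.card * (Z * A)) ∧
    T * (Fintype.card V * A) ≤ S * ∑ v, a v + (Fintype.card V * E + bad.card * (Z * A)) := by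
  have hb : ∑ v, (if v ∈ bad then Z * A else 0) = bad.card * (Z * A) := by
    rw [← Finset.sum_filter]; simp
  have hc : ∀ x : ℕ, ∑ v : V, x = Fintype.card V * x := fun x => by simp
  constructor
  · rw [Finset.mul_sum]
    calc ∑ v, S * a v ≤ ∑ v, (T * A + E + (if v ∈ bad then Z * A else 0)) := by
          refine Finset.sum_le_sum fun v _ => ?_
          by_cases hv : v ∈ bad
          · have : S * a v ≤ Z * A := Nat.mul_le_mul hS (ha v)
            simp only [hv, if_true]; omega
          · have := h1 v hv
            simp only [hv, if_false]; omega
      _ = _ := by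
          rw [Finset.sum_add_distrib, hb, hc]; ring
  · rw [Finset.mul_sum]
    calc T * (Fintype.card V * A) = ∑ v : V, T * A := by rw [hc]; ring
      _ ≤ ∑ v, (S * a v + E + (if v ∈ bad then Z * A else 0)) := by
          refine Finset.sum_le_sum fun v _ => ?_
          by_cases hv : v ∈ bad
          · have : T * A ≤ Z * A := Nat.mul_le_mul_right _ hT
            simp only [hv, if_true]; omega
          · have := h2 v hv
            simp only [hv, if_false]; omega
      _ = _ := by
          rw [Finset.sum_add_distrib, Finset.sum_add_distrib, hb, hc]; ring

end A

section B
set_option linter.unusedSectionVars false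
variable {Fq : Type} [Field Fq] [Fintype Fq]

open Classical in
/-- polynomials of degree at most `n` with prescribed coefficient of index `n` -/
noncomputable def PA (n : ℕ) (α : Fq) : Finset Fq[X] :=
  Finset.univ.image fun c : Fin n → Fq => ∑ i : Fin n, C (c i) * X ^ (i : ℕ) + C α * X ^ n

lemma PA_card (n : ℕ) (α : Fq) : (PA n α).card ≤ Fintype.card Fq ^ n := by
  classical
  unfold PA
  refine Finset.card_image_le.trans ?_
  simp

lemma mem_PA (n : ℕ) (α : Fq) (f : Fq[X]) : f ∈ PA n α ↔ f.natDegree ≤ n ∧ f.coeff n = α := by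
  classical
  unfold PA
  rw [Finset.mem_image]
  constructor
  · rintro ⟨c, -, rfl⟩
    have h1 : (∑ i : Fin n, C (c i) * X ^ (i : ℕ) : Fq[X]).natDegree ≤ n :=
      natDegree_sum_le_of_forall_le _ _ fun i _ => (natDegree_C_mul_X_pow_le _ _).trans i.2.le
    refine ⟨natDegree_add_le_of_degree_le h1 (natDegree_C_mul_X_pow_le _ _), ?_⟩
    rw [coeff_add, finsetSum_coeff, coeff_C_mul_X_pow, if_pos rfl, Finset.sum_eq_zero, zero_add]
    intro i _
    rw [coeff_C_mul_X_pow, if_neg]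
    exact i.2.ne'
  · rintro ⟨h1, h2⟩
    refine ⟨fun i => f.coeff i, Finset.mem_univ _, ?_⟩
    conv_rhs => rw [f.as_sum_range_C_mul_X_pow' (n := n + 1) (by omega), Finset.sum_range_succ, h2]
    congr 1
    exact Fin.sum_univ_eq_sum_range (fun i => C (f.coeff i) * X ^ i) n

lemma VV_inj {M : ℕ} (t0 : Fq) (v w : Fin M → Fq) (h : VV t0 v = VV t0 w) : v = w := by
  have key : ∀ v : Fin M → Fq, ∀ i : Fin M, ((VV t0 v).comp (X + C t0)).coeff (i + 1) = v i := by
    intro v i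
    have : (VV t0 v).comp (X + C t0) = 1 + ∑ i : Fin M, C (v i) * X ^ ((i : ℕ) + 1) := by
      unfold VV
      rw [add_comp, one_comp, Polynomial.sum_comp]
      congr 1
      refine Finset.sum_congr rfl fun i _ => ?_
      simp
    rw [this, coeff_add, finsetSum_coeff, coeff_one, if_neg (by omega), zero_add, Finset.sum_eq_single i]
    · rw [coeff_C_mul_X_pow, if_pos rfl]
    · intro j _ hj
      rw [coeff_C_mul_X_pow, if_neg]
      intro h
      apply hj; ext; omega
    · simp
  funext i
  rw [← key v i, h, key]

lemma FF_inj {M : ℕ} (fu : Fq[X]) (t0 : Fq) {s s' : Fq} {v v' : Fin M → Fq} (hs : s ≠ 0) (h : FF fu t0 s v = FF fu t0 s' v') : s = s' ∧ v = v' := by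
  have h1 := FF_eval fu t0 s v
  rw [h, FF_eval] at h1
  have h2 : s = s' := (add_left_cancel h1).symm
  subst h2
  refine ⟨rfl, VV_inj t0 _ _ ?_⟩
  unfold FF at h
  have h3 := add_left_cancel h
  exact mul_left_cancel₀ (by simpa using hs) h3

variable {I : Type} [Fintype I] [DecidableEq I]

open Classical in
noncomputable def BB (F : I → Fq[X][X]) (n : ℕ) (α : Fq) : Finset Fq[X] := (PA n α).filter fun f => ∀ i, Irreducible (eval f (F i))

lemma fib_count {M : ℕ} (F : I → Fq[X][X]) (fu : Fq[X]) (hfu : fu.natDegree ≤ M + 1) (t0 : Fq) :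
    (BB F (M + 1) (fu.coeff (M + 1))).card ≤ ∑ v : Fin M → Fq, (AA F fu t0 v).card + Fintype.card Fq ^ M ∧
    ∑ v : Fin M → Fq, (AA F fu t0 v).card ≤ (BB F (M + 1) (fu.coeff (M + 1))).card + Fintype.card Fq ^ M := by
  classical
  set q := Fintype.card Fq with hq
  let Φ : (Fin M → Fq) × Fq → Fq[X] := fun x => FF fu t0 x.2 x.1
  let P : Finset ((Fin M → Fq) × Fq) := Finset.univ.filter fun x => x.2 ≠ 0
  let Y : Finset ((Fin M → Fq) × Fq) := Finset.univ.filter fun x => x.2 ∈ AA F fu t0 x.1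
  have hΦ : Set.InjOn Φ P := by
    intro x hx y hy h
    have hx' : x.2 ≠ 0 := (Finset.mem_filter.1 hx).2
    obtain ⟨h1, h2⟩ := FF_inj fu t0 hx' h
    exact Prod.ext h2 h1
  have hY : Y.card = ∑ v : Fin M → Fq, (AA F fu t0 v).card := by
    have : Y = (Finset.univ.sigma (fun v : Fin M → Fq => AA F fu t0 v)).map (Equiv.sigmaEquivProd (Fin M → Fq) Fq).toEmbedding := by
      ext ⟨v, s⟩
      simp [Y]
    rw [this, Finset.card_map, Finset.card_sigma]
  have hP0 : (Finset.univ.filter fun x : (Fin M → Fq) × Fq => x.2 = 0).card = q ^ M := by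
    have : (Finset.univ.filter fun x : (Fin M → Fq) × Fq => x.2 = 0) = Finset.univ ×ˢ {0} := by
      ext ⟨v, s⟩; simp [eq_comm]
    rw [this, Finset.card_product]; simp [hq]
  have hPc : P.card + q ^ M = q ^ (M + 1) := by
    have := Finset.card_filter_add_card_filter_not (s := (Finset.univ : Finset ((Fin M → Fq) × Fq))) (fun x => x.2 = 0)
    rw [hP0] at this
    rw [add_comm, show P.card = (Finset.univ.filter fun x : (Fin M → Fq) × Fq => ¬ x.2 = 0).card from rfl, this]
    simp [hq, pow_succ]
  have hmem : ∀ x, Φ x ∈ PA (M + 1) (fu.coeff (M + 1)) := fun x => (mem_PA _ _ _).2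
    ⟨FF_natDegree fu t0 _ _ hfu (Nat.lt_succ_self _), by rw [FF_coeff fu t0 _ _ (Nat.lt_succ_self _)]; rfl⟩
  have hgood : ∀ x, Φ x ∈ BB F (M + 1) (fu.coeff (M + 1)) ↔ x ∈ Y := by
    intro x
    simp only [BB, Finset.mem_filter, hmem x, true_and, Y, Finset.mem_univ, AA]
    rfl
  constructor
  · have h1 : BB F (M + 1) (fu.coeff (M + 1)) ⊆ (Y ∩ P).image Φ ∪ (PA (M + 1) (fu.coeff (M + 1)) \ P.image Φ) := by
      intro f hf
      by_cases h : f ∈ P.image Φ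
      · obtain ⟨x, hx, rfl⟩ := Finset.mem_image.1 h
        exact Finset.mem_union_left _ (Finset.mem_image_of_mem _ (Finset.mem_inter.2 ⟨(hgood x).1 hf, hx⟩))
      · exact Finset.mem_union_right _ (Finset.mem_sdiff.2 ⟨(Finset.mem_filter.1 hf).1, h⟩)
    have h2 : (PA (M + 1) (fu.coeff (M + 1)) \ P.image Φ).card + P.card ≤ q ^ (M + 1) := by
      rw [← Finset.card_image_of_injOn hΦ, Finset.card_sdiff_add_card_eq_card]
      · exact PA_card _ _
      · intro f hf
        obtain ⟨x, hx, rfl⟩ := Finset.mem_image.1 hf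
        exact hmem x
    have h3 := (Finset.card_le_card h1).trans (Finset.card_union_le _ _)
    have h4 : ((Y ∩ P).image Φ).card ≤ Y.card := Finset.card_image_le.trans (Finset.card_le_card Finset.inter_subset_left)
    rw [hY] at h4
    omega
  · have h1 : ((Y ∩ P).image Φ).card = (Y ∩ P).card := Finset.card_image_of_injOn (hΦ.mono (by
      rw [Finset.coe_inter]; exact Set.inter_subset_right))
    have h2 : (Y ∩ P).image Φ ⊆ BB F (M + 1) (fu.coeff (M + 1)) := by
      intro f hf
      obtain ⟨x, hx, rfl⟩ := Finset.mem_image.1 hf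
      exact (hgood x).2 (Finset.mem_inter.1 hx).1
    have h3 : Y ⊆ (Y ∩ P) ∪ (Finset.univ.filter fun x : (Fin M → Fq) × Fq => x.2 = 0) := by
      intro x hx
      by_cases h : x.2 = 0
      · exact Finset.mem_union_right _ (by simpa using h)
      · exact Finset.mem_union_left _ (Finset.mem_inter.2 ⟨hx, by simpa [P] using h⟩)
    have h4 := (Finset.card_le_card h3).trans (Finset.card_union_le _ _)
    have h5 := Finset.card_le_card h2
    rw [hP0, hY] at h4
    omega

lemma sz_count {k : Type*} [Field k] [Algebra Fq k] {M : ℕ} (Δ : RV k (M + 1)) (hΔ : Δ ≠ 0) (W : ℕ) (hW : Δ.totalDegree ≤ W) :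
    ∃ bad : Finset (Fin (M + 1) → Fq), bad.card ≤ W * Fintype.card Fq ^ M ∧
      ∀ v, v ∉ bad → MvPolynomial.eval (fun i => algebraMap Fq k (v i)) Δ ≠ 0 := by
  classical
  refine ⟨Finset.univ.filter fun v => MvPolynomial.eval (fun i => algebraMap Fq k (v i)) Δ = 0, ?_, by simp⟩
  have hinj : Function.Injective (algebraMap Fq k) := (algebraMap Fq k).injective
  have h := MvPolynomial.schwartz_zippel_totalDegree hΔ (Finset.univ.image (algebraMap Fq k))
  rw [Finset.card_image_of_injective _ hinj, Finset.card_univ] at h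
  set Z := (Finset.filter (fun f => MvPolynomial.eval f Δ = 0) (Fintype.piFinset fun _ : Fin (M + 1) => Finset.univ.image (algebraMap Fq k))) with hZ
  have hq : 0 < Fintype.card Fq := Fintype.card_pos
  have h2 : Z.card ≤ W * Fintype.card Fq ^ M := by
    have hq' : (0 : ℚ≥0) < (Fintype.card Fq : ℚ≥0) := by exact_mod_cast hq
    rw [div_le_div_iff₀ (by positivity) hq', pow_succ, ← mul_assoc] at h
    have h := le_of_mul_le_mul_right h hq'
    have h : Z.card ≤ Δ.totalDegree * Fintype.card Fq ^ M := by exact_mod_cast h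
    exact h.trans (Nat.mul_le_mul_right _ hW)
  refine le_trans ?_ h2
  refine Finset.card_le_card_of_injOn (fun v i => algebraMap Fq k (v i)) ?_ ?_
  · intro v hv
    have hv : MvPolynomial.eval (fun i => algebraMap Fq k (v i)) Δ = 0 := by simpa using hv
    simp [hZ, hv]
  · intro v _ w _ h
    funext i
    exact hinj (congrFun h i)

end B
end BH

namespace BH

theorem alpha_count (N0 m' : ℕ) : ∃ q0 K : ℕ, ∀ (Fq k I J Ω : Type) [Field Fq] [Fintype Fq] [Field k] [IsAlgClosed k] [Algebra Fq k] [Fintype I] [DecidableEq I]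
    [Fintype J] [DecidableEq J] [Fintype Ω] [DecidableEq Ω] (p e0 : ℕ) [Fact p.Prime] [CharP k p] (F : I → Fq[X][X]) (G : J → k[X][X])
    (β : J → I) (ρ : Equiv.Perm J) (ℓ : Ω → J) (_ : XF Fq k I J Ω (m' + 3) p e0 N0 F G β ρ ℓ) (_ : Fintype.card Fq = p ^ e0) (_ : q0 ≤ Fintype.card Fq)
    (α : Fq) (_ : ∀ j, (uu (m' + 3) (G j)).eval (algebraMap Fq k α) ≠ 0),
    Fintype.card (SL ℓ) * (BB F (m' + 3) α).card ≤ (TT β ℓ ρ).card * Fintype.card Fq ^ (m' + 3) + K * (Fintype.card Fq ^ (m' + 2) * Nat.sqrt (Fintype.card Fq)) ∧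
    (TT β ℓ ρ).card * Fintype.card Fq ^ (m' + 3) ≤ Fintype.card (SL ℓ) * (BB F (m' + 3) α).card + K * (Fintype.card Fq ^ (m' + 2) * Nat.sqrt (Fintype.card Fq)) := by
  obtain ⟨q0, K, hline⟩ := line_app N0
  set Z := N0.factorial with hZ
  set W := (N0 * Z + 1) * Z * (Z * (N0 * Z) + Z * (N0 * Z)) with hW
  refine ⟨q0 + (N0 * N0 * (N0 * N0 + N0 * N0) + N0 * (N0 + N0) + 1), K + W * Z + Z, ?_⟩
  intro Fq k I J Ω _ _ _ _ _ _ _ _ _ _ _ p e0 _ _ F G β ρ ℓ h hq hq0 α hα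
  classical
  obtain ⟨fu, t0, r, lam, hfu, hfα, hD, hr, hP, hlam⟩ := exists_base (M := m' + 2) (n := m' + 3) (by omega) h.fam α hα (by omega) ℓ h.fib
  have hS : Fintype.card (SL ℓ) ≤ Z := by
    calc Fintype.card (SL ℓ) ≤ Fintype.card (Equiv.Perm Ω) := Fintype.card_subtype_le _
      _ = (Fintype.card Ω).factorial := Fintype.card_perm
      _ ≤ _ := Nat.factorial_le h.cO
  have hT : (TT β ℓ ρ).card ≤ Z := by
    calc (TT β ℓ ρ).card ≤ Fintype.card (Equiv.Perm Ω) := Finset.card_le_univ _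
      _ = (Fintype.card Ω).factorial := Fintype.card_perm
      _ ≤ _ := Nat.factorial_le h.cO
  obtain ⟨Δ, hΔ0, hΔd, hΔ⟩ := good_v (m := m') (n := m' + 3) (by omega) _ _ G hD ℓ r hr hP lam hlam N0
    (fun j => (h.fam.deg_le (by omega) j).trans (h.fam.cN j)) _ _ rfl rfl
  obtain ⟨bad, hbad, hbad'⟩ := sz_count (Fq := Fq) (M := m' + 1) Δ hΔ0 W (hΔd.trans (by rw [hW]; gcongr))
  have hl := fun v (hv : v ∉ bad) => hline Fq k I J Ω (m' + 3) p e0 F G β ρ ℓ h hq (by omega) (m' + 2) (by omega) fu hfu t0 (by rw [hfα]; exact hα) v lam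
    (hΔ _ (hbad' v hv))
  obtain ⟨e1, e2⟩ := sum_est (fun v => (AA F fu t0 v).card) (Fintype.card (SL ℓ)) (TT β ℓ ρ).card (Fintype.card Fq) (K * Nat.sqrt (Fintype.card Fq)) Z bad
    (fun v hv => (hl v hv).1) (fun v hv => (hl v hv).2) (fun v => Finset.card_le_univ _) hS hT
  obtain ⟨f1, f2⟩ := fib_count (M := m' + 2) F fu hfu t0
  rw [show m' + 2 + 1 = m' + 3 from rfl, hfα] at f1 f2
  generalize hA : ∑ v : Fin (m' + 2) → Fq, (AA F fu t0 v).card = A at e1 e2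
  have hA' : ∑ v : Fin (m' + 2) → Fq, (AA F fu t0 v).card = A := by
    rw [← hA]
  rw [hA'] at f1 f2
  have hV : Fintype.card (Fin (m' + 2) → Fq) = Fintype.card Fq ^ (m' + 2) := by simp
  rw [hV] at e1 e2
  set q := Fintype.card Fq
  have hq1 : 0 < q := Fintype.card_pos
  have hsq : 1 ≤ Nat.sqrt q := Nat.sqrt_pos.2 hq1
  have hE : q ^ (m' + 2) * (K * Nat.sqrt q) + bad.card * (Z * q) + Z * q ^ (m' + 2) ≤ (K + W * Z + Z) * (q ^ (m' + 2) * Nat.sqrt q) := by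
    have h1 : bad.card * (Z * q) ≤ W * Z * q ^ (m' + 2) := by
      calc _ ≤ W * q ^ (m' + 1) * (Z * q) := Nat.mul_le_mul_right _ hbad
        _ = _ := by ring
    have h2 : q ^ (m' + 2) ≤ q ^ (m' + 2) * Nat.sqrt q := Nat.le_mul_of_pos_right _ hsq
    have h3 : W * Z * q ^ (m' + 2) ≤ W * Z * (q ^ (m' + 2) * Nat.sqrt q) := Nat.mul_le_mul_left _ h2
    have h4 : Z * q ^ (m' + 2) ≤ Z * (q ^ (m' + 2) * Nat.sqrt q) := Nat.mul_le_mul_left _ h2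
    calc _ ≤ q ^ (m' + 2) * (K * Nat.sqrt q) + W * Z * (q ^ (m' + 2) * Nat.sqrt q) + Z * (q ^ (m' + 2) * Nat.sqrt q) := by omega
      _ = _ := by ring
  have hp : q ^ (m' + 2) * q = q ^ (m' + 3) := (pow_succ _ _).symm
  rw [hp] at e1 e2
  have g1 := Nat.mul_le_mul_left (Fintype.card (SL ℓ)) f1
  have g2 := Nat.mul_le_mul_left (Fintype.card (SL ℓ)) f2
  have g3 : Fintype.card (SL ℓ) * q ^ (m' + 2) ≤ Z * q ^ (m' + 2) := Nat.mul_le_mul_right _ hS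
  rw [mul_add] at g1 g2
  constructor <;> omega

lemma uu_bad {Fq k J : Type} [Field Fq] [Fintype Fq] [Field k] [Algebra Fq k] [Fintype J] {n p N0 : ℕ} (hn : n ≠ 0) (G : J → k[X][X]) (h : GFam k J n p N0 G) :
    ∃ bad : Finset Fq, bad.card ≤ N0 * N0 + 1 ∧ (0 : Fq) ∈ bad ∧ ∀ α, α ∉ bad → ∀ j, (uu n (G j)).eval (algebraMap Fq k α) ≠ 0 := by
  classical
  let B : J → Finset Fq := fun j => Finset.univ.filter fun α => (uu n (G j)).eval (algebraMap Fq k α) = 0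
  have hB : ∀ j, (B j).card ≤ N0 := by
    intro j
    have hu : uu n (G j) ≠ 0 := uu_ne n (G j) (h.irr j).ne_zero
    calc (B j).card = ((B j).image (algebraMap Fq k)).card := (Finset.card_image_of_injective _ (algebraMap Fq k).injective).symm
      _ ≤ (uu n (G j)).roots.toFinset.card := by
        refine Finset.card_le_card ?_
        intro x hx
        obtain ⟨a, ha, rfl⟩ := Finset.mem_image.1 hx
        rw [Multiset.mem_toFinset, mem_roots hu]
        exact (Finset.mem_filter.1 ha).2
      _ ≤ Multiset.card (uu n (G j)).roots := Multiset.toFinset_card_le _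
      _ ≤ (uu n (G j)).natDegree := card_roots' _
      _ ≤ _ := (uu_natDegree_le n (G j)).trans ((h.deg_le hn j).trans (h.cN j))
  refine ⟨insert 0 (Finset.univ.biUnion B), ?_, Finset.mem_insert_self _ _, ?_⟩
  · refine (Finset.card_insert_le _ _).trans (Nat.add_le_add_right ?_ 1)
    refine (Finset.card_biUnion_le_card_mul _ _ N0 fun j _ => hB j).trans ?_
    exact Nat.mul_le_mul_right _ h.cJ
  · intro α hα j hj
    apply hα
    refine Finset.mem_insert_of_mem (Finset.mem_biUnion.2 ⟨j, Finset.mem_univ _, ?_⟩)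
    simpa [B] using hj

lemma BB_card {Fq I : Type} [Fintype I] [Field Fq] [Fintype Fq] (F : I → Fq[X][X]) (n : ℕ) (α : Fq) :
    (BB F n α).card ≤ Fintype.card Fq ^ n := by
  classical
  exact (Finset.card_le_card (Finset.filter_subset _ _)).trans (PA_card _ _)

lemma total_eq {Fq I : Type} [Fintype I] [Field Fq] [Fintype Fq] [DecidableEq Fq] (F : I → Fq[X][X]) (n : ℕ) :
    Nat.card {f : Fq[X] // f.degree = (n : ℕ) ∧ ∀ i, Irreducible (eval f (F i))} = ∑ α : Fq, if α = 0 then 0 else (BB F n α).card := by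
  classical
  rw [Nat.subtype_card ((Finset.univ.filter fun α : Fq => α ≠ 0).biUnion fun α => BB F n α)]
  · rw [Finset.card_biUnion]
    · rw [Finset.sum_filter]
      refine Finset.sum_congr rfl fun α _ => ?_
      by_cases h : α = 0 <;> simp [h]
    · intro a _ b _ hab
      rw [Function.onFun, Finset.disjoint_left]
      intro f hf hf'
      unfold BB at hf hf'
      rw [Finset.mem_filter, mem_PA] at hf hf'
      exact hab (hf.1.2.symm.trans hf'.1.2)
  · intro f
    simp only [Finset.mem_biUnion, Finset.mem_filter, Finset.mem_univ, true_and, BB, mem_PA]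
    constructor
    · rintro ⟨a, ha, ⟨h1, h2⟩, h3⟩
      refine ⟨?_, h3⟩
      refine le_antisymm (natDegree_le_iff_degree_le.1 h1) (le_degree_of_ne_zero (by rwa [h2]))
    · rintro ⟨h1, h2⟩
      have h3 := natDegree_eq_of_degree_eq_some h1
      refine ⟨f.coeff n, ?_, ⟨h3.le, rfl⟩, h2⟩
      rw [← h3]
      have : f ≠ 0 := by rintro rfl; simp at h1
      simpa using this

theorem full_count (N0 m' : ℕ) : ∃ q0 K : ℕ, ∀ (Fq k I J Ω : Type) [Field Fq] [Fintype Fq] [Field k] [IsAlgClosed k] [Algebra Fq k] [Fintype I] [DecidableEq I]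
    [Fintype J] [DecidableEq J] [Fintype Ω] [DecidableEq Ω] (p e0 : ℕ) [Fact p.Prime] [CharP k p] (F : I → Fq[X][X]) (G : J → k[X][X])
    (β : J → I) (ρ : Equiv.Perm J) (ℓ : Ω → J) (_ : XF Fq k I J Ω (m' + 3) p e0 N0 F G β ρ ℓ) (_ : Fintype.card Fq = p ^ e0) (_ : q0 ≤ Fintype.card Fq),
    Fintype.card (SL ℓ) * Nat.card {f : Fq[X] // f.degree = (m' + 3 : ℕ) ∧ ∀ i, Irreducible (eval f (F i))} ≤
      (TT β ℓ ρ).card * Fintype.card Fq ^ (m' + 3 + 1) + K * (Fintype.card Fq ^ (m' + 3) * Nat.sqrt (Fintype.card Fq)) ∧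
    (TT β ℓ ρ).card * Fintype.card Fq ^ (m' + 3 + 1) ≤
      Fintype.card (SL ℓ) * Nat.card {f : Fq[X] // f.degree = (m' + 3 : ℕ) ∧ ∀ i, Irreducible (eval f (F i))} + K * (Fintype.card Fq ^ (m' + 3) * Nat.sqrt (Fintype.card Fq)) := by
  obtain ⟨q0, K, hA⟩ := alpha_count N0 m'
  set Z := N0.factorial with hZ
  refine ⟨q0, K + (N0 * N0 + 1) * Z, ?_⟩
  intro Fq k I J Ω _ _ _ _ _ _ _ _ _ _ _ p e0 _ _ F G β ρ ℓ h hq hq0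
  classical
  have hS : Fintype.card (SL ℓ) ≤ Z := by
    calc Fintype.card (SL ℓ) ≤ Fintype.card (Equiv.Perm Ω) := Fintype.card_subtype_le _
      _ = (Fintype.card Ω).factorial := Fintype.card_perm
      _ ≤ _ := Nat.factorial_le h.cO
  have hT : (TT β ℓ ρ).card ≤ Z := by
    calc (TT β ℓ ρ).card ≤ Fintype.card (Equiv.Perm Ω) := Finset.card_le_univ _
      _ = (Fintype.card Ω).factorial := Fintype.card_perm
      _ ≤ _ := Nat.factorial_le h.cO
  obtain ⟨bad, hb, hb0, hbad⟩ := uu_bad (Fq := Fq) (n := m' + 3) (by omega) G h.fam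
  have hne : ∀ α : Fq, α ∉ bad → α ≠ 0 := by rintro α h rfl; exact h hb0
  have hl := fun α (hα : α ∉ bad) => hA Fq k I J Ω p e0 F G β ρ ℓ h hq hq0 α (hbad α hα)
  have est := sum_est (fun α : Fq => if α = 0 then 0 else (BB F (m' + 3) α).card) (Fintype.card (SL ℓ)) (TT β ℓ ρ).card (Fintype.card Fq ^ (m' + 3))
    (K * (Fintype.card Fq ^ (m' + 2) * Nat.sqrt (Fintype.card Fq))) Z bad
    (fun α hα => by simp only [if_neg (hne α hα)]; exact (hl α hα).1) (fun α hα => by simp only [if_neg (hne α hα)]; exact (hl α hα).2)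
    (fun α => by
      split_ifs
      · exact Nat.zero_le _
      · exact (Finset.card_le_card (Finset.filter_subset _ _)).trans (PA_card _ _)) hS hT
  rw [← total_eq] at est
  obtain ⟨e1, e2⟩ := est
  set q := Fintype.card Fq
  have hq1 : 0 < q := Fintype.card_pos
  have hsq : 1 ≤ Nat.sqrt q := Nat.sqrt_pos.2 hq1
  have hE : q * (K * (q ^ (m' + 2) * Nat.sqrt q)) + bad.card * (Z * q ^ (m' + 3)) ≤ (K + (N0 * N0 + 1) * Z) * (q ^ (m' + 3) * Nat.sqrt q) := by
    have h2 : q ^ (m' + 3) ≤ q ^ (m' + 3) * Nat.sqrt q := Nat.le_mul_of_pos_right _ hsq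
    calc _ ≤ q * (K * (q ^ (m' + 2) * Nat.sqrt q)) + (N0 * N0 + 1) * (Z * (q ^ (m' + 3) * Nat.sqrt q)) :=
          Nat.add_le_add_left (Nat.mul_le_mul hb (Nat.mul_le_mul_left _ h2)) _
      _ = _ := by ring
  have hp : q * q ^ (m' + 3) = q ^ (m' + 3 + 1) := by ring
  rw [hp] at e1 e2
  constructor <;> omega

end BH

/-- Bateman–Horn statistics for not necessarily monic polynomials.
For all `m ≥ 1`, degrees `d_i` and `n ≥ 3` there is a constant `C` such that for every
finite field `F_q` of characteristic `p` and pairwise non-associate irreducible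
`F_i ∈ F_q[t][x]` with `deg F_i = d_i`, `deg_x F_i > 0`, separable over `F_q(t)`,
setting `N_i = deg_t F_i(t,f♯)`, if `n` exceeds the number of geometric points of
multiplicity `> 2` on the curve `∏ F_i(t,x) = 0` and `p > max N_i`, then, `μ_i` being
the number of irreducible factors of `F_i` over `F̄_q`,
`|#{f : deg f = n, all F_i(t,f) irreducible} − (∏ μ_i/N_i) q^{n+1}| ≤ C q^{n+1/2}`. -/
theorem bateman_horn_nonmonic (m : ℕ) (hm : 1 ≤ m) (d : Fin m → ℕ) (n : ℕ) (hn : 3 ≤ n) :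
    ∃ C : ℝ, ∀ (Fq : Type) [Field Fq] [Fintype Fq],
      ∀ F : Fin m → Polynomial (Polynomial Fq),
        (∀ i, totalDeg (F i) = d i) →
        (∀ i, 0 < (F i).natDegree) →
        (∀ i j, i ≠ j → ¬ Associated (F i) (F j)) →
        (∀ i, Irreducible (F i)) →
        (∀ i, ∀ G : Polynomial (Polynomial Fq),
          F i ≠ G.comp (Polynomial.X ^ ringChar Fq)) →
        (Nat.card {P : (AlgebraicClosure Fq) × (AlgebraicClosure Fq) //
            Polynomial.eval P.1 (Polynomial.eval (Polynomial.C P.2)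
              ((∏ i, F i).map (Polynomial.mapRingHom
                (algebraMap Fq (AlgebraicClosure Fq))))) = 0 ∧
            2 < multAt ((∏ i, F i).map (Polynomial.mapRingHom
              (algebraMap Fq (AlgebraicClosure Fq)))) P.1 P.2} < n) →
        (∀ i, (substF n (F i)).natDegree < ringChar Fq) →
        |(Nat.card {f : Polynomial Fq //
              f.degree = (n : ℕ) ∧ ∀ i, Irreducible (Polynomial.eval f (F i))} : ℝ)
            - (∏ i, ((Multiset.card (UniqueFactorizationMonoid.factors
                  ((F i).map (Polynomial.mapRingHom
                    (algebraMap Fq (AlgebraicClosure Fq)))))) : ℝ) /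
                ((substF n (F i)).natDegree : ℝ)) *
              (Fintype.card Fq : ℝ) ^ (n + 1)|
          ≤ C * (Fintype.card Fq : ℝ) ^ n * Real.sqrt (Fintype.card Fq) := by
  obtain ⟨m', rfl⟩ : ∃ m', n = m' + 3 := ⟨n - 3, by omega⟩
  set N0 : ℕ := (m' + 3) * ∑ i, d i with hN0
  obtain ⟨q0, K, hcount⟩ := BH.full_count N0 m'
  refine ⟨(K : ℝ) + (N0.factorial + 1) * q0, ?_⟩
  intro Fq _ _ F hdF hd hna hF _ _ hp
  classical
  have hprime : (ringChar Fq).Prime := CharP.char_is_prime Fq (ringChar Fq)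
  have : Fact (ringChar Fq).Prime := ⟨hprime⟩
  have : CharP (AlgebraicClosure Fq) (ringChar Fq) :=
    charP_of_injective_algebraMap (algebraMap Fq (AlgebraicClosure Fq)).injective (ringChar Fq)
  obtain ⟨e0, -, hq⟩ := FiniteField.card Fq (ringChar Fq)
  have hNs : ∀ i, (substF (m' + 3) (F i)).natDegree = BH.NN (m' + 3) (F i) := fun i => BH.substF_natDegree _ _ (hF i).ne_zero
  obtain ⟨J, Ω, _, _, _, _, G, β, ρ, ℓ, hX, hST⟩ := BH.setup (k := AlgebraicClosure Fq) (n := m' + 3) (N0 := N0) hq (by omega) F hF hd hna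
    (by
      rw [hN0, Finset.mul_sum]
      refine Finset.sum_le_sum fun i _ => ?_
      rw [← hdF i]
      exact BH.NN_le_totalDeg _ (by omega) _)
    (fun i => by rw [← hNs]; exact hp i)
  have hcnt := hcount Fq (AlgebraicClosure Fq) (Fin m) J Ω (ringChar Fq) e0 F G β ρ ℓ hX hq
  have htriv : Nat.card {f : Polynomial Fq // f.degree = (m' + 3 : ℕ) ∧ ∀ i, Irreducible (Polynomial.eval f (F i))} ≤ Fintype.card Fq ^ (m' + 3 + 1) := by
    rw [BH.total_eq]
    calc _ ≤ ∑ α : Fq, Fintype.card Fq ^ (m' + 3) := by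
          refine Finset.sum_le_sum fun α _ => ?_
          split_ifs
          · exact Nat.zero_le _
          · exact BH.BB_card _ _ _
      _ = _ := by simp [pow_succ, mul_comm]
  have hNpos : ∀ i, 0 < BH.NN (m' + 3) (F i) := fun i =>
    lt_of_lt_of_le (Nat.mul_pos (hd i) (by omega)) (BH.le_NN (m' + 3) (F i) (hF i).ne_zero)
  have hT : (BH.TT β ℓ ρ).card ≤ N0.factorial := by
    calc (BH.TT β ℓ ρ).card ≤ Fintype.card (Equiv.Perm Ω) := Finset.card_le_univ _
      _ = (Fintype.card Ω).factorial := Fintype.card_perm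
      _ ≤ _ := Nat.factorial_le hX.cO
  have hSpos : 0 < Fintype.card (BH.SL ℓ) := Fintype.card_pos
  have hc : (∏ i, ((Multiset.card (UniqueFactorizationMonoid.factors ((F i).map (Polynomial.mapRingHom
      (algebraMap Fq (AlgebraicClosure Fq)))))) : ℝ) / ((substF (m' + 3) (F i)).natDegree : ℝ)) =
      ((BH.TT β ℓ ρ).card : ℝ) / (Fintype.card (BH.SL ℓ) : ℝ) := by
    rw [Finset.prod_div_distrib, div_eq_div_iff]
    · have h := congrArg (Nat.cast : ℕ → ℝ) hST
      push_cast at h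
      simp only [hNs]
      rw [mul_comm]
      exact h
    · refine Finset.prod_ne_zero_iff.2 fun i _ => ?_
      rw [hNs]
      exact_mod_cast (hNpos i).ne'
    · exact_mod_cast hSpos.ne'
  rw [hc]
  set B := Nat.card {f : Polynomial Fq // f.degree = (m' + 3 : ℕ) ∧ ∀ i, Irreducible (Polynomial.eval f (F i))} with hB
  set q := Fintype.card Fq with hqd
  set S := Fintype.card (BH.SL ℓ) with hSd
  set T := (BH.TT β ℓ ρ).card with hTd
  have hq1 : (1 : ℝ) ≤ (q : ℝ) := by exact_mod_cast (Fintype.card_pos : 0 < Fintype.card Fq)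
  have hS1 : (1 : ℝ) ≤ (S : ℝ) := by exact_mod_cast hSpos
  have hT' : (T : ℝ) ≤ (N0.factorial : ℝ) := by exact_mod_cast hT
  have hsq1 : (1 : ℝ) ≤ Real.sqrt q := Real.one_le_sqrt.2 hq1
  have hss : Real.sqrt q * Real.sqrt q = q := Real.mul_self_sqrt (by positivity)
  have hY : (0 : ℝ) ≤ (q : ℝ) ^ (m' + 3) * Real.sqrt q := by positivity
  have hK0 : (0 : ℝ) ≤ (K : ℝ) := Nat.cast_nonneg _
  have hZ0 : (0 : ℝ) ≤ ((N0.factorial : ℝ) + 1) := by positivity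
  by_cases hqs : q0 ≤ q
  · obtain ⟨h1, h2⟩ := hcnt hqs
    have h1' : (S : ℝ) * B ≤ T * (q : ℝ) ^ (m' + 3 + 1) + K * ((q : ℝ) ^ (m' + 3) * (Nat.sqrt q : ℝ)) := by exact_mod_cast h1
    have h2' : T * (q : ℝ) ^ (m' + 3 + 1) ≤ (S : ℝ) * B + K * ((q : ℝ) ^ (m' + 3) * (Nat.sqrt q : ℝ)) := by exact_mod_cast h2
    have h3 : (K : ℝ) * ((q : ℝ) ^ (m' + 3) * (Nat.sqrt q : ℝ)) ≤ K * ((q : ℝ) ^ (m' + 3) * Real.sqrt q) := by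
      have : (Nat.sqrt q : ℝ) ≤ Real.sqrt q := Real.nat_sqrt_le_real_sqrt
      gcongr
    have h4 : |(S : ℝ) * (B - T / S * (q : ℝ) ^ (m' + 3 + 1))| ≤ K * ((q : ℝ) ^ (m' + 3) * Real.sqrt q) := by
      have : (S : ℝ) * (B - T / S * (q : ℝ) ^ (m' + 3 + 1)) = S * B - T * (q : ℝ) ^ (m' + 3 + 1) := by
        field_simp
      rw [this, abs_le]
      constructor <;> linarith
    rw [abs_mul, abs_of_nonneg (by positivity : (0 : ℝ) ≤ (S : ℝ))] at h4
    calc _ ≤ (S : ℝ) * |(B : ℝ) - T / S * (q : ℝ) ^ (m' + 3 + 1)| := le_mul_of_one_le_left (abs_nonneg _) hS1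
      _ ≤ K * ((q : ℝ) ^ (m' + 3) * Real.sqrt q) := h4
      _ ≤ ((K : ℝ) + (N0.factorial + 1) * q0) * ((q : ℝ) ^ (m' + 3) * Real.sqrt q) := by
        refine mul_le_mul_of_nonneg_right ?_ hY
        have : (0 : ℝ) ≤ (N0.factorial + 1) * (q0 : ℝ) := by positivity
        linarith
      _ = _ := by ring
  · have hqq : (q : ℝ) ≤ (q0 : ℝ) := by
      have : q ≤ q0 := by omega
      exact_mod_cast this
    have hpq : (q : ℝ) ^ (m' + 3 + 1) ≤ q0 * ((q : ℝ) ^ (m' + 3) * Real.sqrt q) := by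
      calc (q : ℝ) ^ (m' + 3 + 1) = q * ((q : ℝ) ^ (m' + 3) * 1) := by ring
        _ ≤ _ := by gcongr
    have hB0 : (0 : ℝ) ≤ (B : ℝ) := Nat.cast_nonneg _
    have hB1 : (B : ℝ) ≤ (q : ℝ) ^ (m' + 3 + 1) := by exact_mod_cast htriv
    have hts : (T : ℝ) / S ≤ (N0.factorial : ℝ) := (div_le_self (Nat.cast_nonneg _) hS1).trans hT'
    have hts0 : (0 : ℝ) ≤ (T : ℝ) / S := by positivity
    have hp0 : (0 : ℝ) ≤ (q : ℝ) ^ (m' + 3 + 1) := by positivity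
    have h5 : (T : ℝ) / S * (q : ℝ) ^ (m' + 3 + 1) ≤ N0.factorial * (q : ℝ) ^ (m' + 3 + 1) := mul_le_mul_of_nonneg_right hts hp0
    have h6 : (0 : ℝ) ≤ (T : ℝ) / S * (q : ℝ) ^ (m' + 3 + 1) := mul_nonneg hts0 hp0
    have h7 : (0 : ℝ) ≤ (N0.factorial : ℝ) * (q : ℝ) ^ (m' + 3 + 1) := h6.trans h5
    calc |(B : ℝ) - T / S * (q : ℝ) ^ (m' + 3 + 1)| ≤ (N0.factorial + 1) * (q : ℝ) ^ (m' + 3 + 1) := by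
          rw [abs_le, add_mul, one_mul]
          constructor <;> linarith
      _ ≤ (N0.factorial + 1) * (q0 * ((q : ℝ) ^ (m' + 3) * Real.sqrt q)) := mul_le_mul_of_nonneg_left hpq hZ0
      _ = (N0.factorial + 1) * q0 * ((q : ℝ) ^ (m' + 3) * Real.sqrt q) := by ring
      _ ≤ ((K : ℝ) + (N0.factorial + 1) * q0) * ((q : ℝ) ^ (m' + 3) * Real.sqrt q) := by
        refine mul_le_mul_of_nonneg_right ?_ hY
        linarith
      _ = _ := by ring
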